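/- Let f₀ = (f₀,₁, …, f₀,m) be a tuple of holomorphic functions near the origin o ∈ ℂⁿ and let φ₀, φ be psh functions near o such that |f₀|²e^{-2φ₀} is integrable near o. Assume that |f₀|²e^{-2φ₀}|z|^{2N₀}e^{-2φ} is integrable near o for all sufficiently large N₀, and that |f₀|²e^{-2(φ+φ₀)} is not integrable near o. Then there exists a local Zhou weight Φ related to |f₀|²e^{-2φ₀} near o such that Φ ≥ φ near o; moreover, Φ ≥ N·log|z| + O(1) near o for some N > 0. -/

import Mathlib

open MeasureTheory Filter Topology
open scoped ENNReal NNReal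

noncomputable section

/-- `ℂⁿ`. -/
abbrev Cn (n : ℕ) : Type := Fin n → ℂ

variable {n : ℕ}

/-- The exponential function `EReal → ℝ≥0∞`, with `exp ⊥ = 0` and `exp ⊤ = ⊤`. -/
def expE (x : EReal) : ℝ≥0∞ :=
  if x = ⊥ then 0 else if x = ⊤ then ⊤ else ENNReal.ofReal (Real.exp x.toReal)

/-- The logarithm `ℝ → EReal`, with value `⊥` for `x ≤ 0`. -/
def elog (x : ℝ) : EReal := if x ≤ 0 then (⊥ : EReal) else ((Real.log x : ℝ) : EReal)

/-- The density `e^{c·φ} : ℂⁿ → [0,∞]` associated to an extended-real-valued `φ`. -/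
def wexp (c : ℝ) (φ : Cn n → EReal) (z : Cn n) : ℝ≥0∞ := expE ((c : EReal) * φ z)

/-- `|f₀|² = ∑ⱼ |f₀ⱼ|²` as a `[0,∞]`-valued density, for a tuple `f₀` of functions. -/
def normSq2 {m : ℕ} (f₀ : Fin m → Cn n → ℂ) (z : Cn n) : ℝ≥0∞ :=
  ∑ j, (‖f₀ j z‖₊ : ℝ≥0∞) ^ 2

/-- `log |f₀| = (1/2) log ∑ⱼ |f₀ⱼ|²` for a tuple `f₀`. -/
def logAbsT {m : ℕ} (f₀ : Fin m → Cn n → ℂ) (z : Cn n) : EReal :=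
  elog (Real.sqrt (∑ j, ‖f₀ j z‖ ^ 2))

/-- The weight `|f₀|² e^{-2φ₀}`. -/
def dens0 {m : ℕ} (f₀ : Fin m → Cn n → ℂ) (φ₀ : Cn n → EReal) (z : Cn n) : ℝ≥0∞ :=
  normSq2 f₀ z * wexp (-2) φ₀ z

/-- A nonnegative function is (Lebesgue-)integrable near the origin. -/
def IntNear (g : Cn n → ℝ≥0∞) : Prop := ∃ U ∈ 𝓝 (0 : Cn n), (∫⁻ z in U, g z) < ⊤

/-- `ψ ≤ φ + O(1)` near the origin. -/
def leO (ψ φ : Cn n → EReal) : Prop := ∃ C : ℝ, ∀ᶠ z in 𝓝 (0 : Cn n), ψ z ≤ φ z + (C : EReal)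

/-- `ψ = φ + O(1)` near the origin. -/
def eqO (ψ φ : Cn n → EReal) : Prop := leO ψ φ ∧ leO φ ψ

/-- The truncated average of `u` over the circle `θ ↦ z + r e^{iθ} w`, truncated below at `-m`. -/
def circleAvg (u : Cn n → EReal) (z w : Cn n) (r : ℝ) (m : ℕ) : ℝ :=
  (2 * Real.pi)⁻¹ * ∫ θ in (0:ℝ)..(2 * Real.pi),
    (max (u (z + ((r : ℂ) * Complex.exp (Complex.I * (θ : ℂ))) • w)) ((-(m : ℝ) : ℝ) : EReal)).toReal

/-- `u` is plurisubharmonic on `Ω`: it is upper semicontinuous on `Ω`, takes values in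
`[-∞, ∞)`, is not identically `-∞` on any connected component of `Ω`, and satisfies the
sub-mean value inequality on all small circles inside complex lines. -/
structure PSHOn (u : Cn n → EReal) (Ω : Set (Cn n)) : Prop where
  usc : UpperSemicontinuousOn u Ω
  lt_top : ∀ z ∈ Ω, u z < ⊤
  not_botOnComponents : ∀ z ∈ Ω, ∃ w ∈ connectedComponentIn Ω z, u w ≠ ⊥
  submean : ∀ z ∈ Ω, ∀ w : Cn n, ∃ ε > 0, ∀ r : ℝ, 0 < r → r < ε →
    u z ≤ ⨅ m : ℕ, ((circleAvg u z w r m : ℝ) : EReal)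

/-- `u` is plurisubharmonic near the origin. -/
def PSHNear (u : Cn n → EReal) : Prop := ∃ U ∈ 𝓝 (0 : Cn n), IsOpen U ∧ PSHOn u U

/-- `f` is holomorphic near the origin. -/
def HoloNear (f : Cn n → ℂ) : Prop := ∃ U ∈ 𝓝 (0 : Cn n), IsOpen U ∧ DifferentiableOn ℂ f U

/-- `Φ` is a (local) Zhou weight near the origin related to a general nonnegative
weight `W`. -/
structure IsZhouWeightFor (W : Cn n → ℝ≥0∞) (Φ : Cn n → EReal) : Prop where
  psh : PSHNear Φ
  intN : ∃ N₁ : ℕ, ∀ N₀ : ℕ, N₁ ≤ N₀ →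
    IntNear fun z => W z * ENNReal.ofReal (‖z‖ ^ (2 * N₀)) * wexp (-2) Φ z
  nonint : ¬ IntNear fun z => W z * wexp (-2) Φ z
  maximal : ∀ φ' : Cn n → EReal, PSHNear φ' → leO Φ φ' →
    (¬ IntNear fun z => W z * wexp (-2) φ' z) → eqO φ' Φ

/-- `Φ` is a local Zhou weight related to `|f₀|² e^{-2φ₀}` near the origin (including the
standing assumptions that `f₀` is a tuple of holomorphic functions near `o`, `φ₀` is
plurisubharmonic near `o`, and `|f₀|² e^{-2φ₀}` is integrable near `o`). -/
structure IsLocalZhouWeight {m : ℕ} (f₀ : Fin m → Cn n → ℂ) (φ₀ : Cn n → EReal)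
    (Φ : Cn n → EReal) : Prop where
  holo : ∀ j, HoloNear (f₀ j)
  psh₀ : PSHNear φ₀
  int₀ : IntNear (dens0 f₀ φ₀)
  zhou : IsZhouWeightFor (dens0 f₀ φ₀) Φ

/-- The Zhou number (relative type) `σ(ψ, Φ) = sup { b ≥ 0 : ψ ≤ bΦ + O(1) near o }`. -/
def zhouNumber (ψ Φ : Cn n → EReal) : ℝ :=
  sSup {b : ℝ | 0 ≤ b ∧ leO ψ fun z => (b : EReal) * Φ z}

/-- `log ‖f‖ : ℂⁿ → EReal`. -/
def logAbs (f : Cn n → ℂ) (z : Cn n) : EReal := elog ‖f z‖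

/-- `ν(f, Φ) = σ(log|f|, Φ)`. -/
def nuNumber (f : Cn n → ℂ) (Φ : Cn n → EReal) : ℝ := zhouNumber (logAbs f) Φ

/-- The jumping number `c_o^G(Φ) = sup { c ≥ 0 : |G|² e^{-2cΦ} integrable near o }`. -/
def jumping (G : Cn n → ℂ) (Φ : Cn n → EReal) : ℝ :=
  sSup {c : ℝ | 0 ≤ c ∧ IntNear fun z => (‖G z‖₊ : ℝ≥0∞) ^ 2 * wexp (-2 * c) Φ z}

/-- The inclusion `ℐ(φ)ₒ ⊆ ℐ(ψ)ₒ` of multiplier ideals at the origin. -/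
def mIdealLE (φ ψ : Cn n → EReal) : Prop :=
  ∀ f : Cn n → ℂ, HoloNear f →
    (IntNear fun z => (‖f z‖₊ : ℝ≥0∞) ^ 2 * wexp (-2) φ z) →
    IntNear fun z => (‖f z‖₊ : ℝ≥0∞) ^ 2 * wexp (-2) ψ z

/-- The Tian function `Tn(t; f, v, φ₀) = sup { c ≥ 0 : |f|^{2t} e^{-2cv - 2φ₀} integrable near o }`. -/
def tian (t : ℝ) (f : Cn n → ℂ) (v φ₀ : Cn n → EReal) : ℝ :=
  sSup {c : ℝ | 0 ≤ c ∧
    IntNear fun z => ENNReal.ofReal (‖f z‖ ^ (2 * t)) * wexp (-2 * c) v z * wexp (-2) φ₀ z}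

namespace Zhou

open scoped ContDiff ComplexConjugate Convolution

/-- The first order operator `½ (∂_{x_j} + σ ∂_{y_j})`; `σ = I` gives `∂̄_j`, `σ = -I` gives `∂_j`. -/
def wirt (σ : ℂ) (j : Fin n) (h : Cn n → ℂ) (z : Cn n) : ℂ :=
  (1 / 2) * (fderiv ℝ h z (Pi.single j 1) + σ * fderiv ℝ h z (Pi.single j Complex.I))

/-- The Wirtinger derivative `∂̄_j`. -/
abbrev db (j : Fin n) (h : Cn n → ℂ) : Cn n → ℂ := wirt Complex.I j h

/-- The Wirtinger derivative `∂_j`. -/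
abbrev dz (j : Fin n) (h : Cn n → ℂ) : Cn n → ℂ := wirt (-Complex.I) j h

/-- Smooth functions. -/
abbrev Sm {F : Type*} [NormedAddCommGroup F] [NormedSpace ℝ F] (h : Cn n → F) : Prop :=
  ContDiff ℝ ∞ h

lemma Sm.dAt {F : Type*} [NormedAddCommGroup F] [NormedSpace ℝ F] {h : Cn n → F} (hh : Sm h)
    (z : Cn n) : DifferentiableAt ℝ h z := (hh.differentiable (by simp)) z

lemma Sm.fderiv_apply {h : Cn n → ℂ} (hh : Sm h) (v : Cn n) :
    Sm (fun z => fderiv ℝ h z v) :=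
  (hh.fderiv_right (m := ∞) (by simp)).clm_apply contDiff_const

lemma Sm.wirt {σ : ℂ} {j : Fin n} {h : Cn n → ℂ} (hh : Sm h) : Sm (wirt σ j h) := by
  unfold Zhou.wirt
  exact contDiff_const.mul ((hh.fderiv_apply _).add (contDiff_const.mul (hh.fderiv_apply _)))

lemma Sm.conj {h : Cn n → ℂ} (hh : Sm h) : Sm (fun z => conj (h z)) :=
  (Complex.conjCLE.toContinuousLinearMap.contDiff).comp hh

lemma wirt_congr {σ : ℂ} {j : Fin n} {a b : Cn n → ℂ} {z : Cn n} (h : a =ᶠ[𝓝 z] b) :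
    wirt σ j a z = wirt σ j b z := by
  simp only [wirt, h.fderiv_eq]

lemma wirt_add {σ : ℂ} {j : Fin n} {a b : Cn n → ℂ} {z : Cn n}
    (ha : DifferentiableAt ℝ a z) (hb : DifferentiableAt ℝ b z) :
    wirt σ j (fun x => a x + b x) z = wirt σ j a z + wirt σ j b z := by
  simp only [wirt, fderiv_fun_add ha hb, _root_.add_apply]; ring

lemma wirt_sum {ι : Type*} {σ : ℂ} {j : Fin n} {s : Finset ι} {a : ι → Cn n → ℂ} {z : Cn n}
    (ha : ∀ i ∈ s, DifferentiableAt ℝ (a i) z) :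
    wirt σ j (fun x => ∑ i ∈ s, a i x) z = ∑ i ∈ s, wirt σ j (a i) z := by
  simp only [wirt, fderiv_fun_sum ha, _root_.sum_apply, Finset.mul_sum,
    ← Finset.sum_add_distrib]

lemma wirt_mul {σ : ℂ} {j : Fin n} {a b : Cn n → ℂ} {z : Cn n}
    (ha : DifferentiableAt ℝ a z) (hb : DifferentiableAt ℝ b z) :
    wirt σ j (fun x => a x * b x) z = wirt σ j a z * b z + a z * wirt σ j b z := by
  simp only [wirt, fderiv_fun_mul ha hb, _root_.add_apply,
    _root_.smul_apply, smul_eq_mul]; ring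

lemma wirt_const {σ : ℂ} {j : Fin n} {c : ℂ} {z : Cn n} :
    wirt σ j (fun _ => c) z = 0 := by
  simp [wirt]

lemma wirt_const_mul {σ : ℂ} {j : Fin n} {b : Cn n → ℂ} {z : Cn n} (c : ℂ)
    (hb : DifferentiableAt ℝ b z) :
    wirt σ j (fun x => c * b x) z = c * wirt σ j b z := by
  rw [wirt_mul (differentiableAt_const c) hb, wirt_const]; ring

lemma wirt_neg {σ : ℂ} {j : Fin n} {b : Cn n → ℂ} {z : Cn n} :
    wirt σ j (fun x => - b x) z = - wirt σ j b z := by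
  simp only [wirt, fderiv_fun_neg, _root_.neg_apply]; ring

lemma wirt_sub {σ : ℂ} {j : Fin n} {a b : Cn n → ℂ} {z : Cn n}
    (ha : DifferentiableAt ℝ a z) (hb : DifferentiableAt ℝ b z) :
    wirt σ j (fun x => a x - b x) z = wirt σ j a z - wirt σ j b z := by
  simp only [wirt, fderiv_fun_sub ha hb, _root_.sub_apply]; ring

lemma wirt_conj {σ : ℂ} {j : Fin n} {b : Cn n → ℂ} {z : Cn n} (hb : DifferentiableAt ℝ b z) :
    wirt σ j (fun x => conj (b x)) z = conj (wirt (conj σ) j b z) := by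
  have h : fderiv ℝ (fun x => conj (b x)) z
      = Complex.conjCLE.toContinuousLinearMap.comp (fderiv ℝ b z) :=
    (Complex.conjCLE.toContinuousLinearMap.hasFDerivAt.comp z hb.hasFDerivAt).fderiv
  simp only [wirt, h]
  have h2 : (starRingEnd ℂ) 2 = 2 := Complex.conj_ofNat 2
  simp [h2]

lemma db_conj {j : Fin n} {b : Cn n → ℂ} {z : Cn n} (hb : DifferentiableAt ℝ b z) :
    db j (fun x => conj (b x)) z = conj (dz j b z) := by
  rw [db, wirt_conj hb, Complex.conj_I]

lemma dz_conj {j : Fin n} {b : Cn n → ℂ} {z : Cn n} (hb : DifferentiableAt ℝ b z) :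
    dz j (fun x => conj (b x)) z = conj (db j b z) := by
  rw [dz, wirt_conj hb]; simp

/-- Chain rule for a scalar function of a real function. -/
lemma wirt_comp_real {σ : ℂ} {j : Fin n} {k : ℝ → ℝ} {s : Cn n → ℝ} {z : Cn n}
    (hk : DifferentiableAt ℝ k (s z)) (hs : DifferentiableAt ℝ s z) :
    wirt σ j (fun x => ((k (s x) : ℝ) : ℂ)) z
      = ((deriv k (s z) : ℝ) : ℂ) * wirt σ j (fun x => ((s x : ℝ) : ℂ)) z := by
  have h1 : HasFDerivAt (fun x => ((s x : ℝ) : ℂ)) (Complex.ofRealCLM.comp (fderiv ℝ s z)) z :=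
    Complex.ofRealCLM.hasFDerivAt.comp z hs.hasFDerivAt
  have h2 : HasFDerivAt (fun x => ((k (s x) : ℝ) : ℂ))
      (Complex.ofRealCLM.comp (deriv k (s z) • fderiv ℝ s z)) z :=
    Complex.ofRealCLM.hasFDerivAt.comp z (hk.hasDerivAt.comp_hasFDerivAt z hs.hasFDerivAt)
  simp only [wirt, h1.fderiv, h2.fderiv]
  simp; ring

lemma fderiv_fderiv_comm {h : Cn n → ℂ} (hh : Sm h) (v w z : Cn n) :
    fderiv ℝ (fun x => fderiv ℝ h x v) z w = fderiv ℝ (fun x => fderiv ℝ h x w) z v := by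
  have hs : IsSymmSndFDerivAt ℝ h z := by
    refine (hh.contDiffAt (x := z)).isSymmSndFDerivAt (by simpa using (WithTop.coe_le_coe.2 (le_top : (2 : ℕ∞) ≤ ⊤)))
  have hd : DifferentiableAt ℝ (fderiv ℝ h) z :=
    ((hh.fderiv_right (m := ∞) (by simp)).differentiable (by simp)) z
  have key : ∀ u : Cn n, fderiv ℝ (fun x => fderiv ℝ h x u) z
      = (fderiv ℝ (fderiv ℝ h) z).flip u := by
    intro u
    rw [fderiv_clm_apply hd (differentiableAt_const u)]
    simp
  rw [key, key]
  exact hs.eq w v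

lemma wirt_comm {σ τ : ℂ} {j k : Fin n} {h : Cn n → ℂ} (hh : Sm h) (z : Cn n) :
    wirt σ j (wirt τ k h) z = wirt τ k (wirt σ j h) z := by
  have key : ∀ (α : ℂ) (i : Fin n) (v : Cn n), fderiv ℝ (wirt α i h) z v =
      (1 / 2) * (fderiv ℝ (fun x => fderiv ℝ h x (Pi.single i 1)) z v
        + α * fderiv ℝ (fun x => fderiv ℝ h x (Pi.single i Complex.I)) z v) := by
    intro α i v
    have h1 := (hh.fderiv_apply (Pi.single i 1)).dAt z
    have h2 := (hh.fderiv_apply (Pi.single i Complex.I)).dAt z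
    unfold wirt
    rw [fderiv_const_mul (h1.fun_add (h2.const_mul α)), fderiv_fun_add h1 (h2.const_mul α),
      fderiv_const_mul h2]
    simp [mul_add]
  rw [wirt, wirt, key, key, key, key, fderiv_fderiv_comm hh _ (Pi.single j 1),
    fderiv_fderiv_comm hh _ (Pi.single j 1), fderiv_fderiv_comm hh _ (Pi.single j Complex.I),
    fderiv_fderiv_comm hh _ (Pi.single j Complex.I)]
  ring

lemma hcs_wirt {σ : ℂ} {j : Fin n} {h : Cn n → ℂ} (hc : HasCompactSupport h) :
    HasCompactSupport (wirt σ j h) := by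
  refine (hc.fderiv (𝕜 := ℝ)).mono ?_
  intro x hx
  contrapose! hx
  simp only [Function.mem_support, not_not] at hx ⊢
  simp [wirt, hx]

lemma tsupport_wirt_subset {σ : ℂ} {j : Fin n} {h : Cn n → ℂ} :
    tsupport (wirt σ j h) ⊆ tsupport h := by
  refine closure_minimal ?_ (isClosed_tsupport h)
  intro x hx
  by_contra hn
  have : h =ᶠ[𝓝 x] fun _ => 0 := notMem_tsupport_iff_eventuallyEq.mp hn
  exact hx (by rw [wirt_congr this, wirt_const])

lemma int_of_cs {h : Cn n → ℂ} (hh : Continuous h) (hc : HasCompactSupport h) :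
    Integrable h := hh.integrable_of_hasCompactSupport hc

/-- Integration by parts for Wirtinger derivatives. -/
lemma integral_wirt_mul {σ : ℂ} {j : Fin n} {a b : Cn n → ℂ} (ha : Sm a) (hb : Sm b)
    (hc : HasCompactSupport a ∨ HasCompactSupport b) :
    ∫ z, wirt σ j a z * b z = - ∫ z, a z * wirt σ j b z := by
  have hi : ∀ f g : Cn n → ℂ, Continuous f → Continuous g →
      (HasCompactSupport f ∨ HasCompactSupport g) → Integrable (fun z => f z * g z) := by
    intro f g hf hg h
    refine int_of_cs (hf.mul hg) ?_
    rcases h with h | h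
    · exact h.mul_right
    · exact h.mul_left
  have hcd : ∀ (f : Cn n → ℂ) (v : Cn n), HasCompactSupport f →
      HasCompactSupport (fun x => fderiv ℝ f x v) := by
    intro f v hf
    exact hf.fderiv_apply (𝕜 := ℝ) v
  have hl : ∀ v : Cn n, Integrable (fun z => fderiv ℝ a z v * b z) := fun v =>
    hi _ _ (ha.fderiv_apply v).continuous hb.continuous (hc.imp_left (hcd a v))
  have hr : ∀ v : Cn n, Integrable (fun z => a z * fderiv ℝ b z v) := fun v =>
    hi _ _ ha.continuous (hb.fderiv_apply v).continuous (hc.imp_right (hcd b v))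
  have key : ∀ v : Cn n, ∫ z, fderiv ℝ a z v * b z = - ∫ z, a z * fderiv ℝ b z v := by
    intro v
    rw [integral_mul_fderiv_eq_neg_fderiv_mul_of_integrable (hl v) (hr v)
      (hi _ _ ha.continuous hb.continuous hc) (fun x _ => ha.dAt x) (fun x _ => hb.dAt x)]
    simp
  have e1 : ∀ z, wirt σ j a z * b z = (1 / 2) * (fderiv ℝ a z (Pi.single j 1) * b z)
      + (1 / 2 * σ) * (fderiv ℝ a z (Pi.single j Complex.I) * b z) := fun z => by
    unfold wirt; ring
  have e2 : ∀ z, a z * wirt σ j b z = (1 / 2) * (a z * fderiv ℝ b z (Pi.single j 1))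
      + (1 / 2 * σ) * (a z * fderiv ℝ b z (Pi.single j Complex.I)) := fun z => by
    unfold wirt; ring
  simp_rw [e1, e2]
  rw [integral_add ((hl _).const_mul _) ((hl _).const_mul _),
    integral_add ((hr _).const_mul _) ((hr _).const_mul _)]
  simp only [integral_const_mul, key]
  ring

/-- The complex-valued density `e^{-Θ}`. -/
def cden (Θ : Cn n → ℝ) (z : Cn n) : ℂ := ((Real.exp (-Θ z) : ℝ) : ℂ)

/-- A real function, viewed as complex-valued. -/
def toC (Θ : Cn n → ℝ) (z : Cn n) : ℂ := ((Θ z : ℝ) : ℂ)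

lemma Sm.toC {Θ : Cn n → ℝ} (h : Sm Θ) : Sm (toC Θ) := Complex.ofRealCLM.contDiff.comp h

lemma Sm.cden {Θ : Cn n → ℝ} (h : Sm Θ) : Sm (cden Θ) :=
  Complex.ofRealCLM.contDiff.comp (Real.contDiff_exp.comp h.neg)

lemma wirt_cden {Θ : Cn n → ℝ} (h : Sm Θ) (σ : ℂ) (j : Fin n) (z : Cn n) :
    wirt σ j (cden Θ) z = - (wirt σ j (toC Θ) z * cden Θ z) := by
  have hk : HasDerivAt (fun x : ℝ => Real.exp (-x)) (-Real.exp (-Θ z)) (Θ z) := by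
    simpa using (hasDerivAt_neg (Θ z)).exp
  have := wirt_comp_real (σ := σ) (j := j) (s := Θ) (z := z) hk.differentiableAt (h.dAt z)
  rw [hk.deriv] at this
  unfold cden toC
  rw [this]; push_cast; ring

lemma conj_cden (Θ : Cn n → ℝ) (z : Cn n) : conj (cden Θ z) = cden Θ z := Complex.conj_ofReal _

/-- The operator `δ_j = ∂_j - ∂_jΘ`. -/
def del (Θ : Cn n → ℝ) (j : Fin n) (a : Cn n → ℂ) (z : Cn n) : ℂ :=
  dz j a z - dz j (toC Θ) z * a z

lemma Sm.del {Θ : Cn n → ℝ} (h : Sm Θ) {j : Fin n} {a : Cn n → ℂ} (ha : Sm a) : Sm (del Θ j a) :=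
  ha.wirt.sub (h.toC.wirt.mul ha)

lemma hcs_del {Θ : Cn n → ℝ} {j : Fin n} {a : Cn n → ℂ} (ha : HasCompactSupport a) :
    HasCompactSupport (del Θ j a) := by
  have h1 : HasCompactSupport (dz j a) := hcs_wirt ha
  have h2 : HasCompactSupport (fun z => dz j (toC Θ) z * a z) := ha.mul_left
  exact h1.sub h2

/-- The weighted hermitian product. -/
def ip (Θ : Cn n → ℝ) (a b : Cn n → ℂ) : ℂ := ∫ z, a z * conj (b z) * cden Θ z

lemma ip_conj (Θ : Cn n → ℝ) (a b : Cn n → ℂ) : conj (ip Θ a b) = ip Θ b a := by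
  unfold ip
  rw [← integral_conj]
  congr 1; ext z
  simp only [map_mul, Complex.conj_conj, conj_cden]; ring

lemma ip_int {Θ : Cn n → ℝ} (h : Sm Θ) {a b : Cn n → ℂ} (ha : Continuous a) (hb : Continuous b)
    (hc : HasCompactSupport a ∨ HasCompactSupport b) :
    Integrable (fun z => a z * conj (b z) * cden Θ z) := by
  refine int_of_cs ((ha.mul (Complex.continuous_conj.comp hb)).mul h.cden.continuous) ?_
  rcases hc with hc | hc
  · exact (hc.mul_right).mul_right
  · refine HasCompactSupport.mul_right (HasCompactSupport.mul_left ?_)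
    exact hc.comp_left (g := fun x => conj x) (by simp)

lemma ip_del {Θ : Cn n → ℝ} (h : Sm Θ) {j : Fin n} {a b : Cn n → ℂ} (ha : Sm a) (hb : Sm b)
    (hc : HasCompactSupport a ∨ HasCompactSupport b) :
    ip Θ (del Θ j a) b = - ip Θ a (db j b) := by
  unfold ip
  have e1 : ∀ z, del Θ j a z * conj (b z) * cden Θ z
      = wirt (-Complex.I) j (fun x => a x * cden Θ x) z * conj (b z) := by
    intro z
    rw [wirt_mul (ha.dAt z) (h.cden.dAt z), wirt_cden h, del]; ring
  have e2 : ∀ z, a z * conj (db j b z) * cden Θ z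
      = (a z * cden Θ z) * wirt (-Complex.I) j (fun x => conj (b x)) z := by
    intro z
    have := dz_conj (j := j) (hb.dAt z)
    rw [dz] at this
    rw [this]; ring
  simp_rw [e1, e2]
  refine integral_wirt_mul (ha.mul h.cden) hb.conj ?_
  refine hc.imp (fun hc => hc.mul_right) (fun hc => ?_)
  exact hc.comp_left (g := fun x => conj x) (by simp)

lemma ip_del' {Θ : Cn n → ℝ} (h : Sm Θ) {j : Fin n} {a b : Cn n → ℂ} (ha : Sm a) (hb : Sm b)
    (hc : HasCompactSupport a ∨ HasCompactSupport b) :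
    ip Θ b (del Θ j a) = - ip Θ (db j b) a := by
  rw [← ip_conj, ip_del h ha hb hc, map_neg, ip_conj]

lemma db_del {Θ : Cn n → ℝ} (h : Sm Θ) {j k : Fin n} {a : Cn n → ℂ} (ha : Sm a) (z : Cn n) :
    db j (del Θ k a) z = del Θ k (db j a) z - db j (dz k (toC Θ)) z * a z := by
  have h1 : Sm (dz k a) := ha.wirt
  have h2 : Sm (dz k (toC Θ)) := h.toC.wirt
  have := wirt_sub (σ := Complex.I) (j := j) (h1.dAt z) ((h2.dAt z).fun_mul (ha.dAt z))
  unfold del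
  rw [db, this, wirt_mul (h2.dAt z) (ha.dAt z), dz, wirt_comm ha]
  ring

lemma conj_db_dz {Θ : Cn n → ℝ} (h : Sm Θ) (j k : Fin n) (z : Cn n) :
    conj (db j (dz k (toC Θ)) z) = dz j (db k (toC Θ)) z := by
  have h2 : Sm (dz k (toC Θ)) := h.toC.wirt
  rw [← dz_conj (h2.dAt z)]
  congr 1
  ext x
  rw [← db_conj (h.toC.dAt x)]
  congr 1
  ext y
  simp [toC]

/-- The Levi form of `Θ` at `z`. -/
def levi (Θ : Cn n → ℝ) (z ξ : Cn n) : ℝ :=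
  (∑ j, ∑ k, dz j (db k (toC Θ)) z * ξ j * conj (ξ k)).re

lemma ip_sum_left {Θ : Cn n → ℝ} {ι : Type*} {s : Finset ι} {a : ι → Cn n → ℂ} {b : Cn n → ℂ}
    (hi : ∀ i ∈ s, Integrable (fun z => a i z * conj (b z) * cden Θ z)) :
    ip Θ (fun z => ∑ i ∈ s, a i z) b = ∑ i ∈ s, ip Θ (a i) b := by
  unfold ip
  rw [← integral_finsetSum _ hi]
  simp only [Finset.sum_mul]

lemma ip_self_re (Θ : Cn n → ℝ) (a : Cn n → ℂ) :
    ip Θ a a = ((∫ z, ‖a z‖ ^ 2 * Real.exp (-Θ z) : ℝ) : ℂ) := by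
  unfold ip
  rw [← integral_complex_ofReal]
  congr 1; ext z
  rw [Complex.mul_conj, Complex.normSq_eq_norm_sq, cden]
  push_cast; ring

/-- The Bochner–Kodaira–Nakano inequality for `∂̄η`. -/
lemma bochner {Θ : Cn n → ℝ} (h : Sm Θ) {η : Cn n → ℂ} (hη : Sm η) (hc : HasCompactSupport η) :
    ∫ z, levi Θ z (fun j => db j η z) * Real.exp (-Θ z)
      ≤ ∫ z, ‖∑ j, del Θ j (db j η) z‖ ^ 2 * Real.exp (-Θ z) := by
  have hs : ∀ j, Sm (db j η) := fun j => hη.wirt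
  have hcs : ∀ j, HasCompactSupport (db j η) := fun j => hcs_wirt hc
  have hsd : ∀ j, Sm (del Θ j (db j η)) := fun j => h.del (hs j)
  have hcd : ∀ j, HasCompactSupport (del Θ j (db j η)) := fun j => hcs_del (hcs j)
  have hlint : ∀ j k, Integrable (fun z => dz j (db k (toC Θ)) z * db j η z *
      conj (db k η z) * cden Θ z) := by
    intro j k
    have hL : Sm (dz j (db k (toC Θ))) := h.toC.wirt.wirt
    exact ip_int (a := fun z => dz j (db k (toC Θ)) z * db j η z) h
      (hL.continuous.mul (hs j).continuous) (hs k).continuous (Or.inr (hcs k))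
  have key : ip Θ (fun z => ∑ j, del Θ j (db j η) z) (fun z => ∑ j, del Θ j (db j η) z)
      = ∑ j, ∑ k, ip Θ (db k (db j η)) (db k (db j η)) +
        ∫ z, (∑ j, ∑ k, dz j (db k (toC Θ)) z * db j η z * conj (db k η z)) * cden Θ z := by
    have hsum : Sm (fun z => ∑ j, del Θ j (db j η) z) := ContDiff.sum fun j _ => hsd j
    have hterm : ∀ j k, ip Θ (del Θ j (db j η)) (del Θ k (db k η)) =
        ip Θ (db k (db j η)) (db k (db j η)) +
        ∫ z, dz j (db k (toC Θ)) z * db j η z * conj (db k η z) * cden Θ z := by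
      intro j k
      rw [ip_del h (hs j) (hsd k) (Or.inl (hcs j))]
      have hcomm : db j (db k η) = db k (db j η) := by
        ext z; exact wirt_comm hη z
      have h1 := ip_del' (j := k) h (hs k).wirt (hs j) (Or.inr (hcs j))
        (a := db j (db k η))
      rw [hcomm] at h1
      rw [← neg_eq_iff_eq_neg.mpr h1]
      unfold ip
      have hi1 : Integrable (fun z => db j η z * conj (del Θ k (db k (db j η)) z) * cden Θ z) :=
        ip_int h (hs j).continuous (h.del (hs j).wirt).continuous (Or.inl (hcs j))
      rw [← integral_neg, ← integral_neg, ← integral_add hi1.fun_neg (hlint j k)]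
      congr 1; ext z
      rw [db_del h (hs k), hcomm, map_sub, map_mul, conj_db_dz h]
      ring
    have hl : ∀ j k, Integrable (fun z => del Θ j (db j η) z * conj (del Θ k (db k η) z)
        * cden Θ z) := fun j k => ip_int h (hsd j).continuous (hsd k).continuous (Or.inl (hcd j))
    rw [ip_sum_left (fun j _ => ip_int h (hsd j).continuous hsum.continuous (Or.inl (hcd j)))]
    have hrow : ∀ j, ip Θ (del Θ j (db j η)) (fun z => ∑ k, del Θ k (db k η) z) =
        ∑ k, ip Θ (del Θ j (db j η)) (del Θ k (db k η)) := by
      intro j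
      rw [← ip_conj, ip_sum_left (fun k _ => hl k j), map_sum]
      simp only [ip_conj]
    simp only [hrow, hterm, Finset.sum_add_distrib, Finset.sum_mul]
    congr 1
    rw [integral_finsetSum _ (fun j _ => integrable_finsetSum _ fun k _ => hlint j k)]
    refine Finset.sum_congr rfl fun j _ => ?_
    rw [integral_finsetSum _ (fun k _ => hlint j k)]
  have hre : (∫ z, (∑ j, ∑ k, dz j (db k (toC Θ)) z * db j η z * conj (db k η z)) * cden Θ z).re
      = ∫ z, levi Θ z (fun j => db j η z) * Real.exp (-Θ z) := by
    rw [← RCLike.re_eq_complex_re, ← integral_re]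
    · congr 1; ext z
      simp only [RCLike.re_eq_complex_re, levi, cden, Complex.re_mul_ofReal]
    · simp only [Finset.sum_mul]
      exact integrable_finsetSum _ fun j _ => integrable_finsetSum _ fun k _ => hlint j k
  have := congrArg Complex.re key
  rw [Complex.add_re, hre, ip_self_re, Complex.ofReal_re] at this
  rw [this]
  simp only [ip_self_re]
  have hnn : 0 ≤ (∑ j, ∑ k,
      ((∫ z, ‖db k (db j η) z‖ ^ 2 * Real.exp (-Θ z) : ℝ) : ℂ)).re := by
    simp only [Complex.re_sum, Complex.ofReal_re]
    refine Finset.sum_nonneg fun j _ => Finset.sum_nonneg fun k _ => integral_nonneg fun z => ?_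
    positivity
  linarith

/-- The complex Laplacian `∑ δ_j ∂̄_j` attached to `Θ`. -/
def box (Θ : Cn n → ℝ) (η : Cn n → ℂ) (z : Cn n) : ℂ := ∑ j, del Θ j (db j η) z

lemma Sm.box {Θ : Cn n → ℝ} (h : Sm Θ) {η : Cn n → ℂ} (hη : Sm η) : Sm (box Θ η) :=
  ContDiff.sum fun _ _ => h.del hη.wirt

lemma hcs_box {Θ : Cn n → ℝ} {η : Cn n → ℂ} (hη : HasCompactSupport η) :
    HasCompactSupport (box Θ η) := by
  refine HasCompactSupport.intro hη ?_
  intro x hx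
  have hx' : η =ᶠ[𝓝 x] fun _ => 0 := notMem_tsupport_iff_eventuallyEq.mp hx
  have hev : ∀ᶠ y in 𝓝 x, η =ᶠ[𝓝 y] fun _ => 0 := eventually_eventuallyEq_nhds.mpr hx'
  refine Finset.sum_eq_zero fun j _ => ?_
  have hd : db j η =ᶠ[𝓝 x] fun _ => 0 := by
    filter_upwards [hev] with y hy
    rw [db, wirt_congr hy, wirt_const]
  rw [del, dz, wirt_congr hd, wirt_const, hd.eq_of_nhds]; simp

/-- The half density `e^{-Θ/2}`. -/
def half (Θ : Cn n → ℝ) (z : Cn n) : ℂ := ((Real.exp (-Θ z / 2) : ℝ) : ℂ)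

lemma half_mul_half (Θ : Cn n → ℝ) (z : Cn n) : half Θ z * half Θ z = cden Θ z := by
  rw [half, cden, ← Complex.ofReal_mul, ← Real.exp_add]; ring_nf

lemma half_cont {Θ : Cn n → ℝ} (h : Sm Θ) : Continuous (half Θ) := by
  unfold half
  have := h.continuous
  fun_prop

lemma box_add {Θ : Cn n → ℝ} {a b : Cn n → ℂ} (ha : Sm a) (hb : Sm b) (z : Cn n) :
    box Θ (fun x => a x + b x) z = box Θ a z + box Θ b z := by
  unfold box
  rw [← Finset.sum_add_distrib]
  refine Finset.sum_congr rfl fun j _ => ?_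
  have e : db j (fun x => a x + b x) = fun x => db j a x + db j b x := by
    ext x; exact wirt_add (ha.dAt x) (hb.dAt x)
  have h1 : Sm (db j a) := ha.wirt
  have h2 : Sm (db j b) := hb.wirt
  rw [e, del, dz, wirt_add (h1.dAt z) (h2.dAt z)]
  simp only [del]; ring

lemma box_smul {Θ : Cn n → ℝ} {a : Cn n → ℂ} (ha : Sm a) (c : ℂ) (z : Cn n) :
    box Θ (fun x => c * a x) z = c * box Θ a z := by
  unfold box
  rw [Finset.mul_sum]
  refine Finset.sum_congr rfl fun j _ => ?_
  have e : db j (fun x => c * a x) = fun x => c * db j a x := by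
    ext x; exact wirt_const_mul c (ha.dAt x)
  have h1 : Sm (db j a) := ha.wirt
  rw [e, del, dz, wirt_const_mul c (h1.dAt z)]
  simp only [del]; ring

/-- The subspace of `L²` spanned by the `e^{-Θ/2} □η`, for test functions `η`. -/
def boxRange (Θ : Cn n → ℝ) : Submodule ℂ (Lp ℂ 2 (volume : Measure (Cn n))) where
  carrier := {x | ∃ η : Cn n → ℂ, Sm η ∧ HasCompactSupport η ∧
    (x : Cn n → ℂ) =ᵐ[volume] fun z => box Θ η z * half Θ z}
  zero_mem' := by
    refine ⟨fun _ => 0, contDiff_const, HasCompactSupport.zero, ?_⟩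
    have : ∀ z, box Θ (fun _ : Cn n => (0:ℂ)) z = 0 := fun z => by
      have := box_smul (Θ := Θ) (a := fun _ : Cn n => (0:ℂ)) contDiff_const 0 z
      simpa using this
    filter_upwards [Lp.coeFn_zero ℂ 2 (volume : Measure (Cn n))] with z hz
    rw [hz, this]; simp
  add_mem' := by
    rintro x y ⟨a, ha, hca, hxa⟩ ⟨b, hb, hcb, hyb⟩
    refine ⟨fun z => a z + b z, ha.add hb, hca.add hcb, ?_⟩
    filter_upwards [Lp.coeFn_add x y, hxa, hyb] with z hz h1 h2
    rw [hz, Pi.add_apply, h1, h2, box_add ha hb]; ring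
  smul_mem' := by
    rintro c x ⟨a, ha, hca, hxa⟩
    refine ⟨fun z => c * a z, contDiff_const.mul ha, hca.mul_left, ?_⟩
    filter_upwards [Lp.coeFn_smul c x, hxa] with z hz h1
    rw [hz, Pi.smul_apply, h1, box_smul ha, smul_eq_mul]; ring

lemma memLp_half {Θ : Cn n → ℝ} (h : Sm Θ) {a : Cn n → ℂ} (ha : Continuous a)
    (hc : HasCompactSupport a) : MemLp (fun z => a z * half Θ z) 2 (volume : Measure (Cn n)) :=
  (ha.mul (half_cont h)).memLp_of_hasCompactSupport hc.mul_right

lemma continuous_levi {Θ : Cn n → ℝ} (h : Sm Θ) {ξ : Cn n → Cn n} (hξ : ∀ j, Continuous fun z => ξ z j) :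
    Continuous fun z => levi Θ z (ξ z) := by
  unfold levi
  refine Complex.continuous_re.comp ?_
  refine continuous_finsetSum _ fun j _ => continuous_finsetSum _ fun k _ => ?_
  have : Sm (dz j (db k (toC Θ))) := h.toC.wirt.wirt
  exact (this.continuous.mul (hξ j)).mul (Complex.continuous_conj.comp (hξ k))

lemma pairing_bound {Θ : Cn n → ℝ} (h : Sm Θ) {g : Cn n → ℂ} (hg : Sm g)
    {E : Cn n → ℝ} (hE : ∀ z, 0 ≤ E z) (hEi : Integrable fun z => E z * Real.exp (-Θ z))
    (hlevi : ∀ z ξ, ‖∑ j, db j g z * conj (ξ j)‖ ^ 2 ≤ E z * levi Θ z ξ)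
    (hpos : ∀ z ξ, 0 ≤ levi Θ z ξ)
    {η : Cn n → ℂ} (hη : Sm η) (hc : HasCompactSupport η) :
    2 * ‖ip Θ g (box Θ η)‖ ≤ (∫ z, E z * Real.exp (-Θ z))
      + ∫ z, ‖box Θ η z‖ ^ 2 * Real.exp (-Θ z) := by
  have hs : ∀ j, Sm (db j η) := fun j => hη.wirt
  have hcs : ∀ j, HasCompactSupport (db j η) := fun j => hcs_wirt hc
  have hij : ∀ j, Integrable (fun z => db j g z * conj (db j η z) * cden Θ z) := fun j =>
    ip_int h hg.wirt.continuous (hs j).continuous (Or.inr (hcs j))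
  have e1 : ip Θ g (box Θ η) = - ∫ z, (∑ j, db j g z * conj (db j η z)) * cden Θ z := by
    have : box Θ η = fun z => ∑ j, del Θ j (db j η) z := rfl
    rw [this, ← ip_conj, ip_sum_left, map_sum]
    · simp only [ip_conj]
      simp_rw [fun j => ip_del' (j := j) h (hs j) hg (Or.inl (hcs j)), Finset.sum_mul]
      rw [integral_finsetSum _ fun j _ => hij j, Finset.sum_neg_distrib]
      rfl
    · intro j _
      exact ip_int h (h.del (hs j)).continuous hg.continuous (Or.inl (hcs_del (hcs j)))
  have hQi : Integrable (fun z => levi Θ z (fun j => db j η z) * Real.exp (-Θ z)) := by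
    refine Continuous.integrable_of_hasCompactSupport ?_ ?_
    · exact (continuous_levi h (ξ := fun z j => db j η z) fun j => (hs j).continuous).mul
        (Real.continuous_exp.comp h.continuous.neg)
    · refine HasCompactSupport.mul_right (HasCompactSupport.intro hc ?_)
      intro x hx
      have hx' : η =ᶠ[𝓝 x] fun _ => 0 := notMem_tsupport_iff_eventuallyEq.mp hx
      have : ∀ j, db j η x = 0 := fun j => by rw [db, wirt_congr hx', wirt_const]
      simp [levi, this]
  have hb := bochner h hη hc
  have e2 : ‖∫ z, (∑ j, db j g z * conj (db j η z)) * cden Θ z‖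
      ≤ ∫ z, (E z * Real.exp (-Θ z) + levi Θ z (fun j => db j η z) * Real.exp (-Θ z)) / 2 := by
    refine norm_integral_le_of_norm_le ((hEi.add hQi).div_const 2) (Eventually.of_forall fun z => ?_)
    rw [norm_mul, cden, Complex.norm_real, Real.norm_of_nonneg (Real.exp_pos _).le]
    have h1 := hlevi z (fun j => db j η z)
    have h2 := hpos z (fun j => db j η z)
    have h3 : ‖∑ j, db j g z * conj (db j η z)‖ ≤ (E z + levi Θ z (fun j => db j η z)) / 2 := by
      refine abs_le_of_sq_le_sq' ?_ (by have := hE z; positivity) |>.2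
      nlinarith [sq_nonneg (E z - levi Θ z (fun j => db j η z))]
    have := mul_le_mul_of_nonneg_right h3 (Real.exp_pos (-Θ z)).le
    linarith
  rw [integral_div, integral_add hEi hQi] at e2
  rw [e1, norm_neg]
  have : (∫ z, ‖box Θ η z‖ ^ 2 * Real.exp (-Θ z)) = ∫ z, ‖∑ j, del Θ j (db j η) z‖ ^ 2 * Real.exp (-Θ z) := rfl
  linarith

/-- Projection onto the orthogonal complement of the range of `□`, with the `L²` estimate. -/
theorem exists_orthogonal {Θ : Cn n → ℝ} (h : Sm Θ) {g : Cn n → ℂ} (hg : Sm g)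
    (hgc : HasCompactSupport g)
    {E : Cn n → ℝ} (hE : ∀ z, 0 ≤ E z) (hEi : Integrable fun z => E z * Real.exp (-Θ z))
    (hlevi : ∀ z ξ, ‖∑ j, db j g z * conj (ξ j)‖ ^ 2 ≤ E z * levi Θ z ξ)
    (hpos : ∀ z ξ, 0 ≤ levi Θ z ξ) :
    ∃ v : Cn n → ℂ, MemLp v 2 (volume : Measure (Cn n)) ∧
      (∀ η : Cn n → ℂ, Sm η → HasCompactSupport η →
        ∫ z, v z * conj (box Θ η z) * half Θ z = 0) ∧
      ∫⁻ z, ‖g z * half Θ z - v z‖ₑ ^ 2 ≤ ENNReal.ofReal (∫ z, E z * Real.exp (-Θ z)) := by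
  set A := ∫ z, E z * Real.exp (-Θ z)
  set G : Lp ℂ 2 (volume : Measure (Cn n)) := (memLp_half h hg.continuous hgc).toLp _ with hG
  have hGe : (G : Cn n → ℂ) =ᵐ[volume] fun z => g z * half Θ z := MemLp.coeFn_toLp _
  set K := (boxRange Θ).topologicalClosure
  have : CompleteSpace K := (boxRange Θ).isClosed_topologicalClosure.completeSpace_coe
  have hinner : ∀ x : Lp ℂ 2 (volume : Measure (Cn n)), ∀ η : Cn n → ℂ,
      (x : Cn n → ℂ) =ᵐ[volume] (fun z => box Θ η z * half Θ z) →
      ∀ y : Lp ℂ 2 (volume : Measure (Cn n)),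
      inner ℂ x y = ∫ z, y z * conj (box Θ η z) * half Θ z := by
    intro x η hx y
    rw [MeasureTheory.L2.inner_def]
    refine integral_congr_ae ?_
    filter_upwards [hx] with z hz
    rw [RCLike.inner_apply, hz, map_mul]
    have : conj (half Θ z) = half Θ z := Complex.conj_ofReal _
    rw [this]; ring
  have hbd : ∀ x ∈ K, 2 * ‖inner ℂ x G‖ ≤ A + ‖x‖ ^ 2 := by
    intro x hx
    have hcl : IsClosed {x : Lp ℂ 2 (volume : Measure (Cn n)) | 2 * ‖inner ℂ x G‖ ≤ A + ‖x‖ ^ 2} :=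
      isClosed_le (by fun_prop) (by fun_prop)
    refine closure_minimal ?_ hcl hx
    rintro x ⟨η, hη, hc, hxη⟩
    have h1 : inner ℂ x G = ip Θ g (box Θ η) := by
      rw [hinner x η hxη]
      refine integral_congr_ae ?_
      filter_upwards [hGe] with z hz
      rw [hz, ← half_mul_half]; ring
    have h2 : ‖x‖ ^ 2 = ∫ z, ‖box Θ η z‖ ^ 2 * Real.exp (-Θ z) := by
      have h3 : ((‖x‖ ^ 2 : ℝ) : ℂ) = inner ℂ x x := by
        rw [inner_self_eq_norm_sq_to_K]; simp
      rw [hinner x η hxη] at h3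
      have h4 : ∫ z, x z * conj (box Θ η z) * half Θ z = ip Θ (box Θ η) (box Θ η) := by
        refine integral_congr_ae ?_
        filter_upwards [hxη] with z hz
        rw [hz, ← half_mul_half]; ring
      rw [h4, ip_self_re] at h3
      exact_mod_cast h3
    show 2 * ‖inner ℂ x G‖ ≤ A + ‖x‖ ^ 2
    rw [h1, h2]
    exact pairing_bound h hg hE hEi hlevi hpos hη hc
  set w : Lp ℂ 2 (volume : Measure (Cn n)) := K.starProjection G with hw
  have hwK : w ∈ K := Submodule.starProjection_apply_mem K G
  have horth : ∀ x ∈ K, inner ℂ x (G - w) = 0 := fun x hx =>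
    (Submodule.mem_orthogonal _ _).1 (Submodule.sub_starProjection_mem_orthogonal (K := K) G) x hx
  have hwn : ‖w‖ ^ 2 ≤ A := by
    have h1 := hbd w hwK
    have h2 : inner ℂ w G = inner ℂ w w := by
      have := horth w hwK
      rw [inner_sub_right, sub_eq_zero] at this
      exact this
    rw [h2, inner_self_eq_norm_sq_to_K] at h1
    simp at h1
    linarith
  refine ⟨fun z => (G - w : Lp ℂ 2 (volume : Measure (Cn n))) z, Lp.memLp _, ?_, ?_⟩
  · intro η hη hc
    set x : Lp ℂ 2 (volume : Measure (Cn n)) :=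
      (memLp_half h (h.box hη).continuous (hcs_box hc)).toLp _
    have hxe : (x : Cn n → ℂ) =ᵐ[volume] fun z => box Θ η z * half Θ z := MemLp.coeFn_toLp _
    rw [← hinner x η hxe]
    exact horth x ((boxRange Θ).le_topologicalClosure ⟨η, hη, hc, hxe⟩)
  · have h1 : ∫⁻ z, ‖g z * half Θ z - (G - w : Lp ℂ 2 (volume : Measure (Cn n))) z‖ₑ ^ 2
        = ∫⁻ z, ‖w z‖ₑ ^ 2 := by
      refine lintegral_congr_ae ?_
      filter_upwards [hGe, Lp.coeFn_sub G w] with z h1 h2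
      rw [h2, Pi.sub_apply, h1]; simp
    have h2 : ∫⁻ z, ‖w z‖ₑ ^ 2 = ENNReal.ofReal (‖w‖ ^ 2) := by
      have h3 : (‖w‖ₑ : ℝ≥0∞) ^ 2 = ∫⁻ z, ‖w z‖ₑ ^ 2 := by
        rw [Lp.enorm_def, eLpNorm_eq_lintegral_rpow_enorm_toReal (by simp) (by simp)]
        simp only [ENNReal.toReal_ofNat, ENNReal.rpow_ofNat]
        rw [← ENNReal.rpow_ofNat, ← ENNReal.rpow_mul]; simp
      rw [← h3, ← ofReal_norm, ENNReal.ofReal_pow (norm_nonneg _)]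
    rw [h1, h2]
    exact ENNReal.ofReal_le_ofReal hwn

/-- The squared euclidean norm on `ℂⁿ`. -/
def ssq (z : Cn n) : ℝ := ∑ j, ‖z j‖ ^ 2

lemma sm_ssq : Sm (ssq : Cn n → ℝ) := by
  unfold ssq
  refine ContDiff.sum fun j _ => ?_
  have : ContDiff ℝ ∞ (fun z : Cn n => z j) := contDiff_apply ℝ ℂ j
  exact this.norm_sq ℝ

lemma ssq_nonneg (z : Cn n) : 0 ≤ ssq z := Finset.sum_nonneg fun _ _ => by positivity

lemma norm_sq_le_ssq (z : Cn n) : ‖z‖ ^ 2 ≤ ssq z := by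
  have h : ‖z‖ ≤ Real.sqrt (ssq z) := by
    refine (pi_norm_le_iff_of_nonneg (Real.sqrt_nonneg _)).2 fun j => ?_
    refine Real.le_sqrt_of_sq_le ?_
    exact Finset.single_le_sum (f := fun j => ‖z j‖ ^ 2) (fun _ _ => by positivity)
      (Finset.mem_univ j)
  calc ‖z‖ ^ 2 ≤ Real.sqrt (ssq z) ^ 2 := by gcongr
    _ = ssq z := Real.sq_sqrt (ssq_nonneg z)

lemma ssq_smul (c : ℂ) (z : Cn n) : ssq (c • z) = ‖c‖ ^ 2 * ssq z := by
  simp [ssq, Finset.mul_sum, mul_pow]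

/-- Unnormalised bump. -/
def rho0 (z : Cn n) : ℝ := Real.smoothTransition (1 - ssq z)

lemma sm_rho0 : Sm (rho0 : Cn n → ℝ) :=
  Real.smoothTransition.contDiff.comp (contDiff_const.sub sm_ssq)

lemma rho0_nonneg (z : Cn n) : 0 ≤ rho0 z := Real.smoothTransition.nonneg _

lemma rho0_eq_zero {z : Cn n} (hz : 1 ≤ ‖z‖) : rho0 z = 0 := by
  refine Real.smoothTransition.zero_of_nonpos ?_
  have := norm_sq_le_ssq z
  nlinarith

lemma hcs_rho0 : HasCompactSupport (rho0 : Cn n → ℝ) := by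
  refine HasCompactSupport.intro (isCompact_closedBall (0 : Cn n) 1) fun x hx => rho0_eq_zero ?_
  simp at hx; exact hx.le

/-- The mass of the bump. -/
def rhoMass (n : ℕ) : ℝ := ∫ z : Cn n, rho0 z

lemma rhoMass_pos : 0 < rhoMass n := by
  unfold rhoMass
  refine sm_rho0.continuous.integral_pos_of_hasCompactSupport_nonneg_nonzero hcs_rho0
    rho0_nonneg (x := 0) ?_
  simp [rho0, ssq]

/-- Real dimension of `ℂⁿ`. -/
abbrev rdim (n : ℕ) : ℕ := Module.finrank ℝ (Cn n)

/-- The mollifier of radius `ε`. -/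
def rho (ε : ℝ) (z : Cn n) : ℝ := (ε ^ rdim n * rhoMass n)⁻¹ * rho0 (ε⁻¹ • z)

lemma sm_rho (ε : ℝ) : Sm (rho ε : Cn n → ℝ) :=
  contDiff_const.mul (sm_rho0.comp (contDiff_const_smul _))

lemma rho_nonneg {ε : ℝ} (hε : 0 < ε) (z : Cn n) : 0 ≤ rho ε z := by
  have := rhoMass_pos (n := n)
  have := rho0_nonneg (ε⁻¹ • z)
  unfold rho; positivity

lemma rho_eq_zero {ε : ℝ} (hε : 0 < ε) {z : Cn n} (hz : ε ≤ ‖z‖) : rho ε z = 0 := by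
  unfold rho
  rw [rho0_eq_zero, mul_zero]
  rw [norm_smul, norm_inv, Real.norm_of_nonneg hε.le, inv_mul_eq_div, le_div_iff₀ hε, one_mul]
  exact hz

lemma hcs_rho {ε : ℝ} (hε : 0 < ε) : HasCompactSupport (rho ε : Cn n → ℝ) := by
  refine HasCompactSupport.intro (isCompact_closedBall (0 : Cn n) ε) fun x hx => rho_eq_zero hε ?_
  simp at hx; exact hx.le

lemma rho_le {ε : ℝ} (hε : 0 < ε) (z : Cn n) : rho ε z ≤ (ε ^ rdim n * rhoMass n)⁻¹ := by
  have := rhoMass_pos (n := n)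
  unfold rho
  refine mul_le_of_le_one_right (by positivity) (Real.smoothTransition.le_one _)

lemma integral_rho {ε : ℝ} (hε : 0 < ε) : ∫ z : Cn n, rho ε z = 1 := by
  unfold rho
  have := rhoMass_pos (n := n)
  rw [integral_const_mul, Measure.integral_comp_smul, inv_pow, inv_inv,
    abs_of_pos (by positivity), smul_eq_mul]
  change (ε ^ rdim n * rhoMass n)⁻¹ * (ε ^ rdim n * rhoMass n) = 1
  exact inv_mul_cancel₀ (by positivity)

lemma rho_rot (ε : ℝ) {c : ℂ} (hc : ‖c‖ = 1) (z : Cn n) : rho ε (c • z) = rho ε z := by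
  unfold rho rho0
  rw [smul_comm, ssq_smul, hc]; simp

/-- The mollifier as a complex valued function. -/
abbrev rhoC (ε : ℝ) : Cn n → ℂ := toC (rho ε)

lemma sm_rhoC (ε : ℝ) : Sm (rhoC ε : Cn n → ℂ) := (sm_rho ε).toC

lemma hcs_rhoC {ε : ℝ} (hε : 0 < ε) : HasCompactSupport (rhoC ε : Cn n → ℂ) :=
  (hcs_rho hε).comp_left (g := fun x : ℝ => (x : ℂ)) (by simp)

/-- Convolution `∫ u(y) k(x-y) dy` of a locally integrable function with a kernel. -/
def cv (k u : Cn n → ℂ) (x : Cn n) : ℂ := ∫ y, u y * k (x - y)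

lemma cv_eq_convolution (k u : Cn n → ℂ) :
    cv k u = u ⋆[ContinuousLinearMap.mul ℝ ℂ, volume] k := rfl

lemma sm_cv {k u : Cn n → ℂ} (hk : Sm k) (hc : HasCompactSupport k) (hu : LocallyIntegrable u) :
    Sm (cv k u) := by
  rw [cv_eq_convolution]
  exact hc.contDiff_convolution_right (n := ⊤) _ hu hk

lemma cv_int {k u : Cn n → ℂ} (hk : Continuous k) (hc : HasCompactSupport k)
    (hu : LocallyIntegrable u) (x : Cn n) : Integrable fun y => u y * k (x - y) :=
  hc.convolutionExists_right (ContinuousLinearMap.mul ℝ ℂ) hu hk x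

lemma wirt_cv {σ : ℂ} {j : Fin n} {k u : Cn n → ℂ} (hk : Sm k) (hc : HasCompactSupport k)
    (hu : LocallyIntegrable u) (x : Cn n) :
    wirt σ j (cv k u) x = cv (wirt σ j k) u x := by
  have hd : ∀ v, fderiv ℝ (cv k u) x v = ∫ y, u y * fderiv ℝ k (x - y) v := by
    intro v
    rw [cv_eq_convolution, (hc.hasFDerivAt_convolution_right _ hu (hk.of_le (by simp)) x).fderiv,
      convolution_precompR_apply _ hu (hc.fderiv (𝕜 := ℝ))
        (hk.continuous_fderiv (by simp))]
    rfl
  have hi : ∀ v, Integrable fun y => u y * fderiv ℝ k (x - y) v := fun v =>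
    cv_int (hk.fderiv_apply v).continuous (hc.fderiv_apply (𝕜 := ℝ) v) hu x
  unfold cv
  have e : ∀ y, u y * wirt σ j k (x - y) = (1 / 2) * (u y * fderiv ℝ k (x - y) (Pi.single j 1))
      + (1 / 2 * σ) * (u y * fderiv ℝ k (x - y) (Pi.single j Complex.I)) := fun y => by
    unfold wirt; ring
  simp_rw [e]
  rw [integral_add ((hi _).const_mul _) ((hi _).const_mul _), integral_const_mul,
    integral_const_mul, ← hd, ← hd]
  change wirt σ j (cv k u) x = _
  unfold wirt; ring

/-- Mollification. -/
abbrev moll (ε : ℝ) (u : Cn n → ℂ) : Cn n → ℂ := cv (rhoC ε) u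

lemma sm_moll {ε : ℝ} (hε : 0 < ε) {u : Cn n → ℂ} (hu : LocallyIntegrable u) : Sm (moll ε u) :=
  sm_cv (sm_rhoC ε) (hcs_rhoC hε) hu

lemma moll_eq (ε : ℝ) (u : Cn n → ℂ) (x : Cn n) :
    moll ε u x = ∫ y, (rho ε y : ℂ) * u (x - y) := by
  unfold moll cv
  rw [← integral_sub_left_eq_self _ volume x]
  simp [toC, mul_comm]

/-- A shifted kernel, as a test function. -/
lemma sm_shift {k : Cn n → ℂ} (hk : Sm k) (x : Cn n) : Sm fun y => k (x - y) :=
  hk.comp (contDiff_const.sub contDiff_id)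

lemma hcs_shift {k : Cn n → ℂ} (hk : HasCompactSupport k) (x : Cn n) :
    HasCompactSupport fun y => k (x - y) :=
  hk.comp_homeomorph (Homeomorph.subLeft x)

lemma wirt_shift {σ : ℂ} {j : Fin n} {k : Cn n → ℂ} (hk : Sm k) (x y : Cn n) :
    wirt σ j (fun y => k (x - y)) y = - wirt σ j k (x - y) := by
  have : fderiv ℝ (fun y => k (x - y)) y = - fderiv ℝ k (x - y) := by
    have h1 : HasFDerivAt (fun y : Cn n => x - y) (-ContinuousLinearMap.id ℝ (Cn n)) y :=
      (hasFDerivAt_id y).const_sub x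
    have := ((hk.dAt (x - y)).hasFDerivAt.comp y h1).fderiv
    rw [Function.comp_def] at this
    rw [this]; ext; simp
  simp only [wirt, this, _root_.neg_apply]; ring

/-- Multiplication by a unimodular scalar preserves volume. -/
lemma mp_rot {c : ℂ} (hc : ‖c‖ = 1) :
    MeasurePreserving (fun z : Cn n => c • z) volume volume := by
  have h1 : MeasurePreserving (fun z : ℂ => c * z) volume volume := by
    have := (rotation ⟨c, by simp [Submonoid.unitSphere, hc]⟩).measurePreserving
    exact this
  exact volume_preserving_pi (fun _ : Fin n => h1)

/-- Averages against the mollifier may be replaced by averages of circle averages. -/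
lemma rot_avg {E : Type*} [NormedAddCommGroup E] [NormedSpace ℝ E] [CompleteSpace E]
    {ε : ℝ} {G : Cn n → E}
    (hG : Integrable fun y => rho ε y • G y) :
    Integrable (fun y => rho ε y • ((2 * Real.pi)⁻¹ •
        ∫ θ in (0:ℝ)..(2 * Real.pi), G (circleMap 0 1 θ • y))) ∧
    ∫ y, rho ε y • G y = ∫ y, rho ε y • ((2 * Real.pi)⁻¹ •
        ∫ θ in (0:ℝ)..(2 * Real.pi), G (circleMap 0 1 θ • y)) := by
  set H : Cn n → E := fun y => rho ε y • G y with hH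
  set μ : Measure ℝ := volume.restrict (Set.Ioc 0 (2 * Real.pi)) with hμ
  have hc : ∀ θ : ℝ, ‖circleMap 0 1 θ‖ = 1 := by simp
  have hmeas : Measurable (fun p : ℝ × Cn n => circleMap 0 1 p.1 • p.2) := by
    have : Continuous (fun p : ℝ × Cn n => circleMap 0 1 p.1 • p.2) := by fun_prop
    exact this.measurable
  have hS : MeasurePreserving (fun p : ℝ × Cn n => (p.1, circleMap 0 1 p.1 • p.2))
      (μ.prod volume) (μ.prod volume) :=
    (MeasurePreserving.id μ).skew_product hmeas
      (Eventually.of_forall fun θ => (mp_rot (hc θ)).map_eq)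
  have h0 : Integrable (fun p : ℝ × Cn n => H p.2) (μ.prod volume) := hG.comp_snd μ
  have h1 : Integrable (fun p : ℝ × Cn n => H (circleMap 0 1 p.1 • p.2)) (μ.prod volume) :=
    hS.integrable_comp_of_integrable h0
  have e : ∀ y, ∫ θ, H (circleMap 0 1 θ • y) ∂μ =
      rho ε y • ∫ θ in (0:ℝ)..(2 * Real.pi), G (circleMap 0 1 θ • y) := by
    intro y
    rw [intervalIntegral.integral_of_le (by positivity), ← integral_smul]
    simp only [hH, rho_rot ε (hc _)]; rfl
  have hswap := integral_integral_swap (f := fun θ y => H (circleMap 0 1 θ • y)) h1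
  have hin : ∀ θ : ℝ, ∫ y, H (circleMap 0 1 θ • y) = ∫ y, H y := by
    intro θ
    have hemb : MeasurableEmbedding (fun z : Cn n => circleMap 0 1 θ • z) :=
      (Homeomorph.smulOfNeZero (circleMap 0 1 θ) (by
        rw [← norm_ne_zero_iff, hc]; norm_num)).measurableEmbedding
    exact (mp_rot (hc θ)).integral_comp hemb _
  simp only [hin, e] at hswap
  have hvol : μ.real Set.univ = 2 * Real.pi := by
    simp [hμ, measureReal_def, Real.pi_pos.le]
  rw [integral_const, hvol] at hswap
  have hI : Integrable (fun y => rho ε y • ∫ θ in (0:ℝ)..(2 * Real.pi),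
      G (circleMap 0 1 θ • y)) := by
    have := h1.integral_prod_right
    simpa only [e] using this
  have hcomm : ∀ y, rho ε y • ((2 * Real.pi)⁻¹ •
        ∫ θ in (0:ℝ)..(2 * Real.pi), G (circleMap 0 1 θ • y)) = (2 * Real.pi)⁻¹ •
        (rho ε y • ∫ θ in (0:ℝ)..(2 * Real.pi), G (circleMap 0 1 θ • y)) :=
    fun y => smul_comm _ _ _
  simp only [hcomm]
  refine ⟨hI.smul _, ?_⟩
  rw [integral_smul, ← hswap, smul_smul, inv_mul_cancel₀ (by positivity), one_smul]

/-- Circle averages of holomorphic functions along complex lines. -/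
lemma holo_circle {F : Cn n → ℂ} {x : Cn n} {r : ℝ} (hF : DifferentiableOn ℂ F (Metric.ball x r))
    {w : Cn n} (hw : ‖w‖ < r) :
    (2 * Real.pi)⁻¹ • ∫ θ in (0:ℝ)..(2 * Real.pi), F (x + circleMap 0 1 θ • w) = F x := by
  have hm : ∀ ζ ∈ Metric.closedBall (0:ℂ) 1, x + ζ • w ∈ Metric.ball x r := by
    intro ζ hζ
    simp only [mem_closedBall_zero_iff] at hζ
    simp only [Metric.mem_ball, dist_self_add_left, norm_smul]
    nlinarith [norm_nonneg w]
  have hd : DifferentiableOn ℂ (fun ζ : ℂ => F (x + ζ • w)) (Metric.closedBall 0 1) := by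
    refine hF.comp (g := F) (f := fun ζ : ℂ => x + ζ • w) ?_ hm
    fun_prop
  have h2 : DiffContOnCl ℂ (fun ζ : ℂ => F (x + ζ • w)) (Metric.ball 0 |1|) := by
    rw [abs_one]
    exact DifferentiableOn.diffContOnCl (hd.mono Metric.closure_ball_subset_closedBall)
  have := h2.circleAverage
  simpa [Real.circleAverage_def] using this

/-- Mean value property of holomorphic functions with respect to the mollifier. -/
lemma moll_holo {F : Cn n → ℂ} {x : Cn n} {r ε : ℝ} (hε : 0 < ε) (hr : ε < r)
    (hF : DifferentiableOn ℂ F (Metric.ball x r)) : moll ε F x = F x := by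
  rw [moll_eq]
  have hcont : ContinuousOn (fun y => F (x - y)) (Metric.closedBall 0 ε) := by
    refine hF.continuousOn.comp (by fun_prop) ?_
    intro y hy
    simp at hy
    simp only [Metric.mem_ball, dist_eq_norm]; simp; linarith
  have hI : Integrable fun y => rho ε y • F (x - y) := by
    have h1 : IntegrableOn (fun y => rho ε y • F (x - y)) (Metric.closedBall 0 ε) :=
      ((sm_rho ε).continuous.continuousOn.smul hcont).integrableOn_compact
        (isCompact_closedBall _ _)
    rw [← integrableOn_iff_integrable_of_support_subset (s := Metric.closedBall 0 ε)]
    · exact h1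
    · intro y hy
      by_contra h
      simp at h
      apply hy
      simp [rho_eq_zero hε h.le]
  have := (rot_avg hI).2
  have e0 : ∀ y, (rho ε y : ℂ) * F (x - y) = rho ε y • F (x - y) := fun y => by simp
  simp_rw [e0]
  rw [this]
  have e : ∀ y, rho ε y • ((2 * Real.pi)⁻¹ •
        ∫ θ in (0:ℝ)..(2 * Real.pi), F (x - circleMap 0 1 θ • y)) = rho ε y • F x := by
    intro y
    by_cases hy : ε ≤ ‖y‖
    · simp [rho_eq_zero hε hy]
    · have := holo_circle hF (w := -y) (by rw [norm_neg]; linarith)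
      rw [← this]; simp [sub_eq_add_neg]
  simp_rw [e]
  rw [integral_smul_const, integral_rho hε, one_smul]

lemma moll_congr {ε : ℝ} (hε : 0 < ε) {u v : Cn n → ℂ} {x : Cn n}
    (h : ∀ y ∈ Metric.ball x ε, u y = v y) : moll ε u x = moll ε v x := by
  unfold moll cv
  refine integral_congr_ae (Eventually.of_forall fun y => ?_)
  by_cases hy : y ∈ Metric.ball x ε
  · simp [h y hy]
  · rw [Metric.mem_ball, dist_comm, dist_eq_norm, not_lt] at hy
    simp [toC, rho_eq_zero hε hy]

/-- A real differentiable function with vanishing `∂̄` is complex differentiable. -/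
lemma diff_of_db {F : Cn n → ℂ} {z : Cn n} (hd : DifferentiableAt ℝ F z)
    (h : ∀ j, db j F z = 0) : DifferentiableAt ℂ F z := by
  rw [differentiableAt_iff_restrictScalars ℝ hd]
  have hI : ∀ j, fderiv ℝ F z (Pi.single j Complex.I) = Complex.I * fderiv ℝ F z (Pi.single j 1) := by
    intro j
    have := h j
    unfold db wirt at this
    have h3 : fderiv ℝ F z (Pi.single j 1) + Complex.I * fderiv ℝ F z (Pi.single j Complex.I) = 0 := by
      linear_combination 2 * this
    linear_combination (-Complex.I) * h3 + (fderiv ℝ F z (Pi.single j Complex.I)) * Complex.I_mul_I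
  set L := fderiv ℝ F z
  have hsingle : ∀ (j : Fin n) (a : ℂ), L (Pi.single j a) = a * L (Pi.single j 1) := by
    intro j a
    have : (Pi.single j a : Cn n) = a.re • (Pi.single j (1:ℂ) : Cn n) +
        a.im • (Pi.single j Complex.I : Cn n) := by
      rw [← Pi.single_smul, ← Pi.single_smul, ← Pi.single_add]
      congr 1
      simp [Complex.re_add_im]
    rw [this, map_add, map_smul, map_smul, hI]
    simp only [Complex.real_smul]
    linear_combination (L (Pi.single j 1)) * Complex.re_add_im a
  have hL : ∀ v : Cn n, L v = ∑ j, v j * L (Pi.single j 1) := by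
    intro v
    conv_lhs => rw [← Finset.univ_sum_single v]
    rw [map_sum]
    exact Finset.sum_congr rfl fun j _ => hsingle j _
  refine ⟨{ toFun := L, map_add' := map_add L, map_smul' := ?_, cont := L.continuous }, ?_⟩
  · intro c v
    simp only [hL (c • v), hL v, Pi.smul_apply, smul_eq_mul, RingHom.id_apply, Finset.mul_sum]
    exact Finset.sum_congr rfl fun j _ => by ring
  · ext v; rfl

lemma db_of_diff {F : Cn n → ℂ} {z : Cn n} (hd : DifferentiableAt ℂ F z) (j : Fin n) :
    db j F z = 0 := by
  have : fderiv ℝ F z = (fderiv ℂ F z).restrictScalars ℝ := hd.fderiv_restrictScalars ℝ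
  unfold db wirt
  rw [this]
  have : (Pi.single j Complex.I : Cn n) = Complex.I • Pi.single j (1:ℂ) := by
    rw [← Pi.single_smul]; simp
  simp only [ContinuousLinearMap.coe_restrictScalars', this, map_smul, smul_eq_mul]
  linear_combination (1/2 * (fderiv ℂ F z) (Pi.single j 1)) * Complex.I_mul_I

/-- A holomorphic function agrees near any point with a globally smooth function. -/
lemma exists_smooth_ext {F : Cn n → ℂ} {x : Cn n} {r r' : ℝ} (hr : r' < r)
    (hF : DifferentiableOn ℂ F (Metric.ball x r)) :
    ∃ G : Cn n → ℂ, Sm G ∧ ∀ y ∈ Metric.ball x r', G y = F y := by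
  set ε := (r - r') / 3
  have hε : 0 < ε := by simp only [ε]; linarith
  set s := r - ε / 2
  set G0 := (Metric.closedBall x s).indicator F
  have hs : Metric.closedBall x s ⊆ Metric.ball x r :=
    Metric.closedBall_subset_ball (by simp only [s]; linarith)
  have hi : Integrable G0 := by
    rw [integrable_indicator_iff Metric.isClosed_closedBall.measurableSet]
    exact (hF.continuousOn.mono hs).integrableOn_compact (isCompact_closedBall _ _)
  refine ⟨moll ε G0, sm_moll hε hi.locallyIntegrable, fun y hy => ?_⟩
  have h1 : Metric.ball y (3 * ε / 2) ⊆ Metric.closedBall x s := by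
    intro w hw
    simp only [Metric.mem_ball, Metric.mem_closedBall] at *
    have := dist_triangle w y x
    simp only [s]
    have : 3 * ε = r - r' := by simp only [ε]; ring
    linarith
  rw [moll_congr hε (v := F) fun w hw => Set.indicator_of_mem
    (h1 (Metric.ball_subset_ball (by linarith) hw)) F]
  exact moll_holo hε (by linarith) (hF.mono (h1.trans hs))

/-- Derivatives of holomorphic functions are holomorphic. -/
lemma holo_dz {F : Cn n → ℂ} {U : Set (Cn n)} (hU : IsOpen U) (hF : DifferentiableOn ℂ F U)
    (k : Fin n) : DifferentiableOn ℂ (dz k F) U := by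
  intro x hx
  obtain ⟨r, hr, hb⟩ := Metric.isOpen_iff.1 hU x hx
  obtain ⟨G, hG, hGF⟩ := exists_smooth_ext (half_lt_self hr) (hF.mono hb)
  have hev : ∀ y ∈ Metric.ball x (r/2), G =ᶠ[𝓝 y] F := fun y hy =>
    Filter.eventually_of_mem (Metric.isOpen_ball.mem_nhds hy) hGF
  have hdz : ∀ y ∈ Metric.ball x (r/2), dz k G y = dz k F y := fun y hy =>
    wirt_congr (hev y hy)
  have hxb : x ∈ Metric.ball x (r/2) := Metric.mem_ball_self (by linarith)
  have hdb : ∀ j, ∀ y ∈ Metric.ball x (r/2), db j G y = 0 := fun j y hy => by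
    rw [show db j G y = db j F y from wirt_congr (hev y hy)]
    refine db_of_diff ((hF y (hb (Metric.ball_subset_ball (by linarith) hy))).differentiableAt
      (hU.mem_nhds (hb (Metric.ball_subset_ball (by linarith) hy)))) j
  have h1 : DifferentiableAt ℂ (dz k G) x := by
    refine diff_of_db (hG.wirt.dAt x) fun j => ?_
    rw [show db j (dz k G) x = dz k (db j G) x from wirt_comm hG _ ]
    rw [show dz k (db j G) x = dz k (fun _ => (0:ℂ)) x from wirt_congr
      (Filter.eventually_of_mem (Metric.isOpen_ball.mem_nhds hxb) (hdb j))]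
    simp [dz, wirt]
  exact (h1.congr_of_eventuallyEq (Filter.eventually_of_mem (Metric.isOpen_ball.mem_nhds hxb)
    fun y hy => (hdz y hy).symm)).differentiableWithinAt

lemma eLpNorm_two_sq (w : Cn n → ℂ) : eLpNorm w 2 volume ^ 2 = ∫⁻ x, ‖w x‖ₑ ^ 2 := by
  have := eLpNorm_nnreal_pow_eq_lintegral (μ := (volume : Measure (Cn n))) (f := w)
    (p := 2) (by norm_num)
  simpa using this

/-- Continuity of translations in `L²`. -/
lemma trans_cont {w : Cn n → ℂ} (hw : MemLp w 2 volume) {δ : ℝ≥0∞} (hδ : 0 < δ) :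
    ∃ ε > 0, ∀ h : Cn n, ‖h‖ ≤ ε → ∫⁻ x, ‖w (x + h) - w x‖ₑ ^ 2 ≤ δ := by
  set g : C(Cn n, C(Cn n, Cn n)) :=
    (ContinuousMap.mk (fun a : Cn n × Cn n => a.2 + a.1) (by fun_prop)).curry
  have hgm : ∀ h, MeasurePreserving (g h) volume volume := fun h =>
    measurePreserving_add_right volume h
  set T : Cn n → Lp ℂ 2 (volume : Measure (Cn n)) :=
    fun h => Lp.compMeasurePreserving (g h) (hgm h) (hw.toLp w)
  have hT : ∀ h, T h = (hw.comp_measurePreserving (hgm h)).toLp (w ∘ g h) := fun h =>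
    Lp.toLp_compMeasurePreserving hw (hgm h)
  have hc : Continuous T :=
    (continuous_const (y := hw.toLp w)).compMeasurePreservingLp g.continuous hgm (by simp)
  have h0 : T 0 = hw.toLp w := by
    rw [hT]; congr 1; ext x; simp [g]
  have ht : Tendsto (fun h : Cn n => edist (T h) (hw.toLp w) ^ 2) (𝓝 0) (𝓝 0) := by
    have h1 : Continuous fun h : Cn n => edist (T h) (hw.toLp w) :=
      hc.edist continuous_const
    have := (ENNReal.continuous_pow 2).comp h1 |>.tendsto 0
    simpa [h0, Function.comp_def] using this
  have hev := ht.eventually_le_const hδ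
  obtain ⟨ε, hε, hb⟩ := Metric.nhds_basis_closedBall.eventually_iff.1 hev
  refine ⟨ε, hε, fun h hh => ?_⟩
  have := hb (by simpa using hh)
  rw [hT, Lp.edist_toLp_toLp, eLpNorm_two_sq] at this
  exact this

lemma vol_ball_scale {ε : ℝ} (hε : 0 < ε) (x : Cn n) :
    volume.real (Metric.closedBall x ε) = ε ^ rdim n * volume.real (Metric.closedBall (0 : Cn n) 1) := by
  rw [measureReal_def, Measure.addHaar_closedBall' _ _ hε.le, ENNReal.toReal_mul,
    ENNReal.toReal_ofReal (by positivity), measureReal_def]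

/-- Mollifications converge almost everywhere. -/
lemma moll_ae {u : Cn n → ℂ} (hu : LocallyIntegrable u) :
    ∀ᵐ x, Tendsto (fun ε => moll ε u x) (𝓝[>] 0) (𝓝 (u x)) := by
  filter_upwards [IsUnifLocDoublingMeasure.ae_tendsto_average_norm_sub (volume : Measure (Cn n))
    hu 1] with x hx
  have h1 := hx (fun _ : ℝ => x) (fun ε => ε) (tendsto_id : Tendsto id (𝓝[>] (0:ℝ)) _) (by
    filter_upwards [self_mem_nhdsWithin] with ε hε
    simp only [Set.mem_Ioi] at hε
    simp [hε.le])
  set c := (rhoMass n)⁻¹ * volume.real (Metric.closedBall (0 : Cn n) 1)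
  have hm := rhoMass_pos (n := n)
  have h2 := h1.const_mul c
  rw [mul_zero] at h2
  rw [tendsto_iff_norm_sub_tendsto_zero]
  refine squeeze_zero' (Eventually.of_forall fun _ => norm_nonneg _) ?_ h2
  filter_upwards [self_mem_nhdsWithin] with ε hε
  simp only [Set.mem_Ioi] at hε
  have hI := cv_int (sm_rhoC ε).continuous (hcs_rhoC hε) hu x
  have hI1 : Integrable fun y => u x * rhoC ε (x - y) :=
    cv_int (sm_rhoC ε).continuous (hcs_rhoC hε)
      (locallyIntegrable_const (u x)) x
  have e1 : ∫ y, u x * rhoC ε (x - y) = u x := by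
    rw [integral_const_mul, integral_sub_left_eq_self (fun y => rhoC ε y) volume x]
    simp only [rhoC, toC]
    rw [integral_complex_ofReal, integral_rho hε]; simp
  have e2 : moll ε u x - u x = ∫ y, (u y - u x) * rhoC ε (x - y) := by
    have : ∀ y, (u y - u x) * rhoC ε (x - y) = u y * rhoC ε (x - y) - u x * rhoC ε (x - y) :=
      fun y => by ring
    simp_rw [this]
    rw [integral_sub hI hI1, e1]; rfl
  rw [e2]
  have hsub : IntegrableOn (fun y => ‖u y - u x‖) (Metric.closedBall x ε) :=
    ((hu.sub (locallyIntegrable_const (u x))).integrableOn_isCompact (isCompact_closedBall _ _)).norm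
  have hv : 0 < volume.real (Metric.closedBall (0 : Cn n) 1) := by
    rw [measureReal_def]
    exact ENNReal.toReal_pos (Metric.measure_closedBall_pos _ _ one_pos).ne'
      measure_closedBall_lt_top.ne
  calc ‖∫ y, (u y - u x) * rhoC ε (x - y)‖
      ≤ ∫ y, (Metric.closedBall x ε).indicator
          (fun y => (ε ^ rdim n * rhoMass n)⁻¹ * ‖u y - u x‖) y := by
        refine norm_integral_le_of_norm_le ?_ (Eventually.of_forall fun y => ?_)
        · rw [integrable_indicator_iff Metric.isClosed_closedBall.measurableSet]
          exact hsub.const_mul _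
        · by_cases hy : y ∈ Metric.closedBall x ε
          · rw [Set.indicator_of_mem hy, norm_mul, mul_comm]
            gcongr
            simp only [rhoC, toC, Complex.norm_real, Real.norm_of_nonneg (rho_nonneg hε _)]
            exact rho_le hε _
          · rw [Set.indicator_of_notMem hy]
            rw [Metric.mem_closedBall, dist_comm, dist_eq_norm, not_le] at hy
            simp [toC, rho_eq_zero hε hy.le]
    _ = c * ⨍ y in Metric.closedBall x ε, ‖u y - u x‖ := by
        rw [integral_indicator Metric.isClosed_closedBall.measurableSet, integral_const_mul,
          setAverage_eq, vol_ball_scale hε, smul_eq_mul]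
        simp only [c]
        field_simp

lemma moll_comm {ε δ : ℝ} (hε : 0 < ε) (hδ : 0 < δ) {u : Cn n → ℂ} (hu : LocallyIntegrable u) :
    moll ε (moll δ u) = moll δ (moll ε u) := by
  have key : ∀ {a b : ℝ}, 0 < a → 0 < b → ∀ x, moll b (moll a u) x =
      (u ⋆[ContinuousLinearMap.mul ℝ ℂ, volume]
        (rhoC a ⋆[ContinuousLinearMap.mul ℝ ℂ, volume] rhoC b)) x := by
    intro a b ha hb x
    refine convolution_assoc (ContinuousLinearMap.mul ℝ ℂ) (ContinuousLinearMap.mul ℝ ℂ)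
      (ContinuousLinearMap.mul ℝ ℂ) (ContinuousLinearMap.mul ℝ ℂ) (μ := volume)
      (fun x y z => by simp [mul_assoc]) hu.aestronglyMeasurable
      (sm_rhoC a).continuous.aestronglyMeasurable (sm_rhoC b).continuous.aestronglyMeasurable
      (Eventually.of_forall fun y => (hcs_rhoC ha).convolutionExists_right _ hu
        (sm_rhoC a).continuous y)
      (Eventually.of_forall fun y => (hcs_rhoC hb).norm.convolutionExists_right _
        (sm_rhoC a).continuous.norm.locallyIntegrable (sm_rhoC b).continuous.norm y) ?_
    refine HasCompactSupport.convolutionExists_right _ ?_ (fun y => (hu y).norm) ?_ x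
    · exact (hcs_rhoC ha).norm.convolution _ (hcs_rhoC hb).norm
    · exact (hcs_rhoC hb).norm.continuous_convolution_right _
        (sm_rhoC a).continuous.norm.locallyIntegrable (sm_rhoC b).continuous.norm
  ext x
  rw [key hδ hε, key hε hδ]
  congr 1
  have := convolution_flip (L := ContinuousLinearMap.mul ℝ ℂ) (μ := (volume : Measure (Cn n)))
    (f := rhoC ε) (g := rhoC δ)
  rw [← this]
  congr 1
  ext a; simp

/-- A weakly `∂̄`-closed locally integrable function is almost everywhere equal to an entire one. -/
lemma holo_of_weak {w : Cn n → ℂ} (hw : LocallyIntegrable w)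
    (h : ∀ (j : Fin n) (τ : Cn n → ℂ), Sm τ → HasCompactSupport τ → ∫ y, w y * db j τ y = 0) :
    ∃ F : Cn n → ℂ, Differentiable ℂ F ∧ w =ᵐ[volume] F := by
  have hd : ∀ ε > 0, Differentiable ℂ (moll ε w) := by
    intro ε hε x
    refine diff_of_db ((sm_moll hε hw).dAt x) fun j => ?_
    rw [db, wirt_cv (sm_rhoC ε) (hcs_rhoC hε) hw]
    have := h j _ (sm_shift (sm_rhoC ε) x) (hcs_shift (hcs_rhoC hε) x)
    simp only [db, wirt_shift (sm_rhoC ε), mul_neg, integral_neg, neg_eq_zero] at this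
    exact this
  have he : ∀ ε > 0, moll ε w = moll 1 w := by
    intro ε hε
    have e1 : moll ε (moll 1 w) = moll 1 w := by
      ext x; exact moll_holo hε (r := ε + 1) (by linarith) (hd 1 one_pos).differentiableOn
    have e2 : moll 1 (moll ε w) = moll ε w := by
      ext x; exact moll_holo one_pos (r := 2) (by norm_num) (hd ε hε).differentiableOn
    rw [← e1, ← e2, moll_comm hε one_pos hw, e2]
  refine ⟨moll 1 w, hd 1 one_pos, ?_⟩
  filter_upwards [moll_ae hw] with x hx
  refine tendsto_nhds_unique hx (tendsto_const_nhds.congr' ?_)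
  filter_upwards [self_mem_nhdsWithin] with ε hε
  rw [he ε hε]

lemma wirt_scale {σ : ℂ} {j : Fin n} {h : Cn n → ℂ} (hh : Sm h) (c : ℝ) (z : Cn n) :
    wirt σ j (fun x => h (c • x)) z = c * wirt σ j h (c • z) := by
  have h1 : HasFDerivAt (fun y : Cn n => c • y) (c • ContinuousLinearMap.id ℝ (Cn n)) z :=
    (hasFDerivAt_id z).const_smul c
  have := ((hh.dAt (c • z)).hasFDerivAt.comp z h1).fderiv
  rw [Function.comp_def] at this
  simp only [wirt, this, ContinuousLinearMap.comp_apply, _root_.smul_apply,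
    ContinuousLinearMap.id_apply, map_smul, Complex.real_smul]
  ring

lemma bdd_of_hcs {h : Cn n → ℂ} (hh : Continuous h) (hc : HasCompactSupport h) :
    ∃ C, 0 ≤ C ∧ ∀ z, ‖h z‖ ≤ C := by
  obtain ⟨C, hC⟩ := hh.bounded_above_of_compact_support hc
  exact ⟨C, (norm_nonneg _).trans (hC 0), hC⟩

lemma rhoC_eq (ε : ℝ) : (rhoC ε : Cn n → ℂ) =
    fun z => (((ε ^ rdim n * rhoMass n)⁻¹ : ℝ) : ℂ) * toC rho0 (ε⁻¹ • z) := by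
  ext z; simp [toC, rho]

lemma wirt_rhoC_bound (σ : ℂ) (j : Fin n) : ∃ C, 0 ≤ C ∧ ∀ ε > 0, ∀ z : Cn n,
    ‖wirt σ j (rhoC ε) z‖ ≤ C * (ε ^ rdim n)⁻¹ * ε⁻¹ := by
  have h0 : Sm (toC (rho0 : Cn n → ℝ)) := sm_rho0.toC
  have hc0 : HasCompactSupport (toC (rho0 : Cn n → ℝ)) :=
    hcs_rho0.comp_left (g := fun x : ℝ => (x : ℂ)) (by simp)
  obtain ⟨C, hC0, hC⟩ := bdd_of_hcs (h0.wirt (σ := σ) (j := j)).continuous (hcs_wirt hc0)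
  have hm := rhoMass_pos (n := n)
  refine ⟨C * (rhoMass n)⁻¹, by positivity, fun ε hε z => ?_⟩
  have hs : Sm fun z : Cn n => toC rho0 (ε⁻¹ • z) := h0.comp (contDiff_const_smul _)
  rw [rhoC_eq, wirt_const_mul _ (hs.dAt z), wirt_scale h0, norm_mul, norm_mul,
    Complex.norm_real, Complex.norm_real, Real.norm_of_nonneg (by positivity),
    Real.norm_of_nonneg (by positivity)]
  have := hC (ε⁻¹ • z)
  calc (ε ^ rdim n * rhoMass n)⁻¹ * (ε⁻¹ * ‖wirt σ j (toC rho0) (ε⁻¹ • z)‖)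
      ≤ (ε ^ rdim n * rhoMass n)⁻¹ * (ε⁻¹ * C) := by gcongr
    _ = _ := by rw [mul_inv]; ring

lemma wirt_rhoC_zero {σ : ℂ} {j : Fin n} {ε : ℝ} (hε : 0 < ε) {z : Cn n} (hz : ε < ‖z‖) :
    wirt σ j (rhoC ε) z = 0 := by
  have : rhoC ε =ᶠ[𝓝 z] fun _ => 0 := by
    filter_upwards [(continuous_norm.isOpen_preimage _ isOpen_Ioi).mem_nhds hz] with y hy
    simp only [rhoC, toC, rho_eq_zero hε (le_of_lt hy), Complex.ofReal_zero]
  rw [wirt_congr this, wirt_const]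

/-- Harmonicity tested against arbitrary test functions. -/
lemma weak_eq {Θ : Cn n → ℝ} (h : Sm Θ) {w : Cn n → ℂ}
    (hw : ∀ η : Cn n → ℂ, Sm η → HasCompactSupport η →
      ∫ z, w z * (conj (box Θ η z) * cden Θ z) = 0)
    {κ : Cn n → ℂ} (hκ : Sm κ) (hc : HasCompactSupport κ) :
    ∫ z, w z * ∑ j, db j (fun x => dz j κ x + dz j (toC Θ) x * κ x) z = 0 := by
  set e : Cn n → ℂ := cden (fun z => -Θ z)
  have hs : Sm e := Sm.cden (Θ := fun z => -Θ z) h.neg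
  have hee : ∀ z, e z * cden Θ z = 1 := fun z => by
    simp only [e, cden, ← Complex.ofReal_mul, ← Real.exp_add]; simp
  have hwe : ∀ (σ : ℂ) (j : Fin n) z, wirt σ j e z = wirt σ j (toC Θ) z * e z := by
    intro σ j z
    have e1 : wirt σ j (toC fun z => -Θ z) z = - wirt σ j (toC Θ) z := by
      have : (toC fun z => -Θ z) = fun z => - toC Θ z := by ext; simp [toC]
      rw [this, wirt_neg]
    simp only [e]
    rw [wirt_cden h.neg]
    change -(wirt σ j (toC fun z => -Θ z) z * _) = _
    rw [e1]; ring
  set κ' : Cn n → ℂ := fun z => conj (κ z)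
  have hκ' : Sm κ' := hκ.conj
  have key := hw (fun z => κ' z * e z) (hκ'.mul hs) ((hc.comp_left (by simp)).mul_right)
  rw [← key]
  refine integral_congr_ae (Eventually.of_forall fun z => ?_)
  beta_reduce
  congr 1
  unfold box
  rw [map_sum, Finset.sum_mul]
  refine Finset.sum_congr rfl fun j _ => ?_
  set b : Cn n → ℂ := fun x => db j κ' x + db j (toC Θ) x * κ' x
  have hb : Sm b := hκ'.wirt.add (h.toC.wirt.mul hκ')
  have e2 : db j (fun z => κ' z * e z) = fun x => b x * e x := by
    ext x
    rw [db, wirt_mul (hκ'.dAt x) (hs.dAt x), hwe]; simp only [b]; ring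
  have e3 : del Θ j (db j fun z => κ' z * e z) z = dz j b z * e z := by
    rw [e2, del, dz, wirt_mul (hb.dAt z) (hs.dAt z), hwe]; ring
  have e4 : (fun x => dz j κ x + dz j (toC Θ) x * κ x) = fun x => conj (b x) := by
    ext x
    simp only [b, map_add, map_mul, κ', Complex.conj_conj]
    rw [db_conj (hκ.dAt x), Complex.conj_conj, ← dz_conj (h.toC.dAt x)]
    congr 3
    ext y; simp [toC]
  rw [e3, e4, db_conj (hb.dAt z), map_mul, mul_assoc]
  rw [show conj (e z) = e z from conj_cden _ z, hee, mul_one]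

/-- The commutator kernel. -/
def ker (Θ : Cn n → ℝ) (ε : ℝ) (x y : Cn n) : ℂ :=
  ∑ j, ((dz j (toC Θ) y - dz j (toC Θ) x) * db j (rhoC ε) (x - y)
    - db j (dz j (toC Θ)) y * rhoC ε (x - y))

lemma ker_eq {Θ : Cn n → ℝ} (h : Sm Θ) (ε : ℝ) (x y : Cn n) :
    ker Θ ε x y = ∑ j, - db j (fun y => (dz j (toC Θ) y - dz j (toC Θ) x) * rhoC ε (x - y)) y := by
  refine Finset.sum_congr rfl fun j _ => ?_
  have h1 : Sm (dz j (toC Θ)) := h.toC.wirt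
  have h2 : Sm fun y => dz j (toC Θ) y - dz j (toC Θ) x := h1.sub contDiff_const
  simp only [db]
  rw [wirt_mul (h2.dAt y) ((sm_shift (sm_rhoC ε) x).dAt y), wirt_shift (sm_rhoC ε),
    wirt_sub (h1.dAt y) (differentiableAt_const _), wirt_const]
  ring

lemma ker_int {Θ : Cn n → ℝ} (h : Sm Θ) {ε : ℝ} (hε : 0 < ε) {w : Cn n → ℂ}
    (hw : LocallyIntegrable w) (x : Cn n) : Integrable fun y => w y * ker Θ ε x y := by
  have hc : ∀ f k : Cn n → ℂ, Continuous f → Continuous k → HasCompactSupport k →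
      Integrable fun y => w y * (f y * k (x - y)) := by
    intro f k hf hk hkc
    have : LocallyIntegrable fun y => w y * f y := by
      have := hw.locallyIntegrableOn Set.univ |>.mul_continuousOn hf.continuousOn
        isClosed_univ.isLocallyClosed
      exact locallyIntegrableOn_univ.1 this
    simpa [mul_assoc] using cv_int hk hkc this x
  unfold ker
  simp only [Finset.mul_sum, mul_sub (w _)]
  refine integrable_finsetSum _ fun j _ => ?_
  have h1 : Sm (dz j (toC Θ)) := h.toC.wirt
  have h3 : Sm (db j (dz j (toC Θ))) := h1.wirt
  have h4 : Sm (db j (rhoC ε : Cn n → ℂ)) := (sm_rhoC ε).wirt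
  exact (hc _ _ (h1.continuous.sub continuous_const) h4.continuous (hcs_wirt (hcs_rhoC hε))).sub
    (hc _ _ h3.continuous (sm_rhoC ε).continuous (hcs_rhoC hε))

lemma integral_ker {Θ : Cn n → ℝ} (h : Sm Θ) {ε : ℝ} (hε : 0 < ε) (x : Cn n) :
    ∫ y, ker Θ ε x y = 0 := by
  simp_rw [ker_eq h]
  have hs : ∀ j, Sm fun y => (dz j (toC Θ) y - dz j (toC Θ) x) * rhoC ε (x - y) := fun j => by
    have h1 : Sm (dz j (toC Θ)) := h.toC.wirt
    exact (h1.sub contDiff_const).mul (sm_shift (sm_rhoC ε) x)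
  have hc : ∀ j, HasCompactSupport
      fun y => (dz j (toC Θ) y - dz j (toC Θ) x) * rhoC ε (x - y) := fun j =>
    (hcs_shift (hcs_rhoC hε) x).mul_left
  have hi : ∀ j, Integrable fun y => - db j (fun y => (dz j (toC Θ) y - dz j (toC Θ) x) *
      rhoC ε (x - y)) y := fun j => (int_of_cs (hs j).wirt.continuous (hcs_wirt (hc j))).neg
  rw [integral_finsetSum _ fun j _ => hi j]
  refine Finset.sum_eq_zero fun j _ => ?_
  rw [integral_neg, neg_eq_zero]
  have := integral_wirt_mul (σ := Complex.I) (j := j) (hs j) (contDiff_const (c := (1:ℂ)))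
    (Or.inl (hc j))
  simpa [wirt_const] using this

/-- The mollification almost solves the equation. -/
lemma box_moll {Θ : Cn n → ℝ} (h : Sm Θ) {w : Cn n → ℂ} (hl : LocallyIntegrable w)
    (hw : ∀ η : Cn n → ℂ, Sm η → HasCompactSupport η →
      ∫ z, w z * (conj (box Θ η z) * cden Θ z) = 0) {ε : ℝ} (hε : 0 < ε) (x : Cn n) :
    box Θ (moll ε w) x = ∫ y, (w y - w x) * ker Θ ε x y := by
  have hk := ker_int h hε hl x
  have hk1 := ker_int h hε (locallyIntegrable_const (w x)) x
  have e0 : ∀ y, (w y - w x) * ker Θ ε x y = w y * ker Θ ε x y - w x * ker Θ ε x y :=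
    fun y => by ring
  simp_rw [e0]
  rw [integral_sub hk hk1, integral_const_mul, integral_ker h hε, mul_zero, sub_zero]
  have hsm := sm_moll hε hl
  have hr : ∀ {σ : ℂ} {j : Fin n}, Sm (wirt σ j (rhoC ε)) := (sm_rhoC ε).wirt
  have hrc : ∀ {σ : ℂ} {j : Fin n}, HasCompactSupport (wirt σ j (rhoC ε)) :=
    @fun _ _ => hcs_wirt (hcs_rhoC hε)
  have hdb : ∀ j, db j (moll ε w) = cv (db j (rhoC ε)) w := fun j => by
    ext y; exact wirt_cv (sm_rhoC ε) (hcs_rhoC hε) hl y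
  have e1 : box Θ (moll ε w) x = ∫ y, w y * ∑ j, (dz j (db j (rhoC ε)) (x - y)
      - dz j (toC Θ) x * db j (rhoC ε) (x - y)) := by
    simp only [Finset.mul_sum, mul_sub (w _)]
    have i1 : ∀ j : Fin n, Integrable fun y => w y * dz j (db j (rhoC ε)) (x - y) := fun j =>
      cv_int (hr (j := j)).wirt.continuous (hcs_wirt hrc) hl x
    have i2 : ∀ j : Fin n, Integrable fun y => w y * (dz j (toC Θ) x * db j (rhoC ε) (x - y)) := by
      intro j
      have := (cv_int (hr (σ := Complex.I) (j := j)).continuous hrc hl x).const_mul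
        (dz j (toC Θ) x)
      refine this.congr (Eventually.of_forall fun y => ?_)
      simp only [db]; ring
    have i3 : ∀ j : Fin n, Integrable fun y => w y * dz j (db j (rhoC ε)) (x - y) -
        w y * (dz j (toC Θ) x * db j (rhoC ε) (x - y)) := fun j => (i1 j).sub (i2 j)
    rw [integral_finsetSum _ fun j _ => i3 j]
    refine Finset.sum_congr rfl fun j _ => ?_
    rw [integral_sub (i1 j) (i2 j), del, hdb, dz, wirt_cv hr hrc hl]
    congr 1
    unfold cv
    rw [← integral_const_mul]
    congr 1; ext y; ring
  have e2 := weak_eq h hw (sm_shift (sm_rhoC ε) x) (hcs_shift (hcs_rhoC hε) x)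
  have e3 : ∀ y, ∑ j, db j (fun t => dz j (fun y => rhoC ε (x - y)) t
      + dz j (toC Θ) t * rhoC ε (x - t)) y = ∑ j, (dz j (db j (rhoC ε)) (x - y)
      - dz j (toC Θ) x * db j (rhoC ε) (x - y)) - ker Θ ε x y := by
    intro y
    unfold ker
    rw [← Finset.sum_sub_distrib]
    refine Finset.sum_congr rfl fun j _ => ?_
    have h1 : Sm (dz j (toC Θ)) := h.toC.wirt
    have h2 := sm_shift (sm_rhoC ε) x
    have f1 : dz j (fun y => rhoC ε (x - y)) = fun t => - dz j (rhoC ε) (x - t) := by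
      ext t; exact wirt_shift (sm_rhoC ε) x t
    have h3 : Sm fun t => dz j (rhoC ε) (x - t) := sm_shift hr x
    rw [f1, db, wirt_add (a := fun t => - dz j (rhoC ε) (x - t)) (b := fun t => dz j (toC Θ) t * rhoC ε (x - t))
        (h3.dAt y).neg ((h1.dAt y).mul (h2.dAt y)), wirt_neg, wirt_shift hr,
      wirt_mul (h1.dAt y) (h2.dAt y), wirt_shift (sm_rhoC ε), wirt_comm (sm_rhoC ε)]
    simp only [db, dz]; ring
  simp_rw [e3] at e2
  have i3 : Integrable fun y => w y * ∑ j, (dz j (db j (rhoC ε)) (x - y)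
      - dz j (toC Θ) x * db j (rhoC ε) (x - y)) := by
    refine cv_int (k := fun z => ∑ j, (dz j (db j (rhoC ε)) z
      - dz j (toC Θ) x * db j (rhoC ε) z)) ?_ ?_ hl x
    · refine continuous_finsetSum _ fun j _ => ?_
      exact (hr.wirt.continuous).sub (continuous_const.mul hr.continuous)
    · refine HasCompactSupport.intro (hcs_rhoC (n := n) hε) fun z hz => ?_
      refine Finset.sum_eq_zero fun j _ => ?_
      have z1 : db j (rhoC ε) z = 0 := by
        by_contra hne
        exact hz (tsupport_wirt_subset (subset_tsupport _ hne))
      have z2 : dz j (db j (rhoC ε)) z = 0 := by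
        by_contra hne
        exact hz (tsupport_wirt_subset (tsupport_wirt_subset (subset_tsupport _ hne)))
      rw [z1, z2]; simp
  simp only [mul_sub (w _)] at e2
  rw [integral_sub i3 hk] at e2
  rw [e1]
  exact sub_eq_zero.1 e2

lemma ker_bound {Θ : Cn n → ℝ} (h : Sm Θ) (S : ℝ) : ∃ C, 0 ≤ C ∧ ∀ ε, 0 < ε → ε ≤ 1 →
    ∀ x ∈ Metric.closedBall (0 : Cn n) S, ∀ y,
      ‖ker Θ ε x y‖ ≤ (Metric.closedBall x ε).indicator (fun _ => C * (ε ^ rdim n)⁻¹) y := by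
  have hm := rhoMass_pos (n := n)
  have hL : ∀ j : Fin n, ∃ K : ℝ≥0, LipschitzOnWith K (dz j (toC Θ)) (Metric.closedBall 0 (S + 1)) :=
    fun j => by
      have h1 : Sm (dz j (toC Θ)) := h.toC.wirt
      exact h1.contDiffOn.exists_lipschitzOnWith (by simp) (convex_closedBall _ _)
        (isCompact_closedBall _ _)
  have hB : ∀ j : Fin n, ∃ B, 0 ≤ B ∧ ∀ y ∈ Metric.closedBall (0 : Cn n) (S + 1),
      ‖db j (dz j (toC Θ)) y‖ ≤ B := fun j => by
    have h1 : Sm (db j (dz j (toC Θ))) := (h.toC.wirt).wirt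
    obtain ⟨B, hB⟩ := (isCompact_closedBall (0 : Cn n) (S + 1)).exists_bound_of_continuousOn
      h1.continuous.continuousOn
    exact ⟨max B 0, le_max_right _ _, fun y hy => (hB y hy).trans (le_max_left _ _)⟩
  choose L hL using hL
  choose B hB0 hB using hB
  choose D hD0 hD using fun j : Fin n => wirt_rhoC_bound (n := n) Complex.I j
  refine ⟨∑ j, (L j * D j + B j * (rhoMass n)⁻¹),
    Finset.sum_nonneg fun j _ => by have := hD0 j; have := hB0 j; positivity, ?_⟩
  intro ε hε hε1 x hx y
  by_cases hy : y ∈ Metric.closedBall x ε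
  · rw [Set.indicator_of_mem hy]
    have hy' : y ∈ Metric.closedBall (0 : Cn n) (S + 1) := by
      simp only [Metric.mem_closedBall] at *
      linarith [dist_triangle y x 0]
    have hx' : x ∈ Metric.closedBall (0 : Cn n) (S + 1) :=
      Metric.closedBall_subset_closedBall (by linarith) hx
    unfold ker
    rw [Finset.sum_mul]
    refine (norm_sum_le _ _).trans (Finset.sum_le_sum fun j _ => ?_)
    refine (norm_sub_le _ _).trans ?_
    rw [norm_mul, norm_mul, add_mul]
    have hDj := hD0 j
    refine add_le_add ?_ ?_
    · have h1 : ‖dz j (toC Θ) y - dz j (toC Θ) x‖ ≤ L j * ε := by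
        refine ((hL j).norm_sub_le hy' hx').trans ?_
        rw [← dist_eq_norm]
        gcongr
        exact hy
      calc _ ≤ (L j * ε) * (D j * (ε ^ rdim n)⁻¹ * ε⁻¹) := by
            gcongr
            exact hD j ε hε _
        _ = _ := by field_simp
    · calc _ ≤ B j * (ε ^ rdim n * rhoMass n)⁻¹ := by
            gcongr
            · exact hB0 j
            · exact hB j y hy'
            · simp only [toC, Complex.norm_real, Real.norm_of_nonneg (rho_nonneg hε _)]
              exact rho_le hε _
        _ = _ := by rw [mul_inv]; ring
  · rw [Set.indicator_of_notMem hy]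
    rw [Metric.mem_closedBall, dist_comm, dist_eq_norm, not_le] at hy
    refine le_of_eq (norm_eq_zero.2 (Finset.sum_eq_zero fun j _ => ?_))
    have h0 : db j (rhoC ε) (x - y) = 0 := wirt_rhoC_zero hε hy
    have h1 : rhoC ε (x - y) = 0 := by simp [rhoC, toC, rho_eq_zero hε hy.le]
    simp [h0, h1]

lemma sq_lintegral_le {α : Type*} [MeasurableSpace α] {μ : Measure α} {f : α → ℝ≥0∞}
    (hf : AEMeasurable f μ) : (∫⁻ x, f x ∂μ) ^ 2 ≤ μ Set.univ * ∫⁻ x, f x ^ 2 ∂μ := by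
  have h := ENNReal.lintegral_mul_le_Lp_mul_Lq μ (p := 2) (q := 2)
    (Real.holderConjugate_iff.2 ⟨by norm_num, by norm_num⟩) hf (aemeasurable_const (b := (1:ℝ≥0∞)))
  simp only [Pi.mul_apply, mul_one, ENNReal.one_rpow, lintegral_const, one_mul] at h
  have e : ∀ a : ℝ≥0∞, (a ^ (1 / 2 : ℝ)) ^ 2 = a := fun a => by
    rw [← ENNReal.rpow_natCast, ← ENNReal.rpow_mul]; norm_num
  calc (∫⁻ x, f x ∂μ) ^ 2 ≤ _ := pow_le_pow_left' h 2
    _ = _ := by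
      rw [mul_pow, e, e, mul_comm]
      simp only [ENNReal.rpow_ofNat]

/-- `L²` bound for approximate identities in terms of translation differences. -/
lemma kernel_bound {w : Cn n → ℂ} (hm : Measurable w) {ε C : ℝ} (hε : 0 < ε) (hC : 0 ≤ C)
    {K : Cn n → Cn n → ℂ} {S : Set (Cn n)} (hS : MeasurableSet S)
    (hK : ∀ x ∈ S, ∀ y, ‖K x y‖ ≤
      (Metric.closedBall x ε).indicator (fun _ => C * (ε ^ rdim n)⁻¹) y)
    {δ : ℝ≥0∞} (hδ : ∀ h : Cn n, ‖h‖ ≤ ε → ∫⁻ x, ‖w (x + h) - w x‖ₑ ^ 2 ≤ δ) :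
    ∫⁻ x in S, ‖∫ y, (w y - w x) * K x y‖ₑ ^ 2 ≤
      ENNReal.ofReal ((C * volume.real (Metric.closedBall (0 : Cn n) 1)) ^ 2) * δ := by
  set V := volume.real (Metric.closedBall (0 : Cn n) 1)
  set B := Metric.closedBall (0 : Cn n) ε
  set c := ENNReal.ofReal (C * (ε ^ rdim n)⁻¹)
  have hBm : MeasurableSet B := Metric.isClosed_closedBall.measurableSet
  have hvol : volume B = ENNReal.ofReal (ε ^ rdim n * V) := by
    rw [← vol_ball_scale hε 0, ofReal_measureReal measure_closedBall_lt_top.ne]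
  have hpt : ∀ x ∈ S, ‖∫ y, (w y - w x) * K x y‖ₑ ^ 2 ≤
      c ^ 2 * (volume B * ∫⁻ h in B, ‖w (x + h) - w x‖ₑ ^ 2) := by
    intro x hx
    have h1 : ‖∫ y, (w y - w x) * K x y‖ₑ ≤ c * ∫⁻ h in B, ‖w (x + h) - w x‖ₑ := by
      refine (enorm_integral_le_lintegral_enorm _).trans ?_
      rw [← lintegral_const_mul _ (by fun_prop), ← lintegral_indicator hBm,
        ← lintegral_add_left_eq_self _ x]
      refine lintegral_mono fun h => ?_
      have := hK x hx (x + h)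
      by_cases hh : h ∈ B
      · rw [Set.indicator_of_mem hh]
        rw [Set.indicator_of_mem (by simpa [B] using hh)] at this
        rw [enorm_mul, mul_comm]
        gcongr
        rw [← ofReal_norm]
        exact ENNReal.ofReal_le_ofReal this
      · rw [Set.indicator_of_notMem hh]
        rw [Set.indicator_of_notMem (by simpa [B] using hh)] at this
        have : K x (x + h) = 0 := norm_le_zero_iff.1 this
        simp [this]
    calc _ ≤ (c * ∫⁻ h in B, ‖w (x + h) - w x‖ₑ) ^ 2 := pow_le_pow_left' h1 2
      _ ≤ _ := by
        rw [mul_pow]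
        gcongr
        have := sq_lintegral_le (μ := volume.restrict B) (f := fun h => ‖w (x + h) - w x‖ₑ)
          (by fun_prop)
        simpa using this
  have hmm : Measurable fun p : Cn n × Cn n => ‖w (p.1 + p.2) - w p.1‖ₑ ^ 2 := by fun_prop
  calc ∫⁻ x in S, ‖∫ y, (w y - w x) * K x y‖ₑ ^ 2
      ≤ ∫⁻ x in S, c ^ 2 * (volume B * ∫⁻ h in B, ‖w (x + h) - w x‖ₑ ^ 2) :=
        setLIntegral_mono' hS hpt
    _ ≤ ∫⁻ x, c ^ 2 * (volume B * ∫⁻ h in B, ‖w (x + h) - w x‖ₑ ^ 2) :=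
        setLIntegral_le_lintegral _ _
    _ = c ^ 2 * (volume B * ∫⁻ h in B, ∫⁻ x, ‖w (x + h) - w x‖ₑ ^ 2) := by
        rw [lintegral_const_mul _ (Measurable.const_mul hmm.lintegral_prod_right' _),
          lintegral_const_mul _ hmm.lintegral_prod_right',
          lintegral_lintegral_swap hmm.aemeasurable]
    _ ≤ c ^ 2 * (volume B * ∫⁻ h in B, δ) := by
        gcongr 2
        exact setLIntegral_mono' hBm fun h hh => hδ h (by simpa [B] using hh)
    _ = ENNReal.ofReal ((C * V) ^ 2) * δ := by
        rw [setLIntegral_const, hvol]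
        simp only [c]
        rw [← ENNReal.ofReal_pow (by positivity), mul_comm δ, ← mul_assoc, ← mul_assoc,
          ← ENNReal.ofReal_mul (by positivity), ← ENNReal.ofReal_mul (by positivity)]
        congr 2
        field_simp

/-- The energy identity turned into an estimate. -/
lemma energy {Θ : Cn n → ℝ} (h : Sm Θ) {W : Cn n → ℂ} (hW : Sm W) {χ : Cn n → ℝ} (hχ : Sm χ)
    (hc : HasCompactSupport χ) :
    ∫ z, χ z ^ 2 * (∑ j, ‖db j W z‖ ^ 2) * Real.exp (-Θ z) ≤
      ∫ z, (2 * χ z ^ 2 * ‖box Θ W z‖ * ‖W z‖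
        + 4 * (∑ j, ‖db j (toC χ) z‖ ^ 2) * ‖W z‖ ^ 2) * Real.exp (-Θ z) := by
  set χ2 : Cn n → ℂ := fun z => toC χ z * (toC χ z * W z)
  have hcC : HasCompactSupport (toC χ) := hc.comp_left (g := fun x : ℝ => (x : ℂ)) (by simp)
  have hχ2 : Sm χ2 := hχ.toC.mul (hχ.toC.mul hW)
  have hχ2c : HasCompactSupport χ2 := hcC.mul_right
  have hdW : ∀ j, Sm (db j W) := fun j => hW.wirt
  have hdχ : ∀ j, Sm (db j (toC χ)) := fun j => hχ.toC.wirt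
  have e1 : ip Θ (box Θ W) χ2 = - ∑ j, ip Θ (db j W) (db j χ2) := by
    have : box Θ W = fun z => ∑ j, del Θ j (db j W) z := rfl
    rw [this, ip_sum_left fun j _ => ip_int h (h.del (hdW j)).continuous hχ2.continuous (Or.inr hχ2c),
      ← Finset.sum_neg_distrib]
    exact Finset.sum_congr rfl fun j _ => ip_del h (hdW j) hχ2 (Or.inr hχ2c)
  have hdb2 : ∀ j z, db j χ2 z = 2 * toC χ z * db j (toC χ) z * W z + toC χ z ^ 2 * db j W z := by
    intro j z
    have a1 := hχ.toC.dAt z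
    have a2 := hW.dAt z
    simp only [db, χ2]
    rw [wirt_mul (b := fun z => toC χ z * W z) a1 (a1.mul a2), wirt_mul a1 a2]; ring
  set p : Cn n → ℝ := fun z => Real.exp (-Θ z)
  have hp : Continuous p := Real.continuous_exp.comp h.continuous.neg
  have hX : Integrable fun z => χ z ^ 2 * (∑ j, ‖db j W z‖ ^ 2) * p z := by
    refine Continuous.integrable_of_hasCompactSupport ?_ ?_
    · refine ((hχ.continuous.pow 2).mul (continuous_finsetSum _ fun j _ => ?_)).mul hp
      exact (hdW j).continuous.norm.pow 2
    · refine HasCompactSupport.intro hc fun z hz => ?_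
      simp [image_eq_zero_of_notMem_tsupport hz]
  have hY : Integrable fun z => (2 * χ z ^ 2 * ‖box Θ W z‖ * ‖W z‖
        + 4 * (∑ j, ‖db j (toC χ) z‖ ^ 2) * ‖W z‖ ^ 2) * p z := by
    refine Continuous.integrable_of_hasCompactSupport ?_ ?_
    · refine Continuous.mul (Continuous.add ?_ ?_) hp
      · exact ((continuous_const.mul (hχ.continuous.pow 2)).mul (h.box hW).continuous.norm).mul
          hW.continuous.norm
      · refine (continuous_const.mul (continuous_finsetSum _ fun j _ => ?_)).mul
          (hW.continuous.norm.pow 2)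
        exact (hdχ j).continuous.norm.pow 2
    · refine HasCompactSupport.intro hc fun z hz => ?_
      have hz' : z ∉ tsupport (toC χ) := fun hh => hz
        (closure_mono (s := Function.support (toC χ)) (t := Function.support χ)
          (fun y hy => by simpa [toC] using hy) hh)
      have : ∀ j, db j (toC χ) z = 0 := fun j => by
        by_contra hne
        exact hz' (tsupport_wirt_subset (subset_tsupport _ hne))
      simp [image_eq_zero_of_notMem_tsupport hz, this]
  have hI1 : Integrable fun z => box Θ W z * conj (χ2 z) * cden Θ z :=
    ip_int h (h.box hW).continuous hχ2.continuous (Or.inr hχ2c)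
  have hI2 : ∀ j, Integrable fun z => db j W z * conj (db j χ2 z) * cden Θ z := fun j =>
    ip_int h (hdW j).continuous hχ2.wirt.continuous (Or.inr (hcs_wirt hχ2c))
  have hzero : ∫ z, (box Θ W z * conj (χ2 z) * cden Θ z +
      ∑ j, db j W z * conj (db j χ2 z) * cden Θ z) = 0 := by
    rw [integral_add hI1 (integrable_finsetSum _ fun j _ => hI2 j),
      integral_finsetSum _ fun j _ => hI2 j]
    change ip Θ (box Θ W) χ2 + ∑ j, ip Θ (db j W) (db j χ2) = 0
    rw [e1]; ring
  have hIs : Integrable fun z => box Θ W z * conj (χ2 z) * cden Θ z +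
      ∑ j, db j W z * conj (db j χ2 z) * cden Θ z :=
    hI1.add (integrable_finsetSum _ fun j _ => hI2 j)
  have hre : ∫ z, (box Θ W z * conj (χ2 z) * cden Θ z +
      ∑ j, db j W z * conj (db j χ2 z) * cden Θ z).re = 0 := by
    have := integral_re (𝕜 := ℂ) hIs
    simp only [RCLike.re_to_complex] at this
    rw [this, hzero]; simp
  have hreI : Integrable fun z => (box Θ W z * conj (χ2 z) * cden Θ z +
      ∑ j, db j W z * conj (db j χ2 z) * cden Θ z).re :=
    hIs.re
  rw [← sub_nonneg, ← integral_sub hY hX]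
  have hfin : 0 ≤ ∫ z, ((2 * χ z ^ 2 * ‖box Θ W z‖ * ‖W z‖
        + 4 * (∑ j, ‖db j (toC χ) z‖ ^ 2) * ‖W z‖ ^ 2) * p z
      - χ z ^ 2 * (∑ j, ‖db j W z‖ ^ 2) * p z) + 2 * (box Θ W z * conj (χ2 z) * cden Θ z +
      ∑ j, db j W z * conj (db j χ2 z) * cden Θ z).re := by
    refine integral_nonneg fun z => ?_
    have hpz : 0 < p z := Real.exp_pos _
    have c1 : -(χ z ^ 2 * ‖box Θ W z‖ * ‖W z‖) ≤ (box Θ W z * conj (χ2 z)).re := by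
      refine (neg_le_neg ?_).trans (neg_le_of_abs_le (Complex.abs_re_le_norm _))
      rw [norm_mul, RCLike.norm_conj]
      simp only [χ2, norm_mul, toC, Complex.norm_real, Real.norm_eq_abs]
      rw [← sq_abs (χ z)]
      exact le_of_eq (by ring)
    have c2 : ∀ j, (1 / 2) * (χ z ^ 2 * ‖db j W z‖ ^ 2) - 2 * (‖db j (toC χ) z‖ ^ 2 * ‖W z‖ ^ 2) ≤
        (db j W z * conj (db j χ2 z)).re := by
      intro j
      have : db j W z * conj (db j χ2 z) = ((χ z ^ 2 * ‖db j W z‖ ^ 2 : ℝ) : ℂ)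
          + 2 * χ z * (db j W z * conj (db j (toC χ) z * W z)) := by
        rw [hdb2]
        have : db j W z * conj (db j W z) = ((‖db j W z‖ ^ 2 : ℝ) : ℂ) := by
          rw [Complex.mul_conj, Complex.normSq_eq_norm_sq]
        push_cast at this ⊢
        simp only [map_add, map_mul, map_pow, toC, Complex.conj_ofReal, map_ofNat]
        linear_combination (χ z : ℂ) ^ 2 * this
      rw [this, Complex.add_re, Complex.ofReal_re]
      have c3 : |(2 * χ z * (db j W z * conj (db j (toC χ) z * W z)) : ℂ).re| ≤
          2 * (|χ z| * ‖db j W z‖) * (‖db j (toC χ) z‖ * ‖W z‖) := by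
        refine (Complex.abs_re_le_norm _).trans (le_of_eq ?_)
        simp only [norm_mul, RCLike.norm_conj, Complex.norm_real, Real.norm_eq_abs,
          Complex.norm_ofNat]
        ring
      have c4 := neg_le_of_abs_le c3
      have c5 : χ z ^ 2 * ‖db j W z‖ ^ 2 = (|χ z| * ‖db j W z‖) ^ 2 := by
        rw [mul_pow, sq_abs]
      rw [c5]
      nlinarith [sq_nonneg (|χ z| * ‖db j W z‖ - 2 * (‖db j (toC χ) z‖ * ‖W z‖))]
    have c6 : (∑ j, db j W z * conj (db j χ2 z)).re ≥
        (1 / 2) * (χ z ^ 2 * ∑ j, ‖db j W z‖ ^ 2)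
          - 2 * ((∑ j, ‖db j (toC χ) z‖ ^ 2) * ‖W z‖ ^ 2) := by
      rw [Complex.re_sum, Finset.mul_sum, Finset.sum_mul, Finset.mul_sum, Finset.mul_sum,
        ← Finset.sum_sub_distrib]
      exact Finset.sum_le_sum fun j _ => c2 j
    have c7 : (box Θ W z * conj (χ2 z) * cden Θ z +
      ∑ j, db j W z * conj (db j χ2 z) * cden Θ z).re =
        ((box Θ W z * conj (χ2 z)).re + (∑ j, db j W z * conj (db j χ2 z)).re) * p z := by
      rw [← Finset.sum_mul, ← add_mul, cden, Complex.re_mul_ofReal, Complex.add_re]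
    simp only [Pi.zero_apply, c7]
    nlinarith
  have hYX : Integrable fun z => ((2 * χ z ^ 2 * ‖box Θ W z‖ * ‖W z‖
        + 4 * (∑ j, ‖db j (toC χ) z‖ ^ 2) * ‖W z‖ ^ 2) * p z
      - χ z ^ 2 * (∑ j, ‖db j W z‖ ^ 2) * p z) := hY.sub hX
  rw [integral_add hYX (hreI.const_mul 2), integral_const_mul, hre] at hfin
  simpa using hfin

lemma moll_sub_self {w : Cn n → ℂ} (hl : LocallyIntegrable w) {ε : ℝ} (hε : 0 < ε) (x : Cn n) :
    moll ε w x - w x = ∫ y, (w y - w x) * rhoC ε (x - y) := by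
  have h1 := cv_int (sm_rhoC ε).continuous (hcs_rhoC hε) hl x
  have h2 := cv_int (sm_rhoC ε).continuous (hcs_rhoC hε) (locallyIntegrable_const (w x)) x
  simp_rw [sub_mul]
  rw [integral_sub h1 h2, integral_const_mul, integral_sub_left_eq_self (rhoC ε) volume x]
  have : ∫ y : Cn n, rhoC ε y = 1 := by
    simp only [rhoC, toC]
    rw [integral_complex_ofReal, integral_rho hε, Complex.ofReal_one]
  rw [this, mul_one]; rfl

/-- Mollifications of a weak solution are approximate solutions converging to it locally in `L²`. -/
lemma approx {Θ : Cn n → ℝ} (h : Sm Θ) {w : Cn n → ℂ} (hm : Measurable w)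
    (hl : LocallyIntegrable w) (hL : ∀ S, ∫⁻ z in Metric.closedBall (0 : Cn n) S, ‖w z‖ₑ ^ 2 < ⊤)
    (hw : ∀ η : Cn n → ℂ, Sm η → HasCompactSupport η →
      ∫ z, w z * (conj (box Θ η z) * cden Θ z) = 0) (S : ℝ) {δ : ℝ} (hδ : 0 < δ) :
    ∃ ε > 0, ∫⁻ z in Metric.closedBall 0 S, ‖box Θ (moll ε w) z‖ₑ ^ 2 ≤ ENNReal.ofReal δ ∧
      ∫⁻ z in Metric.closedBall 0 S, ‖moll ε w z - w z‖ₑ ^ 2 ≤ ENNReal.ofReal δ := by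
  obtain ⟨C₁, hC₁, hK⟩ := ker_bound h S
  set C₂ := (rhoMass n)⁻¹
  have hC₂ : 0 ≤ C₂ := inv_nonneg.2 rhoMass_pos.le
  set V := volume.real (Metric.closedBall (0 : Cn n) 1)
  set M := ((C₁ * V) ^ 2 + (C₂ * V) ^ 2 + 1)
  have hM : 0 < M := by positivity
  set B := Metric.closedBall (0 : Cn n) (S + 1)
  have hB : MeasurableSet B := Metric.isClosed_closedBall.measurableSet
  set w1 := B.indicator w
  have hm1 : Measurable w1 := hm.indicator hB
  have hw1 : MemLp w1 2 volume := by
    refine ⟨hm1.aestronglyMeasurable, ?_⟩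
    have e := eLpNorm_two_sq w1
    have : ∫⁻ x, ‖w1 x‖ₑ ^ 2 < ⊤ := by
      refine lt_of_eq_of_lt ?_ (hL (S + 1))
      rw [← lintegral_indicator hB]
      refine lintegral_congr fun x => ?_
      by_cases hx : x ∈ B <;> simp [w1, hx]
    rw [← e] at this
    exact (ENNReal.pow_lt_top_iff.1 this).resolve_right (by norm_num)
  obtain ⟨ε₀, hε₀, ht⟩ := trans_cont hw1 (δ := ENNReal.ofReal (δ / M))
    (ENNReal.ofReal_pos.2 (by positivity))
  set ε := min ε₀ 1
  have hε : 0 < ε := lt_min hε₀ one_pos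
  have ht' : ∀ h : Cn n, ‖h‖ ≤ ε → ∫⁻ x, ‖w1 (x + h) - w1 x‖ₑ ^ 2 ≤ ENNReal.ofReal (δ / M) :=
    fun h hh => ht h (hh.trans (min_le_left _ _))
  have main : ∀ (C : ℝ) (K : Cn n → Cn n → ℂ), 0 ≤ C → (C * V) ^ 2 ≤ M →
      (∀ x ∈ Metric.closedBall (0 : Cn n) S, ∀ y,
        ‖K x y‖ ≤ (Metric.closedBall x ε).indicator (fun _ => C * (ε ^ rdim n)⁻¹) y) →
      ∫⁻ x in Metric.closedBall 0 S, ‖∫ y, (w y - w x) * K x y‖ₑ ^ 2 ≤ ENNReal.ofReal δ := by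
    intro C K hC hCM hK
    have e : ∀ x ∈ Metric.closedBall (0 : Cn n) S, ∫ y, (w y - w x) * K x y =
        ∫ y, (w1 y - w1 x) * K x y := by
      intro x hx
      refine integral_congr_ae (Eventually.of_forall fun y => ?_)
      simp only
      have hx1 : x ∈ B := Metric.closedBall_subset_closedBall (by linarith) hx
      by_cases hy : y ∈ Metric.closedBall x ε
      · have hy1 : y ∈ B := by
          have : ε ≤ 1 := min_le_right _ _
          simp only [Metric.mem_closedBall, B] at *
          linarith [dist_triangle y x 0]
        simp [w1, hx1, hy1]
      · have := hK x hx y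
        rw [Set.indicator_of_notMem hy] at this
        simp [norm_le_zero_iff.1 this]
    rw [setLIntegral_congr_fun Metric.isClosed_closedBall.measurableSet
      (fun x hx => by rw [e x hx])]
    refine (kernel_bound hm1 hε hC Metric.isClosed_closedBall.measurableSet hK ht').trans ?_
    rw [← ENNReal.ofReal_mul (by positivity)]
    refine ENNReal.ofReal_le_ofReal ?_
    rw [mul_div_assoc', div_le_iff₀ hM]
    nlinarith
  refine ⟨ε, hε, ?_, ?_⟩
  · simp_rw [box_moll h hl hw hε]
    exact main C₁ _ hC₁ (by simp only [M]; nlinarith [sq_nonneg (C₂ * V)])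
      (hK ε hε (min_le_right _ _))
  · simp_rw [moll_sub_self hl hε]
    refine main C₂ (fun x y => rhoC ε (x - y)) hC₂ (by simp only [M]; nlinarith [sq_nonneg (C₁ * V)])
      fun x _ y => ?_
    simp only [toC, Complex.norm_real, Real.norm_of_nonneg (rho_nonneg hε _)]
    by_cases hy : y ∈ Metric.closedBall x ε
    · rw [Set.indicator_of_mem hy]
      refine (rho_le hε _).trans (le_of_eq ?_)
      rw [mul_inv]; ring
    · rw [Set.indicator_of_notMem hy]
      rw [Metric.mem_closedBall, dist_comm, dist_eq_norm, not_le] at hy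
      exact (rho_eq_zero hε hy.le).le

lemma weighted_int {h : Cn n → ℂ} (hm : Measurable h) {p : Cn n → ℝ} (hp : Continuous p)
    (hp0 : ∀ z, 0 ≤ p z) {S P : ℝ} (hP : ∀ z ∈ Metric.closedBall (0 : Cn n) S, p z ≤ P)
    (hP0 : 0 ≤ P) {δ : ℝ} (hδ : 0 ≤ δ)
    (hh : ∫⁻ z in Metric.closedBall 0 S, ‖h z‖ₑ ^ 2 ≤ ENNReal.ofReal δ) :
    IntegrableOn (fun z => ‖h z‖ ^ 2 * p z) (Metric.closedBall 0 S) ∧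
      ∫ z in Metric.closedBall 0 S, ‖h z‖ ^ 2 * p z ≤ P * δ := by
  have hmeas : Measurable fun z => ‖h z‖ ^ 2 * p z := (hm.norm.pow_const 2).mul hp.measurable
  have key : ∫⁻ z in Metric.closedBall 0 S, ENNReal.ofReal (‖h z‖ ^ 2 * p z) ≤
      ENNReal.ofReal (P * δ) := by
    calc _ ≤ ∫⁻ z in Metric.closedBall 0 S, ENNReal.ofReal P * ‖h z‖ₑ ^ 2 := by
          refine setLIntegral_mono' Metric.isClosed_closedBall.measurableSet fun z hz => ?_
          rw [mul_comm, ENNReal.ofReal_mul (hp0 z), ENNReal.ofReal_pow (norm_nonneg _), ofReal_norm]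
          gcongr
          exact hP z hz
      _ ≤ _ := by
          rw [lintegral_const_mul _ (by fun_prop), ENNReal.ofReal_mul hP0]
          gcongr
  have hnn : ∀ z, 0 ≤ ‖h z‖ ^ 2 * p z := fun z => mul_nonneg (by positivity) (hp0 z)
  refine ⟨⟨hmeas.aestronglyMeasurable, ?_⟩, ?_⟩
  · rw [hasFiniteIntegral_iff_ofReal (Eventually.of_forall hnn)]
    exact key.trans_lt ENNReal.ofReal_lt_top
  · rw [integral_eq_lintegral_of_nonneg_ae (Eventually.of_forall hnn) hmeas.aestronglyMeasurable]
    exact ENNReal.toReal_le_of_le_ofReal (by positivity) key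

/-- Cutoff functions with small gradient. -/
lemma exists_cutoff (n : ℕ) : ∃ C : ℝ, 0 ≤ C ∧ ∀ S : ℝ, 1 ≤ S → ∃ χ : Cn n → ℝ, Sm χ ∧
    (∀ z, 0 ≤ χ z ∧ χ z ≤ 1) ∧ (∀ z, ssq z ≤ S ^ 2 → χ z = 1) ∧
    (∀ z ∉ Metric.closedBall (0 : Cn n) (2 * S), χ z = 0) ∧
    ∀ z, ∑ j, ‖db j (toC χ) z‖ ^ 2 ≤ C / S ^ 2 := by
  set χ1 : Cn n → ℝ := fun z => Real.smoothTransition (2 - ssq z)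
  have h1 : Sm χ1 := Real.smoothTransition.contDiff.comp (contDiff_const.sub sm_ssq)
  have hz1 : ∀ z ∉ Metric.closedBall (0 : Cn n) 2, χ1 z = 0 := by
    intro z hz
    refine Real.smoothTransition.zero_of_nonpos ?_
    have := norm_sq_le_ssq z
    simp only [Metric.mem_closedBall, dist_zero_right, not_le] at hz
    nlinarith
  have hc : HasCompactSupport χ1 := HasCompactSupport.intro (isCompact_closedBall (0 : Cn n) 2) hz1
  have hcC : HasCompactSupport (toC χ1) := hc.comp_left (g := fun x : ℝ => (x : ℂ)) (by simp)
  choose c hc0 hcb using fun j : Fin n =>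
    bdd_of_hcs (h := db j (toC χ1)) h1.toC.wirt.continuous (hcs_wirt hcC)
  refine ⟨∑ j, c j ^ 2, Finset.sum_nonneg fun j _ => sq_nonneg _, fun S hS => ?_⟩
  have hS0 : 0 < S := by linarith
  have hns : ∀ z : Cn n, ssq (S⁻¹ • z) = (S ^ 2)⁻¹ * ssq z := fun z => by
    have := ssq_smul ((S⁻¹ : ℝ) : ℂ) z
    rw [Complex.norm_real, Real.norm_of_nonneg (by positivity)] at this
    rw [← inv_pow, ← this]
    rfl
  refine ⟨fun z => χ1 (S⁻¹ • z), h1.comp (contDiff_const_smul _),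
    fun z => ⟨Real.smoothTransition.nonneg _, Real.smoothTransition.le_one _⟩, ?_, ?_, ?_⟩
  · intro z hz
    refine Real.smoothTransition.one_of_one_le ?_
    rw [hns]
    have : (S ^ 2)⁻¹ * ssq z ≤ 1 := by
      rw [inv_mul_le_iff₀ (by positivity)]; simpa using hz
    linarith
  · intro z hz
    refine hz1 _ fun hh => hz ?_
    simp only [Metric.mem_closedBall, dist_zero_right] at hh ⊢
    rw [norm_smul, Real.norm_of_nonneg (by positivity), inv_mul_le_iff₀ hS0] at hh
    linarith
  · intro z
    rw [Finset.sum_div]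
    refine Finset.sum_le_sum fun j _ => ?_
    have := wirt_scale (σ := Complex.I) (j := j) h1.toC S⁻¹ z
    have e : db j (toC fun z => χ1 (S⁻¹ • z)) z = ((S⁻¹ : ℝ) : ℂ) * db j (toC χ1) (S⁻¹ • z) := this
    rw [e, norm_mul, Complex.norm_real, Real.norm_of_nonneg (by positivity), mul_pow, inv_pow,
      inv_mul_eq_div]
    gcongr
    exact hcb j _

/-- Square integrability with respect to a continuous positive weight is local square
integrability. -/
lemma local_sq_int {w : Cn n → ℂ} (hm : Measurable w) {p : Cn n → ℝ} (hp : Continuous p)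
    (hp0 : ∀ z, 0 < p z) (hQ : Integrable fun z => ‖w z‖ ^ 2 * p z) :
    LocallyIntegrable w ∧ ∀ S, ∫⁻ z in Metric.closedBall (0 : Cn n) S, ‖w z‖ₑ ^ 2 < ⊤ := by
  have hL : ∀ S, ∫⁻ z in Metric.closedBall (0 : Cn n) S, ‖w z‖ₑ ^ 2 < ⊤ := by
    intro S
    obtain ⟨c, hc, hcp⟩ : ∃ c, 0 < c ∧ ∀ z ∈ Metric.closedBall (0 : Cn n) S, 1 ≤ c * p z := by
      obtain ⟨C, hC⟩ := (isCompact_closedBall (0 : Cn n) S).exists_bound_of_continuousOn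
        (f := fun z => (p z)⁻¹) (hp.inv₀ fun z => (hp0 z).ne').continuousOn
      refine ⟨max C 1, by positivity, fun z hz => ?_⟩
      have h1 := hC z hz
      rw [Real.norm_of_nonneg (inv_nonneg.2 (hp0 z).le)] at h1
      have h2 : (p z)⁻¹ ≤ max C 1 := h1.trans (le_max_left _ _)
      rwa [inv_le_iff_one_le_mul₀ (hp0 z)] at h2
    have h1 : ∫⁻ z, ENNReal.ofReal (‖w z‖ ^ 2 * p z) < ⊤ := hQ.lintegral_lt_top
    calc _ ≤ ∫⁻ z in Metric.closedBall (0 : Cn n) S,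
            ENNReal.ofReal c * ENNReal.ofReal (‖w z‖ ^ 2 * p z) := by
          refine setLIntegral_mono' Metric.isClosed_closedBall.measurableSet fun z hz => ?_
          rw [← ofReal_norm, ← ENNReal.ofReal_pow (norm_nonneg _), ← ENNReal.ofReal_mul hc.le]
          refine ENNReal.ofReal_le_ofReal ?_
          have := hcp z hz
          nlinarith [sq_nonneg ‖w z‖]
      _ ≤ ∫⁻ z, ENNReal.ofReal c * ENNReal.ofReal (‖w z‖ ^ 2 * p z) :=
          setLIntegral_le_lintegral _ _
      _ < ⊤ := by
          rw [lintegral_const_mul _ (by fun_prop)]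
          exact ENNReal.mul_lt_top ENNReal.ofReal_lt_top h1
  refine ⟨locallyIntegrable_iff.2 fun k hk => ?_, hL⟩
  obtain ⟨S, hS⟩ := hk.isBounded.subset_closedBall (0 : Cn n)
  refine IntegrableOn.mono_set ?_ hS
  have : MemLp w 2 (volume.restrict (Metric.closedBall (0 : Cn n) S)) := by
    refine ⟨hm.aestronglyMeasurable, ?_⟩
    have := eLpNorm_nnreal_pow_eq_lintegral
      (μ := (volume.restrict (Metric.closedBall (0 : Cn n) S))) (f := w) (p := 2) (by norm_num)
    have h2 := hL S
    have e : eLpNorm w 2 (volume.restrict (Metric.closedBall (0 : Cn n) S)) ^ 2 < ⊤ := by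
      have e1 : eLpNorm w 2 (volume.restrict (Metric.closedBall (0 : Cn n) S)) ^ 2 =
        ∫⁻ z in Metric.closedBall (0 : Cn n) S, ‖w z‖ₑ ^ 2 := by simpa using this
      rwa [e1]
    exact (ENNReal.pow_lt_top_iff.1 e).resolve_right (by norm_num)
  have hfin : IsFiniteMeasure (volume.restrict (Metric.closedBall (0 : Cn n) S)) :=
    ⟨by simpa using measure_closedBall_lt_top⟩
  exact this.integrable one_le_two

lemma mul_le_sq_weight {a b p S : ℝ} (hp : 0 < p) (hS : 0 < S) :
    a * b ≤ S * (a ^ 2 * p) + S⁻¹ * (b ^ 2 * p⁻¹) := by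
  have h : 0 ≤ (S * p) * (a - (S * p)⁻¹ * b) ^ 2 + (S * p) * a ^ 2 + (S * p)⁻¹ * b ^ 2 := by
    positivity
  have e : (S * p) * (S * p)⁻¹ = 1 := mul_inv_cancel₀ (by positivity)
  have e2 : (S * p) * (a - (S * p)⁻¹ * b) ^ 2 =
      (S * p) * a ^ 2 - 2 * ((S * p) * (S * p)⁻¹) * a * b
        + ((S * p) * (S * p)⁻¹) * (S * p)⁻¹ * b ^ 2 := by ring
  rw [e2, e] at h
  have e3 : S⁻¹ * (b ^ 2 * p⁻¹) = (S * p)⁻¹ * b ^ 2 := by rw [mul_inv]; ring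
  rw [e3]
  linarith

/-- An element of weighted `L²` orthogonal to the range of the weighted Laplacian is weakly
holomorphic. -/
theorem dbar_zero {Θ : Cn n → ℝ} (h : Sm Θ) {w : Cn n → ℂ} (hm : Measurable w)
    (hQ : Integrable fun z => ‖w z‖ ^ 2 * Real.exp (-Θ z))
    (hw : ∀ η : Cn n → ℂ, Sm η → HasCompactSupport η →
      ∫ z, w z * (conj (box Θ η z) * cden Θ z) = 0) (j : Fin n) {τ : Cn n → ℂ} (hτ : Sm τ)
    (hτc : HasCompactSupport τ) : ∫ y, w y * db j τ y = 0 := by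
  set p : Cn n → ℝ := fun z => Real.exp (-Θ z)
  have hp : Continuous p := Real.continuous_exp.comp h.continuous.neg
  have hp0 : ∀ z, 0 < p z := fun z => Real.exp_pos _
  have hpi : Continuous fun z => (p z)⁻¹ := hp.inv₀ fun z => (hp0 z).ne'
  obtain ⟨hl, hL⟩ := local_sq_int hm hp hp0 hQ
  set Q := ∫ z, ‖w z‖ ^ 2 * p z
  have hQ0 : 0 ≤ Q := integral_nonneg fun z => mul_nonneg (by positivity) (hp0 z).le
  obtain ⟨C, hC0, hχ⟩ := exists_cutoff n
  have hdτ : Sm (db j τ) := hτ.wirt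
  have hdτc : HasCompactSupport (db j τ) := hcs_wirt hτc
  have int_cc : ∀ a : Cn n → ℂ, Continuous a → HasCompactSupport a →
      Integrable fun z => ‖a z‖ ^ 2 * (p z)⁻¹ := fun a ha hac =>
    Continuous.integrable_of_hasCompactSupport ((ha.norm.pow 2).mul hpi)
      (HasCompactSupport.intro hac fun z hz => by simp [image_eq_zero_of_notMem_tsupport hz])
  set D₁ := ∫ z, ‖db j τ z‖ ^ 2 * (p z)⁻¹
  set D₂ := ∫ z, ‖τ z‖ ^ 2 * (p z)⁻¹
  obtain ⟨S₀, hS₀⟩ := (hτc.isCompact).exists_bound_of_continuousOn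
    (f := ssq) sm_ssq.continuous.continuousOn
  set C₀ := 1 + (1 + 4 * C) * (2 * Q + 2)
  have key : ∀ S, 1 ≤ S → S₀ ≤ S → ‖∫ y, w y * db j τ y‖ ≤ (1 + D₁ + C₀ + D₂) / S := by
    intro S hS1 hS
    have hSp : 0 < S := by linarith
    obtain ⟨χ, hχs, hχ01, hχ1, hχ0, hχd⟩ := hχ S hS1
    set K := Metric.closedBall (0 : Cn n) (2 * S) with hKdef
    have hKm : MeasurableSet K := Metric.isClosed_closedBall.measurableSet
    have hKc : IsCompact K := isCompact_closedBall _ _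
    have hτ1 : ∀ z, τ z ≠ 0 → χ z = 1 := fun z hz => hχ1 z (by
      have := (le_abs_self _).trans (hS₀ z (subset_tsupport _ hz))
      nlinarith)
    have hKτ : ∀ z ∉ K, τ z = 0 := fun z hz => by
      by_contra hne
      have := hτ1 z hne
      rw [hχ0 z hz] at this
      exact zero_ne_one this
    have hts : tsupport τ ⊆ K := closure_minimal (fun z hz => by
      by_contra hne; exact hz (hKτ z hne)) Metric.isClosed_closedBall
    have hKdτ : ∀ z ∉ K, db j τ z = 0 := fun z hz => by
      by_contra hne
      exact hz (hts (tsupport_wirt_subset (subset_tsupport _ hne)))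
    obtain ⟨P, hP⟩ := hKc.exists_bound_of_continuousOn hp.continuousOn
    have hP' : ∀ z ∈ K, p z ≤ max P 1 := fun z hz =>
      (le_abs_self _).trans ((hP z hz).trans (le_max_left _ _))
    have hP1 : 0 < max P 1 := by positivity
    set δ := (S ^ 4)⁻¹ / max P 1
    have hδ : 0 < δ := by positivity
    obtain ⟨ε, hε, hR, hWw⟩ := approx h hm hl hL hw (2 * S) hδ
    set W := moll ε w
    have hW : Sm W := sm_moll hε hl
    have hRs : Sm (box Θ W) := h.box hW
    have hPδ : max P 1 * δ = (S ^ 4)⁻¹ := by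
      simp only [δ]; field_simp
    obtain ⟨iR, bR⟩ := weighted_int hRs.continuous.measurable hp (fun z => (hp0 z).le) hP' hP1.le
      hδ.le hR
    obtain ⟨iD, bD⟩ := weighted_int (h := fun z => W z - w z) (hW.continuous.measurable.sub hm) hp
      (fun z => (hp0 z).le) hP' hP1.le hδ.le hWw
    rw [hPδ] at bR bD
    have iW : IntegrableOn (fun z => ‖W z‖ ^ 2 * p z) K :=
      ((hW.continuous.norm.pow 2).mul hp).continuousOn.integrableOn_compact hKc
    have hS4 : (S ^ 4)⁻¹ ≤ (1 : ℝ) := inv_le_one_of_one_le₀ (one_le_pow₀ hS1)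
    have bW : ∫ z in K, ‖W z‖ ^ 2 * p z ≤ 2 * Q + 2 := by
      have i1 : IntegrableOn (fun z => 2 * (‖w z‖ ^ 2 * p z) + 2 * (‖W z - w z‖ ^ 2 * p z)) K :=
        (hQ.integrableOn.const_mul 2).add (iD.const_mul 2)
      calc _ ≤ ∫ z in K, (2 * (‖w z‖ ^ 2 * p z) + 2 * (‖W z - w z‖ ^ 2 * p z)) := by
            refine setIntegral_mono_on iW i1 hKm fun z _ => ?_
            have h1 : ‖W z‖ ≤ ‖w z‖ + ‖W z - w z‖ := by
              have := norm_add_le (w z) (W z - w z)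
              simpa using this
            have h2 : ‖W z‖ ^ 2 ≤ 2 * ‖w z‖ ^ 2 + 2 * ‖W z - w z‖ ^ 2 := by
              nlinarith [norm_nonneg (W z), sq_nonneg (‖w z‖ - ‖W z - w z‖)]
            nlinarith [hp0 z]
        _ = 2 * (∫ z in K, ‖w z‖ ^ 2 * p z) + 2 * ∫ z in K, ‖W z - w z‖ ^ 2 * p z := by
            rw [integral_add (hQ.integrableOn.const_mul 2) (iD.const_mul 2), integral_const_mul,
              integral_const_mul]
        _ ≤ 2 * Q + 2 := by
            have : ∫ z in K, ‖w z‖ ^ 2 * p z ≤ Q := setIntegral_le_integral hQ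
              (Eventually.of_forall fun z => mul_nonneg (by positivity) (hp0 z).le)
            linarith
    have hcc : HasCompactSupport χ := HasCompactSupport.intro hKc hχ0
    have hX := energy h hW hχs hcc
    have hdχ : ∀ z ∉ K, ∀ k, db k (toC χ) z = 0 := by
      intro z hz k
      by_contra hne
      have hz' := tsupport_wirt_subset (subset_tsupport _ hne)
      refine hz (closure_minimal (s := Function.support (toC χ)) (fun y hy => ?_)
        Metric.isClosed_closedBall hz')
      by_contra hyK
      exact hy (by simp [toC, hχ0 y hyK])
    have bX : ∫ z, χ z ^ 2 * (∑ j, ‖db j W z‖ ^ 2) * p z ≤ C₀ / S ^ 2 := by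
      refine hX.trans ?_
      have e1 : ∫ z, (2 * χ z ^ 2 * ‖box Θ W z‖ * ‖W z‖
          + 4 * (∑ j, ‖db j (toC χ) z‖ ^ 2) * ‖W z‖ ^ 2) * p z =
          ∫ z in K, (2 * χ z ^ 2 * ‖box Θ W z‖ * ‖W z‖
          + 4 * (∑ j, ‖db j (toC χ) z‖ ^ 2) * ‖W z‖ ^ 2) * p z :=
        (setIntegral_eq_integral_of_forall_compl_eq_zero fun z hz => by
          simp [hχ0 z hz, hdχ z hz]).symm
      change ∫ z, (2 * χ z ^ 2 * ‖box Θ W z‖ * ‖W z‖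
          + 4 * (∑ j, ‖db j (toC χ) z‖ ^ 2) * ‖W z‖ ^ 2) * p z ≤ _
      rw [e1]
      have i2 : IntegrableOn (fun z => S ^ 2 * (‖box Θ W z‖ ^ 2 * p z)
          + (1 + 4 * C) / S ^ 2 * (‖W z‖ ^ 2 * p z)) K := (iR.const_mul _).add (iW.const_mul _)
      have i3 : IntegrableOn (fun z => (2 * χ z ^ 2 * ‖box Θ W z‖ * ‖W z‖
          + 4 * (∑ j, ‖db j (toC χ) z‖ ^ 2) * ‖W z‖ ^ 2) * p z) K := by
        refine (Continuous.continuousOn ?_).integrableOn_compact hKc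
        refine Continuous.mul (Continuous.add ?_ ?_) hp
        · exact ((continuous_const.mul (hχs.continuous.pow 2)).mul hRs.continuous.norm).mul
            hW.continuous.norm
        · refine (continuous_const.mul (continuous_finsetSum _ fun j _ => ?_)).mul
            (hW.continuous.norm.pow 2)
          have : Sm (db j (toC χ)) := hχs.toC.wirt
          exact this.continuous.norm.pow 2
      calc _ ≤ ∫ z in K, (S ^ 2 * (‖box Θ W z‖ ^ 2 * p z)
            + (1 + 4 * C) / S ^ 2 * (‖W z‖ ^ 2 * p z)) := by
            refine setIntegral_mono_on i3 i2 hKm fun z _ => ?_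
            obtain ⟨hc0, hc1⟩ := hχ01 z
            have hχ2 : χ z ^ 2 ≤ 1 := by nlinarith
            have h1 := hχd z
            have h2 : 2 * ‖box Θ W z‖ * ‖W z‖ ≤ S ^ 2 * ‖box Θ W z‖ ^ 2 + (S ^ 2)⁻¹ * ‖W z‖ ^ 2 := by
              have : 0 ≤ (S * ‖box Θ W z‖ - S⁻¹ * ‖W z‖) ^ 2 := sq_nonneg _
              have e : S * S⁻¹ = 1 := mul_inv_cancel₀ hSp.ne'
              have e2 : (S * ‖box Θ W z‖ - S⁻¹ * ‖W z‖) ^ 2 = S ^ 2 * ‖box Θ W z‖ ^ 2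
                - 2 * (S * S⁻¹) * ‖box Θ W z‖ * ‖W z‖ + (S ^ 2)⁻¹ * ‖W z‖ ^ 2 := by
                rw [← inv_pow]; ring
              rw [e2, e] at this
              linarith
            have h3 : 2 * χ z ^ 2 * ‖box Θ W z‖ * ‖W z‖ ≤ 2 * ‖box Θ W z‖ * ‖W z‖ := by
              have : 0 ≤ ‖box Θ W z‖ * ‖W z‖ := by positivity
              nlinarith
            have h4 : 4 * (∑ j, ‖db j (toC χ) z‖ ^ 2) * ‖W z‖ ^ 2 ≤ 4 * (C / S ^ 2) * ‖W z‖ ^ 2 := by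
              gcongr
            have h5 : (2 * χ z ^ 2 * ‖box Θ W z‖ * ‖W z‖
                + 4 * (∑ j, ‖db j (toC χ) z‖ ^ 2) * ‖W z‖ ^ 2) ≤ S ^ 2 * ‖box Θ W z‖ ^ 2
                + (1 + 4 * C) / S ^ 2 * ‖W z‖ ^ 2 := by
              have : (1 + 4 * C) / S ^ 2 = (S ^ 2)⁻¹ + 4 * (C / S ^ 2) := by ring
              rw [this, add_mul]; linarith
            calc _ ≤ (S ^ 2 * ‖box Θ W z‖ ^ 2 + (1 + 4 * C) / S ^ 2 * ‖W z‖ ^ 2) * p z :=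
                  mul_le_mul_of_nonneg_right h5 (hp0 z).le
              _ = _ := by ring
        _ = S ^ 2 * (∫ z in K, ‖box Θ W z‖ ^ 2 * p z)
            + (1 + 4 * C) / S ^ 2 * ∫ z in K, ‖W z‖ ^ 2 * p z := by
            rw [integral_add (iR.const_mul _) (iW.const_mul _), integral_const_mul,
              integral_const_mul]
        _ ≤ S ^ 2 * (S ^ 4)⁻¹ + (1 + 4 * C) / S ^ 2 * (2 * Q + 2) := by gcongr
        _ = C₀ / S ^ 2 := by simp only [C₀]; field_simp
    have iX : Integrable fun z => χ z ^ 2 * (∑ j, ‖db j W z‖ ^ 2) * p z := by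
      refine Continuous.integrable_of_hasCompactSupport ?_ ?_
      · refine ((hχs.continuous.pow 2).mul (continuous_finsetSum _ fun j _ => ?_)).mul hp
        have : Sm (db j W) := hW.wirt
        exact this.continuous.norm.pow 2
      · exact HasCompactSupport.intro hKc fun z hz => by simp [hχ0 z hz]
    have i4 : Integrable fun z => w z * db j τ z :=
      by simpa [mul_comm] using hl.integrable_smul_left_of_hasCompactSupport hdτ.continuous hdτc
    have i5 : Integrable fun z => W z * db j τ z :=
      (hW.continuous.mul hdτ.continuous).integrable_of_hasCompactSupport hdτc.mul_left
    have i6 := int_cc _ hdτ.continuous hdτc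
    have i7 := int_cc _ hτ.continuous hτc
    have t1 : ‖∫ z, (w z - W z) * db j τ z‖ ≤ S * (S ^ 4)⁻¹ + S⁻¹ * D₁ := by
      rw [← setIntegral_eq_integral_of_forall_compl_eq_zero (s := K)
        fun z hz => by simp [hKdτ z hz]]
      refine (norm_integral_le_integral_norm _).trans ?_
      have i8 : IntegrableOn (fun z => S * (‖W z - w z‖ ^ 2 * p z)
          + S⁻¹ * (‖db j τ z‖ ^ 2 * (p z)⁻¹)) K :=
        (iD.const_mul _).add (i6.integrableOn.const_mul _)
      calc _ ≤ ∫ z in K, (S * (‖W z - w z‖ ^ 2 * p z) + S⁻¹ * (‖db j τ z‖ ^ 2 * (p z)⁻¹)) := by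
            refine integral_mono_of_nonneg (Eventually.of_forall fun z => norm_nonneg _) i8
              (Eventually.of_forall fun z => ?_)
            simp only [norm_mul]
            rw [norm_sub_rev]
            exact mul_le_sq_weight (hp0 z) hSp
        _ = S * (∫ z in K, ‖W z - w z‖ ^ 2 * p z) + S⁻¹ * ∫ z in K, ‖db j τ z‖ ^ 2 * (p z)⁻¹ := by
            rw [integral_add (iD.const_mul _) (i6.integrableOn.const_mul _), integral_const_mul,
              integral_const_mul]
        _ ≤ _ := by
            gcongr
            exact setIntegral_le_integral i6
              (Eventually.of_forall fun z => mul_nonneg (by positivity) (inv_nonneg.2 (hp0 z).le))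
    have t2 : ‖∫ z, W z * db j τ z‖ ≤ S * (C₀ / S ^ 2) + S⁻¹ * D₂ := by
      have e := integral_wirt_mul (σ := Complex.I) (j := j) hW hτ (Or.inr hτc)
      have e' : ∫ z, W z * db j τ z = - ∫ z, db j W z * τ z := by
        simp only [db]; rw [e, neg_neg]
      rw [e', norm_neg]
      refine (norm_integral_le_integral_norm _).trans ?_
      calc _ ≤ ∫ z, (S * (χ z ^ 2 * (∑ j, ‖db j W z‖ ^ 2) * p z)
              + S⁻¹ * (‖τ z‖ ^ 2 * (p z)⁻¹)) := by
            refine integral_mono_of_nonneg (Eventually.of_forall fun z => norm_nonneg _)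
              ((iX.const_mul _).add (i7.const_mul _)) (Eventually.of_forall fun z => ?_)
            simp only [norm_mul]
            have hs : ‖db j W z‖ ^ 2 ≤ ∑ k, ‖db k W z‖ ^ 2 :=
              Finset.single_le_sum (f := fun k => ‖db k W z‖ ^ 2) (fun k _ => by positivity)
                (Finset.mem_univ j)
            by_cases hz : τ z = 0
            · simp only [hz, norm_zero, mul_zero]
              have := hp0 z
              have : 0 ≤ ∑ k, ‖db k W z‖ ^ 2 := le_trans (by positivity) hs
              positivity
            · rw [hτ1 z hz, one_pow, one_mul]
              refine (mul_le_sq_weight (hp0 z) hSp).trans ?_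
              have := hp0 z
              gcongr
        _ = S * (∫ z, χ z ^ 2 * (∑ j, ‖db j W z‖ ^ 2) * p z)
            + S⁻¹ * ∫ z, ‖τ z‖ ^ 2 * (p z)⁻¹ := by
            rw [integral_add (iX.const_mul _) (i7.const_mul _), integral_const_mul,
              integral_const_mul]
        _ ≤ _ := by gcongr
    have split : ∫ z, w z * db j τ z = (∫ z, (w z - W z) * db j τ z) + ∫ z, W z * db j τ z := by
      simp_rw [sub_mul]
      rw [integral_sub i4 i5]; ring
    rw [split]
    refine (norm_add_le _ _).trans ((add_le_add t1 t2).trans ?_)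
    have e1 : S * (S ^ 4)⁻¹ ≤ 1 / S := by
      rw [← div_eq_mul_inv, div_le_div_iff₀ (by positivity) hSp]
      nlinarith [one_le_pow₀ hS1 (n := 2), sq_nonneg S]
    have e2 : S * (C₀ / S ^ 2) = C₀ / S := by field_simp
    rw [e2]
    have e3 : (1 + D₁ + C₀ + D₂) / S = 1 / S + S⁻¹ * D₁ + C₀ / S + S⁻¹ * D₂ := by ring
    linarith
  have hlim : Tendsto (fun S : ℝ => (1 + D₁ + C₀ + D₂) / S) atTop (𝓝 0) :=
    tendsto_const_nhds.div_atTop tendsto_id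
  have := ge_of_tendsto hlim (b := ‖∫ y, w y * db j τ y‖) (by
    filter_upwards [eventually_ge_atTop 1, eventually_ge_atTop S₀] with S h1 h2 using key S h1 h2)
  exact norm_le_zero_iff.1 this

/-- **Hörmander's theorem** in the form used below: a smooth compactly supported function is
approximated in weighted `L²` by an entire function, with control by its `∂̄`-derivative. -/
theorem hormander {Θ : Cn n → ℝ} (h : Sm Θ) {g : Cn n → ℂ} (hg : Sm g)
    (hgc : HasCompactSupport g)
    {E : Cn n → ℝ} (hE : ∀ z, 0 ≤ E z) (hEi : Integrable fun z => E z * Real.exp (-Θ z))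
    (hlevi : ∀ z ξ, ‖∑ j, db j g z * conj (ξ j)‖ ^ 2 ≤ E z * levi Θ z ξ)
    (hpos : ∀ z ξ, 0 ≤ levi Θ z ξ) :
    ∃ F : Cn n → ℂ, Differentiable ℂ F ∧
      ∫⁻ z, ENNReal.ofReal (‖F z - g z‖ ^ 2 * Real.exp (-Θ z)) ≤
        ENNReal.ofReal (∫ z, E z * Real.exp (-Θ z)) := by
  obtain ⟨v, hv, hv0, hvb⟩ := exists_orthogonal h hg hgc hE hEi hlevi hpos
  set v' := hv.aestronglyMeasurable.aemeasurable.mk v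
  have hv'm : Measurable v' := hv.aestronglyMeasurable.aemeasurable.measurable_mk
  have hvv : v =ᵐ[volume] v' := hv.aestronglyMeasurable.aemeasurable.ae_eq_mk
  set q : Cn n → ℂ := fun z => ((Real.exp (Θ z / 2) : ℝ) : ℂ)
  have hqh : ∀ z, q z * half Θ z = 1 := fun z => by
    simp only [q, half]
    rw [← Complex.ofReal_mul, ← Real.exp_add]; simp; ring_nf; simp
  have hqm : Measurable q := by
    have := h.continuous
    exact Continuous.measurable (by simp only [q]; fun_prop)
  have hhn : ∀ z, ‖half Θ z‖ ^ 2 = Real.exp (-Θ z) := fun z => by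
    simp only [half, Complex.norm_real, Real.norm_of_nonneg (Real.exp_pos _).le]
    rw [← Real.exp_nat_mul]; congr 1; push_cast; ring
  set w : Cn n → ℂ := fun z => v' z * q z
  have hwv : ∀ z, w z * half Θ z = v' z := fun z => by
    simp only [w]; rw [mul_assoc, hqh, mul_one]
  have hm : Measurable w := hv'm.mul hqm
  have hQ : Integrable fun z => ‖w z‖ ^ 2 * Real.exp (-Θ z) := by
    have : MemLp v' 2 volume := hv.ae_eq hvv
    refine this.integrable_norm_pow (by norm_num) |>.congr (Eventually.of_forall fun z => ?_)
    simp only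
    rw [← hwv z, norm_mul, mul_pow, ← hhn]
  have hw : ∀ η : Cn n → ℂ, Sm η → HasCompactSupport η →
      ∫ z, w z * (conj (box Θ η z) * cden Θ z) = 0 := by
    intro η hη hηc
    rw [← hv0 η hη hηc]
    refine integral_congr_ae ?_
    filter_upwards [hvv] with z hz
    rw [hz, ← hwv z, ← half_mul_half]; ring
  obtain ⟨hl, -⟩ := local_sq_int hm (Real.continuous_exp.comp h.continuous.neg)
    (fun z => Real.exp_pos _) hQ
  obtain ⟨F, hF, hwF⟩ := holo_of_weak hl fun j τ hτ hτc => dbar_zero h hm hQ hw j hτ hτc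
  refine ⟨F, hF, le_trans (le_of_eq ?_) hvb⟩
  refine lintegral_congr_ae ?_
  filter_upwards [hvv, hwF] with z h1 h2
  rw [h1, ← hwv z, ← h2, ← sub_mul, ← ofReal_norm, ← ENNReal.ofReal_pow (norm_nonneg _), norm_mul,
    mul_pow, hhn, norm_sub_rev]

lemma levi_congr {a b : Cn n → ℝ} {z : Cn n} (h : a =ᶠ[𝓝 z] b) (ξ : Cn n) :
    levi a z ξ = levi b z ξ := by
  have h1 : ∀ k, db k (toC a) =ᶠ[𝓝 z] db k (toC b) := fun k => by
    filter_upwards [eventually_eventually_nhds.2 h] with y hy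
    exact wirt_congr (hy.mono fun x hx => by simp [toC, hx])
  unfold levi
  simp only [dz, wirt_congr (h1 _)]

lemma levi_add {a b : Cn n → ℝ} (ha : Sm a) (hb : Sm b) (z ξ : Cn n) :
    levi (fun x => a x + b x) z ξ = levi a z ξ + levi b z ξ := by
  have h1 : ∀ k, db k (toC fun x => a x + b x) = fun x => db k (toC a) x + db k (toC b) x := by
    intro k; ext x
    have : toC (fun x => a x + b x) = fun x => toC a x + toC b x := by ext; simp [toC]
    rw [this]
    exact wirt_add (ha.toC.dAt x) (hb.toC.dAt x)
  have h2 : ∀ j k, dz j (db k (toC fun x => a x + b x)) z =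
      dz j (db k (toC a)) z + dz j (db k (toC b)) z := by
    intro j k
    have s1 : Sm (db k (toC a)) := ha.toC.wirt
    have s2 : Sm (db k (toC b)) := hb.toC.wirt
    rw [h1]
    exact wirt_add (s1.dAt z) (s2.dAt z)
  unfold levi
  simp only [h2, add_mul, Finset.sum_add_distrib, Complex.add_re]

/-- The complex differential `∂s · ξ`. -/
def dd (s : Cn n → ℝ) (z ξ : Cn n) : ℂ := ∑ j, dz j (toC s) z * ξ j

lemma db_toC {s : Cn n → ℝ} (hs : Sm s) (k : Fin n) (z : Cn n) :
    db k (toC s) z = conj (dz k (toC s) z) := by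
  rw [← db_conj (hs.toC.dAt z)]
  congr 1; ext x; simp [toC]

lemma levi_comp {s : Cn n → ℝ} (hs : Sm s) {k k' k'' : ℝ → ℝ}
    (h1 : ∀ z, HasDerivAt k (k' (s z)) (s z)) (h2 : ∀ z, HasDerivAt k' (k'' (s z)) (s z))
    (z ξ : Cn n) :
    levi (fun x => k (s x)) z ξ = k' (s z) * levi s z ξ + k'' (s z) * ‖dd s z ξ‖ ^ 2 := by
  have e1 : ∀ l, db l (toC fun x => k (s x)) =
      fun x => ((k' (s x) : ℝ) : ℂ) * db l (toC s) x := by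
    intro l; ext x
    have := wirt_comp_real (σ := Complex.I) (j := l) (h1 x).differentiableAt (hs.dAt x)
    rw [(h1 x).deriv] at this
    exact this
  have e2 : ∀ j l, dz j (db l (toC fun x => k (s x))) z =
      ((k'' (s z) : ℝ) : ℂ) * dz j (toC s) z * conj (dz l (toC s) z)
        + ((k' (s z) : ℝ) : ℂ) * dz j (db l (toC s)) z := by
    intro j l
    have s1 : Sm (db l (toC s)) := hs.toC.wirt
    have s2 : DifferentiableAt ℝ (fun x => ((k' (s x) : ℝ) : ℂ)) z :=
      Complex.ofRealCLM.differentiableAt.comp z ((h2 z).differentiableAt.comp z (hs.dAt z))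
    rw [e1, ← db_toC hs]
    simp only [dz]
    rw [wirt_mul s2 (s1.dAt z), wirt_comp_real (h2 z).differentiableAt (hs.dAt z), (h2 z).deriv]
    rfl
  have e3 : ∑ j, ∑ l, dz j (db l (toC fun x => k (s x))) z * ξ j * conj (ξ l) =
      ((k'' (s z) : ℝ) : ℂ) * (dd s z ξ * conj (dd s z ξ))
        + ((k' (s z) : ℝ) : ℂ) * ∑ j, ∑ l, dz j (db l (toC s)) z * ξ j * conj (ξ l) := by
    unfold dd
    rw [map_sum, Finset.sum_mul_sum, Finset.mul_sum, Finset.mul_sum, ← Finset.sum_add_distrib]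
    refine Finset.sum_congr rfl fun j _ => ?_
    rw [Finset.mul_sum, Finset.mul_sum, ← Finset.sum_add_distrib]
    refine Finset.sum_congr rfl fun l _ => ?_
    rw [e2, map_mul]; ring
  unfold levi
  rw [e3, Complex.mul_conj, Complex.add_re, Complex.re_ofReal_mul, Complex.re_ofReal_mul,
    Complex.ofReal_re, Complex.normSq_eq_norm_sq]
  ring

lemma sm_coord (k : Fin n) : Sm fun z : Cn n => z k := contDiff_apply ℝ ℂ k

lemma wirt_coord (σ : ℂ) (j k : Fin n) (z : Cn n) :
    wirt σ j (fun z => z k) z = if j = k then (1 / 2) * (1 + σ * Complex.I) else 0 := by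
  have : HasFDerivAt (fun z : Cn n => z k)
    (ContinuousLinearMap.proj (R := ℝ) (φ := fun _ : Fin n => ℂ) k) z :=
    (ContinuousLinearMap.proj (R := ℝ) (φ := fun _ : Fin n => ℂ) k).hasFDerivAt
  unfold wirt
  rw [this.fderiv]
  by_cases h : j = k
  · subst h; simp
  · simp [h, Ne.symm h]

lemma levi_ssq (z ξ : Cn n) : levi ssq z ξ = ssq ξ := by
  have e0 : (toC ssq : Cn n → ℂ) = fun z => ∑ i, z i * conj (z i) := by
    ext z
    simp only [toC, ssq, Complex.mul_conj, Complex.normSq_eq_norm_sq]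
    push_cast; rfl
  have e1 : ∀ k : Fin n, db k (toC ssq) = fun z => z k := by
    intro k; ext z
    rw [e0, db, wirt_sum (a := fun i (z : Cn n) => z i * conj (z i)) fun i _ => ((sm_coord i).dAt z).mul ((sm_coord i).conj.dAt z)]
    have : ∀ i, wirt Complex.I k (fun x : Cn n => x i * conj (x i)) z =
        if k = i then z i else 0 := by
      intro i
      rw [wirt_mul ((sm_coord i).dAt z) ((sm_coord i).conj.dAt z), wirt_conj ((sm_coord i).dAt z),
        wirt_coord, wirt_coord]
      by_cases h : k = i
      · subst h
        have : conj (2 : ℂ) = 2 := Complex.conj_ofNat 2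
        simp [this]; norm_num
      · simp [h]
    simp [this]
  unfold levi
  simp only [e1, dz, wirt_coord]
  have : ∀ j : Fin n, ∑ k, (if j = k then (1 / 2 : ℂ) * (1 + -Complex.I * Complex.I) else 0) * ξ j
      * conj (ξ k) = ((‖ξ j‖ ^ 2 : ℝ) : ℂ) := by
    intro j
    rw [Finset.sum_eq_single j]
    · simp only [if_true, neg_mul, Complex.I_mul_I]
      rw [mul_assoc, Complex.mul_conj, Complex.normSq_eq_norm_sq]; norm_num
    · intro k _ hk; simp [Ne.symm hk]
    · simp
  simp only [this]
  rw [← Complex.ofReal_sum, Complex.ofReal_re]; rfl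

lemma levi_bound {a : Cn n → ℝ} (ha : Sm a) (hc : HasCompactSupport a) :
    ∃ C, 0 ≤ C ∧ ∀ z ξ, -(C * ssq ξ) ≤ levi a z ξ := by
  have hcC : HasCompactSupport (toC a) := hc.comp_left (g := fun x : ℝ => (x : ℂ)) (by simp)
  choose c hc0 hcb using fun p : Fin n × Fin n =>
    bdd_of_hcs (h := dz p.1 (db p.2 (toC a)))
      (by have : Sm (dz p.1 (db p.2 (toC a))) := ha.toC.wirt.wirt
          exact this.continuous) (hcs_wirt (hcs_wirt hcC))
  refine ⟨∑ j, ∑ k, c (j, k), Finset.sum_nonneg fun j _ => Finset.sum_nonneg fun k _ => hc0 _, ?_⟩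
  intro z ξ
  refine (neg_le_neg ?_).trans (neg_le_of_abs_le (Complex.abs_re_le_norm _))
  refine (norm_sum_le _ _).trans ?_
  rw [Finset.sum_mul]
  refine Finset.sum_le_sum fun j _ => (norm_sum_le _ _).trans ?_
  rw [Finset.sum_mul]
  refine Finset.sum_le_sum fun k _ => ?_
  rw [norm_mul, norm_mul, RCLike.norm_conj, mul_assoc]
  have h1 := hcb (j, k) z
  have h2 : ∀ i, ‖ξ i‖ ^ 2 ≤ ssq ξ := fun i =>
    Finset.single_le_sum (f := fun i => ‖ξ i‖ ^ 2) (fun _ _ => by positivity) (Finset.mem_univ i)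
  have h3 : ‖ξ j‖ * ‖ξ k‖ ≤ ssq ξ := by
    nlinarith [h2 j, h2 k, sq_nonneg (‖ξ j‖ - ‖ξ k‖)]
  have := hc0 (j, k)
  gcongr

/-- Euclidean balls, parametrised by the squared radius. -/
def eb (r : ℝ) : Set (Cn n) := {z | ssq z < r}

lemma isOpen_eb (r : ℝ) : IsOpen (eb r : Set (Cn n)) :=
  isOpen_lt sm_ssq.continuous continuous_const

lemma isCompact_ssq_le (r : ℝ) : IsCompact {z : Cn n | ssq z ≤ r} := by
  refine Metric.isCompact_of_isClosed_isBounded (isClosed_le sm_ssq.continuous continuous_const) ?_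
  refine (Metric.isBounded_closedBall (x := (0 : Cn n)) (r := Real.sqrt r)).subset fun z hz => ?_
  rw [mem_closedBall_zero_iff]
  exact Real.le_sqrt_of_sq_le ((norm_sq_le_ssq z).trans hz)

/-- A smooth step from `0` (for `x ≤ -2`) to `1` (for `x ≥ -1`). -/
def stp (x : ℝ) : ℝ := Real.smoothTransition (x + 2)

lemma contDiff_stp : ContDiff ℝ ∞ stp :=
  Real.smoothTransition.contDiff.comp (contDiff_id.add contDiff_const)

lemma deriv_stp_zero {x : ℝ} (hx : x ∉ Set.Icc (-2 : ℝ) (-1)) : deriv stp x = 0 := by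
  rw [Set.mem_Icc, not_and_or, not_le, not_le] at hx
  rcases hx with hx | hx
  · have : stp =ᶠ[𝓝 x] fun _ => 0 := by
      filter_upwards [eventually_lt_nhds hx] with y hy
      exact Real.smoothTransition.zero_of_nonpos (by linarith)
    rw [this.deriv_eq, deriv_const]
  · have : stp =ᶠ[𝓝 x] fun _ => 1 := by
      filter_upwards [eventually_gt_nhds hx] with y hy
      exact Real.smoothTransition.one_of_one_le (by linarith)
    rw [this.deriv_eq, deriv_const]

lemma exists_stp_bound : ∃ C : ℝ, 0 ≤ C ∧ ∀ x, deriv stp x ^ 2 ≤ C := by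
  have hc : Continuous (deriv stp) := contDiff_stp.continuous_deriv (by simp)
  obtain ⟨C, hC⟩ := (isCompact_Icc (a := (-2 : ℝ)) (b := -1)).exists_bound_of_continuousOn
    hc.continuousOn
  refine ⟨C ^ 2, sq_nonneg _, fun x => ?_⟩
  by_cases hx : x ∈ Set.Icc (-2 : ℝ) (-1)
  · rw [← sq_abs]
    exact pow_le_pow_left₀ (abs_nonneg _) (hC x hx) 2
  · rw [deriv_stp_zero hx]; simp [sq_nonneg]

/-- The constant appearing in the twisted weight. -/
def cA : ℝ := 27 / 2 * exists_stp_bound.choose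

lemma cA_nonneg : 0 ≤ cA := mul_nonneg (by norm_num) exists_stp_bound.choose_spec.1

lemma deriv_stp_sq_le (x : ℝ) : deriv stp x ^ 2 ≤ 2 / 27 * cA := by
  refine (exists_stp_bound.choose_spec.2 x).trans (le_of_eq ?_)
  unfold cA; ring

/-- A continuous cutoff: `1` for `x ≤ -t` and `0` for `x ≥ -t/2`. -/
def om (t x : ℝ) : ℝ := max 0 (min 1 (-(2 * x) / t - 1))

lemma om_nonneg (t x : ℝ) : 0 ≤ om t x := le_max_left _ _

lemma om_le_one (t x : ℝ) : om t x ≤ 1 := max_le zero_le_one (min_le_left _ _)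

lemma om_eq_one {t x : ℝ} (ht : 0 < t) (hx : x ≤ -t) : om t x = 1 := by
  have : 1 ≤ -(2 * x) / t - 1 := by
    rw [le_sub_iff_add_le, le_div_iff₀ ht]; linarith
  simp [om, min_eq_left this]

lemma om_eq_zero {t x : ℝ} (ht : 0 < t) (hx : -(t / 2) ≤ x) : om t x = 0 := by
  have : -(2 * x) / t - 1 ≤ 0 := by
    rw [sub_nonpos, div_le_iff₀ ht]; linarith
  exact max_eq_left ((min_le_right _ _).trans this)

lemma continuous_om (t : ℝ) : Continuous (om t) := by unfold om; fun_prop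

/-- The integrand on the right-hand side of the basic estimate. -/
def rhs (t x : ℝ) : ℝ := om t x * Real.exp (-2 * max x (-2 * t))

lemma continuous_rhs (t : ℝ) : Continuous (rhs t) := by
  unfold rhs; have := continuous_om t; fun_prop

lemma rhs_nonneg (t x : ℝ) : 0 ≤ rhs t x := mul_nonneg (om_nonneg _ _) (Real.exp_pos _).le

/-- The twisted weight profile. -/
def tw (t x : ℝ) : ℝ := 2 * x + cA * t * (t - x)⁻¹

lemma hasDerivAt_tw {t x : ℝ} (hx : x < t) :
    HasDerivAt (tw t) (2 + cA * t * ((t - x) ^ 2)⁻¹) x := by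
  have h1 : HasDerivAt (fun x => t - x) (-1) x := by simpa using (hasDerivAt_id x).const_sub t
  have h2 := h1.inv (by linarith : t - x ≠ 0) 
  have h3 := ((hasDerivAt_id x).const_mul 2).add (h2.const_mul (cA * t))
  refine HasDerivAt.congr_deriv (f := tw t) h3 ?_
  field_simp

lemma hasDerivAt_tw' {t x : ℝ} (hx : x < t) :
    HasDerivAt (fun x => 2 + cA * t * ((t - x) ^ 2)⁻¹) (2 * cA * t * ((t - x) ^ 3)⁻¹) x := by
  have h1 : HasDerivAt (fun x => t - x) (-1) x := by simpa using (hasDerivAt_id x).const_sub t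
  have hne : t - x ≠ 0 := by linarith
  have h2 := (h1.pow 2).inv (pow_ne_zero 2 hne)
  have h3 := (h2.const_mul (cA * t)).const_add 2
  refine HasDerivAt.congr_deriv h3 ?_
  simp only [Pi.pow_apply]
  field_simp
  norm_num; ring

lemma tw_ge {t x : ℝ} (ht : 0 < t) (hx : x < t) : 2 * x ≤ tw t x := by
  have := cA_nonneg
  have h : 0 < t - x := by linarith
  have : 0 ≤ cA * t * (t - x)⁻¹ := by positivity
  unfold tw; linarith

lemma tw_le {t x : ℝ} (ht : 0 < t) (hx : x ≤ 0) : tw t x ≤ 2 * x + cA := by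
  have := cA_nonneg
  have h : 0 < t - x := by linarith
  have : cA * t * (t - x)⁻¹ ≤ cA := by
    rw [mul_assoc]
    refine mul_le_of_le_one_right this ?_
    rw [← div_eq_mul_inv, div_le_one h]; linarith
  unfold tw; linarith

lemma cs_sum (a ξ : Fin n → ℂ) : ‖∑ j, a j * conj (ξ j)‖ ^ 2 ≤ (∑ j, ‖a j‖ ^ 2) * ssq ξ := by
  have h1 : ‖∑ j, a j * conj (ξ j)‖ ≤ ∑ j, ‖a j‖ * ‖ξ j‖ :=
    (norm_sum_le _ _).trans (Finset.sum_le_sum fun j _ => by rw [norm_mul, RCLike.norm_conj])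
  exact (pow_le_pow_left₀ (norm_nonneg _) h1 2).trans (Finset.sum_mul_sq_le_sq_mul_sq _ _ _)

lemma levi_tw {s : Cn n → ℝ} (hs : Sm s) (hs1 : ∀ z, s z ≤ -1) {t : ℝ} (ht : 1 ≤ t) {z ξ : Cn n}
    (hl : 0 ≤ levi s z ξ) :
    2 * cA * t * ((t - s z) ^ 3)⁻¹ * ‖dd s z ξ‖ ^ 2 ≤ levi (fun x => tw t (s x)) z ξ := by
  have hst : ∀ z, s z < t := fun z => by linarith [hs1 z]
  rw [levi_comp hs (k := tw t) (k' := fun x => 2 + cA * t * ((t - x) ^ 2)⁻¹)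
    (k'' := fun x => 2 * cA * t * ((t - x) ^ 3)⁻¹) (fun z => hasDerivAt_tw (hst z)) (fun z => hasDerivAt_tw' (hst z))]
  have : 0 ≤ 2 + cA * t * ((t - s z) ^ 2)⁻¹ := by
    have := cA_nonneg; positivity
  nlinarith [mul_nonneg this hl]

lemma sm_tw {s : Cn n → ℝ} (hs : Sm s) {t : ℝ} (hst : ∀ z, s z < t) :
    Sm fun x => tw t (s x) := by
  unfold tw
  refine (contDiff_const.mul hs).add (contDiff_const.mul ((contDiff_const.sub hs).inv fun x => ?_))
  have := hst x
  simp only [ne_eq]; linarith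

/-- The pointwise inequality that makes the twisted weight useful. -/
lemma shell_ineq {t x a : ℝ} (ht : 1 ≤ t) (hx : x ≤ -1) (ha : 0 ≤ a) :
    (deriv stp (x / t) / t) ^ 2 * a ≤
      om t x * Real.exp (2 * x - 2 * max x (-2 * t)) * (2 * cA * t * ((t - x) ^ 3)⁻¹ * a) := by
  have ht0 : 0 < t := by linarith
  have h0 : 0 < t - x := by linarith
  have hc := cA_nonneg
  have hr : 0 ≤ om t x * Real.exp (2 * x - 2 * max x (-2 * t)) *
      (2 * cA * t * ((t - x) ^ 3)⁻¹ * a) := by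
    have := om_nonneg t x
    positivity
  by_cases hI : x / t ∈ Set.Icc (-2 : ℝ) (-1)
  · obtain ⟨h1, h2⟩ := hI
    rw [le_div_iff₀ ht0] at h1
    rw [div_le_iff₀ ht0] at h2
    rw [om_eq_one ht0 (by linarith), max_eq_left h1, sub_self, Real.exp_zero, one_mul, one_mul]
    refine mul_le_mul_of_nonneg_right ?_ ha
    have h3 : (t - x) ^ 3 ≤ (3 * t) ^ 3 := pow_le_pow_left₀ h0.le (by linarith) 3
    have h4 : ((3 * t) ^ 3)⁻¹ ≤ ((t - x) ^ 3)⁻¹ := inv_anti₀ (by positivity) h3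
    calc (deriv stp (x / t) / t) ^ 2 = deriv stp (x / t) ^ 2 / t ^ 2 := div_pow _ _ _
      _ ≤ (2 / 27 * cA) / t ^ 2 := by gcongr; exact deriv_stp_sq_le _
      _ = 2 * cA * t * ((3 * t) ^ 3)⁻¹ := by field_simp; norm_num; ring
      _ ≤ _ := by gcongr
  · rw [deriv_stp_zero hI]
    simpa using hr

lemma levi_ssq_pow {r : ℝ} (M : ℕ) (z ξ : Cn n) :
    levi (fun x => (ssq x / r) ^ (M + 2)) z ξ =
      (M + 2) * (ssq z / r) ^ (M + 1) / r * ssq ξ +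
        (M + 2) * (M + 1) * (ssq z / r) ^ M / r / r * ‖dd ssq z ξ‖ ^ 2 := by
  have h0 : ∀ x : ℝ, HasDerivAt (fun x : ℝ => x / r) (1 / r) x := fun x => (hasDerivAt_id x).div_const r
  rw [levi_comp sm_ssq (k := fun x => (x / r) ^ (M + 2))
    (k' := fun x => (M + 2) * (x / r) ^ (M + 1) / r)
    (k'' := fun x => (M + 2) * (M + 1) * (x / r) ^ M / r / r), levi_ssq]
  · intro w
    refine ((h0 _).pow (M + 2)).congr_deriv ?_
    push_cast; simp; ring
  · intro w
    refine ((((h0 _).pow (M + 1)).const_mul ((M : ℝ) + 2)).div_const r).congr_deriv ?_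
    push_cast; simp; ring

/-- The basic estimate for smooth weights. -/
theorem basic_estimate {s : Cn n → ℝ} (hs : Sm s) (hs1 : ∀ z, s z ≤ -1) {r R : ℝ} (hr : 0 < r)
    (hrR : r < R) (hl : ∀ z ∈ eb R, ∀ ξ, 0 ≤ levi s z ξ) {f : Cn n → ℂ} (hf : Sm f)
    (hfd : ∀ z ∈ eb R, ∀ j, db j f z = 0) {t δ : ℝ} (ht : 1 ≤ t) (hδ : 0 < δ) :
    ∃ F : Cn n → ℂ, Differentiable ℂ F ∧
      ∫⁻ z in eb r, ENNReal.ofReal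
        (‖F z - ((1 - stp (s z / t) : ℝ) : ℂ) * f z‖ ^ 2 * Real.exp (-2 * s z)) ≤
      ENNReal.ofReal (Real.exp (cA + 1) * (∫ z in eb R, ‖f z‖ ^ 2 * rhs t (s z)) + δ) := by
  obtain ⟨r1, hr1, hr1R⟩ := exists_between hrR
  obtain ⟨r2, hr2, hr2R⟩ := exists_between hr1R
  have ht0 : 0 < t := by linarith
  have hst : ∀ z, s z < t := fun z => by linarith [hs1 z]
  -- the cutoff
  set θ : Cn n → ℝ := fun z => Real.smoothTransition ((r2 - ssq z) / (r2 - r1)) with hθdef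
  have hθs : Sm θ := Real.smoothTransition.contDiff.comp ((contDiff_const.sub sm_ssq).div_const _)
  have hθ1 : ∀ z, ssq z ≤ r1 → θ z = 1 := fun z hz =>
    Real.smoothTransition.one_of_one_le (by rw [one_le_div (by linarith)]; linarith)
  have hθ0 : ∀ z, r2 ≤ ssq z → θ z = 0 := fun z hz =>
    Real.smoothTransition.zero_of_nonpos
      (div_nonpos_of_nonpos_of_nonneg (by linarith) (by linarith))
  have hθc : HasCompactSupport θ :=
    HasCompactSupport.intro (isCompact_ssq_le r2) fun z hz => hθ0 z (by simp at hz; exact hz.le)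
  set Θ : Cn n → ℝ := fun z => tw t (s z) with hΘdef
  have hΘs : Sm Θ := sm_tw hs hst
  set a : Cn n → ℝ := fun z => θ z * Θ z with hadef
  have has : Sm a := hθs.mul hΘs
  have hac : HasCompactSupport a := hθc.mul_right
  obtain ⟨C, hC0, hC⟩ := levi_bound has hac
  -- the function to be corrected
  set b : Cn n → ℝ := fun z => 1 - stp (s z / t) with hbdef
  have hbs : Sm b := contDiff_const.sub (contDiff_stp.comp (hs.div_const t))
  set g : Cn n → ℂ := fun z => toC θ z * (toC b z * f z) with hgdef
  have hgs : Sm g := hθs.toC.mul (hbs.toC.mul hf)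
  have hgc : HasCompactSupport g :=
    (hθc.comp_left (g := fun x : ℝ => (x : ℂ)) (by simp)).mul_right
  set E1 : Cn n → ℝ := fun z =>
    ‖f z‖ ^ 2 * (om t (s z) * Real.exp (2 * s z - 2 * max (s z) (-2 * t))) with hE1
  set E2 : Cn n → ℝ := fun z => ∑ j, ‖db j g z‖ ^ 2 with hE2
  have hscont := hs.continuous
  have hfcont := hf.continuous
  have hE1c : Continuous E1 := by
    have := (continuous_om t).comp hscont
    have h2 : Continuous fun z => om t (s z) := this
    fun_prop
  have hE10 : ∀ z, 0 ≤ E1 z := fun z =>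
    mul_nonneg (sq_nonneg _) (mul_nonneg (om_nonneg _ _) (Real.exp_pos _).le)
  have hE2c : Continuous E2 :=
    continuous_finsetSum _ fun j _ => ((hgs.wirt (σ := Complex.I) (j := j)).continuous.norm.pow 2)
  have hE20 : ∀ z, 0 ≤ E2 z := fun z => Finset.sum_nonneg fun _ _ => sq_nonneg _
  have hE2s : HasCompactSupport E2 := by
    refine HasCompactSupport.intro (K := tsupport g) hgc fun z hz => ?_
    refine Finset.sum_eq_zero fun j _ => ?_
    have : db j g z = 0 := image_eq_zero_of_notMem_tsupport fun h => hz (tsupport_wirt_subset h)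
    simp [this]
  set J := ∫ z, E2 z * Real.exp (-a z) with hJ
  have hJi : Integrable fun z => E2 z * Real.exp (-a z) :=
    (hE2c.mul (Real.continuous_exp.comp has.continuous.neg)).integrable_of_hasCompactSupport
      hE2s.mul_right
  -- the choice of the exponent
  obtain ⟨M, hM1, hM2⟩ : ∃ M : ℕ, r * (C + 1) ≤ M + 2 ∧
      Real.exp (-(r1 / r) ^ (M + 2)) * J ≤ δ / Real.exp (cA + 1) := by
    have h1 : Tendsto (fun M : ℕ => Real.exp (-(r1 / r) ^ (M + 2)) * J) atTop (𝓝 (0 * J)) := by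
      refine Tendsto.mul_const _ (Real.tendsto_exp_neg_atTop_nhds_zero.comp ?_)
      exact (tendsto_pow_atTop_atTop_of_one_lt ((one_lt_div hr).2 hr1)).comp (tendsto_add_atTop_nat 2)
    rw [zero_mul] at h1
    have h2 := h1.eventually_le_const (u := δ / Real.exp (cA + 1)) (by positivity)
    obtain ⟨M, hM, hM'⟩ := (h2.and (eventually_ge_atTop ⌈r * (C + 1)⌉₊)).exists
    refine ⟨M, ?_, hM⟩
    have := Nat.le_ceil (r * (C + 1))
    have : (⌈r * (C + 1)⌉₊ : ℝ) ≤ M := by exact_mod_cast hM'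
    linarith
  set q : Cn n → ℝ := fun z => (ssq z / r) ^ (M + 2) with hq
  have hqs : Sm q := (sm_ssq.div_const r).pow _
  have hq0 : ∀ z, 0 ≤ q z := fun z => pow_nonneg (div_nonneg (ssq_nonneg z) hr.le) _
  have hlq : ∀ z ξ, 0 ≤ levi q z ξ := fun z ξ => by
    rw [hq, levi_ssq_pow]
    have := ssq_nonneg z; have := ssq_nonneg ξ; positivity
  have hlq' : ∀ z ξ, r1 ≤ ssq z → (C + 1) * ssq ξ ≤ levi q z ξ := fun z ξ hz => by
    rw [hq, levi_ssq_pow]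
    have h1 : 1 ≤ (ssq z / r) ^ (M + 1) := one_le_pow₀ ((one_le_div hr).2 (by linarith))
    have h2 : C + 1 ≤ (M + 2) * (ssq z / r) ^ (M + 1) / r := by
      rw [le_div_iff₀ hr]; nlinarith
    have h3 : (0 : ℝ) ≤ (M + 2) * (M + 1) * (ssq z / r) ^ M / r / r * ‖dd ssq z ξ‖ ^ 2 := by
      have := ssq_nonneg z; positivity
    nlinarith [ssq_nonneg ξ]
  set Ψ : Cn n → ℝ := fun z => a z + q z with hΨ
  have hΨs : Sm Ψ := has.add hqs
  have hlin : ∀ z ∈ eb r1, ∀ ξ,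
      2 * cA * t * ((t - s z) ^ 3)⁻¹ * ‖dd s z ξ‖ ^ 2 ≤ levi Ψ z ξ := by
    intro z hz ξ
    rw [hΨ, levi_add has hqs]
    have h1 : a =ᶠ[𝓝 z] Θ := by
      filter_upwards [(isOpen_eb r1).mem_nhds hz] with y hy
      simp [hadef, hθ1 y (le_of_lt hy)]
    rw [levi_congr h1]
    have := levi_tw hs hs1 ht (hl z (lt_trans (show ssq z < r1 from hz) hr1R) ξ)
    linarith [hlq z ξ]
  have hlout : ∀ z, r1 ≤ ssq z → ∀ ξ, ssq ξ ≤ levi Ψ z ξ := by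
    intro z hz ξ
    rw [hΨ, levi_add has hqs]
    linarith [hlq' z ξ hz, hC z ξ]
  set E : Cn n → ℝ := fun z => (eb r1).indicator E1 z + (eb r1)ᶜ.indicator E2 z with hE
  have hEin : ∀ z ∈ eb r1, E z = E1 z := fun z hz => by simp [hE, hz]
  have hEout : ∀ z ∉ eb r1, E z = E2 z := fun z hz => by simp [hE, hz]
  have hE0 : ∀ z, 0 ≤ E z := fun z => by
    by_cases hz : z ∈ eb r1
    · rw [hEin z hz]; exact hE10 z
    · rw [hEout z hz]; exact hE20 z
  have hmeas : MeasurableSet (eb r1 : Set (Cn n)) := (isOpen_eb r1).measurableSet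
  have hExp : (fun z => E z * Real.exp (-Ψ z)) = fun z =>
      (eb r1).indicator (fun z => E1 z * Real.exp (-Ψ z)) z +
      (eb r1)ᶜ.indicator (fun z => E2 z * Real.exp (-Ψ z)) z := by
    ext z
    by_cases hz : z ∈ eb r1
    · simp [hEin z hz, hz]
    · simp [hEout z hz, hz]
  have hΨc := hΨs.continuous
  have hec : Continuous fun z => Real.exp (-Ψ z) := by fun_prop
  have hcomp : ∀ {ρ : ℝ} {h : Cn n → ℝ}, Continuous h → IntegrableOn h (eb ρ) := fun {ρ h} hh =>
    (hh.continuousOn.integrableOn_compact (isCompact_ssq_le ρ)).mono_set fun z hz => show ssq z ≤ ρ from le_of_lt hz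
  have hi1 : Integrable ((eb r1).indicator fun z => E1 z * Real.exp (-Ψ z)) :=
    (integrable_indicator_iff hmeas).2 (hcomp (hE1c.mul hec))
  have hi2' : Integrable fun z => E2 z * Real.exp (-Ψ z) :=
    (hE2c.mul hec).integrable_of_hasCompactSupport hE2s.mul_right
  have hi2 : Integrable ((eb r1)ᶜ.indicator fun z => E2 z * Real.exp (-Ψ z)) :=
    hi2'.indicator hmeas.compl
  have hEi : Integrable fun z => E z * Real.exp (-Ψ z) := by
    rw [hExp]; exact hi1.add hi2
  -- pointwise inequality
  have hmain : ∀ z ξ, ‖∑ j, db j g z * conj (ξ j)‖ ^ 2 ≤ E z * levi Ψ z ξ := by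
    intro z ξ
    by_cases hz : z ∈ eb r1
    · rw [hEin z hz]
      have h1 : ∀ j, db j g z = ((-(deriv stp (s z / t) / t) : ℝ) : ℂ) * f z * db j (toC s) z := by
        intro j
        have e1 : g =ᶠ[𝓝 z] fun x => toC b x * f x := by
          filter_upwards [(isOpen_eb r1).mem_nhds hz] with y hy
          simp [hgdef, toC, hθ1 y (le_of_lt hy)]
        have e2 : db j g z = db j (toC b) z * f z + toC b z * db j f z :=
          (wirt_congr e1).trans (wirt_mul (hbs.toC.dAt z) (hf.dAt z))
        have hk : HasDerivAt (fun x => 1 - stp (x / t)) (-(deriv stp (s z / t) / t)) (s z) := by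
          have h0 : HasDerivAt stp (deriv stp (s z / t)) (s z / t) :=
            ((contDiff_stp.differentiable (by simp)) _).hasDerivAt
          have h3 : HasDerivAt (fun x : ℝ => x / t) (1 / t) (s z) := (hasDerivAt_id _).div_const t
          refine ((h0.comp (s z) h3).const_sub 1).congr_deriv ?_
          ring
        have e3 : db j (toC b) z = ((-(deriv stp (s z / t) / t) : ℝ) : ℂ) * db j (toC s) z := by
          have := wirt_comp_real (σ := Complex.I) (j := j) hk.differentiableAt (hs.dAt z)
          rw [hk.deriv] at this
          exact this
        rw [e2, e3, hfd z (lt_trans (show ssq z < r1 from hz) hr1R) j]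
        ring
      have h2 : ∑ j, db j g z * conj (ξ j) =
          ((-(deriv stp (s z / t) / t) : ℝ) : ℂ) * f z * conj (dd s z ξ) := by
        rw [dd, map_sum, Finset.mul_sum]
        refine Finset.sum_congr rfl fun j _ => ?_
        rw [h1, db_toC hs, map_mul]; ring
      rw [h2, norm_mul, norm_mul, RCLike.norm_conj, Complex.norm_real, mul_pow, mul_pow,
        Real.norm_eq_abs, sq_abs, neg_sq]
      have h3 := shell_ineq (a := ‖dd s z ξ‖ ^ 2) ht (hs1 z) (sq_nonneg _)
      have h4 := hlin z hz ξ
      calc _ = ‖f z‖ ^ 2 * ((deriv stp (s z / t) / t) ^ 2 * ‖dd s z ξ‖ ^ 2) := by ring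
        _ ≤ ‖f z‖ ^ 2 * _ := mul_le_mul_of_nonneg_left h3 (sq_nonneg _)
        _ = E1 z * (2 * cA * t * ((t - s z) ^ 3)⁻¹ * ‖dd s z ξ‖ ^ 2) := by
          simp only [hE1]; ring
        _ ≤ _ := mul_le_mul_of_nonneg_left h4 (hE10 z)
    · rw [hEout z hz]
      exact (cs_sum _ ξ).trans (mul_le_mul_of_nonneg_left (hlout z (not_lt.1 hz) ξ) (hE20 z))
  have hpos : ∀ z ξ, 0 ≤ levi Ψ z ξ := by
    intro z ξ
    by_cases hz : z ∈ eb r1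
    · refine le_trans ?_ (hlin z hz ξ)
      have := cA_nonneg
      have : 0 < t - s z := by linarith [hst z]
      positivity
    · exact (ssq_nonneg ξ).trans (hlout z (not_lt.1 hz) ξ)
  obtain ⟨F, hF, hFb⟩ := hormander hΨs hgs hgc hE0 hEi hmain hpos
  refine ⟨F, hF, ?_⟩
  -- the right-hand side
  have hR1 : ∫ z, (eb r1).indicator (fun z => E1 z * Real.exp (-Ψ z)) z ≤
      ∫ z in eb R, ‖f z‖ ^ 2 * rhs t (s z) := by
    have hrc : Continuous fun z => rhs t (s z) := (continuous_rhs t).comp hscont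
    rw [← integral_indicator (isOpen_eb R).measurableSet]
    refine integral_mono hi1 ((integrable_indicator_iff (isOpen_eb R).measurableSet).2
      (hcomp (by fun_prop))) fun z => ?_
    by_cases hz : z ∈ eb r1
    · have hzR : z ∈ eb R := lt_trans (show ssq z < r1 from hz) hr1R
      simp only [Set.indicator_of_mem hz, Set.indicator_of_mem hzR, hE1, rhs]
      have h1 : 2 * s z ≤ Ψ z := by
        have h2 := tw_ge ht0 (hst z)
        have h3 := hq0 z
        have h4 : a z = tw t (s z) := by simp [hadef, hΘdef, hθ1 z (le_of_lt hz)]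
        simp only [hΨ]; linarith
      rw [mul_assoc, mul_assoc, ← Real.exp_add]
      have := om_nonneg t (s z)
      gcongr
      linarith
    · rw [Set.indicator_of_notMem hz]
      exact Set.indicator_nonneg (fun z _ => mul_nonneg (sq_nonneg _) (rhs_nonneg _ _)) z
  have hR2 : ∫ z, (eb r1)ᶜ.indicator (fun z => E2 z * Real.exp (-Ψ z)) z ≤
      δ / Real.exp (cA + 1) := by
    refine le_trans ?_ hM2
    rw [hJ, ← integral_const_mul]
    refine integral_mono hi2 (hJi.const_mul _) fun z => ?_
    by_cases hz : z ∈ eb r1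
    · simp only [Set.indicator_of_notMem (Set.notMem_compl_iff.2 hz)]
      exact mul_nonneg (Real.exp_pos _).le (mul_nonneg (hE20 z) (Real.exp_pos _).le)
    · simp only [Set.indicator_of_mem (Set.mem_compl hz)]
      have h1 : (r1 / r) ^ (M + 2) ≤ q z :=
        pow_le_pow_left₀ (div_nonneg (by linarith) hr.le) (div_le_div_of_nonneg_right (not_lt.1 hz) hr.le) _
      rw [mul_left_comm, ← Real.exp_add]
      refine mul_le_mul_of_nonneg_left (Real.exp_le_exp.2 ?_) (hE20 z)
      simp only [hΨ]; linarith
  have hR : Real.exp (cA + 1) * ∫ z, E z * Real.exp (-Ψ z) ≤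
      Real.exp (cA + 1) * (∫ z in eb R, ‖f z‖ ^ 2 * rhs t (s z)) + δ := by
    rw [hExp, integral_add hi1 hi2]
    have := mul_le_mul_of_nonneg_left (add_le_add hR1 hR2) (Real.exp_pos (cA + 1)).le
    rwa [mul_add (Real.exp (cA + 1)) (∫ z in eb R, _), mul_div_cancel₀ _ (Real.exp_pos _).ne'] at this
  refine le_trans ?_ (ENNReal.ofReal_le_ofReal hR)
  rw [ENNReal.ofReal_mul (Real.exp_pos _).le]
  refine le_trans ?_ (mul_le_mul_right hFb _)
  rw [← lintegral_const_mul' _ _ ENNReal.ofReal_ne_top]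
  refine le_trans ?_ (setLIntegral_le_lintegral (eb r) _)
  refine setLIntegral_mono' (isOpen_eb r).measurableSet fun z hz => ?_
  rw [← ENNReal.ofReal_mul (Real.exp_pos _).le]
  refine ENNReal.ofReal_le_ofReal ?_
  have hz' : ssq z < r := hz
  have h1 : g z = ((1 - stp (s z / t) : ℝ) : ℂ) * f z := by
    simp [hgdef, toC, hθ1 z (by linarith), hbdef]
  rw [h1, mul_left_comm, ← Real.exp_add]
  refine mul_le_mul_of_nonneg_left (Real.exp_le_exp.2 ?_) (sq_nonneg _)
  have h2 := tw_le ht0 (show s z ≤ 0 by linarith [hs1 z])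
  have h3 : q z ≤ 1 := pow_le_one₀ (div_nonneg (ssq_nonneg z) hr.le) ((div_le_one hr).2 hz'.le)
  have h4 : a z = tw t (s z) := by simp [hadef, hΘdef, hθ1 z (by linarith)]
  simp only [hΨ]; linarith

/-- A pointwise limit of uniformly bounded holomorphic functions is holomorphic. -/
lemma holo_of_tendsto {U : Set (Cn n)} (hU : IsOpen U) {F : ℕ → Cn n → ℂ} {G : Cn n → ℂ} {M : ℝ}
    (hF : ∀ j, DifferentiableOn ℂ (F j) U) (hM : ∀ j, ∀ z ∈ U, ‖F j z‖ ≤ M)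
    (hG : ∀ z ∈ U, Tendsto (fun j => F j z) atTop (𝓝 (G z))) : DifferentiableOn ℂ G U := by
  intro x0 hx0
  obtain ⟨ρ, hρ, hb⟩ := Metric.isOpen_iff.1 hU x0 hx0
  have hM0 : 0 ≤ M := (norm_nonneg _).trans (hM 0 x0 hx0)
  set Ft : ℕ → Cn n → ℂ := fun j => U.indicator (F j)
  set Gt : Cn n → ℂ := U.indicator G
  have hFm : ∀ j, AEStronglyMeasurable (Ft j) volume := fun j =>
    (aestronglyMeasurable_indicator_iff hU.measurableSet).2
      ((hF j).continuousOn.aestronglyMeasurable hU.measurableSet)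
  have hFb : ∀ j z, ‖Ft j z‖ ≤ M := fun j z => by
    by_cases hz : z ∈ U
    · simpa [Ft, hz] using hM j z hz
    · simpa [Ft, hz] using hM0
  have hFG : ∀ z, Tendsto (fun j => Ft j z) atTop (𝓝 (Gt z)) := fun z => by
    by_cases hz : z ∈ U
    · simpa [Ft, Gt, hz] using hG z hz
    · simp [Ft, Gt, hz]
  have hGm : AEStronglyMeasurable Gt volume :=
    aestronglyMeasurable_of_tendsto_ae atTop hFm (ae_of_all _ hFG)
  have hGb : ∀ z, ‖Gt z‖ ≤ M := fun z =>
    le_of_tendsto (hFG z).norm (Eventually.of_forall fun j => hFb j z)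
  have hloc : ∀ {h : Cn n → ℂ}, AEStronglyMeasurable h volume → (∀ z, ‖h z‖ ≤ M) →
      LocallyIntegrable h := fun {h} hm hb =>
    (locallyIntegrable_const M).mono hm (ae_of_all _ fun z => by
      simpa [abs_of_nonneg hM0] using hb z)
  have hcv : ∀ {k : Cn n → ℂ}, Continuous k → HasCompactSupport k → ∀ x,
      Tendsto (fun j => cv k (Ft j) x) atTop (𝓝 (cv k Gt x)) := by
    intro k hk hkc x
    have hki : Integrable fun y => k (x - y) := (int_of_cs hk hkc).comp_sub_left x
    refine tendsto_integral_of_dominated_convergence (fun y => M * ‖k (x - y)‖)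
      (fun j => (hFm j).mul hki.aestronglyMeasurable) (hki.norm.const_mul M)
      (fun j => ae_of_all _ fun y => ?_) (ae_of_all _ fun y => (hFG y).mul_const _)
    rw [norm_mul]
    exact mul_le_mul_of_nonneg_right (hFb j y) (norm_nonneg _)
  have hε : 0 < ρ / 4 := by linarith
  have hsub : ∀ x ∈ Metric.ball x0 (ρ / 2), Metric.ball x (ρ / 2) ⊆ U := fun x hx y hy => by
    refine hb ?_
    have := dist_triangle y x x0
    simp only [Metric.mem_ball] at *; linarith
  have hFe : ∀ j, ∀ x ∈ Metric.ball x0 (ρ / 2), moll (ρ / 4) (Ft j) x = F j x := fun j x hx => by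
    have h1 : moll (ρ / 4) (Ft j) x = moll (ρ / 4) (F j) x := by
      refine moll_congr hε fun y hy => ?_
      have hy' : y ∈ U := hsub x hx (Metric.ball_subset_ball (by linarith) hy)
      simp [Ft, hy']
    rw [h1, moll_holo hε (by linarith) ((hF j).mono (hsub x hx))]
  have hGe : ∀ x ∈ Metric.ball x0 (ρ / 2), moll (ρ / 4) Gt x = G x := fun x hx => by
    have h1 := hcv (sm_rhoC (ρ / 4)).continuous (hcs_rhoC hε) x
    have hxU : x ∈ U := hsub x hx (Metric.mem_ball_self (by linarith))
    refine tendsto_nhds_unique h1 ((hG x hxU).congr fun j => (hFe j x hx).symm)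
  have hx00 : x0 ∈ Metric.ball x0 (ρ / 2) := Metric.mem_ball_self (by linarith)
  have hnh : Metric.ball x0 (ρ / 2) ∈ 𝓝 x0 := Metric.isOpen_ball.mem_nhds hx00
  have hd : DifferentiableAt ℂ (moll (ρ / 4) Gt) x0 := by
    refine diff_of_db ((sm_moll hε (hloc hGm hGb)).dAt x0) fun k => ?_
    have e1 : db k (moll (ρ / 4) Gt) x0 = cv (db k (rhoC (ρ / 4))) Gt x0 :=
      wirt_cv (sm_rhoC _) (hcs_rhoC hε) (hloc hGm hGb) x0
    rw [e1]
    refine tendsto_nhds_unique (hcv (sm_rhoC (ρ / 4)).wirt.continuous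
      (hcs_wirt (hcs_rhoC hε)) x0) ?_
    refine tendsto_const_nhds.congr fun j => ?_
    have e2 : db k (moll (ρ / 4) (Ft j)) x0 = cv (db k (rhoC (ρ / 4))) (Ft j) x0 :=
      wirt_cv (sm_rhoC _) (hcs_rhoC hε) (hloc (hFm j) (hFb j)) x0
    have e3 : db k (moll (ρ / 4) (Ft j)) x0 = db k (F j) x0 :=
      wirt_congr (by filter_upwards [hnh] with x hx using hFe j x hx)
    rw [← e2, e3, db_of_diff ((hF j).differentiableAt (hU.mem_nhds hx0))]
  refine (hd.congr_of_eventuallyEq ?_).differentiableWithinAt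
  filter_upwards [hnh] with x hx using (hGe x hx).symm

lemma volume_eb_lt_top (r : ℝ) : volume (eb r : Set (Cn n)) < ⊤ :=
  (measure_mono fun z hz => show ssq z ≤ r from le_of_lt hz).trans_lt
    (isCompact_ssq_le r).measure_lt_top

lemma lintegral_enorm_le {S : Set (Cn n)} {F : Cn n → ℂ} :
    ∫⁻ z in S, ‖F z‖ₑ ≤ volume S + ∫⁻ z in S, ‖F z‖ₑ ^ 2 := by
  have : ∫⁻ z in S, ((1 : ℝ≥0∞) + ‖F z‖ₑ ^ 2) = volume S + ∫⁻ z in S, ‖F z‖ₑ ^ 2 := by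
    rw [lintegral_add_left measurable_const]; simp
  rw [← this]
  refine lintegral_mono fun z => ?_
  rcases le_total ‖F z‖ₑ 1 with h | h
  · exact h.trans le_self_add
  · exact (le_self_pow₀ h two_ne_zero).trans le_add_self

lemma eb_thick {r r' : ℝ} (hr : r < r') : ∃ ε > 0, ∀ x : Cn n, ssq x ≤ r →
    Metric.ball x ε ⊆ eb r' := by
  obtain ⟨δ, hδ, h⟩ := (isCompact_ssq_le (n := n) r).exists_thickening_subset_open (isOpen_eb r')
    (fun z hz => lt_of_le_of_lt hz hr)
  exact ⟨δ, hδ, fun x hx => (Metric.ball_subset_thickening (E := {z : Cn n | ssq z ≤ r}) hx δ).trans h⟩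

lemma holo_repr {r r' ε : ℝ} (hε : 0 < ε)
    (hεr : ∀ x : Cn n, ssq x ≤ r → Metric.ball x (2 * ε) ⊆ eb r') {F : Cn n → ℂ}
    (hF : DifferentiableOn ℂ F (eb r')) {x : Cn n} (hx : ssq x ≤ r) :
    F x = ∫ y in eb r', F y * rhoC ε (x - y) := by
  rw [← moll_holo hε (by linarith : ε < 2 * ε) (hF.mono (hεr x hx)), setIntegral_eq_integral_of_forall_compl_eq_zero]
  · rfl
  intro y hy
  have : rho ε (x - y) = 0 := rho_eq_zero hε (by
    by_contra! hc
    refine hy (hεr x hx ?_)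
    rw [Metric.mem_ball, dist_comm, dist_eq_norm]; linarith)
  simp [rhoC, toC, this]

/-- Montel's theorem for square-integrable holomorphic functions. -/
theorem montel {r r' : ℝ} (hr : r < r') {F : ℕ → Cn n → ℂ}
    (hF : ∀ j, DifferentiableOn ℂ (F j) (eb r')) {B : ℝ≥0∞} (hBt : B ≠ ⊤)
    (hB : ∀ j, ∫⁻ z in eb r', ‖F j z‖ₑ ^ 2 ≤ B) :
    ∃ (G : Cn n → ℂ) (σ : ℕ → ℕ), StrictMono σ ∧ DifferentiableOn ℂ G (eb r) ∧
      ∀ z ∈ eb r, Tendsto (fun j => F (σ j) z) atTop (𝓝 (G z)) := by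
  obtain ⟨ε', hε', hεr'⟩ := eb_thick (n := n) hr
  set ε := ε' / 2
  have hε : 0 < ε := by simp only [ε]; linarith
  have hεr : ∀ x : Cn n, ssq x ≤ r → Metric.ball x (2 * ε) ⊆ eb r' := by
    simpa [ε, mul_div_cancel₀] using hεr'
  set I := (volume (eb r' : Set (Cn n)) + B).toReal with hI
  have hI0 : 0 ≤ I := ENNReal.toReal_nonneg
  have hItop : volume (eb r' : Set (Cn n)) + B ≠ ⊤ :=
    ENNReal.add_ne_top.2 ⟨(volume_eb_lt_top r').ne, hBt⟩
  have hle : ∀ j, ∫⁻ z in eb r', ‖F j z‖ₑ ≤ volume (eb r' : Set (Cn n)) + B := fun j =>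
    lintegral_enorm_le.trans (by gcongr; exact hB j)
  have hFi : ∀ j, IntegrableOn (F j) (eb r') := fun j =>
    ⟨(hF j).continuousOn.aestronglyMeasurable (isOpen_eb r').measurableSet,
      (hle j).trans_lt hItop.lt_top⟩
  have hFI : ∀ j, ∫ z in eb r', ‖F j z‖ ≤ I := fun j => by
    rw [integral_norm_eq_lintegral_enorm (hFi j).aestronglyMeasurable]
    exact ENNReal.toReal_mono hItop (hle j)
  have hki : ∀ j x, IntegrableOn (fun y => F j y * rhoC ε (x - y)) (eb r') := fun j x => by
    refine (hFi j).mul_bdd (c := (ε ^ rdim n * rhoMass n)⁻¹)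
      ((sm_shift (sm_rhoC ε) x).continuous.aestronglyMeasurable) (ae_of_all _ fun y => ?_)
    simp only [rhoC, toC, Complex.norm_real, Real.norm_of_nonneg (rho_nonneg hε _)]
    exact rho_le hε _
  set c := (ε ^ rdim n * rhoMass n)⁻¹
  have hbd : ∀ j x, ssq x ≤ r → ‖F j x‖ ≤ I * c := fun j x hx => by
    rw [holo_repr hε hεr (hF j) hx]
    refine (norm_integral_le_integral_norm _).trans ?_
    calc _ ≤ ∫ y in eb r', ‖F j y‖ * c := by
          refine integral_mono (hki j x).norm ((hFi j).norm.mul_const c) fun y => ?_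
          simp only [norm_mul]
          refine mul_le_mul_of_nonneg_left ?_ (norm_nonneg _)
          simp only [rhoC, toC, Complex.norm_real, Real.norm_of_nonneg (rho_nonneg hε _)]
          exact rho_le hε _
      _ = (∫ y in eb r', ‖F j y‖) * c := integral_mul_const _ _
      _ ≤ I * c := by
        refine mul_le_mul_of_nonneg_right (hFI j) ?_
        have := rhoMass_pos (n := n); positivity
  have huc : UniformContinuous (rhoC ε : Cn n → ℂ) :=
    (hcs_rhoC hε).uniformContinuous_of_continuous (sm_rhoC ε).continuous
  have heq : ∀ η > 0, ∃ d > 0, ∀ j x x', ssq x ≤ r → ssq x' ≤ r → dist x x' < d →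
      dist (F j x) (F j x') ≤ I * η := by
    intro η hη
    obtain ⟨d, hd, h⟩ := Metric.uniformContinuous_iff.1 huc η hη
    refine ⟨d, hd, fun j x x' hx hx' hxx => ?_⟩
    rw [dist_eq_norm, holo_repr hε hεr (hF j) hx, holo_repr hε hεr (hF j) hx',
      ← integral_sub (hki j x) (hki j x')]
    refine (norm_integral_le_integral_norm _).trans ?_
    calc _ ≤ ∫ y in eb r', ‖F j y‖ * η := by
          refine integral_mono ((hki j x).sub (hki j x')).norm ((hFi j).norm.mul_const η) fun y => ?_
          simp only [← mul_sub, norm_mul]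
          refine mul_le_mul_of_nonneg_left ?_ (norm_nonneg _)
          have := h (a := x - y) (b := x' - y) (by simpa using hxx)
          rw [dist_eq_norm] at this; exact this.le
      _ = (∫ y in eb r', ‖F j y‖) * η := integral_mul_const _ _
      _ ≤ I * η := mul_le_mul_of_nonneg_right (hFI j) hη.le
  set K : Set (Cn n) := {z | ssq z ≤ r} with hK
  have hKc : IsCompact K := isCompact_ssq_le r
  have : CompactSpace K := isCompact_iff_compactSpace.1 hKc
  have hKs : K ⊆ eb r' := fun z hz => lt_of_le_of_lt hz hr
  set f : ℕ → BoundedContinuousFunction K ℂ := fun j =>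
    BoundedContinuousFunction.mkOfCompact ⟨K.domRestrict (F j),
      ((hF j).continuousOn.mono hKs).domRestrict⟩ with hf
  have hfv : ∀ j (x : K), f j x = F j x := fun j x => rfl
  have hcomp : IsCompact (closure (Set.range f)) := by
    refine BoundedContinuousFunction.arzela_ascoli (Metric.closedBall (0 : ℂ) (I * c))
      (isCompact_closedBall _ _) _ ?_ ?_
    · rintro _ x ⟨j, rfl⟩
      rw [mem_closedBall_zero_iff, hfv]; exact hbd j x x.2
    · intro x
      rw [Metric.equicontinuousAt_iff]
      intro η hη
      obtain ⟨d, hd, h⟩ := heq (η / (2 * (I + 1))) (by positivity)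
      refine ⟨d, hd, ?_⟩
      rintro y hy ⟨_, ⟨j, rfl⟩⟩
      have h1 := h j x y x.2 y.2 (by rw [dist_comm]; exact hy)
      refine lt_of_le_of_lt h1 ?_
      rw [mul_div_assoc', div_lt_iff₀ (by positivity)]; nlinarith
  obtain ⟨g, -, σ, hσ, hg⟩ := hcomp.tendsto_subseq
    (fun j => subset_closure (Set.mem_range_self j) : ∀ j, f j ∈ closure (Set.range f))
  classical
  set G : Cn n → ℂ := fun z => if h : z ∈ K then g ⟨z, h⟩ else 0 with hGdef
  have hlim : ∀ z ∈ eb r, Tendsto (fun j => F (σ j) z) atTop (𝓝 (G z)) := by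
    intro z hz
    have hzK : z ∈ K := show ssq z ≤ r from le_of_lt hz
    have h1 := (BoundedContinuousFunction.tendsto_iff_tendstoUniformly.1 hg).tendsto_at ⟨z, hzK⟩
    simpa [hGdef, hzK, hfv] using h1
  refine ⟨G, σ, hσ, holo_of_tendsto (isOpen_eb r) (M := I * c) (fun j => (hF (σ j)).mono ?_)
    (fun j z hz => hbd _ z (le_of_lt hz)) hlim, hlim⟩
  exact fun z hz => lt_trans (show ssq z < r from hz) hr

/-- The basic estimate, as a property of a real weight on the ball `eb R`. -/
def Est (R : ℝ) (ψ : Cn n → ℝ) : Prop :=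
  ∀ f : Cn n → ℂ, Sm f → (∀ z ∈ eb R, ∀ j, db j f z = 0) → ∀ r, 0 < r → r < R → ∀ t, 1 ≤ t →
    ∀ δ, 0 < δ → ∃ F : Cn n → ℂ, DifferentiableOn ℂ F (eb r) ∧
      ∫⁻ z in eb r, ENNReal.ofReal
        (‖F z - ((1 - stp (ψ z / t) : ℝ) : ℂ) * f z‖ ^ 2 * Real.exp (-2 * ψ z)) ≤
      ENNReal.ofReal (Real.exp (cA + 1) * (∫ z in eb R, ‖f z‖ ^ 2 * rhs t (ψ z)) + δ)

lemma est_smooth {s : Cn n → ℝ} (hs : Sm s) (hs1 : ∀ z, s z ≤ -1) {R : ℝ}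
    (hl : ∀ z ∈ eb R, ∀ ξ, 0 ≤ levi s z ξ) : Est R s := by
  intro f hf hfd r hr hrR t ht δ hδ
  obtain ⟨F, hF, h⟩ := basic_estimate hs hs1 hr hrR hl hf hfd ht hδ
  exact ⟨F, hF.differentiableOn, h⟩

lemma rhs_le {t : ℝ} (x : ℝ) : rhs t x ≤ Real.exp (4 * t) := by
  unfold rhs
  refine (mul_le_of_le_one_left (Real.exp_pos _).le (om_le_one _ _)).trans (Real.exp_le_exp.2 ?_)
  linarith [le_max_right x (-2 * t)]

lemma continuous_stp : Continuous stp := contDiff_stp.continuous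

lemma stp_nonneg (x : ℝ) : 0 ≤ stp x := Real.smoothTransition.nonneg _

lemma stp_le_one (x : ℝ) : stp x ≤ 1 := Real.smoothTransition.le_one _

lemma sq_norm_le_weighted {F f : ℂ} {b e : ℝ} (hb0 : 0 ≤ b) (hb1 : b ≤ 1) (he : 1 ≤ e) :
    ‖F‖ ^ 2 ≤ 2 * (‖F - (b : ℂ) * f‖ ^ 2 * e) + 2 * ‖f‖ ^ 2 := by
  have h1 : ‖F‖ ≤ ‖F - (b : ℂ) * f‖ + ‖f‖ := by
    have h2 : ‖(b : ℂ) * f‖ ≤ ‖f‖ := by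
      rw [norm_mul, Complex.norm_real, Real.norm_of_nonneg hb0]
      exact mul_le_of_le_one_left (norm_nonneg _) hb1
    calc ‖F‖ = ‖(F - (b : ℂ) * f) + (b : ℂ) * f‖ := by ring_nf
      _ ≤ _ := (norm_add_le _ _).trans (by linarith)
  have h3 := pow_le_pow_left₀ (norm_nonneg _) h1 2
  have h4 : ‖F - (b : ℂ) * f‖ ^ 2 ≤ ‖F - (b : ℂ) * f‖ ^ 2 * e :=
    le_mul_of_one_le_right (sq_nonneg _) he
  nlinarith [sq_nonneg (‖F - (b : ℂ) * f‖ - ‖f‖)]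

lemma enorm_sq_eq (F : ℂ) : ‖F‖ₑ ^ 2 = ENNReal.ofReal (‖F‖ ^ 2) := by
  rw [ENNReal.ofReal_pow (norm_nonneg _), ofReal_norm]

lemma integrableOn_sq_mul {f : Cn n → ℂ} (hf : Continuous f) {R C : ℝ} {h : Cn n → ℝ}
    (hm : AEStronglyMeasurable h (volume.restrict (eb R))) (hb : ∀ z, ‖h z‖ ≤ C) :
    IntegrableOn (fun z => ‖f z‖ ^ 2 * h z) (eb R) := by
  have h1 : IntegrableOn (fun z => ‖f z‖ ^ 2) (eb R) :=
    ((hf.norm.pow 2).continuousOn.integrableOn_compact (isCompact_ssq_le R)).mono_set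
      fun z hz => show ssq z ≤ R from le_of_lt hz
  exact h1.mul_bdd hm (ae_of_all _ hb)

/-- The basic estimate is stable under almost everywhere limits. -/
theorem est_limit {R : ℝ} {ψ : ℕ → Cn n → ℝ} {u : Cn n → ℝ}
    (hm : ∀ j, AEMeasurable (ψ j) (volume.restrict (eb R)))
    (h0 : ∀ j, ∀ᵐ z ∂(volume.restrict (eb R)), ψ j z ≤ 0) (hE : ∀ j, Est R (ψ j))
    (hlim : ∀ᵐ z ∂(volume.restrict (eb R)), Tendsto (fun j => ψ j z) atTop (𝓝 (u z))) :
    Est R u := by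
  intro f hf hfd r hr hrR t ht δ hδ
  obtain ⟨r', hr', hr'R⟩ := exists_between hrR
  have hr'0 : 0 < r' := hr.trans hr'
  choose F hF hFb using fun j => hE j f hf hfd r' hr'0 hr'R t ht δ hδ
  have hsub : (eb r' : Set (Cn n)) ⊆ eb R := fun z hz => lt_trans (show ssq z < r' from hz) hr'R
  have hsub' : (eb r : Set (Cn n)) ⊆ eb r' := fun z hz => lt_trans (show ssq z < r from hz) hr'
  have hle' : volume.restrict (eb r' : Set (Cn n)) ≤ volume.restrict (eb R) :=
    Measure.restrict_mono hsub le_rfl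
  have hle : volume.restrict (eb r : Set (Cn n)) ≤ volume.restrict (eb R) :=
    Measure.restrict_mono (hsub'.trans hsub) le_rfl
  have hmR : ∀ j, AEStronglyMeasurable (fun z => rhs t (ψ j z)) (volume.restrict (eb R)) :=
    fun j => (continuous_rhs t).comp_aestronglyMeasurable (hm j).aestronglyMeasurable
  have hrb : ∀ x, ‖rhs t x‖ ≤ Real.exp (4 * t) := fun x => by
    rw [Real.norm_of_nonneg (rhs_nonneg _ _)]; exact rhs_le x
  have hfi : IntegrableOn (fun z => ‖f z‖ ^ 2 * Real.exp (4 * t)) (eb R) :=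
    integrableOn_sq_mul hf.continuous (h := fun _ => Real.exp (4 * t))
      aestronglyMeasurable_const (fun _ => by rw [Real.norm_of_nonneg (Real.exp_pos _).le])
  have hconv : Tendsto (fun j => ∫ z in eb R, ‖f z‖ ^ 2 * rhs t (ψ j z)) atTop
      (𝓝 (∫ z in eb R, ‖f z‖ ^ 2 * rhs t (u z))) := by
    refine tendsto_integral_of_dominated_convergence (fun z => ‖f z‖ ^ 2 * Real.exp (4 * t))
      (fun j => (integrableOn_sq_mul hf.continuous (hmR j) fun z => hrb _).aestronglyMeasurable)
      hfi (fun j => ae_of_all _ fun z => ?_) ?_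
    · rw [norm_mul, Real.norm_of_nonneg (sq_nonneg _)]
      exact mul_le_mul_of_nonneg_left (hrb _) (sq_nonneg _)
    · filter_upwards [hlim] with z hz
      exact (((continuous_rhs t).tendsto _).comp hz).const_mul _
  set c : ℕ → ℝ := fun j =>
    Real.exp (cA + 1) * (∫ z in eb R, ‖f z‖ ^ 2 * rhs t (ψ j z)) + δ with hc
  have hcl : Tendsto (fun j => ENNReal.ofReal (c j)) atTop
      (𝓝 (ENNReal.ofReal (Real.exp (cA + 1) * (∫ z in eb R, ‖f z‖ ^ 2 * rhs t (u z)) + δ))) :=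
    ENNReal.tendsto_ofReal ((hconv.const_mul _).add_const δ)
  set M0 : ℝ := Real.exp (cA + 1) * (∫ z in eb R, ‖f z‖ ^ 2 * Real.exp (4 * t)) + δ with hM0
  have hcM : ∀ j, c j ≤ M0 := fun j => by
    refine add_le_add_left (mul_le_mul_of_nonneg_left ?_ (Real.exp_pos _).le) δ
    refine integral_mono (integrableOn_sq_mul hf.continuous (hmR j) fun z => hrb _) hfi fun z => ?_
    exact mul_le_mul_of_nonneg_left (rhs_le _) (sq_nonneg _)
  have hL2 : ∀ j, ∫⁻ z in eb r', ‖F j z‖ₑ ^ 2 ≤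
      2 * ENNReal.ofReal M0 + 2 * ∫⁻ z in eb r', ‖f z‖ₑ ^ 2 := by
    intro j
    have hm1 : Measurable fun z => 2 * ‖f z‖ₑ ^ 2 :=
      (hf.continuous.measurable.enorm.pow_const 2).const_mul 2
    have h1 : ∫⁻ z in eb r', ‖F j z‖ₑ ^ 2 ≤ ∫⁻ z in eb r', (2 * ENNReal.ofReal
        (‖F j z - ((1 - stp (ψ j z / t) : ℝ) : ℂ) * f z‖ ^ 2 * Real.exp (-2 * ψ j z))
        + 2 * ‖f z‖ₑ ^ 2) := by
      refine lintegral_mono_ae ?_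
      filter_upwards [ae_mono hle' (h0 j)] with z hz
      have h2 := sq_norm_le_weighted (F := F j z) (f := f z) (b := 1 - stp (ψ j z / t))
        (e := Real.exp (-2 * ψ j z)) (by linarith [stp_le_one (ψ j z / t)])
        (by linarith [stp_nonneg (ψ j z / t)]) (Real.one_le_exp (by linarith))
      have e2 : (2 : ℝ≥0∞) = ENNReal.ofReal 2 := by simp
      rw [enorm_sq_eq, enorm_sq_eq, e2, ← ENNReal.ofReal_mul (by norm_num),
        ← ENNReal.ofReal_mul (by norm_num), ← ENNReal.ofReal_add (by positivity) (by positivity)]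
      exact ENNReal.ofReal_le_ofReal h2
    refine h1.trans ?_
    rw [lintegral_add_right _ hm1, lintegral_const_mul' _ _ (by simp),
      lintegral_const_mul' _ _ (by simp)]
    gcongr
    exact (hFb j).trans (ENNReal.ofReal_le_ofReal (hcM j))
  have hfin : ∫⁻ z in eb r', ‖f z‖ₑ ^ 2 < ⊤ := by
    have h1 : IntegrableOn (fun z => ‖f z‖ ^ 2 * 1) (eb r') :=
      integrableOn_sq_mul hf.continuous (h := fun _ => 1) (C := 1) aestronglyMeasurable_const (by simp)
    have h2 := h1.2
    simp only [HasFiniteIntegral, mul_one, enorm_pow, enorm_norm] at h2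
    exact h2
  obtain ⟨G, σ, hσ, hG, hGl⟩ := montel hr' hF
    (ENNReal.add_ne_top.2 ⟨ENNReal.mul_ne_top (by simp) ENNReal.ofReal_ne_top,
      ENNReal.mul_ne_top (by simp) hfin.ne⟩) hL2
  refine ⟨G, hG, ?_⟩
  set A : ℕ → Cn n → ℝ≥0∞ := fun j z => ENNReal.ofReal
    (‖F j z - ((1 - stp (ψ j z / t) : ℝ) : ℂ) * f z‖ ^ 2 * Real.exp (-2 * ψ j z)) with hA
  have hAm : ∀ j, AEMeasurable (A j) (volume.restrict (eb r)) := by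
    intro j
    have h1 : AEMeasurable (F j) (volume.restrict (eb r)) :=
      (((hF j).continuousOn.mono hsub').aestronglyMeasurable
        (isOpen_eb r).measurableSet).aemeasurable
    have h2 := (hm j).mono_measure hle
    have h3 : AEMeasurable (fun z => stp (ψ j z / t)) (volume.restrict (eb r)) :=
      continuous_stp.measurable.comp_aemeasurable (h2.div_const t)
    have h4 : AEMeasurable (fun z => ((1 - stp (ψ j z / t) : ℝ) : ℂ)) (volume.restrict (eb r)) :=
      Complex.continuous_ofReal.measurable.comp_aemeasurable (h3.const_sub 1)
    have h5 : AEMeasurable f (volume.restrict (eb r)) := hf.continuous.aemeasurable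
    exact ((((h1.sub (h4.mul h5)).norm.pow_const 2).mul
      (Real.measurable_exp.comp_aemeasurable (h2.const_mul (-2))))).ennreal_ofReal
  have hAl : ∀ᵐ z ∂(volume.restrict (eb r)), Tendsto (fun j => A (σ j) z) atTop
      (𝓝 (ENNReal.ofReal
        (‖G z - ((1 - stp (u z / t) : ℝ) : ℂ) * f z‖ ^ 2 * Real.exp (-2 * u z)))) := by
    filter_upwards [ae_mono hle hlim, ae_restrict_mem (isOpen_eb r).measurableSet] with z hz hzr
    have h1 := hz.comp hσ.tendsto_atTop
    have h2 := hGl z hzr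
    have h3 : Tendsto (fun j => stp (ψ (σ j) z / t)) atTop (𝓝 (stp (u z / t))) :=
      (continuous_stp.tendsto _).comp (h1.div_const t)
    have h4 : Tendsto (fun j => ((1 - stp (ψ (σ j) z / t) : ℝ) : ℂ)) atTop
        (𝓝 ((1 - stp (u z / t) : ℝ) : ℂ)) :=
      (Complex.continuous_ofReal.tendsto _).comp (h3.const_sub 1)
    exact ENNReal.tendsto_ofReal (((h2.sub (h4.mul_const _)).norm.pow 2).mul
      ((Real.continuous_exp.tendsto _).comp (h1.const_mul (-2))))
  calc _ = ∫⁻ z in eb r, liminf (fun j => A (σ j) z) atTop :=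
        lintegral_congr_ae (hAl.mono fun z hz => hz.liminf_eq.symm)
    _ ≤ liminf (fun j => ∫⁻ z in eb r, A (σ j) z) atTop := lintegral_liminf_le' fun j => hAm _
    _ ≤ liminf (fun j => ENNReal.ofReal (c (σ j))) atTop := by
        refine liminf_le_liminf (Eventually.of_forall fun j => ?_)
        exact (lintegral_mono_set hsub').trans (hFb (σ j))
    _ = _ := (hcl.comp hσ.tendsto_atTop).liminf_eq

/-- Weights that are limits of smooth plurisubharmonic functions bounded above by `-1`. -/
def Appr (R : ℝ) (u : Cn n → ℝ) : Prop :=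
  ∃ s : ℕ → Cn n → ℝ, (∀ j, Sm (s j)) ∧ (∀ j z, s j z ≤ -1) ∧
    (∀ j, ∀ z ∈ eb R, ∀ ξ, 0 ≤ levi (s j) z ξ) ∧
    ∀ᵐ z ∂(volume.restrict (eb R)), Tendsto (fun j => s j z) atTop (𝓝 (u z))

lemma Appr.est {R : ℝ} {u : Cn n → ℝ} (h : Appr R u) : Est R u := by
  obtain ⟨s, h1, h2, h3, h4⟩ := h
  exact est_limit (fun j => (h1 j).continuous.aemeasurable)
    (fun j => ae_of_all _ fun z => by linarith [h2 j z])
    (fun j => est_smooth (h1 j) (h2 j) (h3 j)) h4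

lemma Appr.aemeasurable {R : ℝ} {u : Cn n → ℝ} (h : Appr R u) :
    AEMeasurable u (volume.restrict (eb R)) := by
  obtain ⟨s, h1, h2, h3, h4⟩ := h
  exact aemeasurable_of_tendsto_metrizable_ae' (fun j => (h1 j).continuous.aemeasurable) h4

lemma Appr.le {R : ℝ} {u : Cn n → ℝ} (h : Appr R u) :
    ∀ᵐ z ∂(volume.restrict (eb R)), u z ≤ -1 := by
  obtain ⟨s, h1, h2, h3, h4⟩ := h
  exact h4.mono fun z hz => le_of_tendsto hz (Eventually.of_forall fun j => h2 j z)

lemma levi_const_mul {a : Cn n → ℝ} (ha : Sm a) (c : ℝ) (z ξ : Cn n) :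
    levi (fun x => c * a x) z ξ = c * levi a z ξ := by
  have h := levi_comp ha (k := fun x => c * x) (k' := fun _ => c) (k'' := fun _ => 0)
    (fun z => by simpa using (hasDerivAt_id (a z)).const_mul c) (fun z => hasDerivAt_const _ _) z ξ
  rw [h]; ring

lemma Appr.add_mul {R : ℝ} {u v : Cn n → ℝ} (hu : Appr R u) (hv : Appr R v) {c : ℝ} (hc : 0 ≤ c) :
    Appr R fun z => u z + c * v z := by
  obtain ⟨s, h1, h2, h3, h4⟩ := hu
  obtain ⟨s', h1', h2', h3', h4'⟩ := hv
  refine ⟨fun j z => s j z + c * s' j z, fun j => (h1 j).add (contDiff_const.mul (h1' j)),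
    fun j z => ?_, fun j z hz ξ => ?_, ?_⟩
  · nlinarith [h2 j z, h2' j z]
  · rw [levi_add (h1 j) (contDiff_const.mul (h1' j)), levi_const_mul (h1' j)]
    exact add_nonneg (h3 j z hz ξ) (mul_nonneg hc (h3' j z hz ξ))
  · filter_upwards [h4, h4'] with z hz hz' using hz.add (hz'.const_mul c)

lemma summable_prod_pow {n : ℕ} (x : Fin n → ℝ) (h0 : ∀ i, 0 ≤ x i) (h1 : ∀ i, x i < 1) :
    Summable fun α : Fin n → ℕ => ∏ i, x i ^ α i := by
  induction n with
  | zero => exact (hasSum_fintype _).summable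
  | succ n ih =>
    have h := (summable_geometric_of_lt_one (h0 0) (h1 0)).mul_of_nonneg
      (ih (fun i => x i.succ) (fun i => h0 _) (fun i => h1 _))
      (fun k => pow_nonneg (h0 0) k)
      (fun α => Finset.prod_nonneg fun i _ => pow_nonneg (h0 _) _)
    rw [← (Fin.consEquiv fun _ : Fin (n+1) => ℕ).summable_iff]
    refine h.congr fun p => ?_
    simp [Fin.prod_univ_succ, Fin.consEquiv]

lemma cons_eq_single_add (ζ : ℂ) (z' : Cn n) :
    (Fin.cons ζ z' : Cn (n+1)) = ζ • Pi.single 0 1 + (Fin.cons 0 z' : Cn (n+1)) := by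
  ext i
  refine Fin.cases ?_ (fun j => ?_) i <;> simp

lemma norm_cons_lt {ζ : ℂ} {z' : Cn n} {ρ : ℝ} (h1 : ‖ζ‖ < ρ) (h2 : ‖z'‖ < ρ) :
    ‖(Fin.cons ζ z' : Cn (n+1))‖ < ρ := by
  have hρ : 0 < ρ := (norm_nonneg _).trans_lt h1
  rw [pi_norm_lt_iff hρ] at h2 ⊢
  intro i
  refine Fin.cases ?_ (fun j => ?_) i
  · simpa using h1
  · simpa using h2 j

lemma hasDerivAt_cons {F : Cn (n+1) → ℂ} {ζ : ℂ} {z' : Cn n}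
    (hF : DifferentiableAt ℂ F (Fin.cons ζ z')) :
    HasDerivAt (fun ζ : ℂ => F (Fin.cons ζ z')) (dz 0 F (Fin.cons ζ z')) ζ := by
  have h1 : HasDerivAt (fun ζ : ℂ => (Fin.cons ζ z' : Cn (n+1))) (Pi.single 0 1) ζ := by
    have : (fun ζ : ℂ => (Fin.cons ζ z' : Cn (n+1)))
        = fun ζ => ζ • (Pi.single 0 1 : Cn (n+1)) + (Fin.cons 0 z' : Cn (n+1)) :=
      funext fun ζ => cons_eq_single_add ζ z'
    rw [this]
    simpa using ((hasDerivAt_id ζ).smul_const (Pi.single 0 1 : Cn (n+1))).add_const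
      (Fin.cons 0 z' : Cn (n+1))
  have h2 := hF.hasFDerivAt.comp_hasDerivAt ζ h1
  refine h2.congr_deriv ?_
  have h3 : fderiv ℝ F (Fin.cons ζ z') = (fderiv ℂ F (Fin.cons ζ z')).restrictScalars ℝ :=
    hF.fderiv_restrictScalars ℝ
  have h4 : (Pi.single 0 Complex.I : Cn (n+1)) = Complex.I • Pi.single 0 (1:ℂ) := by
    ext i; simp [Pi.single_apply]
  unfold dz wirt
  rw [h3, h4]
  simp only [ContinuousLinearMap.coe_restrictScalars', map_smul, smul_eq_mul]
  rw [← mul_assoc]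
  have : (-Complex.I) * Complex.I = 1 := by simp
  rw [this]
  ring

lemma holo_dz_iterate {U : Set (Cn n)} (hU : IsOpen U) {F : Cn n → ℂ}
    (hF : DifferentiableOn ℂ F U) (j : Fin n) (k : ℕ) :
    DifferentiableOn ℂ ((dz j)^[k] F) U := by
  induction k with
  | zero => simpa using hF
  | succ k ih =>
    rw [Function.iterate_succ_apply']
    exact holo_dz hU ih j

lemma iteratedDeriv_cons {F : Cn (n+1) → ℂ} {ρ : ℝ} (hF : DifferentiableOn ℂ F (Metric.ball 0 ρ))
    {z' : Cn n} (hz' : ‖z'‖ < ρ) (k : ℕ) : ∀ ζ : ℂ, ‖ζ‖ < ρ →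
    iteratedDeriv k (fun ζ : ℂ => F (Fin.cons ζ z')) ζ = (dz 0)^[k] F (Fin.cons ζ z') := by
  induction k with
  | zero => intro ζ _; simp
  | succ k ih =>
    intro ζ hζ
    rw [iteratedDeriv_succ, Function.iterate_succ_apply']
    have h1 : iteratedDeriv k (fun ζ : ℂ => F (Fin.cons ζ z')) =ᶠ[𝓝 ζ]
        fun ζ => (dz 0)^[k] F (Fin.cons ζ z') := by
      filter_upwards [(isOpen_lt continuous_norm continuous_const).mem_nhds hζ] with ξ hξ
      exact ih ξ hξ
    rw [h1.deriv_eq]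
    refine (hasDerivAt_cons ?_).deriv
    exact (holo_dz_iterate Metric.isOpen_ball hF 0 k).differentiableAt
      (Metric.isOpen_ball.mem_nhds (by simpa using norm_cons_lt hζ hz'))

/-- Multivariate Taylor expansion with Cauchy estimates. -/
theorem exists_taylor {n : ℕ} {ρ : ℝ} (hρ : 0 < ρ) {M : ℝ} (F : Cn n → ℂ)
    (hF : DifferentiableOn ℂ F (Metric.ball 0 ρ)) (hM : ∀ z ∈ Metric.ball (0:Cn n) ρ, ‖F z‖ ≤ M) :
    ∃ a : (Fin n → ℕ) → ℂ, (∀ α, ‖a α‖ ≤ M * ∏ i, (2 / ρ) ^ α i) ∧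
      ∀ z ∈ Metric.ball (0:Cn n) (ρ/2), HasSum (fun α => a α * ∏ i, z i ^ α i) (F z) := by
  induction n generalizing M with
  | zero =>
    refine ⟨fun _ => F 0, fun α => by simpa using hM 0 (by simpa using hρ), fun z hz => ?_⟩
    have : z = 0 := Subsingleton.elim _ _
    subst this
    simp
  | succ n ih =>
    have hcons : ∀ z' ∈ Metric.ball (0:Cn n) ρ, ∀ ζ : ℂ, ‖ζ‖ < ρ →
        (Fin.cons ζ z' : Cn (n+1)) ∈ Metric.ball (0 : Cn (n+1)) ρ := by
      intro z' hz' ζ hζ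
      simpa using norm_cons_lt hζ (by simpa using hz')
    have hg : ∀ z' ∈ Metric.ball (0:Cn n) ρ,
        DifferentiableOn ℂ (fun ζ : ℂ => F (Fin.cons ζ z')) (Metric.ball 0 ρ) := by
      intro z' hz' ζ hζ
      exact (hasDerivAt_cons (hF.differentiableAt (Metric.isOpen_ball.mem_nhds
        (hcons z' hz' ζ (by simpa using hζ))))).differentiableAt.differentiableWithinAt
    have hA : ∀ k : ℕ, ∃ b : (Fin n → ℕ) → ℂ,
        (∀ α, ‖b α‖ ≤ (M * (2/ρ)^k) * ∏ i, (2 / ρ) ^ α i) ∧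
        ∀ z ∈ Metric.ball (0:Cn n) (ρ/2), HasSum (fun α => b α * ∏ i, z i ^ α i)
          ((k.factorial : ℂ)⁻¹ * (dz 0)^[k] F (Fin.cons 0 z)) := by
      intro k
      refine ih (fun z' => (k.factorial : ℂ)⁻¹ * (dz 0)^[k] F (Fin.cons 0 z')) ?_ ?_
      · refine DifferentiableOn.const_mul ?_ _
        refine (holo_dz_iterate Metric.isOpen_ball hF 0 k).comp (t := Metric.ball 0 ρ) ?_ ?_
        · refine Differentiable.differentiableOn ?_
          rw [differentiable_pi]
          intro i
          refine Fin.cases ?_ (fun j => ?_) i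
          · simp
          · simp only [Fin.cons_succ]; fun_prop
        · intro z' hz'
          exact hcons z' hz' 0 (by simpa using hρ)
      · intro z' hz'
        have h1 : ‖iteratedDeriv k (fun ζ : ℂ => F (Fin.cons ζ z')) 0‖
            ≤ k.factorial * M / (ρ/2)^k := by
          refine Complex.norm_iteratedDeriv_le_of_forall_mem_sphere_norm_le k (by linarith) ?_ ?_
          · refine DifferentiableOn.diffContOnCl ((hg z' hz').mono ?_)
            refine (Metric.closure_ball_subset_closedBall).trans
              (Metric.closedBall_subset_ball (by linarith))
          · intro ζ hζ
            refine hM _ (hcons z' hz' ζ ?_)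
            rw [mem_sphere_zero_iff_norm] at hζ
            linarith
        rw [iteratedDeriv_cons hF (by simpa using hz') k 0 (by simpa using hρ)] at h1
        rw [norm_mul, norm_inv, Complex.norm_natCast]
        have hk : (0:ℝ) < k.factorial := by exact_mod_cast k.factorial_pos
        calc _ ≤ (k.factorial : ℝ)⁻¹ * (k.factorial * M / (ρ/2)^k) := by gcongr
          _ = M * (2/ρ)^k := by
            have h2 : (ρ/2)^k * (2/ρ)^k = 1 := by
              rw [← mul_pow]; field_simp; simp
            field_simp
            rw [mul_assoc, h2, mul_one]
    choose b hb1 hb2 using hA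
    have hbd : ∀ α : Fin (n+1) → ℕ, ‖b (α 0) (Fin.tail α)‖ ≤ M * ∏ i, (2 / ρ) ^ α i := by
      intro α
      refine (hb1 (α 0) (Fin.tail α)).trans (le_of_eq ?_)
      rw [Fin.prod_univ_succ, mul_assoc]
      rfl
    refine ⟨fun α => b (α 0) (Fin.tail α), hbd, fun z hz => ?_⟩
    have hzi : ∀ i, ‖z i‖ < ρ/2 := by
      rw [mem_ball_zero_iff] at hz
      exact (pi_norm_lt_iff (by linarith)).1 hz
    have hsum : Summable fun α : Fin (n+1) → ℕ => b (α 0) (Fin.tail α) * ∏ i, z i ^ α i := by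
      have h := (summable_prod_pow (fun i => (2/ρ) * ‖z i‖) (fun i => by positivity) (fun i => by
        have := hzi i
        rw [div_mul_eq_mul_div, div_lt_one hρ]; linarith)).mul_left M
      refine h.of_norm_bounded fun α => ?_
      rw [norm_mul, norm_prod]
      simp only [norm_pow, mul_pow, Finset.prod_mul_distrib]
      rw [← mul_assoc]
      gcongr
      exact hbd α
    have hsum2 := ((Fin.consEquiv fun _ : Fin (n+1) => ℕ).summable_iff).2 hsum
    have hS := hsum2.hasSum
    set S := ∑' p, ((fun α : Fin (n+1) → ℕ => b (α 0) (Fin.tail α) * ∏ i, z i ^ α i) ∘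
      (Fin.consEquiv fun _ : Fin (n+1) => ℕ)) p with hSdef
    have hzt : Fin.tail z ∈ Metric.ball (0:Cn n) (ρ/2) := by
      rw [mem_ball_zero_iff, pi_norm_lt_iff (by linarith)]
      exact fun i => hzi i.succ
    have hS2 := hS.prod_fiberwise (g := fun k : ℕ =>
      z 0 ^ k * ((k.factorial : ℂ)⁻¹ * (dz 0)^[k] F (Fin.cons 0 (Fin.tail z)))) (by
      intro k
      have := (hb2 k _ hzt).mul_left (z 0 ^ k)
      refine this.congr_fun ?_
      intro α
      simp [Fin.consEquiv, Fin.prod_univ_succ, Fin.tail]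
      ring)
    have hzt' : Fin.tail z ∈ Metric.ball (0:Cn n) ρ :=
      Metric.ball_subset_ball (by linarith) hzt
    have hT := Complex.hasSum_taylorSeries_on_ball (hg _ hzt') (z := z 0)
      (by rw [mem_ball_zero_iff]; linarith [hzi 0])
    have hT2 : HasSum (fun k : ℕ =>
      z 0 ^ k * ((k.factorial : ℂ)⁻¹ * (dz 0)^[k] F (Fin.cons 0 (Fin.tail z)))) (F z) := by
      have h0 : F (Fin.cons (z 0) (Fin.tail z)) = F z := by rw [Fin.cons_self_tail]
      rw [← h0]
      refine hT.congr_fun fun k => ?_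
      rw [iteratedDeriv_cons hF (by simpa using hzt') k 0 (by simpa using hρ)]
      simp only [sub_zero, smul_eq_mul]
      ring
    rw [← hS2.unique hT2]
    exact ((Fin.consEquiv fun _ : Fin (n+1) => ℕ).hasSum_iff).1 hS

/-- Absolutely summable families of coefficients indexed by multi-exponents. -/
abbrev L1 (n : ℕ) := lp (fun _ : Fin n → ℕ => ℂ) 1

lemma L1.summable (h : L1 n) : Summable fun α => ‖h α‖ := by
  simpa using (lp.memℓp h).summable (by simp)

lemma L1.norm_eq (h : L1 n) : ‖h‖ = ∑' α, ‖h α‖ := by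
  simpa using lp.norm_eq_tsum_rpow (p := 1) (by simp) h

/-- The element of `L1 n` with given summable coefficients. -/
def l1mk (f : (Fin n → ℕ) → ℂ) (hf : Summable fun α => ‖f α‖) : L1 n :=
  ⟨f, memℓp_gen (by simpa using hf)⟩

section lift
variable {E : Type*} [NormedAddCommGroup E] [NormedSpace ℂ E] [CompleteSpace E]

/-- The operator `h ↦ ∑ h_α τ_α` attached to a bounded family `τ`. -/
def l1lift (τ : (Fin n → ℕ) → E) (C : ℝ) (hτ : ∀ α, ‖τ α‖ ≤ C) : L1 n →L[ℂ] E :=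
  have hs : ∀ h : L1 n, Summable fun α => ‖h α • τ α‖ := fun h =>
    ((L1.summable h).mul_right C).of_nonneg_of_le (fun _ => norm_nonneg _) fun α => by
      rw [norm_smul]; exact mul_le_mul_of_nonneg_left (hτ α) (norm_nonneg _)
  LinearMap.mkContinuous
    { toFun := fun h => ∑' α, h α • τ α
      map_add' := fun h h' => by
        rw [← (hs h).of_norm.tsum_add (hs h').of_norm]
        exact tsum_congr fun α => by simp [add_smul]
      map_smul' := fun c h => by
        simp only [RingHom.id_apply]
        rw [← (hs h).of_norm.tsum_const_smul c]
        exact tsum_congr fun α => by simp [mul_smul] }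
    C (fun h => by
      refine (norm_tsum_le_tsum_norm (hs h)).trans ?_
      rw [L1.norm_eq, ← tsum_mul_left]
      refine (hs h).tsum_le_tsum (fun α => ?_) ((L1.summable h).mul_left C)
      rw [norm_smul, mul_comm]
      exact mul_le_mul_of_nonneg_right (hτ α) (norm_nonneg _))

lemma l1lift_apply (τ : (Fin n → ℕ) → E) (C : ℝ) (hτ : ∀ α, ‖τ α‖ ≤ C) (h : L1 n) :
    l1lift τ C hτ h = ∑' α, h α • τ α := rfl

lemma l1lift_le (τ : (Fin n → ℕ) → E) (C : ℝ) (hτ : ∀ α, ‖τ α‖ ≤ C) (h : L1 n) :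
    ‖l1lift τ C hτ h‖ ≤ C * ‖h‖ := by
  refine ContinuousLinearMap.le_of_opNorm_le _ ?_ h
  unfold l1lift
  exact LinearMap.mkContinuous_norm_le _ ((norm_nonneg _).trans (hτ 0)) _

/-- The standard basis of `L1 n`. -/
def l1e (α : Fin n → ℕ) : L1 n := lp.single 1 α 1

lemma norm_l1e (α : Fin n → ℕ) : ‖l1e α‖ = 1 := by
  rw [l1e, lp.norm_single (by simp)]; simp

lemma l1e_apply (α β : Fin n → ℕ) : l1e α β = if β = α then 1 else 0 := by
  simp [l1e, Pi.single_apply]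

@[simp] lemma l1lift_e (τ : (Fin n → ℕ) → E) (C : ℝ) (hτ : ∀ α, ‖τ α‖ ≤ C) (α : Fin n → ℕ) :
    l1lift τ C hτ (l1e α) = τ α := by
  rw [l1lift_apply, tsum_eq_single α]
  · simp [l1e_apply]
  · intro β hβ; simp [l1e_apply, hβ]

end lift

lemma l1_ext {E : Type*} [NormedAddCommGroup E] [NormedSpace ℂ E] {S T : L1 n →L[ℂ] E}
    (h : ∀ α, S (l1e α) = T (l1e α)) : S = T := by
  refine lp.ext_continuousLinearMap (by simp) fun α => ?_
  ext
  simpa [l1e] using h α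

/-- Evaluation of a power series with coefficients `c` at the point `w`. -/
def ev (w : Cn n) (c : L1 n) : ℂ := ∑' α, c α * ∏ i, w i ^ α i

lemma norm_mono_le {w : Cn n} (hw : ∀ i, ‖w i‖ ≤ 1) (α : Fin n → ℕ) :
    ‖∏ i, w i ^ α i‖ ≤ 1 := by
  rw [norm_prod]
  refine Finset.prod_le_one (fun i _ => norm_nonneg _) fun i _ => ?_
  rw [norm_pow]
  exact pow_le_one₀ (norm_nonneg _) (hw i)

/-- Evaluation as a continuous functional. -/
def evL (w : Cn n) (hw : ∀ i, ‖w i‖ ≤ 1) : L1 n →L[ℂ] ℂ :=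
  l1lift (fun α => ∏ i, w i ^ α i) 1 (norm_mono_le hw)

lemma evL_apply (w : Cn n) (hw : ∀ i, ‖w i‖ ≤ 1) (c : L1 n) : evL w hw c = ev w c := rfl

/-- Multiplication by the monomial with exponent `γ`. -/
def shiftL (γ : Fin n → ℕ) : L1 n →L[ℂ] L1 n :=
  l1lift (fun α => l1e (α + γ)) 1 (fun _ => (norm_l1e _).le)

lemma shiftL_le (γ : Fin n → ℕ) (c : L1 n) : ‖shiftL γ c‖ ≤ ‖c‖ := by
  have := l1lift_le (fun α => l1e (α + γ)) 1 (fun _ => (norm_l1e _).le) c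
  rwa [one_mul] at this

lemma ev_shift (γ : Fin n → ℕ) (c : L1 n) {w : Cn n} (hw : ∀ i, ‖w i‖ ≤ 1) :
    ev w (shiftL γ c) = (∏ i, w i ^ γ i) * ev w c := by
  have : (evL w hw).comp (shiftL γ) = (∏ i, w i ^ γ i) • evL w hw := by
    refine l1_ext fun α => ?_
    simp [shiftL, evL, pow_add, Finset.prod_mul_distrib, mul_comm]
  exact DFunLike.congr_fun this c

lemma continuousOn_ev (c : L1 n) :
    ContinuousOn (fun w => ev w c) {w : Cn n | ∀ i, ‖w i‖ ≤ 1} := by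
  refine continuousOn_tsum (fun α => Continuous.continuousOn (by fun_prop)) (L1.summable c) ?_
  intro α w hw
  rw [norm_mul]
  exact mul_le_of_le_one_right (norm_nonneg _) (norm_mono_le hw α)

/-- Division by finitely many series whose leading terms dominate. -/
theorem division (B : Finset (Fin n → ℕ)) (G : (Fin n → ℕ) → L1 n)
    (hG : ∀ β ∈ B, ‖G β - l1e β‖ ≤ 1/2) (f : L1 n) :
    ∃ (r : L1 n) (Q : (Fin n → ℕ) → L1 n), ‖r‖ ≤ 2 * ‖f‖ ∧
      (∀ α, (∃ β ∈ B, β ≤ α) → r α = 0) ∧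
      ∀ w : Cn n, (∀ i, ‖w i‖ ≤ 1) → ev w f = ev w r + ∑ β ∈ B, ev w (Q β) * ev w (G β) := by
  classical
  let S : (Fin n → ℕ) → Prop := fun α => ∃ β ∈ B, β ≤ α
  let b : (Fin n → ℕ) → (Fin n → ℕ) := fun α => if h : S α then h.choose else 0
  have hbB : ∀ α, S α → b α ∈ B := fun α h => by
    simp only [b, dif_pos h]; exact h.choose_spec.1
  have hbl : ∀ α, S α → b α ≤ α := fun α h => by
    simp only [b, dif_pos h]; exact h.choose_spec.2
  let σ : (Fin n → ℕ) → L1 n := fun α => if S α then shiftL (α - b α) (G (b α)) - l1e α else 0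
  have hσ : ∀ α, ‖σ α‖ ≤ 1/2 := by
    intro α
    by_cases h : S α
    · simp only [σ, if_pos h]
      have h1 : l1e α = shiftL (α - b α) (l1e (b α)) := by
        simp only [shiftL, l1lift_e]
        rw [add_tsub_cancel_of_le (hbl α h)]
      rw [h1, ← map_sub]
      exact (shiftL_le _ _).trans (hG _ (hbB α h))
    · simp [σ, if_neg h]
  let T : L1 n →L[ℂ] L1 n := l1lift σ (1/2) hσ
  have hT : ∀ h, ‖T h‖ ≤ 1/2 * ‖h‖ := l1lift_le σ (1/2) hσ
  have hTn : ‖-T‖ < 1 := by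
    rw [norm_neg]
    exact (ContinuousLinearMap.opNorm_le_bound _ (by norm_num) hT).trans_lt (by norm_num)
  have hunit : IsUnit (1 - (-T)) := (Units.oneSub (-T) hTn).isUnit
  obtain ⟨h, hh⟩ := (ContinuousLinearMap.isUnit_iff_bijective.1 hunit).2 f
  have hh' : h + T h = f := by simpa using hh
  have hnorm : ‖h‖ ≤ 2 * ‖f‖ := by
    have h1 : ‖h‖ ≤ ‖f‖ + ‖T h‖ := by
      have : h = f - T h := by rw [← hh']; abel
      calc ‖h‖ = ‖f - T h‖ := by rw [← this]
        _ ≤ _ := norm_sub_le _ _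
    have := hT h
    linarith
  let R : L1 n →L[ℂ] L1 n := l1lift (fun α => if S α then 0 else l1e α) 1 (fun α => by
    split_ifs
    · simp
    · exact (norm_l1e _).le)
  let Q : (Fin n → ℕ) → (L1 n →L[ℂ] L1 n) := fun β =>
    l1lift (fun α => if S α ∧ b α = β then l1e (α - β) else 0) 1 (fun α => by
      split_ifs
      · exact (norm_l1e _).le
      · simp)
  refine ⟨R h, fun β => Q β h, ?_, ?_, ?_⟩
  · refine (l1lift_le _ _ _ h).trans ?_
    simpa using hnorm
  · intro α hα
    have : (lp.evalCLM ℂ (fun _ : Fin n → ℕ => ℂ) 1 α).comp R = 0 := by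
      refine l1_ext fun β => ?_
      simp only [R, ContinuousLinearMap.comp_apply, l1lift_e]
      by_cases hβ : S β
      · simp [hβ]
      · have hne : α ≠ β := fun h => hβ (h ▸ hα)
        simp only [if_neg hβ]
        exact (l1e_apply β α).trans (if_neg hne)
    exact DFunLike.congr_fun this h
  · intro w hw
    have key : (evL w hw).comp (1 + T) =
        (evL w hw).comp R + ∑ β ∈ B, ev w (G β) • (evL w hw).comp (Q β) := by
      refine l1_ext fun α => ?_
      simp only [ContinuousLinearMap.comp_apply, _root_.add_apply,
        _root_.sum_apply, _root_.smul_apply,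
        one_apply_eq_self, T, R, Q, l1lift_e, σ]
      by_cases hα : S α
      · simp only [hα, if_true, true_and, map_zero, zero_add, add_sub_cancel]
        rw [Finset.sum_eq_single (b α)]
        · rw [evL_apply, ev_shift _ _ hw]
          simp only [if_true, smul_eq_mul]
          rw [mul_comm]
          congr 1
          simp [evL]
        · intro β _ hβ
          rw [if_neg (Ne.symm hβ)]
          simp
        · intro hn; exact absurd (hbB α hα) hn
      · simp [hα]
    have h1 := DFunLike.congr_fun key h
    simp only [ContinuousLinearMap.comp_apply, _root_.add_apply,
        _root_.sum_apply, _root_.smul_apply,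
        one_apply_eq_self, hh', evL_apply, smul_eq_mul] at h1
    rw [h1]
    congr 1
    exact Finset.sum_congr rfl fun β _ => mul_comm _ _

/-- The `i`-th prime number. -/
def pr (i : ℕ) : ℕ := Nat.nth Nat.Prime i

lemma pr_prime (i : ℕ) : (pr i).Prime := Nat.prime_nth_prime i

lemma pr_inj {i j : ℕ} (h : pr i = pr j) : i = j :=
  Nat.nth_injective Nat.infinite_setOfPred_prime h

/-- A multiplicative injective size function on exponents. -/
def wt (α : Fin n → ℕ) : ℕ := ∏ i : Fin n, pr i ^ α i

lemma wt_pos (α : Fin n → ℕ) : 0 < wt α :=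
  Finset.prod_pos fun i _ => pow_pos (pr_prime i).pos _

lemma wt_inj {α β : Fin n → ℕ} (h : wt α = wt β) : α = β := by
  have key : ∀ (γ : Fin n → ℕ) (j : Fin n), (wt γ).factorization (pr j) = γ j := by
    intro γ j
    unfold wt
    rw [Nat.factorization_prod (fun (i : Fin n) _ => pow_ne_zero _ (pr_prime i).ne_zero)]
    simp only [Finsupp.finsetSum_apply, (pr_prime _).factorization_pow]
    rw [Finset.sum_eq_single j]
    · simp
    · intro i _ hi
      rw [Finsupp.single_apply, if_neg]
      exact fun h => hi (Fin.ext (pr_inj h))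
    · simp
  ext j
  rw [← key α j, ← key β j, h]

/-- Rescaled coordinates. -/
def wz (s : ℕ) (z : Cn n) : Cn n := fun i => (pr i : ℂ) ^ s * z i

lemma wz_mono (s : ℕ) (z : Cn n) (α : Fin n → ℕ) :
    ∏ i, wz s z i ^ α i = (wt α : ℂ) ^ s * ∏ i, z i ^ α i := by
  unfold wz wt
  simp only [mul_pow, Finset.prod_mul_distrib]
  push_cast
  rw [← Finset.prod_pow]
  congr 1
  exact Finset.prod_congr rfl fun i _ => by rw [← pow_mul, ← pow_mul, mul_comm]

lemma continuous_wz (s : ℕ) : Continuous (wz s : Cn n → Cn n) := by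
  unfold wz; fun_prop

lemma eventually_wz (s : ℕ) : ∀ᶠ z : Cn n in 𝓝 0, ∀ i, ‖wz s z i‖ < 1 := by
  rw [eventually_all]
  intro i
  have h : Continuous fun z : Cn n => ‖wz s z i‖ :=
    ((continuous_apply i).comp (continuous_wz s)).norm
  exact (h.tendsto 0).eventually_lt_const (by simp [wz])

lemma continuousAt_ev (s : ℕ) (c : L1 n) :
    ∀ᶠ z : Cn n in 𝓝 0, ContinuousAt (fun z => ev (wz s z) c) z := by
  filter_upwards [eventually_wz s] with z hz
  have ho : IsOpen {w : Cn n | ∀ i, ‖w i‖ < 1} := by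
    simp only [Set.ofPred_forall]
    exact isOpen_iInter_of_finite fun i => isOpen_lt (by fun_prop) continuous_const
  have h1 : ContinuousAt (fun w => ev w c) (wz s z) :=
    (continuousOn_ev c).continuousAt (mem_of_superset (ho.mem_nhds hz) fun w hw i => (hw i).le)
  exact ContinuousAt.comp (g := fun w => ev w c) h1 (continuous_wz s).continuousAt

/-- A module of germs at the origin, stable under multiplication by continuous functions. -/
structure IsGermModule (M : Set (Cn n → ℂ)) : Prop where
  congr : ∀ {g g' : Cn n → ℂ}, g =ᶠ[𝓝 0] g' → g ∈ M → g' ∈ M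
  zero : (fun _ => 0) ∈ M
  add : ∀ {g g' : Cn n → ℂ}, g ∈ M → g' ∈ M → (fun z => g z + g' z) ∈ M
  mul : ∀ {h g : Cn n → ℂ}, (∀ᶠ z in 𝓝 0, ContinuousAt h z) → g ∈ M → (fun z => h z * g z) ∈ M

/-- Leading exponents of the elements of `M`. -/
def lead (M : Set (Cn n → ℂ)) : Set (Fin n → ℕ) :=
  {β | ∃ (s : ℕ) (c : L1 n), (fun z => ev (wz s z) c) ∈ M ∧ c β ≠ 0 ∧
    ∀ α, c α ≠ 0 → wt β ≤ wt α}

lemma lead_mem {M : Set (Cn n → ℂ)} {s : ℕ} {c : L1 n} (hc : (fun z => ev (wz s z) c) ∈ M)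
    (hne : c ≠ 0) : ∃ β ∈ lead M, c β ≠ 0 := by
  have h1 : ∃ α, c α ≠ 0 := by
    by_contra! h
    exact hne (by ext α; simpa using h α)
  obtain ⟨β, hβ, hmin⟩ := WellFounded.has_min (measure (wt (n := n))).wf {α | c α ≠ 0} h1
  refine ⟨β, ⟨s, c, hc, hβ, fun α hα => ?_⟩, hβ⟩
  exact not_lt.1 (hmin α hα)

lemma IsGermModule.sum {M : Set (Cn n → ℂ)} (hM : IsGermModule M) {ι : Type*} (B : Finset ι)
    (g : ι → Cn n → ℂ) (h : ∀ i ∈ B, g i ∈ M) : (fun z => ∑ i ∈ B, g i z) ∈ M := by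
  classical
  induction B using Finset.induction_on with
  | empty => simpa using hM.zero
  | insert a B ha ih =>
    simp only [Finset.sum_insert ha]
    exact hM.add (h a (by simp)) (ih fun i hi => h i (by simp [hi]))

lemma eventually_lead {M : Set (Cn n → ℂ)} (hM : IsGermModule M) {β : Fin n → ℕ}
    (hβ : β ∈ lead M) : ∀ᶠ s : ℕ in atTop, ∃ G : L1 n, ‖G - l1e β‖ ≤ 1/2 ∧
      (fun z => ev (wz s z) G) ∈ M := by
  obtain ⟨s₀, c, hc, hcβ, hmin⟩ := hβ
  set q : ℝ := wt β / (wt β + 1) with hq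
  have hwβ : (0:ℝ) < wt β := by exact_mod_cast wt_pos β
  have hq0 : 0 ≤ q := by positivity
  have hq1 : q < 1 := by rw [hq, div_lt_one (by positivity)]; linarith
  have htend : Tendsto (fun k : ℕ => q ^ k * (‖c‖ / ‖c β‖)) atTop (𝓝 0) := by
    simpa using (tendsto_pow_atTop_nhds_zero_of_lt_one hq0 hq1).mul_const (‖c‖ / ‖c β‖)
  obtain ⟨K, hK⟩ := eventually_atTop.1 (htend.eventually_le_const (show (0:ℝ) < 1/2 by norm_num))
  refine eventually_atTop.2 ⟨s₀ + K, fun s hs => ?_⟩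
  obtain ⟨k, rfl⟩ := Nat.exists_eq_add_of_le (show s₀ ≤ s by omega)
  have hKk := hK k (by omega)
  have hcn : 0 < ‖c β‖ := norm_pos_iff.2 hcβ
  -- comparison of the rescaled coefficients
  let g : (Fin n → ℕ) → ℂ := fun α => c α / c β * ((wt β : ℂ) / wt α) ^ k
  have hg1 : g β = 1 := by
    have : (wt β : ℂ) ≠ 0 := by exact_mod_cast (wt_pos β).ne'
    simp [g, hcβ, this]
  have hg2 : ∀ α, α ≠ β → ‖g α‖ ≤ q ^ k / ‖c β‖ * ‖c α‖ := by
    intro α hα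
    by_cases h0 : c α = 0
    · simp [g, h0]
    · have h1 : wt β + 1 ≤ wt α := by
        have := hmin α h0
        have hne : wt α ≠ wt β := fun h => hα (wt_inj h)
        omega
      have h2 : (wt β + 1 : ℝ) ≤ wt α := by exact_mod_cast h1
      simp only [g, norm_mul, norm_div, norm_pow, Complex.norm_natCast]
      have h3 : (wt β : ℝ) / wt α ≤ q := by rw [hq]; gcongr
      calc ‖c α‖ / ‖c β‖ * ((wt β : ℝ) / wt α) ^ k ≤ ‖c α‖ / ‖c β‖ * q ^ k := by gcongr
        _ = _ := by ring
  have hsum : Summable fun α => ‖(if α = β then 0 else g α)‖ := by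
    refine ((L1.summable c).mul_left (q ^ k / ‖c β‖)).of_nonneg_of_le (fun _ => norm_nonneg _) ?_
    intro α
    split_ifs with h
    · simp; positivity
    · exact hg2 α h
  let D : L1 n := l1mk _ hsum
  have hD : ∀ α, D α = if α = β then 0 else g α := fun _ => rfl
  refine ⟨l1e β + D, ?_, ?_⟩
  · rw [add_sub_cancel_left, L1.norm_eq]
    calc ∑' α, ‖D α‖ ≤ ∑' α, q ^ k / ‖c β‖ * ‖c α‖ := by
          refine hsum.tsum_le_tsum (fun α => ?_) ((L1.summable c).mul_left _)
          rw [hD]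
          split_ifs with h
          · simp; positivity
          · exact hg2 α h
      _ = q ^ k * (‖c‖ / ‖c β‖) := by rw [tsum_mul_left, ← L1.norm_eq]; ring
      _ ≤ 1/2 := hKk
  · have hval : ∀ α, (l1e β + D) α = g α := by
      intro α
      rw [lp.coeFn_add, Pi.add_apply, l1e_apply, hD]
      split_ifs with h
      · rw [h, hg1, add_zero]
      · simp
    have hEq : (fun z : Cn n => ev (wz (s₀ + k) z) (l1e β + D))
        = fun z => ((wt β : ℂ) ^ k / c β) * ev (wz s₀ z) c := by
      funext z
      unfold ev
      rw [← tsum_mul_left]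
      refine tsum_congr fun α => ?_
      rw [hval, wz_mono, wz_mono]
      have : (wt α : ℂ) ≠ 0 := by exact_mod_cast (wt_pos α).ne'
      simp only [g]
      rw [pow_add, div_pow]
      field_simp
    rw [hEq]
    exact hM.mul (Eventually.of_forall fun z => continuousAt_const) hc

lemma exists_l1 {ρ : ℝ} (hρ : 0 < ρ) {M : ℝ} (F : Cn n → ℂ)
    (hF : DifferentiableOn ℂ F (Metric.ball 0 ρ)) (hM : ∀ z ∈ Metric.ball (0:Cn n) ρ, ‖F z‖ ≤ M)
    {s : ℕ} (hs : 4 / ρ ≤ 2 ^ s) :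
    ∃ c : L1 n, ‖c‖ ≤ M * (∑' α : Fin n → ℕ, ∏ i, (1/2 : ℝ) ^ α i) ∧
      ∀ᶠ z in 𝓝 0, ev (wz s z) c = F z := by
  obtain ⟨a, ha, hsum⟩ := exists_taylor hρ F hF hM
  have hM0 : 0 ≤ M := (norm_nonneg _).trans (hM 0 (by simpa using hρ))
  have hgeo := summable_prod_pow (fun _ : Fin n => (1/2:ℝ)) (fun _ => by norm_num)
    (fun _ => by norm_num)
  have hb : ∀ α, ‖a α / (wt α : ℂ) ^ s‖ ≤ M * ∏ i, (1/2 : ℝ) ^ α i := by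
    intro α
    have hw : (0:ℝ) < wt α := by exact_mod_cast wt_pos α
    rw [norm_div, norm_pow, Complex.norm_natCast, div_le_iff₀ (by positivity)]
    refine (ha α).trans ?_
    rw [mul_assoc]
    refine mul_le_mul_of_nonneg_left ?_ hM0
    have : (wt α : ℝ) ^ s = ∏ i : Fin n, ((pr i : ℝ) ^ s) ^ α i := by
      unfold wt
      push_cast
      rw [← Finset.prod_pow]
      exact Finset.prod_congr rfl fun i _ => by rw [← pow_mul, ← pow_mul, mul_comm]
    rw [this, ← Finset.prod_mul_distrib]
    refine Finset.prod_le_prod (fun i _ => by positivity) fun i _ => ?_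
    rw [← mul_pow]
    refine pow_le_pow_left₀ (by positivity) ?_ _
    have h2 : (2:ℝ) ^ s ≤ (pr i : ℝ) ^ s := by
      have : (2:ℝ) ≤ pr i := by exact_mod_cast (pr_prime i).two_le
      gcongr
    have h3 : 4 / ρ = 2 * (2 / ρ) := by ring
    linarith
  have hsm : Summable fun α => ‖a α / (wt α : ℂ) ^ s‖ :=
    (hgeo.mul_left M).of_nonneg_of_le (fun _ => norm_nonneg _) hb
  refine ⟨l1mk _ hsm, ?_, ?_⟩
  · rw [L1.norm_eq, ← tsum_mul_left]
    exact hsm.tsum_le_tsum hb (hgeo.mul_left M)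
  · filter_upwards [Metric.ball_mem_nhds (0:Cn n) (half_pos hρ)] with z hz
    rw [← (hsum z hz).tsum_eq]
    unfold ev
    refine tsum_congr fun α => ?_
    rw [wz_mono]
    have : (wt α : ℂ) ≠ 0 := by exact_mod_cast (wt_pos α).ne'
    show a α / (wt α : ℂ) ^ s * _ = _
    field_simp

/-- Modules of germs are closed under uniform convergence on a fixed neighbourhood. -/
theorem IsGermModule.closed {M : Set (Cn n → ℂ)} (hM : IsGermModule M) {ρ : ℝ} (hρ : 0 < ρ)
    {f : Cn n → ℂ} {F : ℕ → Cn n → ℂ} (hf : DifferentiableOn ℂ f (Metric.ball 0 ρ)) {C : ℝ}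
    (hfC : ∀ z ∈ Metric.ball (0:Cn n) ρ, ‖f z‖ ≤ C)
    (hF : ∀ j, DifferentiableOn ℂ (F j) (Metric.ball 0 ρ)) {δ : ℕ → ℝ}
    (hFδ : ∀ j, ∀ z ∈ Metric.ball (0:Cn n) ρ, ‖F j z‖ ≤ δ j) (hδ : Tendsto δ atTop (𝓝 0))
    (hmem : ∀ j, (fun z => f z - F j z) ∈ M) : f ∈ M := by
  classical
  have hpwo := Set.isPWO_of_wellQuasiOrderedLE (lead M)
  have hfin : {β | Minimal (· ∈ lead M) β}.Finite :=
    (setOfPred_minimal_antichain _).finite_of_partiallyWellOrderedOn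
      (hpwo.mono (setOfPred_minimal_subset _))
  set B := hfin.toFinset with hB
  have hBmem : ∀ β, β ∈ B ↔ Minimal (· ∈ lead M) β := fun β => by simp [hB]
  have hBS : ∀ α ∈ lead M, ∃ β ∈ B, β ≤ α := by
    intro α hα
    obtain ⟨β, hle, hβ⟩ := hpwo.exists_le_minimal hα
    exact ⟨β, (hBmem β).2 hβ, hle⟩
  have hev : ∀ᶠ s : ℕ in atTop, (∀ β ∈ B, ∃ G : L1 n, ‖G - l1e β‖ ≤ 1/2 ∧
      (fun z => ev (wz s z) G) ∈ M) ∧ 4 / ρ ≤ 2 ^ s := by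
    refine Filter.Eventually.and ?_ ?_
    · rw [Finset.eventually_all]
      exact fun β hβ => eventually_lead hM ((hBmem β).1 hβ).1
    · exact (tendsto_pow_atTop_atTop_of_one_lt (show (1:ℝ) < 2 by norm_num)).eventually_ge_atTop _
  obtain ⟨s, hsG, hs⟩ := hev.exists
  have hG' : ∀ β, ∃ G : L1 n, β ∈ B → ‖G - l1e β‖ ≤ 1/2 ∧ (fun z => ev (wz s z) G) ∈ M := by
    intro β
    by_cases h : β ∈ B
    · obtain ⟨G, hG⟩ := hsG β h
      exact ⟨G, fun _ => hG⟩
    · exact ⟨0, fun h' => absurd h' h⟩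
  choose G hG using hG'
  have hGd : ∀ β ∈ B, ‖G β - l1e β‖ ≤ 1/2 := fun β hβ => (hG β hβ).1
  set K := ∑' α : Fin n → ℕ, ∏ i, (1/2 : ℝ) ^ α i
  obtain ⟨c, -, hce⟩ := exists_l1 hρ f hf hfC hs
  obtain ⟨r, Q, -, hr0, hrQ⟩ := division B G hGd c
  have hQM : ∀ Q : (Fin n → ℕ) → L1 n,
      (fun z => ∑ β ∈ B, ev (wz s z) (Q β) * ev (wz s z) (G β)) ∈ M := fun Q =>
    hM.sum B _ fun β hβ => hM.mul (continuousAt_ev s _) (hG β hβ).2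
  have hneg : ∀ {g : Cn n → ℂ}, g ∈ M → (fun z => -g z) ∈ M := fun {g} hg => by
    have := hM.mul (h := fun _ => -1) (Eventually.of_forall fun z => continuousAt_const) hg
    simpa using this
  have hr : ∀ j, ‖r‖ ≤ 2 * (δ j * K) := by
    intro j
    obtain ⟨c', hc'n, hc'e⟩ := exists_l1 hρ (F j) (hF j) (hFδ j) hs
    obtain ⟨r', Q', hr'n, hr'0, hr'Q⟩ := division B G hGd c'
    have hsub : r - r' = 0 := by
      by_contra hne
      have hin : (fun z => ev (wz s z) (r - r')) ∈ M := by
        refine hM.congr ?_ (hM.add (hmem j) (hM.add (hneg (hQM Q)) (hQM Q')))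
        filter_upwards [hce, hc'e, eventually_wz s] with z h1 h2 h3
        have h3' : ∀ i, ‖wz s z i‖ ≤ 1 := fun i => (h3 i).le
        rw [← h1, ← h2, hrQ _ h3', hr'Q _ h3', show ev (wz s z) (r - r') = ev (wz s z) r - ev (wz s z) r' from
          map_sub (evL _ h3') r r']
        ring
      obtain ⟨β, hβ, hβ0⟩ := lead_mem hin hne
      refine hβ0 ?_
      rw [lp.coeFn_sub, Pi.sub_apply, hr0 β (hBS β hβ), hr'0 β (hBS β hβ), sub_zero]
    rw [sub_eq_zero.1 hsub]
    exact hr'n.trans (by linarith)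
  have hr00 : r = 0 := by
    have ht : Tendsto (fun j => 2 * (δ j * K)) atTop (𝓝 0) := by
      simpa using (hδ.mul_const K).const_mul 2
    exact norm_le_zero_iff.1 (ge_of_tendsto' ht hr)
  refine hM.congr ?_ (hQM Q)
  filter_upwards [hce, eventually_wz s] with z h1 h3
  rw [← h1, hrQ _ fun i => (h3 i).le, hr00]
  simp [ev]

lemma sup_le_of_l2 {r r' : ℝ} (hr : r < r') : ∃ C : ℝ, 0 < C ∧ ∀ F : Cn n → ℂ,
    DifferentiableOn ℂ F (eb r') → ∀ B : ℝ, 0 ≤ B →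
    ∫⁻ z in eb r', ‖F z‖ₑ ^ 2 ≤ ENNReal.ofReal B → ∀ x, ssq x ≤ r → ‖F x‖ ≤ C * (1 + B) := by
  obtain ⟨ε', hε', hεr'⟩ := eb_thick (n := n) hr
  set ε := ε' / 2
  have hε : 0 < ε := by simp only [ε]; linarith
  have hεr : ∀ x : Cn n, ssq x ≤ r → Metric.ball x (2 * ε) ⊆ eb r' := by
    simpa [ε, mul_div_cancel₀] using hεr'
  set c := (ε ^ rdim n * rhoMass n)⁻¹ with hc
  have hc0 : 0 < c := by have := rhoMass_pos (n := n); positivity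
  set V := (volume (eb r' : Set (Cn n))).toReal with hV
  have hV0 : 0 ≤ V := ENNReal.toReal_nonneg
  refine ⟨(V + 1) * c, by positivity, fun F hF B hB0 hB x hx => ?_⟩
  have hle : ∫⁻ z in eb r', ‖F z‖ₑ ≤ ENNReal.ofReal (V + B) := by
    rw [ENNReal.ofReal_add hV0 hB0, hV, ENNReal.ofReal_toReal (volume_eb_lt_top r').ne]
    exact lintegral_enorm_le.trans (by gcongr)
  have hFi : IntegrableOn F (eb r') :=
    ⟨hF.continuousOn.aestronglyMeasurable (isOpen_eb r').measurableSet,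
      hle.trans_lt ENNReal.ofReal_lt_top⟩
  have hFI : ∫ z in eb r', ‖F z‖ ≤ V + B := by
    rw [integral_norm_eq_lintegral_enorm hFi.aestronglyMeasurable]
    exact ENNReal.toReal_le_of_le_ofReal (by positivity) hle
  have hki : IntegrableOn (fun y => F y * rhoC ε (x - y)) (eb r') := by
    refine hFi.mul_bdd (c := c)
      ((sm_shift (sm_rhoC ε) x).continuous.aestronglyMeasurable) (ae_of_all _ fun y => ?_)
    simp only [rhoC, toC, Complex.norm_real, Real.norm_of_nonneg (rho_nonneg hε _)]
    exact rho_le hε _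
  rw [holo_repr hε hεr hF hx]
  refine (norm_integral_le_integral_norm _).trans ?_
  calc _ ≤ ∫ y in eb r', ‖F y‖ * c := by
        refine integral_mono hki.norm (hFi.norm.mul_const c) fun y => ?_
        simp only [norm_mul]
        refine mul_le_mul_of_nonneg_left ?_ (norm_nonneg _)
        simp only [rhoC, toC, Complex.norm_real, Real.norm_of_nonneg (rho_nonneg hε _)]
        exact rho_le hε _
    _ = (∫ y in eb r', ‖F y‖) * c := integral_mul_const _ _
    _ ≤ (V + B) * c := mul_le_mul_of_nonneg_right hFI hc0.le
    _ ≤ (V + 1) * c * (1 + B) := by nlinarith [mul_nonneg hV0 hB0, mul_nonneg (mul_nonneg hV0 hB0) hc0.le]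

lemma sup_small_of_l2 {r r' : ℝ} (hr : r < r') {η : ℝ} (hη : 0 < η) : ∃ δ > 0, ∀ F : Cn n → ℂ,
    DifferentiableOn ℂ F (eb r') →
    ∫⁻ z in eb r', ‖F z‖ₑ ^ 2 ≤ ENNReal.ofReal δ → ∀ x, ssq x ≤ r → ‖F x‖ ≤ η := by
  obtain ⟨C, hC, h⟩ := sup_le_of_l2 (n := n) hr
  set A := 2 * C / η with hA
  have hA0 : 0 < A := by positivity
  refine ⟨1 / A ^ 2, by positivity, fun F hF hB x hx => ?_⟩
  have := h (fun z => (A : ℂ) * F z) (hF.const_mul _) 1 zero_le_one (by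
    calc ∫⁻ z in eb r', ‖(A : ℂ) * F z‖ₑ ^ 2
        = ENNReal.ofReal (A ^ 2) * ∫⁻ z in eb r', ‖F z‖ₑ ^ 2 := by
          rw [← lintegral_const_mul' _ _ ENNReal.ofReal_ne_top]
          refine lintegral_congr fun z => ?_
          rw [enorm_sq_eq, enorm_sq_eq, ← ENNReal.ofReal_mul (by positivity), norm_mul,
            Complex.norm_real, Real.norm_of_nonneg hA0.le, mul_pow]
      _ ≤ ENNReal.ofReal (A ^ 2) * ENNReal.ofReal (1 / A ^ 2) := by gcongr
      _ = ENNReal.ofReal 1 := by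
          rw [← ENNReal.ofReal_mul (by positivity)]; congr 1; field_simp) x hx
  rw [norm_mul, Complex.norm_real, Real.norm_of_nonneg hA0.le, hA, div_mul_eq_mul_div,
    div_le_iff₀ hη] at this
  nlinarith

lemma eb_mem_nhds {r : ℝ} (hr : 0 < r) : (eb r : Set (Cn n)) ∈ 𝓝 0 :=
  (isOpen_eb r).mem_nhds (show ssq (0 : Cn n) < r by simpa [ssq] using hr)

lemma exists_eb_subset {U : Set (Cn n)} (hU : U ∈ 𝓝 0) : ∃ r > 0, (eb r : Set (Cn n)) ⊆ U := by
  obtain ⟨ε, hε, h⟩ := Metric.mem_nhds_iff.1 hU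
  refine ⟨ε ^ 2, by positivity, fun z hz => h ?_⟩
  have h1 : ssq z < ε ^ 2 := hz
  rw [mem_ball_zero_iff]
  exact lt_of_pow_lt_pow_left₀ 2 hε.le ((norm_sq_le_ssq z).trans_lt h1)

lemma eb_mono {r r' : ℝ} (h : r ≤ r') : (eb r : Set (Cn n)) ⊆ eb r' :=
  fun z hz => lt_of_lt_of_le (show ssq z < r from hz) h

/-- Germs square integrable against one of the weights `ψ k`. -/
def germMod (ψ : ℕ → Cn n → ℝ) : Set (Cn n → ℂ) :=
  {g | (∀ᶠ z in 𝓝 0, ContinuousAt g z) ∧ ∃ k, ∃ r > 0,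
    ∫⁻ z in eb r, ENNReal.ofReal (‖g z‖ ^ 2 * Real.exp (-2 * ψ k z)) < ⊤}

lemma aemeasurable_of_cont {g : Cn n → ℂ} {r : ℝ} (h : ∀ z ∈ eb r, ContinuousAt g z) :
    AEMeasurable g (volume.restrict (eb r)) :=
  ContinuousOn.aemeasurable (fun z hz => (h z hz).continuousWithinAt) (isOpen_eb r).measurableSet

lemma isGermModule_germMod {ψ : ℕ → Cn n → ℝ} {R : ℝ} (hR : 0 < R)
    (hm : ∀ k, AEMeasurable (ψ k) (volume.restrict (eb R)))
    (hmono : ∀ k l, k ≤ l → ∀ᵐ z ∂(volume.restrict (eb R)), ψ k z ≤ ψ l z) :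
    IsGermModule (germMod ψ) where
  congr := by
    rintro g g' hgg ⟨hg, k, r, hr, hi⟩
    refine ⟨?_, k, ?_⟩
    · filter_upwards [hg, hgg.eventually_nhds] with z h1 h2
      exact h1.congr h2
    · obtain ⟨r₁, hr₁, h₁⟩ := exists_eb_subset hgg
      refine ⟨min r r₁, lt_min hr hr₁, lt_of_le_of_lt ?_ hi⟩
      refine (setLIntegral_congr_fun (isOpen_eb _).measurableSet fun z hz => ?_).trans_le
        (lintegral_mono_set (eb_mono (min_le_left r r₁)))
      have : g z = g' z := h₁ (eb_mono (min_le_right _ _) hz)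
      simp only [this]
  zero := ⟨Eventually.of_forall fun z => continuousAt_const, 0, 1, one_pos, by simp⟩
  add := by
    rintro g g' ⟨hg, k, r, hr, hi⟩ ⟨hg', k', r', hr', hi'⟩
    refine ⟨by filter_upwards [hg, hg'] with z h1 h2 using h1.add h2, max k k', ?_⟩
    obtain ⟨r₁, hr₁, h₁⟩ := exists_eb_subset hg
    set s := min (min r r') (min r₁ R) with hs
    have hs0 : 0 < s := by positivity
    refine ⟨s, hs0, ?_⟩
    have hsr : s ≤ r := (min_le_left _ _).trans (min_le_left _ _)
    have hsr' : s ≤ r' := (min_le_left _ _).trans (min_le_right _ _)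
    have hsr₁ : s ≤ r₁ := (min_le_right _ _).trans (min_le_left _ _)
    have hsR : s ≤ R := (min_le_right _ _).trans (min_le_right _ _)
    have hle : volume.restrict (eb s : Set (Cn n)) ≤ volume.restrict (eb R) :=
      Measure.restrict_mono (eb_mono hsR) le_rfl
    have hgm : AEMeasurable g (volume.restrict (eb s)) :=
      aemeasurable_of_cont fun z hz => h₁ (eb_mono hsr₁ hz)
    have hma : AEMeasurable (fun z => 2 * ENNReal.ofReal (‖g z‖ ^ 2 * Real.exp (-2 * ψ k z)))
        (volume.restrict (eb s)) := by
      have := (hm k).mono_measure hle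
      fun_prop
    have hb : ∀ᵐ z ∂(volume.restrict (eb s : Set (Cn n))),
        ENNReal.ofReal (‖g z + g' z‖ ^ 2 * Real.exp (-2 * ψ (max k k') z)) ≤
        2 * ENNReal.ofReal (‖g z‖ ^ 2 * Real.exp (-2 * ψ k z))
        + 2 * ENNReal.ofReal (‖g' z‖ ^ 2 * Real.exp (-2 * ψ k' z)) := by
      filter_upwards [ae_mono hle (hmono k _ (le_max_left k k')),
        ae_mono hle (hmono k' _ (le_max_right k k'))] with z h1 h2
      have e2 : (2 : ℝ≥0∞) = ENNReal.ofReal 2 := by simp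
      rw [e2, ← ENNReal.ofReal_mul (by norm_num), ← ENNReal.ofReal_mul (by norm_num),
        ← ENNReal.ofReal_add (by positivity) (by positivity)]
      refine ENNReal.ofReal_le_ofReal ?_
      have e1 : Real.exp (-2 * ψ (max k k') z) ≤ Real.exp (-2 * ψ k z) :=
        Real.exp_le_exp.2 (by linarith)
      have e1' : Real.exp (-2 * ψ (max k k') z) ≤ Real.exp (-2 * ψ k' z) :=
        Real.exp_le_exp.2 (by linarith)
      have e3 : ‖g z + g' z‖ ^ 2 ≤ 2 * ‖g z‖ ^ 2 + 2 * ‖g' z‖ ^ 2 := by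
        have := norm_add_le (g z) (g' z)
        nlinarith [norm_nonneg (g z + g' z), sq_nonneg (‖g z‖ - ‖g' z‖)]
      calc _ ≤ (2 * ‖g z‖ ^ 2 + 2 * ‖g' z‖ ^ 2) * Real.exp (-2 * ψ (max k k') z) := by gcongr
        _ = 2 * (‖g z‖ ^ 2 * Real.exp (-2 * ψ (max k k') z)) +
          2 * (‖g' z‖ ^ 2 * Real.exp (-2 * ψ (max k k') z)) := by ring
        _ ≤ _ := by gcongr
    refine (lintegral_mono_ae hb).trans_lt ?_
    rw [lintegral_add_left' hma, lintegral_const_mul' _ _ (by simp),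
      lintegral_const_mul' _ _ (by simp)]
    refine ENNReal.add_lt_top.2 ⟨ENNReal.mul_lt_top (by simp) ?_, ENNReal.mul_lt_top (by simp) ?_⟩
    · exact (lintegral_mono_set (eb_mono hsr)).trans_lt hi
    · exact (lintegral_mono_set (eb_mono hsr')).trans_lt hi'
  mul := by
    rintro h g hh ⟨hg, k, r, hr, hi⟩
    refine ⟨by filter_upwards [hg, hh] with z h1 h2 using h2.mul h1, k, ?_⟩
    have hb : ∀ᶠ z in 𝓝 (0 : Cn n), ‖h z‖ < ‖h 0‖ + 1 :=
      (hh.self_of_nhds.norm).eventually_lt_const (by linarith)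
    obtain ⟨r₁, hr₁, h₁⟩ := exists_eb_subset hb
    refine ⟨min r r₁, lt_min hr hr₁, ?_⟩
    calc ∫⁻ z in eb (min r r₁), ENNReal.ofReal (‖h z * g z‖ ^ 2 * Real.exp (-2 * ψ k z))
        ≤ ∫⁻ z in eb (min r r₁), ENNReal.ofReal ((‖h 0‖ + 1) ^ 2) *
          ENNReal.ofReal (‖g z‖ ^ 2 * Real.exp (-2 * ψ k z)) := by
          refine setLIntegral_mono' (isOpen_eb _).measurableSet fun z hz => ?_
          have h2 : ‖h z‖ < ‖h 0‖ + 1 := h₁ (eb_mono (min_le_right _ _) hz)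
          rw [← ENNReal.ofReal_mul (by positivity), ← mul_assoc, norm_mul, mul_pow]
          refine ENNReal.ofReal_le_ofReal ?_
          gcongr
      _ ≤ ENNReal.ofReal ((‖h 0‖ + 1) ^ 2) *
          ∫⁻ z in eb r, ENNReal.ofReal (‖g z‖ ^ 2 * Real.exp (-2 * ψ k z)) := by
          rw [lintegral_const_mul' _ _ ENNReal.ofReal_ne_top]
          exact mul_le_mul' le_rfl (lintegral_mono_set (eb_mono (min_le_left _ _)))
      _ < ⊤ := ENNReal.mul_lt_top ENNReal.ofReal_lt_top hi

lemma rhs_le_exp {t : ℝ} (x : ℝ) : rhs t x ≤ Real.exp (-2 * x) := by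
  unfold rhs
  refine (mul_le_of_le_one_left (Real.exp_pos _).le (om_le_one _ _)).trans (Real.exp_le_exp.2 ?_)
  linarith [le_max_left x (-2 * t)]

lemma stp_eq_zero {x : ℝ} (hx : x ≤ -2) : stp x = 0 :=
  Real.smoothTransition.zero_of_nonpos (by linarith)

lemma stp_eq_one {x : ℝ} (hx : -1 ≤ x) : stp x = 1 :=
  Real.smoothTransition.one_of_one_le (by linarith)

lemma norm_one_sub_stp_sq_le (x : ℝ) : ‖(1 - stp x) ^ 2‖ ≤ 1 := by
  rw [Real.norm_of_nonneg (sq_nonneg _)]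
  have := stp_nonneg x; have := stp_le_one x
  nlinarith

/-- Convergence of integrals of a bounded continuous function of the weights. -/
lemma tendsto_integral_weight {R : ℝ} {ψ : ℕ → Cn n → ℝ} {u : Cn n → ℝ} {f : Cn n → ℂ}
    (hf : Continuous f) (hm : ∀ j, AEMeasurable (ψ j) (volume.restrict (eb R)))
    (hlim : ∀ᵐ z ∂(volume.restrict (eb R)), Tendsto (fun j => ψ j z) atTop (𝓝 (u z)))
    {χ : ℝ → ℝ} (hχ : Continuous χ) {C : ℝ} (hC : ∀ x, ‖χ x‖ ≤ C) :
    Tendsto (fun j => ∫ z in eb R, ‖f z‖ ^ 2 * χ (ψ j z)) atTop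
      (𝓝 (∫ z in eb R, ‖f z‖ ^ 2 * χ (u z))) := by
  have hmR : ∀ j, AEStronglyMeasurable (fun z => χ (ψ j z)) (volume.restrict (eb R)) :=
    fun j => hχ.comp_aestronglyMeasurable (hm j).aestronglyMeasurable
  have hC0 : 0 ≤ C := (norm_nonneg _).trans (hC 0)
  refine tendsto_integral_of_dominated_convergence (fun z => ‖f z‖ ^ 2 * C)
    (fun j => (integrableOn_sq_mul hf (hmR j) fun z => hC _).aestronglyMeasurable)
    (integrableOn_sq_mul hf (h := fun _ => C) (C := C) aestronglyMeasurable_const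
      (fun _ => by rw [Real.norm_of_nonneg hC0])) (fun j => ae_of_all _ fun z => ?_) ?_
  · rw [norm_mul, Real.norm_of_nonneg (sq_nonneg _)]
    exact mul_le_mul_of_nonneg_left (hC _) (sq_nonneg _)
  · filter_upwards [hlim] with z hz
    exact ((hχ.tendsto _).comp hz).const_mul _

/-- Cutoffs supported in smaller and smaller sublevel sets have vanishing integrals. -/
lemma tendsto_integral_cutoff {R : ℝ} {u : Cn n → ℝ} {f : Cn n → ℂ} (hf : Continuous f)
    (hm : AEMeasurable u (volume.restrict (eb R)))
    (hi : IntegrableOn (fun z => ‖f z‖ ^ 2 * Real.exp (-2 * u z)) (eb R))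
    (hu : ∀ᵐ z ∂(volume.restrict (eb R)), u z ≤ 0)
    {χ : ℕ → ℝ → ℝ} (hχ : ∀ j, Continuous (χ j)) (hb : ∀ j x, x ≤ 0 → ‖χ j x‖ ≤ Real.exp (-2 * x))
    (h0 : ∀ x, ∀ᶠ j in atTop, χ j x = 0) :
    Tendsto (fun j => ∫ z in eb R, ‖f z‖ ^ 2 * χ j (u z)) atTop (𝓝 0) := by
  have : (0 : ℝ) = ∫ z in eb R, (0 : ℝ) ∂(volume : Measure (Cn n)) := by simp
  rw [this]
  refine tendsto_integral_of_dominated_convergence _ (fun j => ?_) hi (fun j => ?_) ?_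
  · exact (hf.norm.pow 2).aestronglyMeasurable.mul
      ((hχ j).comp_aestronglyMeasurable hm.aestronglyMeasurable)
  · filter_upwards [hu] with z hz
    rw [norm_mul, Real.norm_of_nonneg (sq_nonneg _)]
    exact mul_le_mul_of_nonneg_left (hb j _ hz) (sq_nonneg _)
  · refine ae_of_all _ fun z => tendsto_const_nhds.congr' ?_
    filter_upwards [h0 (u z)] with j hj
    simp [hj]

/-- Strong openness along an increasing sequence of weights. -/
theorem strong_openness {R : ℝ} (hR : 0 < R) {ψ : ℕ → Cn n → ℝ} {u : Cn n → ℝ}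
    (hm : ∀ j, AEMeasurable (ψ j) (volume.restrict (eb R)))
    (h0 : ∀ j, ∀ᵐ z ∂(volume.restrict (eb R)), ψ j z ≤ 0) (hE : ∀ j, Est R (ψ j))
    (hmono : ∀ k l, k ≤ l → ∀ᵐ z ∂(volume.restrict (eb R)), ψ k z ≤ ψ l z)
    (hlim : ∀ᵐ z ∂(volume.restrict (eb R)), Tendsto (fun j => ψ j z) atTop (𝓝 (u z)))
    {f : Cn n → ℂ} (hf : Sm f) (hfd : ∀ z ∈ eb R, ∀ j, db j f z = 0)
    (hi : IntegrableOn (fun z => ‖f z‖ ^ 2 * Real.exp (-2 * u z)) (eb R)) :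
    ∃ k, ∃ r > 0, ∫⁻ z in eb r, ENNReal.ofReal (‖f z‖ ^ 2 * Real.exp (-2 * ψ k z)) < ⊤ := by
  suffices h : f ∈ germMod ψ from h.2
  have hum : AEMeasurable u (volume.restrict (eb R)) :=
    aemeasurable_of_tendsto_metrizable_ae' hm hlim
  have hu0 : ∀ᵐ z ∂(volume.restrict (eb R)), u z ≤ 0 := by
    filter_upwards [hlim, ae_all_iff.2 h0] with z h1 h2
    exact le_of_tendsto' h1 h2
  have hfholo : DifferentiableOn ℂ f (eb R) := fun z hz =>
    (diff_of_db (hf.dAt z) (hfd z hz)).differentiableWithinAt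
  have hrb : ∀ t x, ‖rhs t x‖ ≤ Real.exp (4 * t) := fun t x => by
    rw [Real.norm_of_nonneg (rhs_nonneg _ _)]; exact rhs_le x
  have hr : 0 < R / 2 := by linarith
  have hrR : R / 2 < R := by linarith
  have hsub : (eb (R/2) : Set (Cn n)) ⊆ eb R := eb_mono hrR.le
  have hle : volume.restrict (eb (R/2) : Set (Cn n)) ≤ volume.restrict (eb R) :=
    Measure.restrict_mono hsub le_rfl
  -- the competitor functions
  have key : ∀ δ : ℝ, 0 < δ → ∃ F : Cn n → ℂ, DifferentiableOn ℂ F (eb (R/2)) ∧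
      ∫⁻ z in eb (R/2), ‖F z‖ₑ ^ 2 ≤ ENNReal.ofReal δ ∧ (fun z => f z - F z) ∈ germMod ψ := by
    intro δ hδ
    set K := Real.exp (cA + 1) with hK
    have hK0 : 0 < K := Real.exp_pos _
    have l1 := tendsto_integral_cutoff hf.continuous hum hi hu0
      (χ := fun j => rhs (j + 1)) (fun j => continuous_rhs _) (fun j x _ => by
        rw [Real.norm_of_nonneg (rhs_nonneg _ _)]; exact rhs_le_exp x) (fun x => by
        filter_upwards [eventually_ge_atTop ⌈-(2 * x)⌉₊] with j hj
        have : -(2 * x) ≤ j := Nat.ceil_le.1 hj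
        simp [rhs, om_eq_zero (t := (j:ℝ) + 1) (by positivity) (show -(((j:ℝ)+1)/2) ≤ x by linarith)])
    have l2 := tendsto_integral_cutoff hf.continuous hum hi hu0
      (χ := fun j x => (1 - stp (x / (j + 1))) ^ 2)
      (fun j => by have := continuous_stp; fun_prop) (fun j x hx => by
        exact (norm_one_sub_stp_sq_le _).trans (Real.one_le_exp (by linarith))) (fun x => by
        filter_upwards [eventually_ge_atTop ⌈-x⌉₊] with j hj
        have : -x ≤ j := Nat.ceil_le.1 hj
        rw [stp_eq_one]
        · simp
        · rw [le_div_iff₀ (by positivity)]; linarith)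
    have l3 : Tendsto (fun j : ℕ => 2 * (K * (∫ z in eb R, ‖f z‖ ^ 2 * rhs (j+1) (u z)) + δ / 8)
        + 2 * ∫ z in eb R, ‖f z‖ ^ 2 * (1 - stp (u z / (j + 1))) ^ 2) atTop
        (𝓝 (2 * (K * 0 + δ / 8) + 2 * 0)) :=
      (((l1.const_mul K).add_const _).const_mul 2).add (l2.const_mul 2)
    obtain ⟨j, hj⟩ := (l3.eventually_lt_const (show 2 * (K * 0 + δ / 8) + 2 * 0 < δ by
      linarith)).exists
    set t : ℝ := j + 1 with ht
    have ht1 : 1 ≤ t := by simp [ht]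
    have ht0 : 0 < t := by linarith
    have l4 := tendsto_integral_weight hf.continuous hm hlim (continuous_rhs t) (hrb t)
    have l5 := tendsto_integral_weight hf.continuous hm hlim
      (χ := fun x => (1 - stp (x / t)) ^ 2) (by have := continuous_stp; fun_prop)
      (fun x => norm_one_sub_stp_sq_le _)
    have l6 := (((l4.const_mul K).add_const (δ/8)).const_mul 2).add (l5.const_mul 2)
    obtain ⟨k, hk⟩ := (l6.eventually_lt_const hj).exists
    obtain ⟨F, hF, hFe⟩ := hE k f hf hfd (R/2) hr hrR t ht1 (δ/8) (by linarith)
    set A := K * (∫ z in eb R, ‖f z‖ ^ 2 * rhs t (ψ k z)) + δ / 8 with hA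
    have hA0 : 0 ≤ A := by
      have : 0 ≤ ∫ z in eb R, ‖f z‖ ^ 2 * rhs t (ψ k z) :=
        integral_nonneg fun z => mul_nonneg (sq_nonneg _) (rhs_nonneg _ _)
      positivity
    set b : Cn n → ℝ := fun z => stp (ψ k z / t) with hb
    have hbm : AEMeasurable b (volume.restrict (eb R)) :=
      continuous_stp.measurable.comp_aemeasurable ((hm k).div_const t)
    have hI : IntegrableOn (fun z => ‖f z‖ ^ 2 * (1 - b z) ^ 2) (eb R) :=
      integrableOn_sq_mul hf.continuous (C := 1)
        (by fun_prop) (fun z => norm_one_sub_stp_sq_le _)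
    have e2 : (2 : ℝ≥0∞) = ENNReal.ofReal 2 := by simp
    refine ⟨F, hF, ?_, ?_⟩
    · have hpt : ∀ᵐ z ∂(volume.restrict (eb (R/2) : Set (Cn n))), ‖F z‖ₑ ^ 2 ≤
          2 * ENNReal.ofReal (‖F z - ((1 - b z : ℝ) : ℂ) * f z‖ ^ 2 * Real.exp (-2 * ψ k z))
          + 2 * ENNReal.ofReal (‖f z‖ ^ 2 * (1 - b z) ^ 2) := by
        filter_upwards [ae_mono hle (h0 k)] with z hz
        rw [enorm_sq_eq, e2, ← ENNReal.ofReal_mul (by norm_num), ← ENNReal.ofReal_mul (by norm_num),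
          ← ENNReal.ofReal_add (by positivity) (by positivity)]
        refine ENNReal.ofReal_le_ofReal ?_
        have he : 1 ≤ Real.exp (-2 * ψ k z) := Real.one_le_exp (by linarith)
        set G := F z - ((1 - b z : ℝ) : ℂ) * f z with hG
        have hFG : F z = G + ((1 - b z : ℝ) : ℂ) * f z := by rw [hG]; ring
        have hn : ‖((1 - b z : ℝ) : ℂ) * f z‖ ^ 2 = ‖f z‖ ^ 2 * (1 - b z) ^ 2 := by
          rw [norm_mul, mul_pow, Complex.norm_real, Real.norm_eq_abs, sq_abs, mul_comm]
        rw [← hn, hFG]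
        have h1 := norm_add_le G (((1 - b z : ℝ) : ℂ) * f z)
        have h2 : ‖G‖ ^ 2 ≤ ‖G‖ ^ 2 * Real.exp (-2 * ψ k z) :=
          le_mul_of_one_le_right (sq_nonneg _) he
        nlinarith [norm_nonneg (G + ((1 - b z : ℝ) : ℂ) * f z),
          sq_nonneg (‖G‖ - ‖((1 - b z : ℝ) : ℂ) * f z‖)]
      refine (lintegral_mono_ae hpt).trans ?_
      have hmm : AEMeasurable (fun z => 2 * ENNReal.ofReal (‖f z‖ ^ 2 * (1 - b z) ^ 2))
          (volume.restrict (eb (R/2))) :=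
        (ENNReal.measurable_ofReal.comp_aemeasurable
          (hI.mono_set hsub).aemeasurable).const_mul 2
      rw [lintegral_add_right' _ hmm, lintegral_const_mul' _ _ (by simp),
        lintegral_const_mul' _ _ (by simp)]
      have h7 : ∫⁻ z in eb (R/2), ENNReal.ofReal (‖f z‖ ^ 2 * (1 - b z) ^ 2) ≤
          ENNReal.ofReal (∫ z in eb R, ‖f z‖ ^ 2 * (1 - b z) ^ 2) := by
        rw [ofReal_integral_eq_lintegral_ofReal hI (ae_of_all _ fun z => by positivity)]
        exact lintegral_mono_set hsub
      calc _ ≤ 2 * ENNReal.ofReal A + 2 * ENNReal.ofReal (∫ z in eb R, ‖f z‖ ^ 2 * (1 - b z) ^ 2) := by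
            gcongr
        _ = ENNReal.ofReal (2 * A + 2 * ∫ z in eb R, ‖f z‖ ^ 2 * (1 - b z) ^ 2) := by
            have hn : 0 ≤ ∫ z in eb R, ‖f z‖ ^ 2 * (1 - b z) ^ 2 :=
              integral_nonneg fun z => by positivity
            rw [e2, ← ENNReal.ofReal_mul (by norm_num), ← ENNReal.ofReal_mul (by norm_num),
              ← ENNReal.ofReal_add (by positivity) (by positivity)]
        _ ≤ ENNReal.ofReal δ := ENNReal.ofReal_le_ofReal hk.le
    · refine ⟨?_, k, R/2, hr, ?_⟩
      · filter_upwards [eb_mem_nhds hr] with z hz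
        exact hf.continuous.continuousAt.sub
          (hF.differentiableAt ((isOpen_eb _).mem_nhds hz)).continuousAt
      · have hpt : ∀ z, ENNReal.ofReal (‖f z - F z‖ ^ 2 * Real.exp (-2 * ψ k z)) ≤
          2 * ENNReal.ofReal (‖F z - ((1 - b z : ℝ) : ℂ) * f z‖ ^ 2 * Real.exp (-2 * ψ k z))
          + 2 * ENNReal.ofReal (‖f z‖ ^ 2 * Real.exp (4 * t)) := by
          intro z
          rw [e2, ← ENNReal.ofReal_mul (by norm_num), ← ENNReal.ofReal_mul (by norm_num),
            ← ENNReal.ofReal_add (by positivity) (by positivity)]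
          refine ENNReal.ofReal_le_ofReal ?_
          set e := Real.exp (-2 * ψ k z) with he
          have he0 : 0 < e := Real.exp_pos _
          have hbe : b z ^ 2 * e ≤ Real.exp (4 * t) := by
            by_cases hc : ψ k z / t ≤ -2
            · simp only [hb, stp_eq_zero hc]
              simp; positivity
            · push Not at hc
              rw [lt_div_iff₀ ht0] at hc
              have h1 : b z ^ 2 ≤ 1 := by
                have := stp_nonneg (ψ k z / t); have := stp_le_one (ψ k z / t)
                simp only [hb]; nlinarith
              calc b z ^ 2 * e ≤ e := mul_le_of_le_one_left he0.le h1
                _ ≤ _ := Real.exp_le_exp.2 (by linarith)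
          set G := F z - ((1 - b z : ℝ) : ℂ) * f z with hG
          have hFG : f z - F z = ((b z : ℝ) : ℂ) * f z - G := by rw [hG]; push_cast; ring
          have hn : ‖((b z : ℝ) : ℂ) * f z‖ ^ 2 = ‖f z‖ ^ 2 * (b z) ^ 2 := by
            rw [norm_mul, mul_pow, Complex.norm_real, Real.norm_eq_abs, sq_abs, mul_comm]
          have h1 := norm_sub_le (((b z : ℝ) : ℂ) * f z) G
          have h2 : ‖((b z : ℝ) : ℂ) * f z - G‖ ^ 2 ≤ 2 * ‖G‖ ^ 2 + 2 * (‖f z‖ ^ 2 * (b z) ^ 2) := by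
            rw [← hn]
            nlinarith [norm_nonneg (((b z : ℝ) : ℂ) * f z - G),
              sq_nonneg (‖G‖ - ‖((b z : ℝ) : ℂ) * f z‖)]
          rw [hFG]
          calc _ ≤ (2 * ‖G‖ ^ 2 + 2 * (‖f z‖ ^ 2 * (b z) ^ 2)) * e := by gcongr
            _ = 2 * (‖G‖ ^ 2 * e) + 2 * (‖f z‖ ^ 2 * ((b z) ^ 2 * e)) := by ring
            _ ≤ _ := by gcongr
        refine (lintegral_mono hpt).trans_lt ?_
        have hmm : Measurable (fun z => 2 * ENNReal.ofReal (‖f z‖ ^ 2 * Real.exp (4 * t))) := by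
          have := hf.continuous.measurable
          fun_prop
        rw [lintegral_add_right _ hmm, lintegral_const_mul' _ _ (by simp),
          lintegral_const_mul' _ _ (by simp)]
        refine ENNReal.add_lt_top.2 ⟨ENNReal.mul_lt_top (by simp) ?_,
          ENNReal.mul_lt_top (by simp) ?_⟩
        · exact hFe.trans_lt ENNReal.ofReal_lt_top
        · have hI2 : IntegrableOn (fun z => ‖f z‖ ^ 2 * Real.exp (4 * t)) (eb (R/2)) :=
            integrableOn_sq_mul hf.continuous (h := fun _ => Real.exp (4 * t))
              aestronglyMeasurable_const
              (fun _ => by rw [Real.norm_of_nonneg (Real.exp_pos _).le])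
          rw [← ofReal_integral_eq_lintegral_ofReal hI2 (ae_of_all _ fun z => by positivity)]
          exact ENNReal.ofReal_lt_top
  have hr4 : R / 4 < R / 2 := by linarith
  choose d hd0 hd using fun j : ℕ => sup_small_of_l2 (n := n) hr4
    (η := 1 / ((j : ℝ) + 1)) (by positivity)
  choose F hF hFd hFm using fun j : ℕ => key (d j) (hd0 j)
  obtain ⟨ρ, hρ, hρs⟩ := Metric.mem_nhds_iff.1 (eb_mem_nhds (n := n) (show 0 < R / 4 by linarith))
  obtain ⟨C, hC⟩ := (isCompact_ssq_le (n := n) (R/4)).exists_bound_of_continuousOn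
    hf.continuous.continuousOn
  refine (isGermModule_germMod hR hm hmono).closed hρ
    (hfholo.mono (hρs.trans (eb_mono (by linarith)))) (C := C)
    (fun z hz => hC z (show ssq z ≤ R/4 from le_of_lt (hρs hz))) (F := F)
    (fun j => (hF j).mono (hρs.trans (eb_mono (by linarith))))
    (fun j z hz => hd j (F j) (hF j) (hFd j) z (show ssq z ≤ R/4 from le_of_lt (hρs hz)))
    tendsto_one_div_add_atTop_nhds_zero_nat hFm

/-- Continuous functions on a circle are uniform limits of real parts of entire functions. -/
lemma exists_entire_approx {h : ℂ → ℝ} (hh : Continuous h) {R : ℝ} (hR : 0 < R) {ε : ℝ}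
    (hε : 0 < ε) :
    ∃ Q : ℂ → ℂ, Differentiable ℂ Q ∧ ∀ l : ℂ, ‖l‖ = R → |(Q l).re - h l| < ε := by
  have : Fact (0 < 2 * Real.pi) := ⟨Real.two_pi_pos⟩
  let e : C(AddCircle (2 * Real.pi), ℂ) := fourier 1
  let S : Submodule ℂ C(AddCircle (2 * Real.pi), ℂ) :=
    { carrier := {g | ∃ A B : ℂ → ℂ, Differentiable ℂ A ∧ Differentiable ℂ B ∧
        ∀ x, g x = A (e x) + conj (B (e x))}
      zero_mem' := ⟨0, 0, by fun_prop, by fun_prop, fun x => by simp⟩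
      add_mem' := by
        rintro g g' ⟨A, B, hA, hB, h1⟩ ⟨A', B', hA', hB', h2⟩
        exact ⟨A + A', B + B', hA.add hA', hB.add hB', fun x => by
          simp [h1, h2]; ring⟩
      smul_mem' := by
        rintro c g ⟨A, B, hA, hB, h1⟩
        exact ⟨c • A, conj c • B, hA.const_smul c, hB.const_smul _, fun x => by
          simp [h1]; ring⟩ }
  have hpow : ∀ (k : ℕ) x, fourier (T := 2 * Real.pi) (k : ℤ) x = e x ^ k := by
    intro k x
    induction k with
    | zero => simp
    | succ k ih => rw [Nat.cast_succ, fourier_add, ih, pow_succ]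
  have hS : Submodule.span ℂ (Set.range (@fourier (2 * Real.pi))) ≤ S := by
    rw [Submodule.span_le]
    rintro _ ⟨k, rfl⟩
    obtain ⟨k, rfl | rfl⟩ := k.eq_nat_or_neg
    · exact ⟨fun z => z ^ k, 0, by fun_prop, by fun_prop, fun x => by rw [hpow]; simp⟩
    · exact ⟨0, fun z => z ^ k, by fun_prop, by fun_prop, fun x => by
        rw [fourier_neg, hpow]; simp⟩
  let H : C(AddCircle (2 * Real.pi), ℂ) := ⟨fun x => (h (R * e x) : ℂ), by fun_prop⟩
  have hH : H ∈ (Submodule.span ℂ (Set.range (@fourier (2 * Real.pi)))).topologicalClosure := by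
    rw [span_fourier_closure_eq_top]; trivial
  obtain ⟨g, hg, hgd⟩ := Metric.mem_closure_iff.1 hH ε hε
  obtain ⟨A, B, hA, hB, h1⟩ := hS hg
  refine ⟨fun l => A ((R : ℂ)⁻¹ * l) + B ((R : ℂ)⁻¹ * l), by fun_prop, fun l hl => ?_⟩
  have hl0 : l ≠ 0 := fun h0 => by simp [h0] at hl; linarith
  have he : e ((Complex.arg l : ℝ) : AddCircle (2 * Real.pi)) = (R : ℂ)⁻¹ * l := by
    have h2 := Complex.norm_mul_exp_arg_mul_I l
    rw [hl] at h2
    have hRC : (R : ℂ) ≠ 0 := by exact_mod_cast hR.ne'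
    have hpi : (Real.pi : ℂ) ≠ 0 := by exact_mod_cast Real.pi_ne_zero
    rw [eq_comm, inv_mul_eq_iff_eq_mul₀ hRC, ← h2, fourier_coe_apply]
    simp only [h2]
    push_cast
    field_simp
    rw [mul_comm Complex.I, h2]
  have h3 := (ContinuousMap.dist_lt_iff hε).1 hgd ((Complex.arg l : ℝ) : AddCircle (2 * Real.pi))
  rw [dist_comm, dist_eq_norm, h1, he] at h3
  have hRC : (R : ℂ) ≠ 0 := by exact_mod_cast hR.ne'
  have h4 : H ((Complex.arg l : ℝ) : AddCircle (2 * Real.pi)) = (h l : ℂ) := by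
    show ((h (R * e _) : ℝ) : ℂ) = _
    rw [he, mul_inv_cancel_left₀ hRC]
  rw [h4] at h3
  refine lt_of_le_of_lt ?_ h3
  have := Complex.abs_re_le_norm (A ((R : ℂ)⁻¹ * l) + conj (B ((R : ℂ)⁻¹ * l)) - (h l : ℂ))
  simpa using this

/-- Maximum principle for functions satisfying a local sub-mean value inequality. -/
lemma max_principle {g : ℂ → ℝ} {R a : ℝ} (hR : 0 < R) (hI : ∀ c r, CircleIntegrable g c r)
    (husc : UpperSemicontinuousOn g (Metric.closedBall 0 R))
    (hsub : ∀ l ∈ Metric.ball (0 : ℂ) R, ∃ ε > 0, ∀ r : ℝ, 0 < r → r < ε →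
      g l ≤ Real.circleAverage g l r)
    (hb : ∀ l ∈ Metric.sphere (0 : ℂ) R, g l ≤ a) : g 0 ≤ a := by
  by_contra! h0
  obtain ⟨l1, hl1, hmax⟩ := husc.exists_isMaxOn ⟨0, by simp [hR.le]⟩ (isCompact_closedBall 0 R)
  set M := g l1 with hM
  have hMa : a < M := h0.trans_le (hmax (by simp [hR.le]))
  have hK : IsCompact (Metric.closedBall (0 : ℂ) R ∩ g ⁻¹' Set.Ici M) :=
    husc.isCompact_inter_preimage_Ici (isCompact_closedBall 0 R) M
  obtain ⟨l, hl, hmin⟩ := hK.exists_isMinOn ⟨l1, hl1, le_refl M⟩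
    (Complex.continuous_re.continuousOn)
  have hlb : l ∈ Metric.ball (0 : ℂ) R := by
    rcases (mem_closedBall_zero_iff.1 hl.1).lt_or_eq with h | h
    · simpa using h
    · have := hb l (by simpa using h)
      have h2 : M ≤ g l := hl.2
      linarith
  obtain ⟨ε, hε, hs⟩ := hsub l hlb
  have hlR : ‖l‖ < R := by simpa using hlb
  obtain ⟨r, hr0, hr⟩ := exists_between (lt_min hε (sub_pos.2 hlR))
  have h1 := hs r hr0 (hr.trans_le (min_le_left _ _))
  have hin : ∀ θ, circleMap l r θ ∈ Metric.closedBall (0 : ℂ) R := fun θ => by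
    have h2 := circleMap_mem_sphere l hr0.le θ
    rw [mem_sphere_iff_norm] at h2
    rw [mem_closedBall_zero_iff]
    have h3 := norm_add_le (circleMap l r θ - l) l
    rw [sub_add_cancel] at h3
    have := hr.trans_le (min_le_right _ _)
    linarith
  have hle : ∀ θ, g (circleMap l r θ) ≤ M := fun θ => hmax (hin θ)
  have hMl : M ≤ g l := hl.2
  have h2 : ∫ θ in (0:ℝ)..(2 * Real.pi), (M - g (circleMap l r θ)) ≤ 0 := by
    rw [intervalIntegral.integral_sub (by simp) (hI l r)]
    rw [Real.circleAverage_def, smul_eq_mul, inv_mul_eq_div, le_div_iff₀ Real.two_pi_pos] at h1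
    simp only [intervalIntegral.integral_const, sub_zero, smul_eq_mul]
    nlinarith [Real.two_pi_pos]
  rw [intervalIntegral.integral_of_le Real.two_pi_pos.le] at h2
  have h3 := le_antisymm h2 (integral_nonneg fun θ => sub_nonneg.2 (hle θ))
  have hgi : Integrable (fun θ => M - g (circleMap l r θ))
      (volume.restrict (Set.Ioc 0 (2 * Real.pi))) :=
    (integrable_const M).sub (hI l r).1
  rw [integral_eq_zero_iff_of_nonneg (fun θ => sub_nonneg.2 (hle θ)) hgi] at h3
  have h4 : volume (Set.Ioo (Real.pi / 2) (3 * Real.pi / 2)) = 0 := by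
    have h5 := ae_restrict_iff' measurableSet_Ioc |>.1 h3
    refine measure_mono_null (fun θ hθ => ?_) (ae_iff.1 h5)
    have hpi := Real.pi_pos
    simp only [Set.mem_Ioo] at hθ
    show ¬ (θ ∈ Set.Ioc 0 (2 * Real.pi) → M - g (circleMap l r θ) = 0)
    intro h6
    have h7 := h6 ⟨by linarith, by linarith⟩
    have h8 : l.re ≤ (circleMap l r θ).re :=
      hmin ⟨hin θ, show M ≤ _ by linarith⟩
    have h9 : (circleMap l r θ).re = l.re + r * Real.cos θ := by
      simp [circleMap, Complex.exp_ofReal_mul_I_re]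
    have h10 : Real.cos θ < 0 := Real.cos_neg_of_pi_div_two_lt_of_lt hθ.1 (by linarith)
    nlinarith
  rw [Real.volume_Ioo, ENNReal.ofReal_eq_zero] at h4
  linarith [Real.pi_pos]

/-- A bounded upper semicontinuous function on a compact set is a limit of larger continuous
functions. -/
lemma exists_continuous_approx {X : Type*} [PseudoMetricSpace X] {g : X → ℝ} {K : Set X}
    (husc : UpperSemicontinuousOn g K) {B : ℝ} (hB : ∀ x, |g x| ≤ B) :
    ∃ h : ℕ → X → ℝ, (∀ k, Continuous (h k)) ∧ (∀ k x, |h k x| ≤ B) ∧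
      (∀ k, ∀ x ∈ K, g x ≤ h k x) ∧ ∀ x ∈ K, Tendsto (fun k => h k x) atTop (𝓝 (g x)) := by
  rcases K.eq_empty_or_nonempty with rfl | hK
  · by_cases hX : Nonempty X
    · obtain ⟨x⟩ := hX
      exact ⟨fun _ _ => 0, fun _ => continuous_const, fun _ y => by
        simpa using (abs_nonneg _).trans (hB y), by simp, by simp⟩
    · exact ⟨fun _ _ => 0, fun _ => continuous_const, fun _ y => (hX ⟨y⟩).elim, by simp, by simp⟩
  have : Nonempty K := hK.to_subtype
  have hub : ∀ (k : ℕ) x (y : K), g y - k * dist x (y : X) ≤ B := fun k x y => by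
    have := (abs_le.1 (hB y)).2
    have : 0 ≤ k * dist x (y : X) := by positivity
    linarith
  set h0 : ℕ → X → ℝ := fun k x => ⨆ y : K, (g y - k * dist x (y : X)) with hh0
  have hbd : ∀ (k : ℕ) x, BddAbove (Set.range fun y : K => g y - k * dist x (y : X)) := fun k x =>
    ⟨B, by rintro _ ⟨y, rfl⟩; exact hub k x y⟩
  have hle : ∀ k x, h0 k x ≤ B := fun k x => ciSup_le (hub k x)
  have hlip : ∀ k x x', h0 k x ≤ h0 k x' + k * dist x x' := by
    intro k x x'
    refine ciSup_le fun y => ?_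
    have h1 := le_ciSup (hbd k x') y
    have h2 := dist_triangle x' x (y : X)
    rw [dist_comm x' x] at h2
    have : (k : ℝ) * dist x' (y : X) ≤ k * (dist x x' + dist x y) := by gcongr
    linarith
  have hge : ∀ k, ∀ x ∈ K, g x ≤ h0 k x := fun k x hx => by
    have := le_ciSup (hbd k x) ⟨x, hx⟩
    simpa using this
  refine ⟨fun k x => max (h0 k x) (-B), fun k => ?_, fun k x => ?_,
    fun k x hx => (hge k x hx).trans (le_max_left _ _), fun x hx => ?_⟩
  · refine Continuous.max ?_ continuous_const
    refine (LipschitzWith.of_dist_le_mul (K := (k : ℝ≥0)) fun x x' => ?_).continuous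
    rw [Real.dist_eq, abs_le]
    have h1 := hlip k x x'
    have h2 := hlip k x' x
    rw [dist_comm x' x] at h2
    simp only [NNReal.coe_natCast]
    constructor <;> linarith
  · have hB0 : 0 ≤ B := (abs_nonneg _).trans (hB x)
    exact abs_le.2 ⟨le_max_right _ _, max_le (hle k x) (by linarith)⟩
  · refine Metric.tendsto_atTop.2 fun ε hε => ?_
    have h1 := husc x hx (g x + ε / 2) (by linarith)
    obtain ⟨η, hη, h2⟩ := Metric.mem_nhdsWithin_iff.1 h1
    obtain ⟨N, hN⟩ := exists_nat_gt (2 * B / η)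
    refine ⟨N, fun k hk => ?_⟩
    have hgB := abs_le.1 (hB x)
    have h3 : h0 k x ≤ g x + ε / 2 := by
      refine ciSup_le fun y => ?_
      by_cases hy : dist (y : X) x < η
      · have h4 : g y < g x + ε / 2 := h2 ⟨hy, y.2⟩
        have : 0 ≤ k * dist x (y : X) := by positivity
        linarith
      · rw [not_lt, dist_comm] at hy
        have h5 : 2 * B < N * η := by rwa [div_lt_iff₀ hη] at hN
        have h6 : (N : ℝ) ≤ k := by exact_mod_cast hk
        have h7 : (N : ℝ) * η ≤ k * dist x (y : X) := by gcongr
        have := (abs_le.1 (hB y)).2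
        linarith
    have := hge k x hx
    show dist (max (h0 k x) (-B)) (g x) < ε
    rw [Real.dist_eq, max_eq_left (by linarith), abs_lt]
    constructor <;> linarith

/-- The sub-mean value inequality on a disc follows from the local one. -/
lemma submean_disc {g : ℂ → ℝ} {R B : ℝ} (hR : 0 < R) (hm : Measurable g) (hB : ∀ l, |g l| ≤ B)
    (husc : UpperSemicontinuousOn g (Metric.closedBall 0 R))
    (hsub : ∀ l ∈ Metric.ball (0 : ℂ) R, ∃ ε > 0, ∀ r : ℝ, 0 < r → r < ε →
      g l ≤ Real.circleAverage g l r) : g 0 ≤ Real.circleAverage g 0 R := by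
  have hI : ∀ c r, CircleIntegrable g c r := fun c r => by
    have hc : Continuous (circleMap c r) := continuous_circleMap c r
    exact (intervalIntegrable_const (c := B)).mono_fun
      (hm.comp hc.measurable).aestronglyMeasurable
      (ae_of_all _ fun θ => (hB _).trans (le_abs_self B))
  obtain ⟨h, hc, hhB, hge, hlim⟩ := exists_continuous_approx husc hB
  have hIc : ∀ {q : ℂ → ℝ}, Continuous q → ∀ c r, CircleIntegrable q c r := fun hq c r =>
    hq.continuousOn.circleIntegrable'
  have key : ∀ k, g 0 ≤ Real.circleAverage (h k) 0 R := by
    intro k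
    refine le_of_forall_pos_le_add fun ε hε => ?_
    obtain ⟨Q, hQ, hQh⟩ := exists_entire_approx (hc k) hR (half_pos hε)
    have hQc : Continuous fun l => (Q l).re := Complex.continuous_re.comp hQ.continuous
    have hmean : ∀ c r, Real.circleAverage (fun l => (Q l).re) c r = (Q c).re := by
      intro c r
      have h1 : Real.circleAverage Q c r = Q c := hQ.diffContOnCl.circleAverage
      have h2 := Complex.reCLM.circleAverage_comp_comm
        (hQ.continuous.continuousOn.circleIntegrable' : CircleIntegrable Q c r)
      rw [← h1]; exact h2
    have h1 := max_principle (g := fun l => g l - (Q l).re) (a := ε / 2) hR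
      (fun c r => (hI c r).sub (hIc hQc c r))
      (by
        simp only [sub_eq_add_neg]
        exact husc.add (hQc.neg.continuousOn.upperSemicontinuousOn))
      (fun l hl => by
        obtain ⟨ε, hε, hs⟩ := hsub l hl
        refine ⟨ε, hε, fun r h1 h2 => ?_⟩
        rw [show (fun l => g l - (Q l).re) = g - fun l => (Q l).re from rfl,
          Real.circleAverage_sub (hI l r) (hIc hQc l r), hmean]
        exact sub_le_sub_right (hs r h1 h2) _)
      (fun l hl => by
        have h1 := hge k l (Metric.sphere_subset_closedBall hl)
        have h2 := abs_lt.1 (hQh l (by simpa using hl))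
        linarith)
    have h2 : (Q 0).re ≤ Real.circleAverage (h k) 0 R + ε / 2 := by
      rw [← hmean 0 R]
      rw [← Real.circleAverage_const (ε / 2) 0 R, ← Real.circleAverage_fun_add (hIc (hc k) _ _)
        (hIc continuous_const _ _)]
      refine Real.circleAverage_mono (hIc hQc _ _) (hIc ((hc k).add continuous_const) _ _)
        fun l hl => ?_
      have h2 := abs_lt.1 (hQh l (by simpa [abs_of_pos hR] using hl))
      linarith
    have h3 : g 0 - (Q 0).re ≤ ε / 2 := h1
    linarith
  refine ge_of_tendsto (x := atTop) ?_ (Eventually.of_forall key)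
  simp only [Real.circleAverage_def]
  refine Tendsto.const_smul ?_ _
  refine intervalIntegral.tendsto_integral_filter_of_dominated_convergence (fun _ => B)
    (Eventually.of_forall fun k =>
      ((hc k).comp (continuous_circleMap 0 R)).aestronglyMeasurable)
    (Eventually.of_forall fun k => ae_of_all _ fun θ _ => hhB k _)
    intervalIntegrable_const (ae_of_all _ fun θ _ => hlim _ ?_)
  exact Metric.sphere_subset_closedBall (circleMap_mem_sphere 0 hR.le θ)

/-- Bounded measurable functions that are plurisubharmonic on `Ω`. -/
structure BSub (v : Cn n → ℝ) (Ω : Set (Cn n)) : Prop where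
  meas : Measurable v
  bdd : ∃ B, ∀ z, |v z| ≤ B
  usc : UpperSemicontinuousOn v Ω
  sub : ∀ z ∈ Ω, ∀ w, ∃ ε > 0, ∀ r : ℝ, 0 < r → r < ε →
    v z ≤ Real.circleAverage (fun l : ℂ => v (z + l • w)) 0 r

lemma BSub.mono {v : Cn n → ℝ} {Ω Ω' : Set (Cn n)} (h : BSub v Ω) (hs : Ω' ⊆ Ω) : BSub v Ω' :=
  ⟨h.meas, h.bdd, h.usc.mono hs, fun z hz => h.sub z (hs hz)⟩

lemma BSub.submean {v : Cn n → ℝ} {Ω : Set (Cn n)} (h : BSub v Ω) {z w : Cn n} {r : ℝ} (hr : 0 < r)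
    (hin : ∀ l : ℂ, ‖l‖ ≤ r → z + l • w ∈ Ω) :
    v z ≤ Real.circleAverage (fun l : ℂ => v (z + l • w)) 0 r := by
  obtain ⟨B, hB⟩ := h.bdd
  have hc : Continuous fun l : ℂ => z + l • w := by fun_prop
  have := submean_disc (g := fun l : ℂ => v (z + l • w)) hr (h.meas.comp hc.measurable)
    (fun l => hB _) (h.usc.comp hc.continuousOn fun l hl => hin l (by simpa using hl))
    (fun l hl => by
      obtain ⟨ε, hε, hs⟩ := h.sub (z + l • w) (hin l (by
        rw [mem_ball_zero_iff] at hl; exact hl.le)) w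
      refine ⟨ε, hε, fun r h1 h2 => (hs r h1 h2).trans_eq ?_⟩
      rw [← Real.circleAverage_map_add_const (c := l)]
      congr 1; ext l'; congr 1; rw [add_smul]; abel)
  simpa using this

/-- Mollification of a real function. -/
def rm (ε : ℝ) (v : Cn n → ℝ) (x : Cn n) : ℝ := (moll ε (toC v) x).re

lemma rm_eq (ε : ℝ) (v : Cn n → ℝ) (x : Cn n) : rm ε v x = ∫ y, rho ε y * v (x - y) := by
  unfold rm
  rw [moll_eq]
  have : ∀ y, (rho ε y : ℂ) * toC v (x - y) = ((rho ε y * v (x - y) : ℝ) : ℂ) := fun y => by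
    simp [toC]
  simp_rw [this]
  rw [integral_complex_ofReal, Complex.ofReal_re]

lemma locInt_of_bdd {v : Cn n → ℝ} (hm : Measurable v) {B : ℝ} (hB : ∀ z, |v z| ≤ B) :
    LocallyIntegrable (toC v) := by
  have h1 : LocallyIntegrable (fun _ : Cn n => B) := locallyIntegrable_const B
  refine h1.mono (Complex.measurable_ofReal.comp hm).aestronglyMeasurable (ae_of_all _ fun z => ?_)
  simp only [toC, Complex.norm_real, Real.norm_eq_abs]
  exact (hB z).trans (le_abs_self B)

lemma sm_rm {ε : ℝ} (hε : 0 < ε) {v : Cn n → ℝ} (hl : LocallyIntegrable (toC v)) :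
    Sm (rm ε v) :=
  Complex.reCLM.contDiff.comp (sm_moll hε hl)

lemma integrable_rho {ε : ℝ} (hε : 0 < ε) : Integrable (rho ε : Cn n → ℝ) :=
  (sm_rho ε).continuous.integrable_of_hasCompactSupport (hcs_rho hε)

lemma integrable_rho_mul {ε : ℝ} (hε : 0 < ε) {v : Cn n → ℝ} (hm : Measurable v) {B : ℝ}
    (hB : ∀ z, |v z| ≤ B) : Integrable fun y => rho ε y * v y := by
  exact (integrable_rho hε).mul_bdd (c := B) hm.aestronglyMeasurable (ae_of_all _ fun y => hB y)

lemma rm_le {ε : ℝ} (hε : 0 < ε) {v : Cn n → ℝ} (hm : Measurable v) {B : ℝ} (hB : ∀ z, |v z| ≤ B)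
    {x : Cn n} {c : ℝ} (h : ∀ y, ‖y‖ < ε → v (x - y) ≤ c) : rm ε v x ≤ c := by
  rw [rm_eq, ← mul_one c, ← integral_rho (n := n) hε, ← integral_const_mul]
  refine integral_mono (integrable_rho_mul hε (hm.comp (measurable_const.sub measurable_id))
    fun y => hB _) ((integrable_rho hε).const_mul c) fun y => ?_
  by_cases hy : ‖y‖ < ε
  · show rho ε y * v (x - y) ≤ c * rho ε y
    rw [mul_comm c]
    exact mul_le_mul_of_nonneg_left (h y hy) (rho_nonneg hε y)
  · simp [rho_eq_zero hε (not_lt.1 hy)]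

lemma BSub.le_rm {v : Cn n → ℝ} {Ω : Set (Cn n)} (h : BSub v Ω) {x : Cn n} {ε : ℝ} (hε : 0 < ε)
    (hin : Metric.closedBall x ε ⊆ Ω) : v x ≤ rm ε v x := by
  obtain ⟨B, hB⟩ := h.bdd
  have hgi := integrable_rho_mul hε (v := fun y => v (x - y))
    (h.meas.comp (measurable_const.sub measurable_id)) fun y => hB _
  obtain ⟨h1, h2⟩ := rot_avg (ε := ε) (G := fun y => v (x - y)) hgi
  simp only [smul_eq_mul] at h1 h2
  have h3 : v x = ∫ y : Cn n, v x * rho ε y := by rw [integral_const_mul, integral_rho hε, mul_one]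
  rw [rm_eq, h2, h3]
  refine integral_mono ((integrable_rho hε).const_mul _) h1 fun y => ?_
  by_cases hy : ‖y‖ < ε
  · show v x * rho ε y ≤ rho ε y * _
    rw [mul_comm]
    refine mul_le_mul_of_nonneg_left ?_ (rho_nonneg hε y)
    have := h.submean (z := x) (w := -y) (r := 1) one_pos (fun l hl => hin (by
      rw [mem_closedBall_iff_norm, add_sub_cancel_left, norm_smul, norm_neg]
      nlinarith [norm_nonneg y]))
    refine this.trans_eq ?_
    rw [Real.circleAverage_def, smul_eq_mul]
    simp [sub_eq_add_neg]
  · simp [rho_eq_zero hε (not_lt.1 hy)]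

/-- Mollification preserves sub-mean value inequalities. -/
lemma BSub.submean_rm {v : Cn n → ℝ} {Ω : Set (Cn n)} (h : BSub v Ω) {x w : Cn n} {ε r : ℝ}
    (hε : 0 < ε) (hr : 0 < r) (hin : Metric.closedBall x (ε + r * ‖w‖) ⊆ Ω) :
    rm ε v x ≤ Real.circleAverage (fun l : ℂ => rm ε v (x + l • w)) 0 r := by
  obtain ⟨B, hB⟩ := h.bdd
  have hswap : Real.circleAverage (fun l : ℂ => rm ε v (x + l • w)) 0 r
      = ∫ y, rho ε y * Real.circleAverage (fun l : ℂ => v (x - y + l • w)) 0 r := by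
    simp only [Real.circleAverage_def, smul_eq_mul, rm_eq]
    rw [intervalIntegral_integral_swap]
    · rw [← integral_const_mul]
      refine integral_congr_ae (ae_of_all _ fun y => ?_)
      simp only
      rw [intervalIntegral.integral_const_mul]
      have : ∀ θ, x + circleMap 0 r θ • w - y = x - y + circleMap 0 r θ • w := fun θ => by abel
      simp only [this]; ring
    · have hμ : IsFiniteMeasure (volume.restrict (Set.uIoc 0 (2 * Real.pi))) := by
        rw [Set.uIoc_of_le Real.two_pi_pos.le]; infer_instance
      have h1 : Integrable (fun p : ℝ × Cn n => rho ε p.2)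
          ((volume.restrict (Set.uIoc 0 (2 * Real.pi))).prod volume) :=
        (integrable_rho hε).comp_snd _
      refine h1.mul_bdd (c := B) (Measurable.aestronglyMeasurable ?_) (ae_of_all _ fun p => hB _)
      refine h.meas.comp ?_
      have : Continuous fun p : ℝ × Cn n => x + circleMap 0 r p.1 • w - p.2 := by
        have := continuous_circleMap 0 r
        fun_prop
      exact this.measurable
  rw [hswap, rm_eq]
  have hav : ∀ y, |Real.circleAverage (fun l : ℂ => v (x - y + l • w)) 0 r| ≤ B := fun y => by
    rw [Real.circleAverage_def, smul_eq_mul, abs_mul, abs_of_pos (by positivity : 0 < (2 * Real.pi)⁻¹),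
      inv_mul_le_iff₀ Real.two_pi_pos, mul_comm _ B]
    have := intervalIntegral.norm_integral_le_of_norm_le_const (a := 0) (b := 2 * Real.pi)
      (f := fun θ => v (x - y + circleMap 0 r θ • w)) (C := B) fun θ _ => hB _
    simpa [abs_of_pos Real.pi_pos] using this
  have hmav : Measurable fun y => Real.circleAverage (fun l : ℂ => v (x - y + l • w)) 0 r := by
    simp only [Real.circleAverage_def, intervalIntegral.integral_of_le Real.two_pi_pos.le,
      smul_eq_mul]
    refine Measurable.const_mul (StronglyMeasurable.measurable ?_) _
    refine StronglyMeasurable.integral_prod_right'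
      (f := fun p : Cn n × ℝ => v (x - p.1 + circleMap 0 r p.2 • w)) ?_
    have : Continuous fun p : Cn n × ℝ => x - p.1 + circleMap 0 r p.2 • w := by
      have := continuous_circleMap 0 r
      fun_prop
    exact (h.meas.comp this.measurable).stronglyMeasurable
  refine integral_mono (integrable_rho_mul hε (h.meas.comp (measurable_const.sub measurable_id))
    fun y => hB _) (integrable_rho_mul hε hmav hav) fun y => ?_
  by_cases hy : ‖y‖ < ε
  · refine mul_le_mul_of_nonneg_left ?_ (rho_nonneg hε y)
    refine h.submean hr fun l hl => hin ?_
    rw [mem_closedBall_iff_norm, show x - y + l • w - x = l • w - y by abel]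
    refine (norm_sub_le _ _).trans ?_
    rw [norm_smul]
    have := mul_le_mul_of_nonneg_right hl (norm_nonneg w)
    linarith
  · simp [rho_eq_zero hε (not_lt.1 hy)]

/-- Differentiation under the integral over a compact interval. -/
lemma hasDerivAt_intervalIntegral {G G' : ℝ → ℝ → ℝ} (hG : Continuous (Function.uncurry G))
    (hG' : Continuous (Function.uncurry G')) (h : ∀ r θ, HasDerivAt (fun r => G r θ) (G' r θ) r)
    (a b r : ℝ) :
    HasDerivAt (fun r => ∫ θ in a..b, G r θ) (∫ θ in a..b, G' r θ) r := by
  have hc : ∀ r, Continuous (G r) := fun r => hG.comp (Continuous.prodMk_right r)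
  have hc' : ∀ r, Continuous (G' r) := fun r => hG'.comp (Continuous.prodMk_right r)
  obtain ⟨C, hC⟩ := ((isCompact_closedBall r 1).prod
    (isCompact_uIcc (a := a) (b := b))).exists_bound_of_continuousOn hG'.continuousOn
  refine (intervalIntegral.hasDerivAt_integral_of_dominated_loc_of_deriv_le
    (F := G) (F' := G') (s := Metric.closedBall r 1) (bound := fun _ => C)
    (Metric.closedBall_mem_nhds r one_pos)
    (Eventually.of_forall fun r => (hc r).aestronglyMeasurable)
    ((hc r).intervalIntegrable a b) (hc' r).aestronglyMeasurable
    (ae_of_all _ fun θ hθ r' hr' => hC (r', θ) ⟨hr', Set.uIoc_subset_uIcc hθ⟩)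
    intervalIntegrable_const (ae_of_all _ fun θ _ r' _ => h r' θ)).2

/-- A smooth function satisfying a sub-mean value inequality on ellipses has non-negative trace of
the Hessian in the corresponding plane. -/
lemma hessian_nonneg {E : Type*} [NormedAddCommGroup E] [NormedSpace ℝ E] {s : E → ℝ}
    (hs : ContDiff ℝ ∞ s) {x ξ η : E} {ε : ℝ} (hε : 0 < ε)
    (hsub : ∀ r, 0 < r → r < ε →
      2 * Real.pi * s x ≤ ∫ θ in (0:ℝ)..(2 * Real.pi), s (x + r • (Real.cos θ • ξ + Real.sin θ • η))) :
    0 ≤ fderiv ℝ (fderiv ℝ s) x ξ ξ + fderiv ℝ (fderiv ℝ s) x η η := by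
  set d : ℝ → E := fun θ => Real.cos θ • ξ + Real.sin θ • η with hd
  have hdc : Continuous d := by fun_prop
  have hs1 : ContDiff ℝ ∞ (fderiv ℝ s) := hs.fderiv_right (by simp)
  have hs2 : ContDiff ℝ ∞ (fderiv ℝ (fderiv ℝ s)) := hs1.fderiv_right (by simp)
  have hline : ∀ θ r, HasDerivAt (fun r : ℝ => x + r • d θ) (d θ) r := fun θ r => by
    simpa using ((hasDerivAt_id r).smul_const (d θ)).const_add x
  have hpc : Continuous fun p : ℝ × ℝ => x + p.1 • d p.2 := by fun_prop
  have hF1 := hasDerivAt_intervalIntegral (G := fun r θ => s (x + r • d θ))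
    (G' := fun r θ => fderiv ℝ s (x + r • d θ) (d θ)) (hs.continuous.comp hpc)
    ((hs1.continuous.comp hpc).clm_apply (hdc.comp continuous_snd))
    (fun r θ => ((hs.differentiable (by simp)).differentiableAt.hasFDerivAt).comp_hasDerivAt r
      (hline θ r)) 0 (2 * Real.pi)
  have hF2 := hasDerivAt_intervalIntegral (G := fun r θ => fderiv ℝ s (x + r • d θ) (d θ))
    (G' := fun r θ => fderiv ℝ (fderiv ℝ s) (x + r • d θ) (d θ) (d θ))
    ((hs1.continuous.comp hpc).clm_apply (hdc.comp continuous_snd))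
    (((hs2.continuous.comp hpc).clm_apply (hdc.comp continuous_snd)).clm_apply
      (hdc.comp continuous_snd))
    (fun r θ => by
      have := (((hs1.differentiable (by simp)).differentiableAt.hasFDerivAt).comp_hasDerivAt r
        (hline θ r)).clm_apply (hasDerivAt_const r (d θ))
      simpa using this) 0 (2 * Real.pi)
  set F : ℝ → ℝ := fun r => ∫ θ in (0:ℝ)..(2 * Real.pi), s (x + r • d θ) with hF
  set B := fderiv ℝ (fderiv ℝ s) x with hB
  have hF0 : F 0 = 2 * Real.pi * s x := by simp [hF]
  have hF'0 : ∫ θ in (0:ℝ)..(2 * Real.pi), fderiv ℝ s (x + (0 : ℝ) • d θ) (d θ) = 0 := by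
    simp only [zero_smul, add_zero, hd, map_add, map_smul, smul_eq_mul]
    rw [intervalIntegral.integral_add (Continuous.intervalIntegrable (by fun_prop) _ _)
      (Continuous.intervalIntegrable (by fun_prop) _ _)]
    simp
  have hF''0 : ∫ θ in (0:ℝ)..(2 * Real.pi), B (d θ) (d θ) = Real.pi * (B ξ ξ + B η η) := by
    have : ∀ θ, B (d θ) (d θ) = Real.cos θ ^ 2 * B ξ ξ +
        (Real.sin θ * Real.cos θ * (B ξ η + B η ξ) + Real.sin θ ^ 2 * B η η) := fun θ => by
      simp only [hd, map_add, map_smul, smul_eq_mul, _root_.add_apply, _root_.smul_apply]; ring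
    simp only [this]
    rw [intervalIntegral.integral_add (Continuous.intervalIntegrable (by fun_prop) _ _)
      (Continuous.intervalIntegrable (by fun_prop) _ _),
      intervalIntegral.integral_add (Continuous.intervalIntegrable (by fun_prop) _ _)
      (Continuous.intervalIntegrable (by fun_prop) _ _)]
    simp only [intervalIntegral.integral_mul_const]
    rw [integral_cos_sq, integral_sin_sq, integral_sin_mul_cos₁]
    simp; ring
  by_contra! hneg
  set δ := -(Real.pi * (B ξ ξ + B η η)) / 4 with hδ
  have hδ0 : 0 < δ := by
    have := mul_neg_of_pos_of_neg Real.pi_pos hneg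
    rw [hδ]; linarith
  have hd1 : deriv (fun r => F r + δ * r ^ 2) = fun r =>
      (∫ θ in (0:ℝ)..(2 * Real.pi), fderiv ℝ s (x + r • d θ) (d θ)) + δ * (2 * r) := by
    ext r
    have := (hF1 r).fun_add ((hasDerivAt_pow 2 r).const_mul δ)
    simpa using this.deriv
  have hd2 : deriv (deriv (fun r => F r + δ * r ^ 2)) 0 = Real.pi * (B ξ ξ + B η η) + 2 * δ := by
    rw [hd1]
    have h1 := hF2 0
    simp only [zero_smul, add_zero, ← hB] at h1
    rw [hF''0] at h1
    have := h1.add (((hasDerivAt_id (0:ℝ)).const_mul 2).const_mul δ)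
    have h2 := this.deriv
    simp only [mul_one] at h2
    rw [mul_comm 2 δ, ← h2]; rfl
  have hmax : IsLocalMax (fun r => F r + δ * r ^ 2) 0 := by
    refine isLocalMax_of_deriv_deriv_neg ?_ ?_ ?_
    · rw [hd2, hδ]
      have := mul_neg_of_pos_of_neg Real.pi_pos hneg
      linarith
    · rw [hd1]; simp only [hF'0]; simp
    · exact (hF1 0).continuousAt.add (by fun_prop)
  have h1 : ∀ᶠ r in 𝓝[>] (0:ℝ), F r + δ * r ^ 2 ≤ F 0 + δ * 0 ^ 2 :=
    hmax.filter_mono nhdsWithin_le_nhds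
  obtain ⟨r, h2, hr⟩ := (h1.and (Ioo_mem_nhdsGT hε)).exists
  have h3 := hsub r hr.1 hr.2
  have h4 : 0 < δ * r ^ 2 := by have := hr.1; positivity
  rw [hF0] at h2
  have : F r = ∫ θ in (0:ℝ)..(2 * Real.pi), s (x + r • (Real.cos θ • ξ + Real.sin θ • η)) := rfl
  linarith

lemma clm_expand (L : Cn n →L[ℝ] ℂ) (ξ : Cn n) :
    L ξ = ∑ j, ((ξ j).re * L (Pi.single j 1) + (ξ j).im * L (Pi.single j Complex.I)) := by
  have h : ξ = ∑ j, ((ξ j).re • (Pi.single j 1 : Cn n) + (ξ j).im • (Pi.single j Complex.I : Cn n)) := by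
    ext k
    simp only [Finset.sum_apply, Pi.add_apply, Pi.smul_apply]
    rw [Finset.sum_eq_single k]
    · simp
    · intro j _ hj
      simp [Pi.single_eq_of_ne (Ne.symm hj)]
    · simp
  conv_lhs => rw [h]
  simp [map_sum, map_add]

lemma sum_dz (h : Cn n → ℂ) (z ξ : Cn n) :
    ∑ j, dz j h z * ξ j = (1 / 2) * (fderiv ℝ h z ξ - Complex.I * fderiv ℝ h z (Complex.I • ξ)) := by
  rw [clm_expand (fderiv ℝ h z) ξ, clm_expand (fderiv ℝ h z) (Complex.I • ξ), Finset.mul_sum,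
    ← Finset.sum_sub_distrib, Finset.mul_sum]
  refine Finset.sum_congr rfl fun j _ => ?_
  conv_lhs => rw [← Complex.re_add_im (ξ j)]
  simp only [dz, wirt, Pi.smul_apply, smul_eq_mul, Complex.mul_re, Complex.mul_im, Complex.I_re,
    Complex.I_im]
  push_cast
  linear_combination -(1 / 2) * (ξ j).im * fderiv ℝ h z (Pi.single j Complex.I) * Complex.I_sq

lemma sum_db (h : Cn n → ℂ) (z ξ : Cn n) :
    ∑ j, db j h z * conj (ξ j) =
      (1 / 2) * (fderiv ℝ h z ξ + Complex.I * fderiv ℝ h z (Complex.I • ξ)) := by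
  rw [clm_expand (fderiv ℝ h z) ξ, clm_expand (fderiv ℝ h z) (Complex.I • ξ), Finset.mul_sum,
    ← Finset.sum_add_distrib, Finset.mul_sum]
  refine Finset.sum_congr rfl fun j _ => ?_
  conv_lhs => rw [← Complex.re_add_im (ξ j)]
  simp only [db, wirt, Pi.smul_apply, smul_eq_mul, Complex.mul_re, Complex.mul_im, Complex.I_re,
    Complex.I_im, map_add, map_mul, Complex.conj_I, Complex.conj_ofReal]
  push_cast
  linear_combination -
    (1 / 2) * (ξ j).im * fderiv ℝ h z (Pi.single j Complex.I) * Complex.I_sq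

lemma levi_eq_hessian {s : Cn n → ℝ} (hs : Sm s) (z ξ : Cn n) :
    4 * levi s z ξ = fderiv ℝ (fderiv ℝ s) z ξ ξ
      + fderiv ℝ (fderiv ℝ s) z (Complex.I • ξ) (Complex.I • ξ) := by
  have hd1 : DifferentiableAt ℝ (fderiv ℝ s) z :=
    (ContDiff.differentiable (hs.fderiv_right (m := ∞) (by simp)) (by simp)) z
  have e0 : ∀ x v, fderiv ℝ (toC s) x v = ((fderiv ℝ s x v : ℝ) : ℂ) := fun x v => by
    have := (Complex.ofRealCLM.hasFDerivAt.comp x (hs.dAt x).hasFDerivAt).fderiv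
    have h2 : toC s = Complex.ofRealCLM ∘ s := rfl
    rw [h2, this]; simp
  set b : Cn n → Cn n → ℝ := fun v w => fderiv ℝ (fderiv ℝ s) z w v with hb
  have e1 : ∀ v w, fderiv ℝ (fun x => fderiv ℝ (toC s) x v) z w = (b v w : ℂ) := fun v w => by
    have h1 : (fun x => fderiv ℝ (toC s) x v) = Complex.ofRealCLM ∘ fun x => fderiv ℝ s x v := by
      ext x; simp [e0]
    have h3 : HasFDerivAt (fun x => fderiv ℝ s x v) ((fderiv ℝ (fderiv ℝ s) z).flip v) z := by
      have := hd1.hasFDerivAt.clm_apply (hasFDerivAt_const v z)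
      simpa using this
    rw [h1, (Complex.ofRealCLM.hasFDerivAt.comp z h3).fderiv]
    simp [hb]
  have e2 : ∀ j, ∑ k, dz j (db k (toC s)) z * ξ j * conj (ξ k) =
      dz j (fun x => ∑ k, db k (toC s) x * conj (ξ k)) z * ξ j := fun j => by
    have hW : ∀ k, DifferentiableAt ℝ (db k (toC s)) z := fun k => (Sm.wirt hs.toC).dAt z
    have : dz j (fun x => ∑ k, db k (toC s) x * conj (ξ k)) z =
        ∑ k, dz j (fun x => db k (toC s) x * conj (ξ k)) z :=
      wirt_sum (fun k _ => (hW k).mul_const _)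
    rw [this, Finset.sum_mul]
    refine Finset.sum_congr rfl fun k _ => ?_
    have : dz j (fun x => db k (toC s) x * conj (ξ k)) z = dz j (db k (toC s)) z * conj (ξ k) := by
      unfold dz wirt
      rw [fderiv_mul_const (hW k)]
      simp; ring
    rw [this]; ring
  unfold levi
  simp only [e2, sum_dz, sum_db]
  have hv : ∀ v, DifferentiableAt ℝ (fun x => fderiv ℝ (toC s) x v) z := fun v =>
    (hs.toC.fderiv_apply v).dAt z
  have e3 : ∀ w, fderiv ℝ (fun x => (1 / 2 : ℂ) * (fderiv ℝ (toC s) x ξ +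
      Complex.I * fderiv ℝ (toC s) x (Complex.I • ξ))) z w =
      (1 / 2) * (b ξ w + Complex.I * b (Complex.I • ξ) w) := fun w => by
    rw [fderiv_const_mul ((hv _).fun_add ((hv _).const_mul _)),
      fderiv_fun_add (hv _) ((hv _).const_mul _), fderiv_const_mul (hv _)]
    simp [e1]; ring
  rw [e3, e3]
  simp; ring

/-- Mollifications are plurisubharmonic. -/
lemma BSub.levi_rm {v : Cn n → ℝ} {Ω : Set (Cn n)} (h : BSub v Ω) {x : Cn n} {ε ε' : ℝ}
    (hε : 0 < ε) (hε' : ε < ε') (hin : Metric.closedBall x ε' ⊆ Ω) (ξ : Cn n) :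
    0 ≤ levi (rm ε v) x ξ := by
  obtain ⟨B, hB⟩ := h.bdd
  have hs := sm_rm hε (locInt_of_bdd h.meas hB)
  suffices hh : 0 ≤ 4 * levi (rm ε v) x ξ by linarith
  rw [levi_eq_hessian hs]
  refine hessian_nonneg hs (ε := (ε' - ε) / (‖ξ‖ + 1))
    (div_pos (by linarith) (by positivity)) fun r hr hr' => ?_
  have h1 := h.submean_rm (x := x) (w := ξ) hε hr ((Metric.closedBall_subset_closedBall (by
    rw [lt_div_iff₀ (by positivity)] at hr'
    nlinarith)).trans hin)
  rw [Real.circleAverage_def, smul_eq_mul, inv_mul_eq_div, le_div_iff₀ Real.two_pi_pos,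
    mul_comm] at h1
  refine h1.trans_eq (intervalIntegral.integral_congr fun θ _ => ?_)
  show rm ε v _ = rm ε v _
  congr 2
  ext j
  simp only [circleMap, Complex.exp_mul_I, Pi.smul_apply, Pi.add_apply, smul_eq_mul,
    Complex.real_smul]
  push_cast; ring

open Classical in
/-- The truncation `max u (-m)` on `Ω`, extended by `-m`. -/
def cut (Ω : Set (Cn n)) (m : ℕ) (u : Cn n → EReal) (z : Cn n) : ℝ :=
  if z ∈ Ω then (max (u z) ((-(m : ℝ) : ℝ) : EReal)).toReal else -(m : ℝ)

lemma coe_toReal_max {x : EReal} (hx : x < ⊤) (a : ℝ) :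
    (((max x (a : EReal)).toReal : ℝ) : EReal) = max x (a : EReal) :=
  EReal.coe_toReal (max_lt hx (EReal.coe_lt_top a)).ne
    (((EReal.bot_lt_coe a).trans_le (le_max_right _ _)).ne')

lemma coe_cut {Ω : Set (Cn n)} {m : ℕ} {u : Cn n → EReal} {z : Cn n} (hz : z ∈ Ω) (hu : u z < ⊤) :
    ((cut Ω m u z : ℝ) : EReal) = max (u z) ((-(m : ℝ) : ℝ) : EReal) := by
  rw [cut, if_pos hz, coe_toReal_max hu]

lemma cut_of_notMem {Ω : Set (Cn n)} {m : ℕ} {u : Cn n → EReal} {z : Cn n} (hz : z ∉ Ω) :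
    cut Ω m u z = -(m : ℝ) := by
  rw [cut, if_neg hz]

/-- Functions on `Ω` bounded above by `c` that are plurisubharmonic, possibly `-∞`. -/
structure PSub (u : Cn n → EReal) (Ω : Set (Cn n)) (c : ℝ) : Prop where
  op : IsOpen Ω
  usc : UpperSemicontinuousOn u Ω
  le : ∀ z ∈ Ω, u z ≤ (c : EReal)
  sub : ∀ m : ℕ, ∀ z ∈ Ω, ∀ w, ∃ ε > 0, ∀ r : ℝ, 0 < r → r < ε →
    cut Ω m u z ≤ Real.circleAverage (fun l : ℂ => cut Ω m u (z + l • w)) 0 r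

lemma PSub.lt_top {u : Cn n → EReal} {Ω : Set (Cn n)} {c : ℝ} (h : PSub u Ω c) {z : Cn n}
    (hz : z ∈ Ω) : u z < ⊤ := (h.le z hz).trans_lt (EReal.coe_lt_top c)

lemma neg_le_cut {Ω : Set (Cn n)} {u : Cn n → EReal} (hu : ∀ z ∈ Ω, u z < ⊤) (m : ℕ) (z : Cn n) :
    -(m : ℝ) ≤ cut Ω m u z := by
  by_cases hz : z ∈ Ω
  · rw [← EReal.coe_le_coe_iff, coe_cut hz (hu z hz)]
    exact le_max_right _ _
  · rw [cut_of_notMem hz]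

lemma cut_le {Ω : Set (Cn n)} {u : Cn n → EReal} {c : ℝ} (hu : ∀ z ∈ Ω, u z ≤ (c : EReal)) (m : ℕ)
    (z : Cn n) : cut Ω m u z ≤ max c (-(m : ℝ)) := by
  by_cases hz : z ∈ Ω
  · rw [← EReal.coe_le_coe_iff, coe_cut hz ((hu z hz).trans_lt (EReal.coe_lt_top c)),
      (EReal.coe_strictMono.monotone.map_max : ((max c (-(m:ℝ)) : ℝ) : EReal) = _)]
    exact max_le_max (hu z hz) le_rfl
  · rw [cut_of_notMem hz]; exact le_max_right _ _

lemma usc_cut {Ω : Set (Cn n)} {u : Cn n → EReal} (husc : UpperSemicontinuousOn u Ω)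
    (hu : ∀ z ∈ Ω, u z < ⊤) (m : ℕ) : UpperSemicontinuousOn (cut Ω m u) Ω := by
  intro z hz a ha
  rw [← EReal.coe_lt_coe_iff, coe_cut hz (hu z hz), max_lt_iff] at ha
  filter_upwards [husc z hz a ha.1, self_mem_nhdsWithin] with y hy hy'
  rw [← EReal.coe_lt_coe_iff, coe_cut hy' (hu y hy'), max_lt_iff]
  exact ⟨hy, ha.2⟩

lemma measurable_of_usc {Ω : Set (Cn n)} (ho : IsOpen Ω) {v : Cn n → ℝ}
    (hv : UpperSemicontinuousOn v Ω) {b : ℝ} (hb : ∀ z ∉ Ω, v z = b) : Measurable v := by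
  refine measurable_of_Iio fun a => ?_
  have h1 : IsOpen (Ω ∩ v ⁻¹' Set.Iio a) := by
    rw [isOpen_iff_mem_nhds]
    intro z hz
    have := hv z hz.1 a hz.2
    rw [ho.nhdsWithin_eq hz.1] at this
    filter_upwards [this, ho.mem_nhds hz.1] with y h1 h2
    exact ⟨h2, h1⟩
  have h2 : v ⁻¹' Set.Iio a = (Ω ∩ v ⁻¹' Set.Iio a) ∪ (Ωᶜ ∩ {_z | b < a}) := by
    ext z
    by_cases hz : z ∈ Ω
    · simp [hz]
    · simp [hz, hb z hz]
  rw [h2]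
  exact h1.measurableSet.union (ho.measurableSet.compl.inter (MeasurableSet.const _))

lemma PSub.bsub {u : Cn n → EReal} {Ω : Set (Cn n)} {c : ℝ} (h : PSub u Ω c) (m : ℕ) :
    BSub (cut Ω m u) Ω := by
  have hu : UpperSemicontinuousOn (cut Ω m u) Ω := usc_cut h.usc (fun z hz => h.lt_top hz) m
  refine ⟨measurable_of_usc h.op hu (fun z hz => cut_of_notMem hz), ⟨|c| + m, fun z => ?_⟩, hu, h.sub m⟩
  have h1 := neg_le_cut (fun z hz => h.lt_top hz) m z
  have h2 := cut_le h.le m z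
  have h3 := le_abs_self c
  have h4 := abs_nonneg c
  have h5 : (0:ℝ) ≤ m := Nat.cast_nonneg m
  rw [abs_le]
  exact ⟨by linarith, h2.trans (max_le (by linarith) (by linarith))⟩

lemma bounded_circleIntegrable {v : Cn n → ℝ} (hm : Measurable v) {B : ℝ} (hB : ∀ z, |v z| ≤ B)
    (z w : Cn n) (r : ℝ) : CircleIntegrable (fun l : ℂ => v (z + l • w)) 0 r := by
  have hc : Continuous fun θ : ℝ => z + circleMap 0 r θ • w := by
    have := continuous_circleMap 0 r; fun_prop
  refine (intervalIntegrable_const (c := B)).mono_fun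
    (hm.comp hc.measurable).aestronglyMeasurable (ae_of_all _ fun θ => ?_)
  exact (hB _).trans (le_abs_self B)

lemma circleAverage_of_const_le {v : Cn n → ℝ} (hm : Measurable v) {B : ℝ} (hB : ∀ z, |v z| ≤ B)
    {a : ℝ} (ha : ∀ z, a ≤ v z) (z w : Cn n) (r : ℝ) :
    a ≤ Real.circleAverage (fun l : ℂ => v (z + l • w)) 0 r := by
  have := Real.circleAverage_mono (c := 0) (R := r) (f₁ := fun _ => a) (circleIntegrable_const a 0 r)
    (bounded_circleIntegrable hm hB z w r) (fun x _ => ha _)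
  rwa [Real.circleAverage_const] at this

lemma circleAvg_eq {u : Cn n → EReal} {Ω : Set (Cn n)} {z w : Cn n} {r : ℝ} (hr : 0 < r)
    (hin : ∀ l : ℂ, ‖l‖ = r → z + l • w ∈ Ω) (m : ℕ) :
    circleAvg u z w r m = Real.circleAverage (fun l : ℂ => cut Ω m u (z + l • w)) 0 r := by
  rw [circleAvg, Real.circleAverage_def, smul_eq_mul]
  congr 1
  refine intervalIntegral.integral_congr fun θ _ => ?_
  have h1 : circleMap 0 r θ = (r : ℂ) * Complex.exp (Complex.I * θ) := by
    rw [circleMap, zero_add, mul_comm Complex.I]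
  show _ = cut Ω m u _
  rw [h1, cut, if_pos]
  exact hin _ (by rw [← h1]; simp [abs_of_pos hr])

lemma exists_small_disc {Ω : Set (Cn n)} (ho : IsOpen Ω) {z : Cn n} (hz : z ∈ Ω) (w : Cn n) :
    ∃ ε > 0, ∀ l : ℂ, ‖l‖ < ε → z + l • w ∈ Ω := by
  have hc : ContinuousAt (fun l : ℂ => z + l • w) 0 := by fun_prop
  have := hc.preimage_mem_nhds (ho.mem_nhds (by simpa using hz))
  obtain ⟨ε, hε, h⟩ := Metric.mem_nhds_iff.1 this
  exact ⟨ε, hε, fun l hl => h (by simpa using hl)⟩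

lemma _root_.PSHOn.psub {u : Cn n → EReal} {U Ω : Set (Cn n)} {c : ℝ} (h : PSHOn u U) (ho : IsOpen Ω)
    (hs : Ω ⊆ U) (hc : ∀ z ∈ Ω, u z ≤ (c : EReal)) : PSub u Ω c := by
  have husc := h.usc.mono hs
  have htop : ∀ z ∈ Ω, u z < ⊤ := fun z hz => h.lt_top z (hs hz)
  refine ⟨ho, husc, hc, fun m z hz w => ?_⟩
  obtain ⟨ε, hε, h1⟩ := h.submean z (hs hz) w
  obtain ⟨ε', hε', h2⟩ := exists_small_disc ho hz w
  refine ⟨min ε ε', lt_min hε hε', fun r hr hr' => ?_⟩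
  rw [← EReal.coe_le_coe_iff, coe_cut hz (htop z hz)]
  refine max_le ?_ ?_
  · rw [← circleAvg_eq hr (fun l hl => h2 l (hl.trans_lt (hr'.trans_le (min_le_right _ _))))]
    exact (h1 r hr (hr'.trans_le (min_le_left _ _))).trans (iInf_le _ m)
  · rw [EReal.coe_le_coe_iff]
    refine circleAverage_of_const_le (B := |c| + m)
      (measurable_of_usc ho (usc_cut husc htop m) (fun z hz => cut_of_notMem hz)) (fun z => ?_)
      (neg_le_cut htop m) z w r
    have h1 := neg_le_cut htop m z
    have h2 := cut_le hc m z
    have h3 := le_abs_self c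
    have h4 := abs_nonneg c
    have h5 : (0:ℝ) ≤ m := Nat.cast_nonneg m
    rw [abs_le]
    exact ⟨by linarith, h2.trans (max_le (by linarith) (by linarith))⟩

lemma PSub.pshOn {u : Cn n → EReal} {Ω : Set (Cn n)} {c : ℝ} (h : PSub u Ω c)
    (hb : ∀ z ∈ Ω, ∃ w ∈ connectedComponentIn Ω z, u w ≠ ⊥) : PSHOn u Ω := by
  refine ⟨h.usc, fun z hz => h.lt_top hz, hb, fun z hz w => ?_⟩
  obtain ⟨ε, hε, h2⟩ := exists_small_disc h.op hz w
  refine ⟨ε, hε, fun r hr hr' => le_iInf fun m => ?_⟩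
  have hin : ∀ l : ℂ, ‖l‖ ≤ r → z + l • w ∈ Ω := fun l hl => h2 l (hl.trans_lt hr')
  rw [circleAvg_eq hr (fun l hl => hin l hl.le)]
  refine le_trans ?_ (EReal.coe_le_coe_iff.2 ((h.bsub m).submean hr hin))
  rw [coe_cut hz (h.lt_top hz)]
  exact le_max_left _ _

lemma rho_pos {ε : ℝ} (hε : 0 < ε) {y : Cn n} (hy : ssq y < ε ^ 2) : 0 < rho ε y := by
  have := rhoMass_pos (n := n)
  unfold rho rho0
  refine mul_pos (by positivity) (Real.smoothTransition.pos_of_pos ?_)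
  have h1 : (ε⁻¹ • y : Cn n) = ((ε⁻¹ : ℝ) : ℂ) • y := by ext i; simp
  rw [h1, ssq_smul, Complex.norm_real, Real.norm_of_nonneg (by positivity), inv_pow,
    inv_mul_eq_div, sub_pos, div_lt_one (by positivity)]
  exact hy

lemma PSub.measurableSet_bot {u : Cn n → EReal} {Ω : Set (Cn n)} {c : ℝ} (h : PSub u Ω c) :
    MeasurableSet {z ∈ Ω | u z = ⊥} := by
  have : {z ∈ Ω | u z = ⊥} = Ω ∩ ⋂ m : ℕ, cut Ω m u ⁻¹' {-(m : ℝ)} := by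
    ext z
    simp only [Set.mem_ofPred_eq, Set.mem_inter_iff, Set.mem_iInter, Set.mem_preimage,
      Set.mem_singleton_iff, and_congr_right_iff]
    intro hz
    constructor
    · intro hu m
      rw [← EReal.coe_eq_coe_iff, coe_cut hz (h.lt_top hz), hu]
      simp
    · intro hm
      rw [EReal.eq_bot_iff_forall_lt]
      intro y
      obtain ⟨k, hk⟩ := exists_nat_gt (-y)
      have := hm k
      rw [← EReal.coe_eq_coe_iff, coe_cut hz (h.lt_top hz)] at this
      refine ((le_max_left _ _).trans_eq this).trans_lt (EReal.coe_lt_coe_iff.2 (by linarith))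
  rw [this]
  exact h.op.measurableSet.inter
    (MeasurableSet.iInter fun m => (h.bsub m).meas (measurableSet_singleton _))

/-- If a plurisubharmonic function is finite at a point then it is finite almost everywhere
nearby. -/
lemma PSub.ae_ne_bot_of_ne {u : Cn n → EReal} {Ω : Set (Cn n)} {c : ℝ} (h : PSub u Ω c) {x : Cn n}
    {ε : ℝ} (hε : 0 < ε) (hin : Metric.closedBall x ε ⊆ Ω) (hx : u x ≠ ⊥) :
    ∀ᵐ y, ssq (x - y) < ε ^ 2 → u y ≠ ⊥ := by
  have hxΩ : x ∈ Ω := hin (Metric.mem_closedBall_self hε.le)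
  set E := {z ∈ Ω | u z = ⊥} with hE
  have hEm : MeasurableSet E := h.measurableSet_bot
  set S := (fun y => x - y) ⁻¹' E with hS
  have hSm : MeasurableSet S := hEm.preimage (measurable_const.sub measurable_id)
  set a := ∫ y in S, rho ε y with ha
  set C := max c 0 with hC
  have hle : ∀ m : ℕ, cut Ω m u x ≤ C - m * a := fun m => by
    have hb := h.bsub m
    obtain ⟨B, hB⟩ := hb.bdd
    refine (hb.le_rm hε hin).trans ?_
    have e1 : C - m * a ≥ ∫ y : Cn n, (C * rho ε y - m * S.indicator (rho ε) y) := by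
      rw [integral_sub ((integrable_rho hε).const_mul C)
        (((integrable_rho hε).indicator hSm).const_mul _), integral_const_mul, integral_const_mul,
        integral_rho hε, integral_indicator hSm, mul_one]
    refine le_trans ?_ e1
    rw [rm_eq]
    refine integral_mono (integrable_rho_mul hε (v := fun y => cut Ω m u (x - y))
      (hb.meas.comp (measurable_const.sub measurable_id)) fun y => hB _)
      (((integrable_rho hε).const_mul C).sub
        (((integrable_rho hε).indicator hSm).const_mul _)) fun y => ?_
    show rho ε y * cut Ω m u (x - y) ≤ C * rho ε y - m * S.indicator (rho ε) y
    have hr := rho_nonneg hε y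
    have hC0 : 0 ≤ C := le_max_right _ _
    by_cases hy : y ∈ S
    · rw [Set.indicator_of_mem hy]
      have : cut Ω m u (x - y) = -(m : ℝ) := by
        have hy1 : x - y ∈ Ω := hy.1
        rw [← EReal.coe_eq_coe_iff, coe_cut hy1 (h.lt_top hy1), show u (x - y) = ⊥ from hy.2]
        simp
      rw [this]; nlinarith
    · rw [Set.indicator_of_notMem hy]
      have h2 := cut_le h.le m (x - y)
      have : cut Ω m u (x - y) ≤ C := h2.trans (max_le (le_max_left _ _)
        (le_trans (by simp) (le_max_right c 0)))
      nlinarith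
  have hux : ∀ m : ℕ, (u x).toReal ≤ cut Ω m u x := fun m => by
    rw [← EReal.coe_le_coe_iff, coe_cut hxΩ (h.lt_top hxΩ), EReal.coe_toReal (h.lt_top hxΩ).ne hx]
    exact le_max_left _ _
  have ha0 : 0 ≤ a := integral_nonneg fun y => rho_nonneg hε y
  have haz : a = 0 := by
    by_contra hne
    have hpos : 0 < a := lt_of_le_of_ne ha0 (Ne.symm hne)
    obtain ⟨m, hm⟩ := exists_nat_gt ((C - (u x).toReal) / a)
    rw [div_lt_iff₀ hpos] at hm
    linarith [hle m, hux m]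
  rw [ha, setIntegral_eq_zero_iff_of_nonneg_ae (ae_of_all _ fun y => rho_nonneg hε y)
    (integrable_rho hε).integrableOn] at haz
  rw [EventuallyEq, ae_restrict_iff' hSm] at haz
  have hmp : MeasurePreserving (fun y : Cn n => x - y) := Measure.measurePreserving_sub_left volume x
  have := hmp.quasiMeasurePreserving.ae haz
  filter_upwards [this] with y hy hys hbot
  have hyB : y ∈ Metric.closedBall x ε := by
    rw [mem_closedBall_iff_norm']
    have := norm_sq_le_ssq (x - y)
    exact abs_le_of_sq_le_sq (by linarith) hε.le |>.trans' (le_abs_self _)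
  have h3 := hy (by
    show x - (x - y) ∈ E
    rw [sub_sub_cancel]; exact ⟨hin hyB, hbot⟩)
  exact (rho_pos hε hys).ne' h3

lemma _root_.PSHOn.exists_bound {u : Cn n → EReal} {U : Set (Cn n)} (h : PSHOn u U)
    (ho : IsOpen U) {x : Cn n} (hx : x ∈ U) : ∃ c : ℝ, ∀ᶠ y in 𝓝 x, y ∈ U ∧ u y ≤ (c : EReal) := by
  obtain ⟨c, hc, -⟩ := EReal.lt_iff_exists_real_btwn.1 (h.lt_top x hx)
  refine ⟨c, ?_⟩
  have := h.usc x hx c hc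
  rw [ho.nhdsWithin_eq hx] at this
  filter_upwards [this, ho.mem_nhds hx] with y h1 h2
  exact ⟨h2, le_of_lt h1⟩

lemma _root_.PSHOn.ae_ne_bot {u : Cn n → EReal} {U : Set (Cn n)} (h : PSHOn u U) (ho : IsOpen U)
    {x : Cn n} (hx : x ∈ U) : ∃ V, IsOpen V ∧ x ∈ V ∧ ∀ᵐ y, y ∈ V → u y ≠ ⊥ := by
  set A := ⋃₀ {V : Set (Cn n) | IsOpen V ∧ ∀ᵐ y, y ∈ V → u y ≠ ⊥} with hA
  set B := ⋃₀ {V : Set (Cn n) | IsOpen V ∧ ∀ y ∈ V, u y = ⊥} with hB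
  have hcov : U ⊆ A ∪ B := by
    intro z hz
    obtain ⟨c, hc⟩ := h.exists_bound ho hz
    obtain ⟨δ', hδ', hsub⟩ := Metric.eventually_nhds_iff_ball.1 hc
    set δ := δ' / 3 with hδ
    have hδ0 : 0 < δ := by positivity
    have hp : PSub u (Metric.ball z δ') c :=
      h.psub Metric.isOpen_ball (fun y hy => (hsub y hy).1) fun y hy => (hsub y hy).2
    by_cases hb : ∀ y, ssq (y - z) < δ ^ 2 → u y = ⊥
    · refine Or.inr ⟨{y | ssq (y - z) < δ ^ 2}, ⟨?_, hb⟩, ?_⟩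
      · exact isOpen_lt (sm_ssq.continuous.comp (by fun_prop)) continuous_const
      · show ssq (z - z) < δ ^ 2
        simp [ssq]; positivity
    · push Not at hb
      obtain ⟨y, hy, hyb⟩ := hb
      have hyz : ‖y - z‖ ≤ δ :=
        abs_le_of_sq_le_sq (by linarith [norm_sq_le_ssq (y - z)]) hδ0.le |>.trans' (le_abs_self _)
      refine Or.inl ⟨{x | ssq (y - x) < δ ^ 2}, ⟨?_, hp.ae_ne_bot_of_ne hδ0 (fun x hx => ?_) hyb⟩, hy⟩
      · exact isOpen_lt (sm_ssq.continuous.comp (by fun_prop)) continuous_const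
      · rw [mem_closedBall_iff_norm] at hx
        rw [mem_ball_iff_norm]
        have := norm_add_le (x - y) (y - z)
        rw [sub_add_sub_cancel] at this
        linarith
  have hAo : IsOpen A := isOpen_sUnion fun V hV => hV.1
  have hBo : IsOpen B := isOpen_sUnion fun V hV => hV.1
  have hdis : ∀ z, z ∈ A → z ∉ B := by
    rintro z ⟨V, ⟨hV, hVa⟩, hzV⟩ ⟨V', ⟨hV', hVb⟩, hzV'⟩
    have hpos : 0 < volume (V ∩ V') := (hV.inter hV').measure_pos volume ⟨z, hzV, hzV'⟩
    refine hpos.ne' (measure_mono_null (fun y hy => ?_) hVa)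
    exact fun hc => hc hy.1 (hVb y hy.2)
  obtain ⟨w, hw, hwb⟩ := h.not_botOnComponents x hx
  have hK := connectedComponentIn_subset U x
  have hwA : w ∈ A := (hcov (hK hw)).resolve_right fun ⟨V, hV, hwV⟩ => hwb (hV.2 w hwV)
  have hxA : x ∈ A := by
    refine (hcov hx).resolve_right fun hxB => ?_
    obtain ⟨z, -, hzA, hzB⟩ := isPreconnected_connectedComponentIn A B hAo hBo (hK.trans hcov)
      ⟨w, hw, hwA⟩ ⟨x, mem_connectedComponentIn hx, hxB⟩
    exact hdis z hzA hzB
  obtain ⟨V, hV, hxV⟩ := hxA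
  exact ⟨V, hV.1, hxV, hV.2⟩

/-- Bounded-above plurisubharmonic functions on the Euclidean ball `eb R`, finite almost
everywhere. -/
structure Psh (R c : ℝ) (u : Cn n → EReal) : Prop where
  psub : PSub u (eb R) c
  ae : ∀ᵐ z ∂(volume.restrict (eb R)), u z ≠ ⊥

lemma _root_.PSHNear.psh {u : Cn n → EReal} (h : PSHNear u) :
    ∃ R₀ > 0, ∃ c : ℝ, ∀ R, 0 < R → R ≤ R₀ → ∀ c', c ≤ c' → Psh R c' u := by
  obtain ⟨U, hU, ho, hu⟩ := h
  have h0 : (0 : Cn n) ∈ U := mem_of_mem_nhds hU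
  obtain ⟨c, hc⟩ := hu.exists_bound ho h0
  obtain ⟨V, hV, h0V, hVa⟩ := hu.ae_ne_bot ho h0
  obtain ⟨R₀, hR₀, hs⟩ := exists_eb_subset (inter_mem hc (hV.mem_nhds h0V))
  refine ⟨R₀, hR₀, c, fun R hR hRR c' hc' => ?_⟩
  have hs' : eb R ⊆ _ := (eb_mono hRR).trans hs
  refine ⟨hu.psub (isOpen_eb R) (fun z hz => (hs' hz).1.1) fun z hz =>
    (hs' hz).1.2.trans (EReal.coe_le_coe_iff.2 hc'), ?_⟩
  rw [ae_restrict_iff' (isOpen_eb R).measurableSet]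
  filter_upwards [hVa] with z hz hzR
  exact hz (hs' hzR).2

lemma zero_mem_eb {R : ℝ} (hR : 0 < R) : (0 : Cn n) ∈ eb R := by
  show ssq 0 < R
  simpa [ssq] using hR

lemma convex_eb (R : ℝ) : IsPreconnected (eb R : Set (Cn n)) := by
  rcases le_or_gt R 0 with hR | hR
  · have : (eb R : Set (Cn n)) = ∅ := by
      ext z
      simp only [Set.mem_empty_iff_false, iff_false]
      exact fun hz => absurd (show ssq z < R from hz) (not_lt.2 (hR.trans (ssq_nonneg z)))
    rw [this]; exact isPreconnected_empty
  · refine (StarConvex.isPathConnected (a := (0 : Cn n)) ?_ (zero_mem_eb hR)).isConnected.isPreconnected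
    intro y hy a b ha hb hab
    rw [smul_zero, zero_add]
    have h1 : (b • y : Cn n) = ((b : ℝ) : ℂ) • y := by ext i; simp
    show ssq (b • y) < R
    rw [h1, ssq_smul, Complex.norm_real, Real.norm_of_nonneg hb]
    have : ssq y < R := hy
    have h2 := ssq_nonneg y
    nlinarith [mul_le_mul_of_nonneg_right (show b ^ 2 ≤ 1 by nlinarith) h2]

lemma Psh.pshOn {R c : ℝ} {u : Cn n → EReal} (h : Psh R c u) : PSHOn u (eb R) := by
  refine h.psub.pshOn fun z hz => ?_
  rw [(convex_eb R).connectedComponentIn hz]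
  have hpos : 0 < volume (eb R : Set (Cn n)) := (isOpen_eb R).measure_pos volume ⟨z, hz⟩
  by_contra! hc
  have h1 := h.ae
  rw [ae_restrict_iff' (isOpen_eb R).measurableSet] at h1
  refine hpos.ne' (measure_mono_null (fun y hy => ?_) h1)
  exact fun h' => h' hy (hc y hy)

lemma Psh.pshNear {R c : ℝ} (hR : 0 < R) {u : Cn n → EReal} (h : Psh R c u) : PSHNear u :=
  ⟨eb R, eb_mem_nhds hR, isOpen_eb R, h.pshOn⟩

/-- Truncations of plurisubharmonic functions are limits of smooth plurisubharmonic functions. -/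
lemma PSub.appr {u : Cn n → EReal} {R R' : ℝ} (h : PSub u (eb R') (-1)) (hR : R < R') {m : ℕ}
    (hm : 1 ≤ m) : Appr R (cut (eb R') m u) := by
  obtain ⟨ε', hε', hth⟩ := eb_thick (n := n) hR
  set ε := ε' / 2
  have hε : 0 < ε := half_pos hε'
  have hb := h.bsub m
  obtain ⟨B, hB⟩ := hb.bdd
  have hl := locInt_of_bdd hb.meas hB
  set e : ℕ → ℝ := fun j => ε / (j + 2) with he
  have he0 : ∀ j, 0 < e j := fun j => by simp only [he]; positivity
  have heε : ∀ j, e j < ε := fun j => by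
    simp only [he]
    exact div_lt_self hε (by have : (0:ℝ) ≤ j := Nat.cast_nonneg j
                             linarith)
  have helim : Tendsto e atTop (𝓝[>] 0) := by
    refine tendsto_nhdsWithin_iff.2 ⟨?_, Eventually.of_forall he0⟩
    have : Tendsto (fun j : ℕ => (j : ℝ) + 2) atTop atTop :=
      tendsto_atTop_add_const_right _ _ tendsto_natCast_atTop_atTop
    exact this.const_div_atTop ε
  have hm1 : (1:ℝ) ≤ m := by exact_mod_cast hm
  refine ⟨fun j => rm (e j) (cut (eb R') m u), fun j => sm_rm (he0 j) hl, fun j z => ?_,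
    fun j z hz ξ => ?_, ?_⟩
  · refine rm_le (he0 j) hb.meas hB fun y _ => (cut_le h.le m _).trans (max_le le_rfl ?_)
    linarith
  · exact hb.levi_rm (he0 j) (heε j) 
      ((Metric.closedBall_subset_ball (half_lt_self hε')).trans (hth z (le_of_lt hz))) ξ
  · refine ae_restrict_of_ae ?_
    filter_upwards [moll_ae hl] with z hz
    have := (Complex.continuous_re.tendsto _).comp (hz.comp helim)
    exact this

lemma tendsto_cut {u : Cn n → EReal} {Ω : Set (Cn n)} {z : Cn n} (hz : z ∈ Ω) (h1 : u z ≠ ⊥)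
    (h2 : u z < ⊤) : Tendsto (fun m => cut Ω m u z) atTop (𝓝 (u z).toReal) := by
  refine tendsto_const_nhds.congr' ?_
  obtain ⟨k, hk⟩ := exists_nat_gt (-(u z).toReal)
  filter_upwards [eventually_ge_atTop k] with m hm
  rw [← EReal.coe_eq_coe_iff, coe_cut hz h2, EReal.coe_toReal h2.ne h1, max_eq_left]
  rw [← EReal.coe_toReal h2.ne h1, EReal.coe_le_coe_iff]
  have : (k : ℝ) ≤ m := by exact_mod_cast hm
  linarith

lemma Psh.est {u v : Cn n → EReal} {R R' : ℝ} (hu : Psh R' (-1) u) (hv : Psh R' (-1) v)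
    (hR : R < R') {c : ℝ} (hc : 0 ≤ c) :
    AEMeasurable (fun z => (u z).toReal + c * (v z).toReal) (volume.restrict (eb R)) ∧
    (∀ᵐ z ∂(volume.restrict (eb R)), (u z).toReal + c * (v z).toReal ≤ 0) ∧
    Est R fun z => (u z).toReal + c * (v z).toReal := by
  have hA : ∀ m : ℕ, Appr R fun z => cut (eb R') (m + 1) u z + c * cut (eb R') (m + 1) v z :=
    fun m => (hu.psub.appr hR (by simp)).add_mul (hv.psub.appr hR (by simp)) hc
  have hlim : ∀ᵐ z ∂(volume.restrict (eb R)),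
      Tendsto (fun m : ℕ => cut (eb R') (m + 1) u z + c * cut (eb R') (m + 1) v z) atTop
        (𝓝 ((u z).toReal + c * (v z).toReal)) := by
    filter_upwards [ae_restrict_of_ae_restrict_of_subset (eb_mono hR.le) hu.ae,
      ae_restrict_of_ae_restrict_of_subset (eb_mono hR.le) hv.ae,
      ae_restrict_mem (isOpen_eb R).measurableSet] with z h1 h2 hz
    have hz' := eb_mono hR.le hz
    exact ((tendsto_cut hz' h1 (hu.psub.lt_top hz')).comp (tendsto_add_atTop_nat 1)).add
      (((tendsto_cut hz' h2 (hv.psub.lt_top hz')).comp (tendsto_add_atTop_nat 1)).const_mul c)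
  have h0 : ∀ j : ℕ, ∀ᵐ z ∂(volume.restrict (eb R)),
      cut (eb R') (j + 1) u z + c * cut (eb R') (j + 1) v z ≤ 0 := fun j => by
    filter_upwards [(hA j).le] with z hz
    linarith
  refine ⟨aemeasurable_of_tendsto_metrizable_ae' (fun m => (hA m).aemeasurable) hlim, ?_,
    est_limit (fun m => (hA m).aemeasurable) h0 (fun m => (hA m).est) hlim⟩
  filter_upwards [hlim, ae_all_iff.2 h0] with z h1 h2
  exact le_of_tendsto' h1 h2

lemma BSub.max {v w : Cn n → ℝ} {Ω : Set (Cn n)} (hv : BSub v Ω) (hw : BSub w Ω) :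
    BSub (fun z => Max.max (v z) (w z)) Ω := by
  obtain ⟨B, hB⟩ := hv.bdd
  obtain ⟨B', hB'⟩ := hw.bdd
  have hm : Measurable fun z => Max.max (v z) (w z) := hv.meas.max hw.meas
  have hbd : ∀ z, |Max.max (v z) (w z)| ≤ Max.max B B' := fun z =>
    abs_max_le_max_abs_abs.trans (max_le_max (hB z) (hB' z))
  refine ⟨hm, ⟨_, hbd⟩, hv.usc.sup hw.usc, fun z hz ξ => ?_⟩
  obtain ⟨ε, hε, h1⟩ := hv.sub z hz ξ
  obtain ⟨ε', hε', h2⟩ := hw.sub z hz ξ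
  refine ⟨min ε ε', lt_min hε hε', fun r hr hr' => max_le ?_ ?_⟩
  · exact (h1 r hr (hr'.trans_le (min_le_left _ _))).trans (Real.circleAverage_mono
      (bounded_circleIntegrable hv.meas hB z ξ r) (bounded_circleIntegrable hm hbd z ξ r)
      fun l _ => le_max_left _ _)
  · exact (h2 r hr (hr'.trans_le (min_le_right _ _))).trans (Real.circleAverage_mono
      (bounded_circleIntegrable hw.meas hB' z ξ r) (bounded_circleIntegrable hm hbd z ξ r)
      fun l _ => le_max_right _ _)

lemma BSub.const (b : ℝ) (Ω : Set (Cn n)) : BSub (fun _ => b) Ω :=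
  ⟨measurable_const, ⟨|b|, fun _ => le_rfl⟩, upperSemicontinuousOn_const, fun z _ w =>
    ⟨1, one_pos, fun r _ _ => by rw [Real.circleAverage_const]⟩⟩

lemma BSub.add_const {v : Cn n → ℝ} {Ω : Set (Cn n)} (hv : BSub v Ω) (b : ℝ) :
    BSub (fun z => v z + b) Ω := by
  obtain ⟨B, hB⟩ := hv.bdd
  refine ⟨hv.meas.add_const b, ⟨B + |b|, fun z => (abs_add_le _ _).trans (by gcongr; exact hB z)⟩,
    fun z hz a ha => ?_, fun z hz w => ?_⟩
  · filter_upwards [hv.usc z hz (a - b) (by simp only at ha; linarith)] with y hy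
    linarith
  · obtain ⟨ε, hε, h1⟩ := hv.sub z hz w
    refine ⟨ε, hε, fun r hr hr' => ?_⟩
    rw [Real.circleAverage_fun_add (bounded_circleIntegrable hv.meas hB z w r)
      (circleIntegrable_const b 0 r), Real.circleAverage_const]
    linarith [h1 r hr hr']

/-- Plurisubharmonicity is local. -/
lemma PSub.of_local {u : Cn n → EReal} {Ω : Set (Cn n)} {c : ℝ} (ho : IsOpen Ω)
    (hle : ∀ z ∈ Ω, u z ≤ (c : EReal)) (husc : UpperSemicontinuousOn u Ω)
    (h : ∀ m : ℕ, ∀ z ∈ Ω, ∃ v Ω', IsOpen Ω' ∧ z ∈ Ω' ∧ BSub v Ω' ∧ ∀ y ∈ Ω', cut Ω m u y = v y) :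
    PSub u Ω c := by
  refine ⟨ho, husc, hle, fun m z hz w => ?_⟩
  obtain ⟨v, Ω', ho', hz', hv, he⟩ := h m z hz
  obtain ⟨ε, hε, h1⟩ := hv.sub z hz' w
  obtain ⟨ε', hε', h2⟩ := exists_small_disc ho' hz' w
  refine ⟨min ε ε', lt_min hε hε', fun r hr hr' => ?_⟩
  rw [he z hz', Real.circleAverage_congr_sphere (f₂ := fun l : ℂ => v (z + l • w))]
  · exact h1 r hr (hr'.trans_le (min_le_left _ _))
  · intro l hl
    refine he _ (h2 l ?_)
    have : ‖l‖ = r := by simpa [abs_of_pos hr] using hl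
    rw [this]; exact hr'.trans_le (min_le_right _ _)

lemma PSub.mono {u : Cn n → EReal} {Ω Ω' : Set (Cn n)} {c c' : ℝ} (h : PSub u Ω c) (ho : IsOpen Ω')
    (hs : Ω' ⊆ Ω) (hc : c ≤ c') : PSub u Ω' c' := by
  refine PSub.of_local ho (fun z hz => (h.le z (hs hz)).trans (EReal.coe_le_coe_iff.2 hc))
    (h.usc.mono hs) fun m z hz => ⟨cut Ω m u, Ω', ho, hz, (h.bsub m).mono hs, fun y hy => ?_⟩
  rw [cut, cut, if_pos hy, if_pos (hs hy)]

lemma cut_max {u v : Cn n → EReal} {Ω : Set (Cn n)} {m : ℕ} {z : Cn n} (hz : z ∈ Ω)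
    (hu : u z < ⊤) (hv : v z < ⊤) :
    cut Ω m (fun z => Max.max (u z) (v z)) z = Max.max (cut Ω m u z) (cut Ω m v z) := by
  rw [← EReal.coe_eq_coe_iff, coe_cut hz (max_lt hu hv),
    (EReal.coe_strictMono.monotone.map_max : ((Max.max (cut Ω m u z) (cut Ω m v z) : ℝ) : EReal) = _),
    coe_cut hz hu, coe_cut hz hv, max_max_max_comm, max_self]

lemma PSub.max {u v : Cn n → EReal} {Ω : Set (Cn n)} {c : ℝ} (hu : PSub u Ω c) (hv : PSub v Ω c) :
    PSub (fun z => Max.max (u z) (v z)) Ω c :=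
  PSub.of_local hu.op (fun z hz => max_le (hu.le z hz) (hv.le z hz)) (hu.usc.sup hv.usc)
    fun m _ hz => ⟨_, Ω, hu.op, hz, (hu.bsub m).max (hv.bsub m), fun _ hy =>
      cut_max hy (hu.lt_top hy) (hv.lt_top hy)⟩

lemma PSub.add_const {u : Cn n → EReal} {Ω : Set (Cn n)} {c : ℝ} (h : PSub u Ω c) (b : ℝ) :
    PSub (fun z => u z + (b : EReal)) Ω (c + b) := by
  have hle : ∀ z ∈ Ω, u z + (b : EReal) ≤ ((c + b : ℝ) : EReal) := fun z hz => by
    rw [EReal.coe_add]; exact add_le_add_left (h.le z hz) _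
  refine PSub.of_local h.op hle (fun z hz a ha => ?_) fun m z hz => ?_
  · obtain ⟨a', ha1, ha2⟩ := EReal.lt_iff_exists_real_btwn.1 ha
    have : u z < ((a' - b : ℝ) : EReal) := by
      rw [EReal.coe_sub]
      exact EReal.lt_sub_iff_add_lt (by simp) (by simp) |>.2 ha1
    filter_upwards [h.usc z hz _ this] with y hy
    refine lt_trans ?_ ha2
    rw [EReal.coe_sub] at hy
    exact EReal.lt_sub_iff_add_lt (by simp) (by simp) |>.1 hy
  · obtain ⟨M, hM⟩ := exists_nat_gt (m + b)
    refine ⟨fun z => Max.max (cut Ω M u z) (-m - b) + b, Ω, h.op, hz,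
      ((h.bsub M).max (BSub.const _ Ω)).add_const b, fun y hy => ?_⟩
    have ht := h.lt_top hy
    show _ = Max.max (cut Ω M u y) (-m - b) + b
    rw [← EReal.coe_eq_coe_iff, coe_cut hy ((hle y hy).trans_lt (EReal.coe_lt_top _)),
      ← max_add_add_right, (EReal.coe_strictMono.monotone.map_max :
        ((Max.max (cut Ω M u y + b) (-m - b + b) : ℝ) : EReal) = _), EReal.coe_add, coe_cut hy ht,
      ← max_add_add_right (u y), max_assoc]
    congr 1
    rw [sub_add_cancel, ← EReal.coe_add, max_eq_right]
    rw [EReal.coe_le_coe_iff]; linarith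

lemma mul_elog {N t : ℝ} (ht : 0 < t) : (N : EReal) * elog t = ((N * Real.log t : ℝ) : EReal) := by
  rw [elog, if_neg (not_le.2 ht), EReal.coe_mul]

lemma mul_elog_of_nonpos {N t : ℝ} (hN : 0 < N) (ht : t ≤ 0) : (N : EReal) * elog t = ⊥ := by
  rw [elog, if_pos ht, EReal.coe_mul_bot_of_pos hN]

lemma mul_elog_lt {N t b : ℝ} (hN : 0 < N) (ht : 0 ≤ t) :
    (N : EReal) * elog t < (b : EReal) ↔ t < Real.exp (b / N) := by
  rcases ht.eq_or_lt with h | h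
  · rw [← h, mul_elog_of_nonpos hN le_rfl]
    simp [Real.exp_pos]
  · rw [mul_elog h, EReal.coe_lt_coe_iff, ← Real.log_lt_iff_lt_exp h, lt_div_iff₀ hN, mul_comm]

lemma usc_elog {N : ℝ} (hN : 0 < N) :
    UpperSemicontinuous fun z : Cn n => (N : EReal) * elog ‖z‖ := by
  intro z a ha
  obtain ⟨b, h1, h2⟩ := EReal.lt_iff_exists_real_btwn.1 ha
  rw [mul_elog_lt hN (norm_nonneg _)] at h1
  filter_upwards [(isOpen_lt (continuous_norm (E := Cn n)) continuous_const).mem_nhds h1] with y hy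
  exact ((mul_elog_lt hN (norm_nonneg _)).2 hy).trans h2

lemma psub_elog {N R : ℝ} (hN : 0 < N) {c : ℝ} (hc : N * Real.log (Real.sqrt R) ≤ c) :
    PSub (fun z : Cn n => (N : EReal) * elog ‖z‖) (eb R) c := by
  have hle : ∀ z ∈ (eb R : Set (Cn n)), (N : EReal) * elog ‖z‖ ≤ (c : EReal) := fun z hz => by
    rcases (norm_nonneg z).eq_or_lt with h | h
    · rw [← h, mul_elog_of_nonpos hN le_rfl]; exact bot_le
    · rw [mul_elog h, EReal.coe_le_coe_iff]
      refine le_trans ?_ hc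
      have : ‖z‖ ≤ Real.sqrt R := Real.le_sqrt_of_sq_le
        ((norm_sq_le_ssq z).trans (le_of_lt hz))
      gcongr
  have hlt : ∀ z ∈ (eb R : Set (Cn n)), (N : EReal) * elog ‖z‖ < ⊤ := fun z hz =>
    (hle z hz).trans_lt (EReal.coe_lt_top c)
  have husc := (usc_elog (n := n) hN).upperSemicontinuousOn (eb R)
  refine ⟨isOpen_eb R, husc, hle, fun m z hz w => ?_⟩
  have hm := measurable_of_usc (isOpen_eb R) (usc_cut husc hlt m) (fun z hz => cut_of_notMem hz)
  have hB : ∀ z, |cut (eb R) m (fun z : Cn n => (N : EReal) * elog ‖z‖) z| ≤ |c| + m := fun z => by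
    have h1 := neg_le_cut hlt m z
    have h2 := cut_le hle m z
    have h3 := le_abs_self c
    have h4 := abs_nonneg c
    have h5 : (0:ℝ) ≤ m := Nat.cast_nonneg m
    rw [abs_le]
    exact ⟨by linarith, h2.trans (max_le (by linarith) (by linarith))⟩
  have hconst := fun r => circleAverage_of_const_le hm hB (neg_le_cut hlt m) z w r
  rcases (norm_nonneg z).eq_or_lt with h | h
  · refine ⟨1, one_pos, fun r _ _ => le_trans (le_of_eq ?_) (hconst r)⟩
    rw [← EReal.coe_eq_coe_iff, coe_cut hz (hlt z hz), ← h, mul_elog_of_nonpos hN le_rfl]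
    simp
  · obtain ⟨i, hi⟩ : ∃ i, ‖z i‖ = ‖z‖ := by
      by_contra! hne
      have : ‖z‖ < ‖z‖ := (pi_norm_lt_iff h).2 fun i => lt_of_le_of_ne (norm_le_pi_norm z i) (hne i)
      exact this.false
    obtain ⟨ε, hε, h2⟩ := exists_small_disc
      ((isOpen_eb R).inter (isOpen_ne_fun (continuous_apply i) continuous_const))
      (z := z) ⟨hz, show z i ≠ 0 by rw [← norm_pos_iff, hi]; exact h⟩ w
    refine ⟨ε, hε, fun r hr hr' => ?_⟩
    rw [← EReal.coe_le_coe_iff, coe_cut hz (hlt z hz)]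
    refine max_le ?_ (EReal.coe_le_coe_iff.2 (hconst r))
    rw [mul_elog h, EReal.coe_le_coe_iff, ← hi]
    have hh : Real.circleAverage (fun l : ℂ => Real.log ‖z i + l * w i‖) 0 r
        = Real.log ‖z i‖ := by
      have := AnalyticOnNhd.circleAverage_log_norm_of_ne_zero (R := r) (c := 0)
        (g := fun l : ℂ => z i + l * w i) (fun l _ => by fun_prop)
        (fun l hl => (h2 l (by
          rw [mem_closedBall_zero_iff, abs_of_pos hr] at hl
          exact hl.trans_lt hr')).2)
      simpa using this
    rw [← hh, ← smul_eq_mul, ← Real.circleAverage_fun_smul]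
    have hne : ∀ θ, z i + circleMap 0 r θ * w i ≠ 0 := fun θ =>
      (h2 (circleMap 0 r θ) (by simpa [abs_of_pos hr] using hr')).2
    refine Real.circleAverage_mono (Continuous.intervalIntegrable ?_ _ _)
      (bounded_circleIntegrable hm hB z w r) fun l hl => ?_
    · have hcm := continuous_circleMap 0 r
      exact continuous_const.mul (Continuous.log (by fun_prop) fun θ => norm_ne_zero_iff.2 (hne θ))
    · obtain ⟨h3, h4⟩ := h2 l (by
        rw [mem_sphere_zero_iff_norm, abs_of_pos hr] at hl
        exact hl.trans_lt hr')
      rw [← EReal.coe_le_coe_iff, coe_cut h3 (hlt _ h3)]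
      refine le_trans ?_ (le_max_left _ _)
      have h5 : 0 < ‖z i + l * w i‖ := norm_pos_iff.2 h4
      have h6 : ‖z i + l * w i‖ ≤ ‖z + l • w‖ := norm_le_pi_norm (z + l • w) i
      show ((N * _ : ℝ) : EReal) ≤ _
      rw [mul_elog (h5.trans_le h6), EReal.coe_le_coe_iff]
      gcongr

lemma integrable_rho_mul_sub {ε : ℝ} (hε : 0 < ε) {v : Cn n → ℝ} (hm : Measurable v) {B : ℝ}
    (hB : ∀ z, |v z| ≤ B) (x : Cn n) : Integrable fun y => rho ε y * v (x - y) :=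
  integrable_rho_mul hε (v := fun y => v (x - y)) (hm.comp (measurable_const.sub measurable_id))
    fun _ => hB _

lemma rm_mono {ε : ℝ} (hε : 0 < ε) {v w : Cn n → ℝ} (hv : Measurable v) (hw : Measurable w)
    {B B' : ℝ} (hB : ∀ z, |v z| ≤ B) (hB' : ∀ z, |w z| ≤ B') {x : Cn n} {Ω : Set (Cn n)}
    (hin : Metric.closedBall x ε ⊆ Ω) (h : ∀ᵐ y, y ∈ Ω → v y ≤ w y) : rm ε v x ≤ rm ε w x := by
  rw [rm_eq, rm_eq]
  refine integral_mono_ae (integrable_rho_mul_sub hε hv hB x) (integrable_rho_mul_sub hε hw hB' x) ?_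
  have hmp : MeasurePreserving (fun y : Cn n => x - y) := Measure.measurePreserving_sub_left volume x
  filter_upwards [hmp.quasiMeasurePreserving.ae h] with y hy
  by_cases hy' : ‖y‖ < ε
  · exact mul_le_mul_of_nonneg_left (hy (hin (by
      rw [mem_closedBall_iff_norm]; simpa using hy'.le))) (rho_nonneg hε y)
  · simp [rho_eq_zero hε (not_lt.1 hy')]

lemma abs_rm_le {ε : ℝ} (hε : 0 < ε) {v : Cn n → ℝ} {B : ℝ} (hB : ∀ z, |v z| ≤ B) (x : Cn n) :
    |rm ε v x| ≤ B := by
  rw [rm_eq]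
  have := norm_integral_le_of_norm_le ((integrable_rho (n := n) hε).mul_const B)
    (f := fun y => rho ε y * v (x - y)) (ae_of_all _ fun y => by
      rw [norm_mul, Real.norm_of_nonneg (rho_nonneg hε y)]
      exact mul_le_mul_of_nonneg_left (hB _) (rho_nonneg hε y))
  rwa [integral_mul_const, integral_rho hε, one_mul] at this

lemma rm_le_of_usc {v w : Cn n → ℝ} (hm : Measurable w) {B : ℝ} (hB : ∀ z, |w z| ≤ B)
    {Ω : Set (Cn n)} (ho : IsOpen Ω) (hv : UpperSemicontinuousOn v Ω) (hle : ∀ z ∈ Ω, w z ≤ v z)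
    {x : Cn n} (hx : x ∈ Ω) {a : ℝ} (ha : v x < a) : ∀ᶠ ε in 𝓝[>] (0:ℝ), rm ε w x ≤ a := by
  have h1 := hv x hx a ha
  rw [ho.nhdsWithin_eq hx] at h1
  obtain ⟨δ, hδ, h2⟩ := Metric.eventually_nhds_iff_ball.1 (h1.and (ho.mem_nhds hx))
  filter_upwards [Ioo_mem_nhdsGT hδ] with ε hε
  refine rm_le hε.1 hm hB fun y hy => ?_
  obtain ⟨h3, h4⟩ := h2 (x - y) (by rw [mem_ball_iff_norm]; simpa using hy.trans hε.2)
  exact (hle _ h4).trans (le_of_lt h3)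

lemma eventually_closedBall {Ω : Set (Cn n)} (ho : IsOpen Ω) {x : Cn n} (hx : x ∈ Ω) :
    ∀ᶠ ε in 𝓝[>] (0:ℝ), Metric.closedBall x ε ⊆ Ω :=
  (Metric.nhds_basis_closedBall.mem_iff.1 (ho.mem_nhds hx)).elim fun δ ⟨hδ, h⟩ => by
    filter_upwards [Ioo_mem_nhdsGT hδ] with ε hε
    exact (Metric.closedBall_subset_closedBall hε.2.le).trans h

/-- Almost everywhere inequalities between plurisubharmonic functions hold everywhere. -/
lemma BSub.le_of_ae {v w : Cn n → ℝ} {Ω : Set (Cn n)} (ho : IsOpen Ω) (hv : BSub v Ω)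
    (hw : BSub w Ω) (h : ∀ᵐ y, y ∈ Ω → v y ≤ w y) {x : Cn n} (hx : x ∈ Ω) : v x ≤ w x := by
  obtain ⟨B, hB⟩ := hv.bdd
  obtain ⟨B', hB'⟩ := hw.bdd
  refine le_of_forall_gt_imp_ge_of_dense fun a ha => ?_
  obtain ⟨ε, ⟨h1, h2⟩, hε⟩ := ((rm_le_of_usc hw.meas hB' ho hw.usc (fun z _ => le_rfl) hx ha).and
    (eventually_closedBall ho hx) |>.and self_mem_nhdsWithin).exists
  exact (hv.le_rm hε h2).trans ((rm_mono hε hv.meas hw.meas hB hB' h2 h).trans h1)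

lemma PSub.le_of_ae {u v : Cn n → EReal} {Ω : Set (Cn n)} {c c' : ℝ} (hu : PSub u Ω c)
    (hv : PSub v Ω c') (h : ∀ᵐ y, y ∈ Ω → u y ≤ v y) {x : Cn n} (hx : x ∈ Ω) : u x ≤ v x := by
  have key : ∀ m : ℕ, u x ≤ Max.max (v x) ((-(m : ℝ) : ℝ) : EReal) := fun m => by
    have := (hu.bsub m).le_of_ae hu.op (hv.bsub m) (by
      filter_upwards [h] with y hy hyΩ
      rw [← EReal.coe_le_coe_iff, coe_cut hyΩ (hu.lt_top hyΩ), coe_cut hyΩ (hv.lt_top hyΩ)]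
      exact max_le_max (hy hyΩ) le_rfl) hx
    rw [← EReal.coe_le_coe_iff, coe_cut hx (hu.lt_top hx), coe_cut hx (hv.lt_top hx)] at this
    exact (le_max_left _ _).trans this
  by_contra! hlt
  obtain ⟨b, h1, h2⟩ := EReal.lt_iff_exists_real_btwn.1 hlt
  obtain ⟨m, hm⟩ := exists_nat_gt (-b)
  refine absurd (key m) (not_le.2 (max_lt hlt (lt_trans (EReal.coe_lt_coe_iff.2 ?_) h2)))
  linarith

/-- The upper regularisation of an increasing sequence of bounded plurisubharmonic functions. -/
lemma BSub.reg {v : ℕ → Cn n → ℝ} {V : Cn n → ℝ} {Ω : Set (Cn n)} {B B' : ℝ} (ho : IsOpen Ω)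
    (hv : ∀ k, BSub (v k) Ω) (hB : ∀ k z, |v k z| ≤ B) (hmono : ∀ z, Monotone fun k => v k z)
    (hVm : Measurable V) (hVB : ∀ z, |V z| ≤ B') (hV : UpperSemicontinuousOn V Ω)
    (hle : ∀ k, ∀ z ∈ Ω, v k z ≤ V z)
    (hreg : ∀ x ∈ Ω, ∀ a, (∀ᶠ y in 𝓝 x, ∀ k, v k y ≤ a) → V x ≤ a) :
    BSub V Ω ∧ ∀ᵐ z, z ∈ Ω → Tendsto (fun k => v k z) atTop (𝓝 (V z)) := by
  set L : Cn n → ℝ := fun z => ⨆ k, v k z with hL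
  have hbdd : ∀ z, BddAbove (Set.range fun k => v k z) := fun z =>
    ⟨B, by rintro _ ⟨k, rfl⟩; exact (abs_le.1 (hB k z)).2⟩
  have hLlim : ∀ z, Tendsto (fun k => v k z) atTop (𝓝 (L z)) := fun z =>
    tendsto_atTop_ciSup (hmono z) (hbdd z)
  have hkL : ∀ k z, v k z ≤ L z := fun k z => le_ciSup (hbdd z) k
  have hLm : Measurable L := measurable_of_tendsto_metrizable (fun k => (hv k).meas)
    (tendsto_pi_nhds.2 hLlim)
  have hLB : ∀ z, |L z| ≤ B := fun z =>
    le_of_tendsto' ((continuous_abs.tendsto _).comp (hLlim z)) fun k => hB k z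
  have hLV : ∀ z ∈ Ω, L z ≤ V z := fun z hz => ciSup_le fun k => hle k z hz
  have hrlim : ∀ ε, 0 < ε → ∀ x, Tendsto (fun k => rm ε (v k) x) atTop (𝓝 (rm ε L x)) := by
    intro ε hε x
    simp only [rm_eq]
    refine tendsto_integral_of_dominated_convergence (fun y => rho ε y * B)
      (fun k => (integrable_rho_mul_sub hε (hv k).meas (hB k) x).aestronglyMeasurable)
      ((integrable_rho hε).mul_const B) (fun k => ae_of_all _ fun y => ?_)
      (ae_of_all _ fun y => (hLlim _).const_mul _)
    rw [norm_mul, Real.norm_of_nonneg (rho_nonneg hε y)]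
    exact mul_le_mul_of_nonneg_left (hB _ _) (rho_nonneg hε y)
  have hsm : ∀ ε, 0 < ε → Continuous (rm ε L) := fun ε hε =>
    (sm_rm hε (locInt_of_bdd hLm hLB)).continuous
  have hkr : ∀ k ε, 0 < ε → ∀ x, rm ε (v k) x ≤ rm ε L x := fun k ε hε x =>
    rm_mono hε (hv k).meas hLm (hB k) hLB (Set.subset_univ _) (ae_of_all _ fun y _ => hkL k y)
  have hVr : ∀ x ε ε', 0 < ε → ε < ε' → Metric.closedBall x ε' ⊆ Ω → V x ≤ rm ε L x := by
    intro x ε ε' hε hεε hin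
    refine le_of_forall_gt_imp_ge_of_dense fun a ha => ?_
    refine hreg x (hin (Metric.mem_closedBall_self (hε.trans hεε).le)) a ?_
    filter_upwards [(hsm ε hε).continuousAt.eventually_lt continuousAt_const ha,
      Metric.ball_mem_nhds x (sub_pos.2 hεε)] with y h1 h2 k
    refine ((hv k).le_rm hε (fun z hz => hin ?_)).trans ((hkr k ε hε y).trans h1.le)
    rw [Metric.mem_closedBall] at hz ⊢
    rw [Metric.mem_ball] at h2
    linarith [dist_triangle z y x]
  have hVr' : ∀ x ∈ Ω, ∀ᶠ ε in 𝓝[>] (0:ℝ), V x ≤ rm ε L x := fun x hx => by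
    obtain ⟨δ, hδ, hin⟩ := Metric.nhds_basis_closedBall.mem_iff.1 (ho.mem_nhds hx)
    filter_upwards [Ioo_mem_nhdsGT hδ] with ε hε
    exact hVr x ε δ hε.1 hε.2 hin
  have hconv : ∀ x ∈ Ω, Tendsto (fun ε => rm ε L x) (𝓝[>] 0) (𝓝 (V x)) := fun x hx => by
    refine tendsto_order.2 ⟨fun a ha => ?_, fun a ha => ?_⟩
    · filter_upwards [hVr' x hx] with ε h
      linarith
    · obtain ⟨b, hb, hba⟩ := exists_between ha
      filter_upwards [rm_le_of_usc hLm hLB ho hV hLV hx hb] with ε h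
      linarith
  refine ⟨⟨hVm, ⟨B', hVB⟩, hV, fun x hx w => ?_⟩, ?_⟩
  · obtain ⟨δ, hδ, hin⟩ := Metric.nhds_basis_closedBall.mem_iff.1 (ho.mem_nhds hx)
    refine ⟨δ / 2 / (‖w‖ + 1), by positivity, fun r hr hr' => ?_⟩
    have hrw : r * ‖w‖ < δ / 2 := by
      rw [lt_div_iff₀ (by positivity)] at hr'
      nlinarith
    have hcirc : ∀ l : ℂ, ‖l‖ = r → x + l • w ∈ Ω := fun l hl => hin (by
      rw [mem_closedBall_iff_norm, add_sub_cancel_left, norm_smul, hl]; linarith)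
    have hlim : Tendsto (fun ε => Real.circleAverage (fun l : ℂ => rm ε L (x + l • w)) 0 r) (𝓝[>] 0)
        (𝓝 (Real.circleAverage (fun l : ℂ => V (x + l • w)) 0 r)) := by
      simp only [Real.circleAverage_def]
      refine Tendsto.const_smul ?_ _
      refine intervalIntegral.tendsto_integral_filter_of_dominated_convergence (fun _ => B) ?_ ?_
        intervalIntegrable_const (ae_of_all _ fun θ _ => hconv _ (hcirc _ (by simp [abs_of_pos hr])))
      · filter_upwards [self_mem_nhdsWithin] with ε hε
        have hcm := continuous_circleMap 0 r
        exact ((hsm ε hε).comp (by fun_prop)).aestronglyMeasurable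
      · filter_upwards [self_mem_nhdsWithin] with ε hε
        exact ae_of_all _ fun θ _ => abs_rm_le hε hLB _
    refine le_of_tendsto_of_tendsto (hconv x hx) hlim ?_
    filter_upwards [Ioo_mem_nhdsGT (half_pos hδ)] with ε hε
    refine le_of_tendsto' (hrlim ε hε.1 x) fun k => ?_
    refine ((hv k).submean_rm hε.1 hr ((Metric.closedBall_subset_closedBall
      (by linarith [hε.2])).trans hin)).trans ?_
    have hci : ∀ g : Cn n → ℝ, Continuous g → CircleIntegrable (fun l : ℂ => g (x + l • w)) 0 r :=
      fun g hg => by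
        have hcm := continuous_circleMap 0 r
        exact Continuous.intervalIntegrable (hg.comp (by fun_prop)) _ _
    exact Real.circleAverage_mono
      (hci _ (sm_rm hε.1 (locInt_of_bdd (hv k).meas (hB k))).continuous) (hci _ (hsm ε hε.1))
      fun l _ => hkr k ε hε.1 _
  · filter_upwards [moll_ae (locInt_of_bdd hLm hLB)] with x hx hxΩ
    have h1 : Tendsto (fun ε => rm ε L x) (𝓝[>] 0) (𝓝 (L x)) :=
      (Complex.continuous_re.tendsto _).comp hx
    rw [tendsto_nhds_unique (hconv x hxΩ) h1]
    exact hLlim x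

open Classical in
/-- Upper regularisation of an increasing sequence of plurisubharmonic functions. -/
lemma Psh.reg {R c : ℝ} {ψ : ℕ → Cn n → EReal} (hψ : ∀ k, Psh R c (ψ k))
    (hmono : ∀ k l, k ≤ l → ∀ z ∈ eb R, ψ k z ≤ ψ l z) :
    ∃ Ψ : Cn n → EReal, Psh R c Ψ ∧ (∀ k, ∀ z ∈ eb R, ψ k z ≤ Ψ z) ∧ (∀ z ∉ eb R, Ψ z = ⊥) ∧
      ∀ᵐ z ∂(volume.restrict (eb R)), Tendsto (fun k => (ψ k z).toReal) atTop (𝓝 (Ψ z).toReal) := by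
  set Ψ : Cn n → EReal := fun z =>
    if z ∈ eb R then sInf {a : EReal | ∀ᶠ y in 𝓝 z, ∀ k, ψ k y ≤ a} else ⊥ with hΨ
  have hpos : ∀ z ∈ eb R, Ψ z = sInf {a : EReal | ∀ᶠ y in 𝓝 z, ∀ k, ψ k y ≤ a} :=
    fun z hz => if_pos hz
  have hge : ∀ k, ∀ z ∈ eb R, ψ k z ≤ Ψ z := fun k z hz => by
    rw [hpos z hz]
    exact le_sInf fun a ha => (Eventually.self_of_nhds ha) k
  have hle : ∀ z ∈ eb R, Ψ z ≤ (c : EReal) := fun z hz => by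
    rw [hpos z hz]
    refine sInf_le ?_
    filter_upwards [(isOpen_eb R).mem_nhds hz] with y hy k
    exact (hψ k).psub.le y hy
  have hlt : ∀ z ∈ eb R, Ψ z < ⊤ := fun z hz => (hle z hz).trans_lt (EReal.coe_lt_top c)
  have husc : UpperSemicontinuousOn Ψ (eb R) := by
    intro z hz b hb
    rw [hpos z hz, sInf_lt_iff] at hb
    obtain ⟨a, ha, hab⟩ := hb
    have ha' : ∀ᶠ y in 𝓝 z, ∀ k, ψ k y ≤ a := ha
    filter_upwards [nhdsWithin_le_nhds ha'.eventually_nhds, self_mem_nhdsWithin] with y hy hyR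
    rw [hpos y hyR]
    have h : sInf {a : EReal | ∀ᶠ y' in 𝓝 y, ∀ k, ψ k y' ≤ a} ≤ a :=
      sInf_le (show ∀ᶠ y' in 𝓝 y, ∀ k, ψ k y' ≤ a from hy)
    exact lt_of_le_of_lt h hab
  have hB : ∀ (u : Cn n → EReal), (∀ z ∈ eb R, u z ≤ (c : EReal)) → ∀ (m : ℕ) z,
      |cut (eb R) m u z| ≤ |c| + m := fun u hu m z => by
    have h1 := neg_le_cut (fun z hz => (hu z hz).trans_lt (EReal.coe_lt_top c)) m z
    have h2 := cut_le hu m z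
    have h3 := le_abs_self c
    have h4 := abs_nonneg c
    have h5 : (0:ℝ) ≤ m := Nat.cast_nonneg m
    rw [abs_le]
    exact ⟨by linarith, h2.trans (max_le (by linarith) (by linarith))⟩
  have hcm : ∀ (m : ℕ) (u v : Cn n → EReal) z, (∀ z ∈ eb R, u z < ⊤) → (∀ z ∈ eb R, v z < ⊤) →
      (∀ z ∈ eb R, u z ≤ v z) → cut (eb R) m u z ≤ cut (eb R) m v z := fun m u v z hu hv huv => by
    by_cases hz : z ∈ eb R
    · rw [← EReal.coe_le_coe_iff, coe_cut hz (hu z hz), coe_cut hz (hv z hz)]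
      exact max_le_max (huv z hz) le_rfl
    · rw [cut_of_notMem hz, cut_of_notMem hz]
  have key : ∀ m : ℕ, BSub (cut (eb R) m Ψ) (eb R) ∧ ∀ᵐ z, z ∈ eb R →
      Tendsto (fun k => cut (eb R) m (ψ k) z) atTop (𝓝 (cut (eb R) m Ψ z)) := fun m => by
    have hu := usc_cut husc hlt m
    refine BSub.reg (isOpen_eb R) (fun k => (hψ k).psub.bsub m) (fun k => hB _ (hψ k).psub.le m)
      (fun z k l hkl => hcm m _ _ z (fun z hz => (hψ k).psub.lt_top hz)
        (fun z hz => (hψ l).psub.lt_top hz) (hmono k l hkl))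
      (measurable_of_usc (isOpen_eb R) hu fun z hz => cut_of_notMem hz) (hB _ hle m) hu
      (fun k z _ => hcm m _ _ z (fun z hz => (hψ k).psub.lt_top hz) hlt (hge k))
      fun x hx a ha => ?_
    rw [← EReal.coe_le_coe_iff, coe_cut hx (hlt x hx)]
    refine max_le ?_ ?_
    · rw [hpos x hx]
      refine sInf_le ?_
      filter_upwards [ha, (isOpen_eb R).mem_nhds hx] with y hy hyR k
      have := hy k
      rw [← EReal.coe_le_coe_iff, coe_cut hyR ((hψ k).psub.lt_top hyR)] at this
      exact (le_max_left _ _).trans this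
    · rw [EReal.coe_le_coe_iff]
      exact (neg_le_cut (fun z hz => (hψ 0).psub.lt_top hz) m x).trans (ha.self_of_nhds 0)
  refine ⟨Ψ, ⟨⟨isOpen_eb R, husc, hle, fun m => (key m).1.sub⟩, ?_⟩, hge, fun z hz => if_neg hz, ?_⟩
  · filter_upwards [(hψ 0).ae, ae_restrict_mem (isOpen_eb R).measurableSet] with z h1 hz
    exact ne_bot_of_le_ne_bot h1 (hge 0 z hz)
  · have h1 := ae_all_iff.2 fun m => (key m).2
    filter_upwards [(hψ 0).ae, ae_restrict_of_ae h1, ae_restrict_mem (isOpen_eb R).measurableSet]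
      with z h0 h1 hz
    obtain ⟨m, hm⟩ := exists_nat_gt (-(ψ 0 z).toReal)
    have hcut : ∀ u : Cn n → EReal, u z < ⊤ → ψ 0 z ≤ u z → cut (eb R) m u z = (u z).toReal :=
      fun u hu h0u => by
        have hub := ne_bot_of_le_ne_bot h0 h0u
        rw [← EReal.coe_eq_coe_iff, coe_cut hz hu, EReal.coe_toReal hu.ne hub, max_eq_left]
        refine le_trans ?_ h0u
        rw [← EReal.coe_toReal ((hψ 0).psub.lt_top hz).ne h0, EReal.coe_le_coe_iff]
        linarith
    have := h1 m hz
    rw [hcut Ψ (hlt z hz) (hge 0 z hz)] at this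
    refine this.congr fun k => hcut (ψ k) ((hψ k).psub.lt_top hz) (hmono 0 k (Nat.zero_le k) z hz)

lemma _root_.IntNear.of_le {g h : Cn n → ℝ≥0∞} (hh : IntNear h) {C : ℝ} {r : ℝ} (hr : 0 < r)
    (hle : ∀ᵐ z ∂(volume.restrict (eb r)), g z ≤ ENNReal.ofReal C * h z) : IntNear g := by
  obtain ⟨U, hU, hi⟩ := hh
  refine ⟨eb r ∩ U, inter_mem (eb_mem_nhds hr) hU, ?_⟩
  calc ∫⁻ z in eb r ∩ U, g z ≤ ∫⁻ z in eb r ∩ U, ENNReal.ofReal C * h z :=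
        lintegral_mono_ae (ae_restrict_of_ae_restrict_of_subset Set.inter_subset_left hle)
    _ = ENNReal.ofReal C * ∫⁻ z in eb r ∩ U, h z := lintegral_const_mul' _ _ ENNReal.ofReal_ne_top
    _ ≤ ENNReal.ofReal C * ∫⁻ z in U, h z := by
        gcongr
        exact Set.inter_subset_right
    _ < ⊤ := ENNReal.mul_lt_top ENNReal.ofReal_lt_top hi

lemma expE_coe (x : ℝ) : expE (x : EReal) = ENNReal.ofReal (Real.exp x) := by
  rw [expE, if_neg (EReal.coe_ne_bot x), if_neg (EReal.coe_ne_top x), EReal.toReal_coe]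

lemma wexp_eq {u : Cn n → EReal} {z : Cn n} (h1 : u z ≠ ⊥) (h2 : u z ≠ ⊤) :
    wexp (-2) u z = ENNReal.ofReal (Real.exp (-2 * (u z).toReal)) := by
  rw [wexp, ← expE_coe, EReal.coe_mul, EReal.coe_toReal h2 h1]

lemma expE_mono {x y : EReal} (h : x ≤ y) : expE x ≤ expE y := by
  induction x with
  | bot => simp [expE]
  | top => rw [top_le_iff.1 h]
  | coe x =>
    induction y with
    | bot => simp at h
    | top => simp [expE]
    | coe y =>
      rw [expE_coe, expE_coe]
      exact ENNReal.ofReal_le_ofReal (Real.exp_le_exp.2 (EReal.coe_le_coe_iff.1 h))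

lemma expE_neg_two_anti {x y : EReal} (h : x ≤ y) :
    expE (((-2 : ℝ) : EReal) * y) ≤ expE (((-2 : ℝ) : EReal) * x) := by
  refine expE_mono ?_
  induction x with
  | bot => rw [EReal.coe_mul_bot_of_neg (by norm_num)]; exact le_top
  | top => rw [top_le_iff.1 h]
  | coe x =>
    induction y with
    | bot => simp at h
    | top => rw [EReal.coe_mul_top_of_neg (by norm_num)]; exact bot_le
    | coe y =>
      rw [← EReal.coe_mul, ← EReal.coe_mul, EReal.coe_le_coe_iff]
      linarith [EReal.coe_le_coe_iff.1 h]

lemma _root_.HoloNear.eventually_ext {f : Cn n → ℂ} (hf : HoloNear f) : ∀ᶠ r in 𝓝[>] (0 : ℝ),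
    ∃ G : Cn n → ℂ, Sm G ∧ ∀ z ∈ eb r, G z = f z ∧ ∀ j, db j G z = 0 := by
  obtain ⟨U, hU, ho, hd⟩ := hf
  obtain ⟨ε, hε, hb⟩ := Metric.mem_nhds_iff.1 hU
  obtain ⟨G, hG, he⟩ := exists_smooth_ext (half_lt_self hε) (hd.mono hb)
  obtain ⟨ρ, hρ, hs⟩ := exists_eb_subset (Metric.ball_mem_nhds (0 : Cn n) (half_pos hε))
  filter_upwards [Ioo_mem_nhdsGT hρ] with r hr
  refine ⟨G, hG, fun z hz => ?_⟩
  have hz' := hs (eb_mono hr.2.le hz)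
  refine ⟨he z hz', fun j => db_of_diff ?_ j⟩
  refine (hd.differentiableAt (ho.mem_nhds (hb (Metric.ball_subset_ball
    (by linarith) hz')))).congr_of_eventuallyEq ?_
  filter_upwards [Metric.isOpen_ball.mem_nhds hz'] with y hy using he y hy

/-- Strong openness for a finite family of holomorphic functions and an increasing sequence of
plurisubharmonic weights. -/
theorem strong_openness_family {ι : Type*} [Fintype ι] {f : ι → Cn n → ℂ} (hf : ∀ j, HoloNear (f j))
    {R : ℝ} (hR : 0 < R) {u : Cn n → EReal} {v : ℕ → Cn n → EReal} {w : Cn n → ℝ} {c : ℕ → ℝ}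
    (hu : Psh R (-1) u) (hv : ∀ k, Psh R (-1) (v k)) (hc : ∀ k, 0 ≤ c k)
    (hmono : ∀ k l, k ≤ l → ∀ᵐ z ∂(volume.restrict (eb R)),
      c k * (v k z).toReal ≤ c l * (v l z).toReal)
    (hlim : ∀ᵐ z ∂(volume.restrict (eb R)),
      Tendsto (fun k => c k * (v k z).toReal) atTop (𝓝 (w z)))
    (hi : IntNear fun z => (∑ j, (‖f j z‖₊ : ℝ≥0∞) ^ 2) *
      ENNReal.ofReal (Real.exp (-2 * ((u z).toReal + w z)))) :
    ∃ k, ∃ t > 0, AEMeasurable (fun z => (∑ j, (‖f j z‖₊ : ℝ≥0∞) ^ 2) * ENNReal.ofReal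
        (Real.exp (-2 * ((u z).toReal + c k * (v k z).toReal)))) (volume.restrict (eb t)) ∧
      ∫⁻ z in eb t, (∑ j, (‖f j z‖₊ : ℝ≥0∞) ^ 2) * ENNReal.ofReal
        (Real.exp (-2 * ((u z).toReal + c k * (v k z).toReal))) < ⊤ := by
  obtain ⟨U, hU, hi⟩ := hi
  obtain ⟨ρ, hρ, hρU⟩ := exists_eb_subset hU
  obtain ⟨r, hext, hr⟩ := ((eventually_all.2 fun j => (hf j).eventually_ext).and
    (Ioo_mem_nhdsGT (lt_min hR hρ))).exists
  have hrR : r < R := hr.2.trans_le (min_le_left _ _)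
  have hr0 : 0 < r := hr.1
  have hsub : (eb r : Set (Cn n)) ⊆ eb R := eb_mono hrR.le
  choose G hG hGf using hext
  set q : ℕ → Cn n → ℝ := fun k z => (u z).toReal + c k * (v k z).toReal with hq
  have hest := fun k => hu.est (hv k) hrR (hc k)
  have hqm : ∀ k l, k ≤ l → ∀ᵐ z ∂(volume.restrict (eb r)), q k z ≤ q l z := fun k l hkl => by
    filter_upwards [ae_restrict_of_ae_restrict_of_subset hsub (hmono k l hkl)] with z hz
    exact add_le_add_right hz _
  have hql : ∀ᵐ z ∂(volume.restrict (eb r)),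
      Tendsto (fun k => q k z) atTop (𝓝 ((u z).toReal + w z)) := by
    filter_upwards [ae_restrict_of_ae_restrict_of_subset hsub hlim] with z hz
    exact hz.const_add _
  have hwm : AEMeasurable (fun z => (u z).toReal + w z) (volume.restrict (eb r)) :=
    aemeasurable_of_tendsto_metrizable_ae atTop (fun k => (hest k).1) hql
  have hone : ∀ j z, (‖f j z‖₊ : ℝ≥0∞) ^ 2 = ENNReal.ofReal (‖f j z‖ ^ 2) := fun j z => by
    rw [ENNReal.ofReal_pow (norm_nonneg _), ofReal_norm]; rfl
  have hmain : ∀ j, ∃ k, ∃ s > 0, s ≤ r ∧ ∫⁻ z in eb s,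
      (‖f j z‖₊ : ℝ≥0∞) ^ 2 * ENNReal.ofReal (Real.exp (-2 * q k z)) < ⊤ := fun j => by
    obtain ⟨k, s, hs, hfin⟩ := strong_openness hr0 (fun k => (hest k).1) (fun k => (hest k).2.1)
      (fun k => (hest k).2.2) hqm hql (hG j) (fun z hz => (hGf j z hz).2) (by
        refine ⟨?_, ?_⟩
        · refine AEMeasurable.aestronglyMeasurable ?_
          exact ((hG j).continuous.measurable.norm.pow_const 2).aemeasurable.mul
            (Real.measurable_exp.comp_aemeasurable (hwm.const_mul (-2)))
        · rw [hasFiniteIntegral_iff_ofReal (ae_of_all _ fun z => by positivity)]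
          refine lt_of_le_of_lt ?_ hi
          refine le_trans ?_ (lintegral_mono_set ((eb_mono (hr.2.trans_le (min_le_right _ _)).le).trans hρU))
          refine setLIntegral_mono' (isOpen_eb r).measurableSet fun z hz => ?_
          rw [(hGf j z hz).1, ENNReal.ofReal_mul (by positivity), ← hone]
          gcongr
          exact Finset.single_le_sum (f := fun j => (‖f j z‖₊ : ℝ≥0∞) ^ 2) (fun _ _ => zero_le)
            (Finset.mem_univ j))
    refine ⟨k, min s r, lt_min hs hr0, min_le_right _ _, ?_⟩
    refine lt_of_le_of_lt ?_ hfin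
    refine le_trans ?_ (lintegral_mono_set (eb_mono (min_le_left s r)))
    refine setLIntegral_mono' (isOpen_eb _).measurableSet fun z hz => ?_
    rw [(hGf j z (eb_mono (min_le_right _ _) hz)).1, ENNReal.ofReal_mul (sq_nonneg _), ← hone]
  choose k s hs hsr hfin using hmain
  obtain ⟨t, ht, ht0⟩ := ((eventually_all.2 fun j => Ioo_mem_nhdsGT (hs j)).and
    (Ioo_mem_nhdsGT hr0)).exists
  set K := Finset.univ.sup k
  have hmeas : ∀ j, AEMeasurable (fun z => (‖f j z‖₊ : ℝ≥0∞) ^ 2 *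
      ENNReal.ofReal (Real.exp (-2 * q K z))) (volume.restrict (eb t)) := fun j => by
    have h1 : AEMeasurable (f j) (volume.restrict (eb t)) := by
      refine (hG j).continuous.measurable.aemeasurable.congr ?_
      filter_upwards [ae_restrict_mem (isOpen_eb t).measurableSet] with z hz
      exact (hGf j z (eb_mono ht0.2.le hz)).1
    have h2 := (hest K).1.mono_measure (Measure.restrict_mono (eb_mono ht0.2.le) le_rfl)
    exact (h1.nnnorm.coe_nnreal_ennreal.pow_const 2).mul
      (Real.measurable_exp.comp_aemeasurable (h2.const_mul (-2))).ennreal_ofReal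
  simp only [Finset.sum_mul]
  refine ⟨K, t, ht0.1, Finset.aemeasurable_fun_sum _ fun j _ => hmeas j, ?_⟩
  rw [lintegral_finsetSum' _ fun j _ => hmeas j]
  refine ENNReal.sum_lt_top.2 fun j _ => lt_of_le_of_lt ?_ (hfin j)
  refine le_trans (lintegral_mono_ae ?_) (lintegral_mono_set (eb_mono (ht j).2.le))
  filter_upwards [ae_restrict_of_ae_restrict_of_subset (eb_mono ht0.2.le)
    (hqm (k j) K (Finset.le_sup (Finset.mem_univ j)))] with z hz
  refine mul_le_mul' le_rfl (ENNReal.ofReal_le_ofReal (Real.exp_le_exp.2 ?_))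
  linarith

lemma toReal_add_coe {x : EReal} (h1 : x ≠ ⊥) (h2 : x ≠ ⊤) (b : ℝ) :
    (x + (b : EReal)).toReal = x.toReal + b := by
  rw [EReal.toReal_add h2 h1 (EReal.coe_ne_top b) (EReal.coe_ne_bot b), EReal.toReal_coe]

lemma Psh.shift {R c : ℝ} {u : Cn n → EReal} (h : Psh R c u) :
    Psh R (-1) fun z => u z + ((-1 - c : ℝ) : EReal) := by
  refine ⟨by simpa using h.psub.add_const (-1 - c), ?_⟩
  filter_upwards [h.ae] with z hz
  rw [ne_eq, EReal.add_eq_bot_iff]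
  exact not_or.2 ⟨hz, EReal.coe_ne_bot _⟩

lemma Psh.ae_finite {R c : ℝ} {u : Cn n → EReal} (h : Psh R c u) :
    ∀ᵐ z ∂(volume.restrict (eb R)), u z ≠ ⊥ ∧ u z ≠ ⊤ := by
  filter_upwards [h.ae, ae_restrict_mem (isOpen_eb R).measurableSet] with z h1 hz
  exact ⟨h1, (h.psub.lt_top hz).ne⟩

lemma dens_mul_wexp {m : ℕ} {f : Fin m → Cn n → ℂ} {φ₀ ψ : Cn n → EReal} {z : Cn n}
    (h0 : φ₀ z ≠ ⊥ ∧ φ₀ z ≠ ⊤) (h : ψ z ≠ ⊥ ∧ ψ z ≠ ⊤) : dens0 f φ₀ z * wexp (-2) ψ z =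
      normSq2 f z * ENNReal.ofReal (Real.exp (-2 * ((φ₀ z).toReal + (ψ z).toReal))) := by
  rw [dens0, wexp_eq h0.1 h0.2, wexp_eq h.1 h.2, mul_assoc, ← ENNReal.ofReal_mul (Real.exp_pos _).le,
    ← Real.exp_add, mul_add]

/-- Non-integrability passes to regularised increasing limits. -/
lemma nonint_of_tendsto {m : ℕ} {f : Fin m → Cn n → ℂ} (hf : ∀ j, HoloNear (f j)) {R c c₀ : ℝ}
    (hR : 0 < R) {φ₀ Ψ : Cn n → EReal} {ψ : ℕ → Cn n → EReal} (h0 : Psh R c₀ φ₀)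
    (hψ : ∀ k, Psh R c (ψ k)) (hΨ : Psh R c Ψ)
    (hmono : ∀ k l, k ≤ l → ∀ z ∈ eb R, ψ k z ≤ ψ l z)
    (hlim : ∀ᵐ z ∂(volume.restrict (eb R)),
      Tendsto (fun k => (ψ k z).toReal) atTop (𝓝 (Ψ z).toReal))
    (hn : ∀ k, ¬ IntNear fun z => dens0 f φ₀ z * wexp (-2) (ψ k) z) :
    ¬ IntNear fun z => dens0 f φ₀ z * wexp (-2) Ψ z := by
  intro hi
  have hfin := ae_all_iff.2 fun k => (hψ k).ae_finite
  obtain ⟨k, t, ht, -, hk⟩ := strong_openness_family hf hR h0.shift (fun k => (hψ k).shift)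
    (c := fun _ => 1) (w := fun z => (Ψ z).toReal + (-1 - c)) (fun _ => zero_le_one) (by
      intro k l hkl
      filter_upwards [hfin, ae_restrict_mem (isOpen_eb R).measurableSet] with z h hz
      rw [toReal_add_coe (h k).1 (h k).2, toReal_add_coe (h l).1 (h l).2]
      have := EReal.toReal_le_toReal (hmono k l hkl z hz) (h k).1 (h l).2
      linarith) (by
      filter_upwards [hfin, hlim] with z h hz
      simp only [one_mul]
      refine (hz.add_const (-1 - c)).congr fun k => ?_
      rw [toReal_add_coe (h k).1 (h k).2]) (by
      refine hi.of_le (C := Real.exp (-2 * (-1 - c₀ + (-1 - c)))) hR ?_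
      filter_upwards [h0.ae_finite, hΨ.ae_finite] with z h1 h2
      rw [dens_mul_wexp h1 h2, toReal_add_coe h1.1 h1.2, mul_left_comm,
        ← ENNReal.ofReal_mul (Real.exp_pos _).le, ← Real.exp_add]
      refine mul_le_mul' le_rfl (ENNReal.ofReal_le_ofReal (Real.exp_le_exp.2 (le_of_eq ?_)))
      ring)
  refine hn k (IntNear.of_le ⟨eb t, eb_mem_nhds ht, hk⟩
    (C := Real.exp (2 * (-1 - c₀ + (-1 - c)))) hR ?_)
  filter_upwards [h0.ae_finite, hfin] with z h1 h2
  rw [dens_mul_wexp h1 (h2 k), toReal_add_coe h1.1 h1.2, toReal_add_coe (h2 k).1 (h2 k).2,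
    mul_left_comm, ← ENNReal.ofReal_mul (Real.exp_pos _).le, ← Real.exp_add]
  refine mul_le_mul' le_rfl (ENNReal.ofReal_le_ofReal (Real.exp_le_exp.2 (le_of_eq ?_)))
  ring

lemma sum_pow_le (z : Cn n) (N : ℕ) : ∑ i, ‖z i‖ ^ (2 * N) ≤ n * ‖z‖ ^ (2 * N) := by
  calc ∑ i, ‖z i‖ ^ (2 * N) ≤ ∑ _i : Fin n, ‖z‖ ^ (2 * N) :=
        Finset.sum_le_sum fun i _ => pow_le_pow_left₀ (norm_nonneg _) (norm_le_pi_norm z i) _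
    _ = n * ‖z‖ ^ (2 * N) := by simp

lemma le_sum_pow {z : Cn n} (hz : 0 < ‖z‖) (N : ℕ) : ‖z‖ ^ (2 * N) ≤ ∑ i, ‖z i‖ ^ (2 * N) := by
  have : ∃ i, ‖z‖ = ‖z i‖ := by
    by_contra! h
    exact lt_irrefl _ ((pi_norm_lt_iff hz).2 fun i => lt_of_le_of_ne (norm_le_pi_norm z i) (h i).symm)
  obtain ⟨i, hi⟩ := this
  rw [hi]
  exact Finset.single_le_sum (f := fun i => ‖z i‖ ^ (2 * N)) (fun _ _ => by positivity)
    (Finset.mem_univ i)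

lemma sum_prod_sq {m : ℕ} (f : Fin m → Cn n → ℂ) (N : ℕ) (z : Cn n) :
    ∑ p : Fin n × Fin m, (‖z p.1 ^ N * f p.2 z‖₊ : ℝ≥0∞) ^ 2 =
      ENNReal.ofReal (∑ i, ‖z i‖ ^ (2 * N)) * normSq2 f z := by
  rw [Fintype.sum_prod_type, ENNReal.ofReal_sum_of_nonneg fun _ _ => by positivity, normSq2,
    Finset.sum_mul_sum]
  refine Finset.sum_congr rfl fun i _ => Finset.sum_congr rfl fun j _ => ?_
  rw [nnnorm_mul, nnnorm_pow, ENNReal.coe_mul, ENNReal.coe_pow, mul_pow, ← pow_mul, mul_comm N 2,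
    ENNReal.ofReal_pow (norm_nonneg _), ofReal_norm]
  rfl

/-- A weight whose singularity is isolated up to the given density may be truncated by a multiple
of `log ‖z‖` without becoming integrable. -/
lemma exists_nonint_max_elog {m : ℕ} {f : Fin m → Cn n → ℂ} (hf : ∀ j, HoloNear (f j)) {R c c₀ : ℝ}
    (hR : 0 < R) {φ₀ φ : Cn n → EReal} (h0 : Psh R c₀ φ₀) (hφ : Psh R c φ) {N₀ : ℕ} (hN : 1 ≤ N₀)
    (hi : IntNear fun z => dens0 f φ₀ z * ENNReal.ofReal (‖z‖ ^ (2 * N₀)) * wexp (-2) φ z)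
    (hn : ¬ IntNear fun z => dens0 f φ₀ z * wexp (-2) φ z) :
    ∃ N : ℝ, 0 < N ∧ ¬ IntNear fun z =>
      dens0 f φ₀ z * wexp (-2) (fun z => max (φ z) ((N : EReal) * elog ‖z‖)) z := by
  have hfin := hφ.ae_finite
  have hlim1 : Tendsto (fun k : ℕ => (1 : ℝ) + 1 / ((k : ℝ) + 1)) atTop (𝓝 (1 + 0)) :=
    tendsto_one_div_add_atTop_nhds_zero_nat.const_add 1
  obtain ⟨k, t, ht, hkm, hk⟩ := strong_openness_family
    (f := fun (p : Fin n × Fin m) z => z p.1 ^ N₀ * f p.2 z) (fun p => by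
      obtain ⟨U, hU, ho, hd⟩ := hf p.2
      exact ⟨U, hU, ho, DifferentiableOn.mul (by fun_prop) hd⟩)
    hR h0.shift (fun _ => hφ.shift) (c := fun k : ℕ => (1 : ℝ) + 1 / ((k : ℝ) + 1))
    (w := fun z => (φ z).toReal + (-1 - c)) (fun k => by positivity) (by
      intro k l hkl
      filter_upwards [hfin, ae_restrict_mem (isOpen_eb R).measurableSet] with z h hz
      rw [toReal_add_coe h.1 h.2]
      have h1 : (φ z).toReal ≤ c := by
        rw [← EReal.coe_le_coe_iff, EReal.coe_toReal h.2 h.1]; exact hφ.psub.le z hz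
      have h2 : (1 : ℝ) / (l + 1) ≤ 1 / (k + 1) :=
        one_div_le_one_div_of_le (by positivity) (by gcongr)
      nlinarith) (by
      filter_upwards [hfin] with z h
      have := hlim1.mul_const ((φ z).toReal + (-1 - c))
      rw [add_zero, one_mul] at this
      simpa only [toReal_add_coe h.1 h.2] using this) (by
      refine hi.of_le (C := n * Real.exp (-2 * (-1 - c₀ + (-1 - c)))) hR ?_
      filter_upwards [h0.ae_finite, hfin] with z h1 h2
      rw [mul_right_comm (dens0 f φ₀ z), dens_mul_wexp h1 h2, toReal_add_coe h1.1 h1.2, sum_prod_sq]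
      rw [show ∀ S E C B : ℝ≥0∞, C * (S * E * B) = S * (C * B * E) from fun _ _ _ _ => by ring,
        mul_right_comm, mul_comm _ (normSq2 f z), mul_assoc]
      refine mul_le_mul' le_rfl ?_
      rw [← ENNReal.ofReal_mul (by positivity), ← ENNReal.ofReal_mul (by positivity),
        ← ENNReal.ofReal_mul (by positivity)]
      refine ENNReal.ofReal_le_ofReal ?_
      rw [show -2 * ((φ₀ z).toReal + (-1 - c₀) + ((φ z).toReal + (-1 - c))) =
        -2 * (-1 - c₀ + (-1 - c)) + -2 * ((φ₀ z).toReal + (φ z).toReal) by ring, Real.exp_add]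
      have := mul_le_mul_of_nonneg_right (sum_pow_le z N₀)
        (mul_pos (Real.exp_pos (-2 * (-1 - c₀ + (-1 - c))))
          (Real.exp_pos (-2 * ((φ₀ z).toReal + (φ z).toReal)))).le
      linarith)
  have hk1 : (0 : ℝ) < (k : ℝ) + 1 := by positivity
  have hN0 : (0 : ℝ) < N₀ := by exact_mod_cast hN
  refine ⟨((k : ℝ) + 1) * N₀, by positivity, fun hmax => hn ?_⟩
  set κ : ℝ := 1 + 1 / ((k : ℝ) + 1) with hκ
  set C : ℝ := Real.exp (2 * (-1 - c₀ + κ * (-1 - c)))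
  obtain ⟨U, hU, hUi⟩ := hmax
  obtain ⟨s, hs, hsU⟩ := exists_eb_subset hU
  set ρ := min (min s t) R
  have hρs : ρ ≤ s := (min_le_left _ _).trans (min_le_left _ _)
  have hρt : ρ ≤ t := (min_le_left _ _).trans (min_le_right _ _)
  refine ⟨eb ρ, eb_mem_nhds (lt_min (lt_min hs ht) hR), ?_⟩
  refine lt_of_le_of_lt (lintegral_mono_ae (g := fun z => dens0 f φ₀ z * wexp (-2)
    (fun z => max (φ z) (((((k : ℝ) + 1) * N₀ : ℝ) : EReal) * elog ‖z‖)) z +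
      ENNReal.ofReal C * ((∑ p : Fin n × Fin m, (‖z p.1 ^ N₀ * f p.2 z‖₊ : ℝ≥0∞) ^ 2) *
      ENNReal.ofReal (Real.exp (-2 * ((φ₀ z + ((-1 - c₀ : ℝ) : EReal)).toReal +
        κ * (φ z + ((-1 - c : ℝ) : EReal)).toReal))))) ?_) ?_
  · filter_upwards [ae_restrict_of_ae_restrict_of_subset (eb_mono (min_le_right _ _)) h0.ae_finite,
      ae_restrict_of_ae_restrict_of_subset (eb_mono (min_le_right _ _)) hfin] with z h1 h2
    rcases le_or_gt (((((k : ℝ) + 1) * N₀ : ℝ) : EReal) * elog ‖z‖) (φ z) with hle | hlt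
    · refine le_trans (le_of_eq ?_) le_self_add
      rw [wexp, wexp, max_eq_left hle]
    · refine le_trans ?_ le_add_self
      rcases (norm_nonneg z).eq_or_lt with hz | hz
      · rw [← hz, mul_elog_of_nonpos (by positivity) le_rfl] at hlt
        exact absurd hlt not_lt_bot
      rw [mul_elog hz, ← EReal.coe_toReal h2.2 h2.1, EReal.coe_lt_coe_iff] at hlt
      rw [dens_mul_wexp h1 h2, toReal_add_coe h1.1 h1.2, toReal_add_coe h2.1 h2.2, sum_prod_sq]
      rw [show ∀ S D A B : ℝ≥0∞, A * (B * S * D) = S * (B * A * D) from fun _ _ _ _ => by ring]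
      refine mul_le_mul' le_rfl ?_
      rw [← ENNReal.ofReal_mul (by positivity), ← ENNReal.ofReal_mul (by positivity)]
      refine ENNReal.ofReal_le_ofReal ?_
      refine le_trans ?_ (mul_le_mul_of_nonneg_right (mul_le_mul_of_nonneg_right
        (le_sum_pow hz N₀) (Real.exp_pos _).le) (Real.exp_pos _).le)
      rw [← Real.exp_log (pow_pos hz _), ← Real.exp_add, ← Real.exp_add, Real.log_pow]
      refine Real.exp_le_exp.2 ?_
      have h3 : (φ z).toReal / ((k : ℝ) + 1) ≤ N₀ * Real.log ‖z‖ := by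
        rw [div_le_iff₀ hk1]; linarith
      have h4 : κ * (φ z).toReal = (φ z).toReal + (φ z).toReal / ((k : ℝ) + 1) := by
        rw [hκ]; ring
      push_cast
      nlinarith
  · rw [lintegral_add_right' _ ((hkm.mono_measure
      (Measure.restrict_mono (eb_mono hρt) le_rfl)).const_mul _)]
    refine ENNReal.add_lt_top.2 ⟨?_, ?_⟩
    · exact (lintegral_mono_set ((eb_mono hρs).trans hsU)).trans_lt hUi
    · rw [lintegral_const_mul' _ _ ENNReal.ofReal_ne_top]
      exact ENNReal.mul_lt_top ENNReal.ofReal_lt_top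
        ((lintegral_mono_set (eb_mono hρt)).trans_lt hk)

lemma expE_eq {x : EReal} (h1 : x ≠ ⊥) (h2 : x ≠ ⊤) :
    expE x = ENNReal.ofReal (Real.exp x.toReal) := by
  rw [expE, if_neg h1, if_neg h2]

lemma Psh.aemeasurable_toReal {R c : ℝ} {u : Cn n → EReal} (h : Psh R c u) :
    AEMeasurable (fun z => (u z).toReal) (volume.restrict (eb R)) := by
  refine aemeasurable_of_tendsto_metrizable_ae atTop
    (fun m : ℕ => (h.psub.bsub m).meas.aemeasurable) ?_
  filter_upwards [h.ae, ae_restrict_mem (isOpen_eb R).measurableSet] with z h1 hz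
  exact tendsto_cut hz h1 (h.psub.lt_top hz)

lemma Psh.lintegral_expE_ne_top {R c : ℝ} {u : Cn n → EReal} (h : Psh R c u) :
    ∫⁻ z in eb R, expE (u z) ≠ ⊤ := by
  refine ((setLIntegral_mono' (isOpen_eb R).measurableSet
    fun z hz => expE_mono (h.psub.le z hz)).trans_lt ?_).ne
  rw [setLIntegral_const, expE_coe]
  exact ENNReal.mul_lt_top ENNReal.ofReal_lt_top (volume_eb_lt_top R)

/-- Comparable plurisubharmonic functions with the same integral coincide. -/
lemma Psh.le_of_lintegral_le {R c : ℝ} {u v : Cn n → EReal} (hu : Psh R c u) (hv : Psh R c v)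
    (huv : ∀ z ∈ eb R, u z ≤ v z) (hi : ∫⁻ z in eb R, expE (v z) ≤ ∫⁻ z in eb R, expE (u z)) :
    ∀ z ∈ eb R, v z ≤ u z := by
  have hm : AEMeasurable (fun z => expE (v z)) (volume.restrict (eb R)) := by
    refine (Real.measurable_exp.comp_aemeasurable hv.aemeasurable_toReal).ennreal_ofReal.congr ?_
    filter_upwards [hv.ae_finite] with z hz
    exact (expE_eq hz.1 hz.2).symm
  have hle : (fun z => expE (u z)) ≤ᵐ[volume.restrict (eb R)] fun z => expE (v z) := by
    filter_upwards [ae_restrict_mem (isOpen_eb R).measurableSet] with z hz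
    exact expE_mono (huv z hz)
  have heq := ae_eq_of_ae_le_of_lintegral_le hle hu.lintegral_expE_ne_top hm hi
  intro z hz
  refine hv.psub.le_of_ae hu.psub ?_ hz
  rw [← ae_restrict_iff' (isOpen_eb R).measurableSet]
  filter_upwards [heq, hu.ae_finite, hv.ae_finite] with z he h1 h2
  rw [expE_eq h1.1 h1.2, expE_eq h2.1 h2.2,
    ENNReal.ofReal_eq_ofReal_iff (Real.exp_pos _).le (Real.exp_pos _).le, Real.exp_eq_exp] at he
  rw [← EReal.coe_toReal h1.2 h1.1, ← EReal.coe_toReal h2.2 h2.1, he]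

/-- The plurisubharmonic competitors on `eb R` that are bounded above by `c`, extended by `⊥`, and
for which the weight `dens0 f φ₀ · e^{-2ψ}` is not integrable near the origin. -/
def cand {m : ℕ} (R c : ℝ) (f : Fin m → Cn n → ℂ) (φ₀ : Cn n → EReal) : Set (Cn n → EReal) :=
  {ψ | Psh R c ψ ∧ (∀ z ∉ eb R, ψ z = ⊥) ∧ ¬ IntNear fun z => dens0 f φ₀ z * wexp (-2) ψ z}

lemma exists_maximal_cand {m : ℕ} {f : Fin m → Cn n → ℂ} (hf : ∀ j, HoloNear (f j)) {R c c₀ : ℝ}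
    (hR : 0 < R) {φ₀ φ : Cn n → EReal} (h0 : Psh R c₀ φ₀) (hφ : φ ∈ cand R c f φ₀) :
    ∃ Φ, φ ≤ Φ ∧ Maximal (· ∈ cand R c f φ₀) Φ := by
  refine zorn_le_nonempty₀ _ (fun C hC hchain y hy => ?_) φ hφ
  set I : (Cn n → EReal) → ℝ≥0∞ := fun ψ => ∫⁻ z in eb R, expE (ψ z) with hI
  have hImono : ∀ {u v : Cn n → EReal}, (∀ z ∈ eb R, u z ≤ v z) → I u ≤ I v := fun h =>
    setLIntegral_mono' (isOpen_eb R).measurableSet fun z hz => expE_mono (h z hz)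
  obtain ⟨a, ha, halim, haS⟩ := exists_seq_tendsto_sSup (S := I '' C) ⟨_, y, hy, rfl⟩
    (OrderTop.bddAbove _)
  choose ψ hψC hψa using haS
  have hψ : ∀ k, Psh R c (ψ k) := fun k => (hC (hψC k)).1
  have hmono : ∀ k l, k ≤ l → ∀ z ∈ eb R, ψ k z ≤ ψ l z := fun k l hkl z hz => by
    rcases hchain.total (hψC k) (hψC l) with h | h
    · exact h z
    · exact (hψ l).le_of_lintegral_le (hψ k) (fun z _ => h z)
        (show I (ψ k) ≤ I (ψ l) by rw [hψa, hψa]; exact ha hkl) z hz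
  obtain ⟨Ψ, hΨ, hge, hoff, hlim⟩ := Psh.reg hψ hmono
  refine ⟨Ψ, ⟨hΨ, hoff, nonint_of_tendsto hf hR h0 hψ hΨ hmono hlim fun k => (hC (hψC k)).2.2⟩,
    fun u hu z => ?_⟩
  by_cases hz : z ∈ eb R
  swap
  · rw [(hC hu).2.1 z hz]; exact bot_le
  by_cases hk : ∃ k, u ≤ ψ k
  · obtain ⟨k, hk⟩ := hk
    exact (hk z).trans (hge k z hz)
  · push Not at hk
    have hku : ∀ k, ψ k ≤ u := fun k => (hchain.total hu (hψC k)).resolve_left (hk k)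
    have huP := (hC hu).1
    have hΨu : ∀ z ∈ eb R, Ψ z ≤ u z := fun z hz => by
      refine hΨ.psub.le_of_ae huP.psub ?_ hz
      rw [← ae_restrict_iff' (isOpen_eb R).measurableSet]
      filter_upwards [hlim, hΨ.ae_finite, huP.ae_finite, ae_all_iff.2 fun k => (hψ k).ae_finite]
        with z h1 h2 h3 h4
      rw [← EReal.coe_toReal h2.2 h2.1, ← EReal.coe_toReal h3.2 h3.1, EReal.coe_le_coe_iff]
      exact le_of_tendsto' h1 fun k => EReal.toReal_le_toReal (hku k z) (h4 k).1 h3.2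
    refine hΨ.le_of_lintegral_le huP hΨu ?_ z hz
    calc I u ≤ sSup (I '' C) := le_sSup ⟨u, hu, rfl⟩
      _ ≤ I Ψ := le_of_tendsto' halim fun k => by
          rw [← hψa k]; exact hImono (hge k)

lemma ssq_le_mul_norm_sq (z : Cn n) : ssq z ≤ n * ‖z‖ ^ 2 := by
  simpa [ssq] using sum_pow_le z 1

lemma le_mul_elog_of_le_ssq {N r : ℝ} (hN : 0 < N) (hr : 0 < r) {z : Cn n} (hz : r ≤ ssq z) :
    ((N / 2 * Real.log (r / (n + 1)) : ℝ) : EReal) ≤ (N : EReal) * elog ‖z‖ := by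
  have h2 : r / (n + 1) ≤ ‖z‖ ^ 2 := by
    rw [div_le_iff₀ (by positivity)]
    have := ssq_le_mul_norm_sq z
    nlinarith [sq_nonneg ‖z‖]
  have h3 : 0 < r / ((n : ℝ) + 1) := by positivity
  have h4 : 0 < ‖z‖ := lt_of_le_of_ne (norm_nonneg z) fun h => by
    rw [← h] at h2; norm_num at h2; linarith
  rw [mul_elog h4, EReal.coe_le_coe_iff]
  have := Real.log_le_log h3 h2
  rw [Real.log_pow] at this
  push_cast at this
  nlinarith

open Classical in
/-- Gluing of a plurisubharmonic function on `eb R` with a competitor on a smaller ball `eb s`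
which is dominated near the boundary of `eb s`. -/
lemma Psh.glue {R s r c : ℝ} {u v : Cn n → EReal} (hu : Psh R c u) (hv : Psh s c v) (hsR : s ≤ R)
    (hrs : r < s) (hle : ∀ z ∈ eb s, r ≤ ssq z → v z ≤ u z) :
    Psh R c fun z => if z ∈ eb s then Max.max (u z) (v z) else u z := by
  set w : Cn n → EReal := fun z => if z ∈ eb s then Max.max (u z) (v z) else u z with hw
  have hsub : (eb s : Set (Cn n)) ⊆ eb R := eb_mono hsR
  have hmax := (hu.psub.mono (isOpen_eb s) hsub le_rfl).max hv.psub
  have hin : ∀ z ∈ eb s, w z = Max.max (u z) (v z) := fun z hz => if_pos hz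
  have hout : ∀ z, r ≤ ssq z → w z = u z := fun z hz => by
    by_cases h : z ∈ eb s
    · rw [hin z h, max_eq_left (hle z h hz)]
    · exact if_neg h
  have hopen : IsOpen {z : Cn n | r < ssq z} := isOpen_lt continuous_const sm_ssq.continuous
  have hcase : ∀ z : Cn n, z ∉ eb s → r < ssq z := fun z hz =>
    hrs.trans_le (not_lt.1 fun h => hz h)
  refine ⟨PSub.of_local (isOpen_eb R) (fun z hz => ?_) (fun z hz a ha => ?_) fun m z hz => ?_, ?_⟩
  · by_cases h : z ∈ eb s
    · rw [hin z h]; exact hmax.le z h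
    · rw [hout z (hcase z h).le]; exact hu.psub.le z hz
  · replace ha : w z < a := ha
    by_cases h : z ∈ eb s
    · rw [hin z h] at ha
      have := hmax.usc z h a ha
      rw [(isOpen_eb s).nhdsWithin_eq h] at this
      refine nhdsWithin_le_nhds ?_
      filter_upwards [this, (isOpen_eb s).mem_nhds h] with y hy hys
      show w y < a
      rw [hin y hys]; exact hy
    · rw [hout z (hcase z h).le] at ha
      filter_upwards [hu.psub.usc z hz a ha, nhdsWithin_le_nhds (hopen.mem_nhds (hcase z h))]
        with y hy hys
      show w y < a
      rw [hout y (le_of_lt hys)]; exact hy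
  · by_cases h : z ∈ eb s
    · refine ⟨_, eb s, isOpen_eb s, h, hmax.bsub m, fun y hy => ?_⟩
      rw [cut, cut, if_pos hy, if_pos (hsub hy), hin y hy]
    · refine ⟨_, eb R ∩ {z : Cn n | r < ssq z}, (isOpen_eb R).inter hopen, ⟨hz, hcase z h⟩,
        (hu.psub.bsub m).mono Set.inter_subset_left, fun y hy => ?_⟩
      rw [cut, cut, hout y (le_of_lt hy.2)]
  · filter_upwards [hu.ae] with z hz
    refine ne_bot_of_le_ne_bot hz ?_
    by_cases h : z ∈ eb s
    · rw [hin z h]; exact le_max_left _ _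
    · exact (if_neg h).ge

/-- A maximal competitor dominating a multiple of `log ‖z‖` is maximal as a germ. -/
lemma leO_of_maximal {m : ℕ} {f : Fin m → Cn n → ℂ} {R c N : ℝ} (hR : 0 < R) (hN : 0 < N)
    {φ₀ Φ φ' : Cn n → EReal} (hΦ : Maximal (· ∈ cand R c f φ₀) Φ)
    (hlog : ∀ z ∈ eb R, (N : EReal) * elog ‖z‖ ≤ Φ z) (hφ' : PSHNear φ') (hle : leO Φ φ')
    (hn : ¬ IntNear fun z => dens0 f φ₀ z * wexp (-2) φ' z) : leO φ' Φ := by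
  obtain ⟨R₀, hR₀, c', hpsh⟩ := hφ'.psh
  set s := min R R₀
  have hs : 0 < s := lt_min hR hR₀
  have hsR : s ≤ R := min_le_left _ _
  have hφs : Psh s c' φ' := hpsh s hs (min_le_right _ _) c' le_rfl
  set A : ℝ := N / 2 * Real.log (s / 2 / (n + 1))
  set B : ℝ := min A c - c' with hB
  have hBc : c' + B ≤ c := by rw [hB]; linarith [min_le_right A c]
  have hBA : c' + B ≤ A := by rw [hB]; linarith [min_le_left A c]
  have hv : Psh s c fun z => φ' z + (B : EReal) := by
    refine ⟨(hφs.psub.add_const B).mono (isOpen_eb s) le_rfl hBc, ?_⟩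
    filter_upwards [hφs.ae] with z hz
    rw [ne_eq, EReal.add_eq_bot_iff]
    exact not_or.2 ⟨hz, EReal.coe_ne_bot _⟩
  have hglue := hΦ.prop.1.glue hv hsR (half_lt_self hs) fun z hz hz2 =>
    ((hφs.psub.add_const B).le z hz).trans ((EReal.coe_le_coe_iff.2 hBA).trans
      ((le_mul_elog_of_le_ssq hN (half_pos hs) hz2).trans (hlog z (eb_mono hsR hz))))
  classical
  set w : Cn n → EReal := fun z => if z ∈ eb s then Max.max (Φ z) (φ' z + (B : EReal)) else Φ z
    with hw
  have hin : ∀ z ∈ eb s, w z = Max.max (Φ z) (φ' z + (B : EReal)) := fun z hz => if_pos hz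
  have hwc : w ∈ cand R c f φ₀ := by
    refine ⟨hglue, fun z hz => ?_, fun hi => hn ?_⟩
    · rw [hw]; simp only
      rw [if_neg fun h => hz (eb_mono hsR h), hΦ.prop.2.1 z hz]
    · obtain ⟨K, hK⟩ := hle
      obtain ⟨t, ht, htK⟩ := exists_eb_subset hK
      refine hi.of_le (C := Real.exp (2 * max K B)) (lt_min ht hs) ?_
      filter_upwards [ae_restrict_of_ae_restrict_of_subset (eb_mono (min_le_right t s))
        hφs.ae_finite, ae_restrict_mem (isOpen_eb _).measurableSet] with z hz hzm
      have hzt : Φ z ≤ φ' z + (K : EReal) := htK (eb_mono (min_le_left t s) hzm)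
      have hwz : w z ≤ (((φ' z).toReal + max K B : ℝ) : EReal) := by
        rw [hin z (eb_mono (min_le_right t s) hzm), EReal.coe_add, EReal.coe_toReal hz.2 hz.1]
        exact max_le (hzt.trans (add_le_add_right (EReal.coe_le_coe_iff.2 (le_max_left _ _)) _))
          (add_le_add_right (EReal.coe_le_coe_iff.2 (le_max_right _ _)) _)
      have h1 := expE_neg_two_anti hwz
      rw [← EReal.coe_mul, expE_coe] at h1
      rw [mul_left_comm]
      refine mul_le_mul' le_rfl (le_trans ?_ (mul_le_mul' le_rfl h1))
      rw [wexp_eq hz.1 hz.2, ← ENNReal.ofReal_mul (Real.exp_pos _).le, ← Real.exp_add]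
      exact ENNReal.ofReal_le_ofReal (Real.exp_le_exp.2 (by linarith))
  have hwΦ : w ≤ Φ := hΦ.2 hwc fun z => by
    by_cases h : z ∈ eb s
    · rw [hin z h]; exact le_max_left _ _
    · exact (if_neg h).ge
  refine ⟨-B, ?_⟩
  filter_upwards [eb_mem_nhds hs] with z hz
  have := (le_max_right _ _).trans ((hin z hz).symm.trans_le (hwΦ z))
  calc φ' z = φ' z + (B : EReal) + ((-B : ℝ) : EReal) := by
        rw [add_assoc, ← EReal.coe_add, add_neg_cancel, EReal.coe_zero, add_zero]
    _ ≤ Φ z + ((-B : ℝ) : EReal) := add_le_add_left this _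

open Classical in
theorem exists_zhou_weight {m : ℕ} {f₀ : Fin m → Cn n → ℂ} {φ₀ φ : Cn n → EReal}
    (hf₀ : ∀ j, HoloNear (f₀ j)) (hφ₀ : PSHNear φ₀) (hφ : PSHNear φ)
    (hgi₀ : IntNear (dens0 f₀ φ₀))
    (hintN : ∃ N₁ : ℕ, ∀ N₀ : ℕ, N₁ ≤ N₀ →
      IntNear fun z => dens0 f₀ φ₀ z * ENNReal.ofReal (‖z‖ ^ (2 * N₀)) * wexp (-2) φ z)
    (hnonint : ¬ IntNear fun z => normSq2 f₀ z * wexp (-2) (fun w => φ w + φ₀ w) z) :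
    ∃ Φ : Cn n → EReal, IsLocalZhouWeight f₀ φ₀ Φ ∧
      (∀ᶠ z in 𝓝 (0 : Cn n), φ z ≤ Φ z) ∧
      ∃ N : ℝ, 0 < N ∧ leO (fun z => (N : EReal) * elog ‖z‖) Φ := by
  obtain ⟨R₁, hR₁, c₀, h0⟩ := hφ₀.psh
  obtain ⟨R₂, hR₂, c₁, h1⟩ := hφ.psh
  obtain ⟨N₁, hN₁⟩ := hintN
  set R := min R₁ R₂
  have hR : 0 < R := lt_min hR₁ hR₂
  have h0R : Psh R c₀ φ₀ := h0 R hR (min_le_left _ _) c₀ le_rfl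
  have h1R := h1 R hR (min_le_right _ _)
  have hn : ¬ IntNear fun z => dens0 f₀ φ₀ z * wexp (-2) φ z := fun hi => hnonint <| by
    refine hi.of_le (C := 1) hR ?_
    filter_upwards [h0R.ae_finite, (h1R c₁ le_rfl).ae_finite] with z h2 h3
    have h4 : ((φ z + φ₀ z : EReal)) = (((φ z).toReal + (φ₀ z).toReal : ℝ) : EReal) := by
      rw [EReal.coe_add, EReal.coe_toReal h2.2 h2.1, EReal.coe_toReal h3.2 h3.1]
    rw [dens_mul_wexp h2 h3, wexp, h4, ← EReal.coe_mul, expE_coe, ENNReal.ofReal_one, one_mul,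
      add_comm (φ z).toReal]
  obtain ⟨N, hN, hmax⟩ := exists_nonint_max_elog hf₀ hR h0R (h1R c₁ le_rfl)
    (le_max_right N₁ 1) (hN₁ _ (le_max_left N₁ 1)) hn
  set c := max c₁ (N * Real.log (Real.sqrt R))
  have hP : Psh R c fun z => max (φ z) ((N : EReal) * elog ‖z‖) := by
    refine ⟨(h1R c (le_max_left _ _)).psub.max (psub_elog hN (le_max_right _ _)), ?_⟩
    filter_upwards [(h1R c₁ le_rfl).ae] with z hz
    exact ne_bot_of_le_ne_bot hz (le_max_left _ _)
  set φ₁ : Cn n → EReal := fun z => if z ∈ eb R then max (φ z) ((N : EReal) * elog ‖z‖) else ⊥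
    with hφ₁
  have hin : ∀ z ∈ eb R, φ₁ z = max (φ z) ((N : EReal) * elog ‖z‖) := fun z hz => if_pos hz
  have hcand : φ₁ ∈ cand R c f₀ φ₀ := by
    refine ⟨⟨PSub.of_local (isOpen_eb R) (fun z hz => ?_) (fun z hz a ha => ?_)
      fun k z hz => ⟨_, eb R, isOpen_eb R, hz, hP.psub.bsub k, fun y hy => ?_⟩, ?_⟩,
      fun z hz => if_neg hz, fun hi => hmax ?_⟩
    · rw [hin z hz]; exact hP.psub.le z hz
    · replace ha : φ₁ z < a := ha
      rw [hin z hz] at ha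
      filter_upwards [hP.psub.usc z hz a ha, self_mem_nhdsWithin] with y hy hyR
      show φ₁ y < a
      rw [hin y hyR]; exact hy
    · rw [cut, cut, hin y hy]
    · filter_upwards [hP.ae, ae_restrict_mem (isOpen_eb R).measurableSet] with z hz hzR
      rw [hin z hzR]; exact hz
    · refine hi.of_le (C := 1) hR ?_
      filter_upwards [ae_restrict_mem (isOpen_eb R).measurableSet] with z hz
      rw [ENNReal.ofReal_one, one_mul, wexp, wexp, hin z hz]
  obtain ⟨Φ, hΦge, hΦ⟩ := exists_maximal_cand hf₀ hR h0R hcand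
  have hge : ∀ z ∈ eb R, max (φ z) ((N : EReal) * elog ‖z‖) ≤ Φ z := fun z hz =>
    (hin z hz).symm.trans_le (hΦge z)
  have hφΦ : ∀ z ∈ eb R, φ z ≤ Φ z := fun z hz => (le_max_left _ _).trans (hge z hz)
  have hlog : ∀ z ∈ eb R, (N : EReal) * elog ‖z‖ ≤ Φ z := fun z hz =>
    (le_max_right _ _).trans (hge z hz)
  refine ⟨Φ, ⟨hf₀, hφ₀, hgi₀, ⟨hΦ.prop.1.pshNear hR, ⟨N₁, fun N₀ hN₀ => ?_⟩, hΦ.prop.2.2,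
    fun φ' h1 h2 h3 => ⟨leO_of_maximal hR hN hΦ hlog h1 h2 h3, h2⟩⟩⟩, ?_, N, hN, 0, ?_⟩
  · refine (hN₁ N₀ hN₀).of_le (C := 1) hR ?_
    filter_upwards [ae_restrict_mem (isOpen_eb R).measurableSet] with z hz
    rw [ENNReal.ofReal_one, one_mul]
    exact mul_le_mul' le_rfl (expE_neg_two_anti (hφΦ z hz))
  · filter_upwards [eb_mem_nhds hR] with z hz using hφΦ z hz
  · filter_upwards [eb_mem_nhds hR] with z hz
    rw [EReal.coe_zero, add_zero]
    exact hlog z hz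

end Zhou

/-- existence of local Zhou weights dominating a given weight. -/
theorem statement0 {n m : ℕ} (f₀ : Fin m → Cn n → ℂ) (φ₀ φ : Cn n → EReal)
    (hf₀ : ∀ j, HoloNear (f₀ j)) (hφ₀ : PSHNear φ₀) (hφ : PSHNear φ)
    (hint₀ : IntNear (dens0 f₀ φ₀))
    (hintN : ∃ N₁ : ℕ, ∀ N₀ : ℕ, N₁ ≤ N₀ →
      IntNear fun z => dens0 f₀ φ₀ z * ENNReal.ofReal (‖z‖ ^ (2 * N₀)) * wexp (-2) φ z)
    (hnonint : ¬ IntNear fun z => normSq2 f₀ z * wexp (-2) (fun w => φ w + φ₀ w) z) :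
    ∃ Φ : Cn n → EReal, IsLocalZhouWeight f₀ φ₀ Φ ∧
      (∀ᶠ z in 𝓝 (0 : Cn n), φ z ≤ Φ z) ∧
      ∃ N : ℝ, 0 < N ∧ leO (fun z => (N : EReal) * elog ‖z‖) Φ :=
  Zhou.exists_zhou_weight hf₀ hφ₀ hφ hint₀ hintN hnonint
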